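/- Let κ > 0, δ > 0, θ ∈ (0,1), C > 0 be constants and let V : ℝ² → ℝ be measurable with V ∈ L²_loc(ℝ² ∖ {0}), with 1_{{|x|≥1}} V_+ ∈ L²(ℝ²), and with |V(x) − κ|x|^{-1}| ≤ C|x|^{-θ} for all 0 < |x| ≤ δ. For h > 0 define S(h) := inf { Σ_{i=1}^n ∫_{ℝ²} ( h²|∇ψ_i(x)|² − V(x)|ψ_i(x)|² ) dx : n ∈ ℕ, ψ_1,…,ψ_n ∈ C_c^∞(ℝ² ∖ {0}) orthonormal in L²(ℝ²) } (the sum of the negative eigenvalues of −h²Δ − V). Then, as h → 0⁺, S(h) = −(8πh²)^{-1} ∫_{ℝ²} ( [V(x)]_+² − κ²[|x|^{-1} − 1]_+² ) dx + κ²(4h²)^{-1} ( ln(2κ^{-1}h²) + c^H ) + o(h^{-2}), i.e. h² times the difference of the two sides tends to 0. -/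

import Mathlib

open Real MeasureTheory Filter

/-- The semiclassical eigenvalue sum `S(h)`: the infimum over finite orthonormal families
of smooth functions compactly supported in `ℝ² ∖ {0}` of
`∑ᵢ ∫ (h²|∇ψᵢ|² − V|ψᵢ|²)`; this is the sum of the negative eigenvalues of `−h²Δ − V`. -/
noncomputable def negEigSum (V : EuclideanSpace ℝ (Fin 2) → ℝ) (h : ℝ) : ℝ :=
  sInf {E : ℝ | ∃ (n : ℕ) (ψ : Fin n → EuclideanSpace ℝ (Fin 2) → ℝ),
    (∀ i, ContDiff ℝ (⊤ : ℕ∞) (ψ i)) ∧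
    (∀ i, HasCompactSupport (ψ i)) ∧
    (∀ i, tsupport (ψ i) ⊆ {x : EuclideanSpace ℝ (Fin 2) | x ≠ 0}) ∧
    (∀ i j, (∫ x : EuclideanSpace ℝ (Fin 2), ψ i x * ψ j x)
      = if i = j then (1 : ℝ) else 0) ∧
    E = ∑ i, ∫ x : EuclideanSpace ℝ (Fin 2),
      (h ^ 2 * ‖fderiv ℝ (ψ i) x‖ ^ 2 - V x * ψ i x ^ 2)}

/-- A finite family whose Gram matrix with respect to `ip` is bounded by the identity. -/
def SubOrthonormal {X : Type*} [AddCommGroup X] [Module ℝ X] (ip : X →ₗ[ℝ] X →ₗ[ℝ] ℝ)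
    {ι : Type*} [Fintype ι] (f : ι → X) : Prop :=
  ∀ c : ι → ℝ, ip (∑ i, c i • f i) (∑ i, c i • f i) ≤ ∑ i, c i ^ 2

section Abstract

variable {X : Type*} [AddCommGroup X] [Module ℝ X]

lemma bilin_sum_sum (B : X →ₗ[ℝ] X →ₗ[ℝ] ℝ) {ι κ : Type*} [Fintype ι] [Fintype κ]
    (c : ι → ℝ) (f : ι → X) (d : κ → ℝ) (g : κ → X) :
    B (∑ i, c i • f i) (∑ j, d j • g j) = ∑ i, ∑ j, c i * d j * B (f i) (g j) := by
  simp only [map_sum, LinearMap.sum_apply, map_smul, LinearMap.smul_apply, smul_eq_mul,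
    Finset.mul_sum]
  rw [Finset.sum_comm]
  refine Finset.sum_congr rfl fun i _ => Finset.sum_congr rfl fun j _ => by ring

lemma trace_rotate (B : X →ₗ[ℝ] X →ₗ[ℝ] ℝ) {ι : Type*} [Fintype ι] [DecidableEq ι]
    (f : ι → X) (U : Matrix ι ι ℝ) (hU : U * U.transpose = 1) :
    ∑ j, B (∑ i, U i j • f i) (∑ i, U i j • f i) = ∑ i, B (f i) (f i) := by
  simp only [bilin_sum_sum]
  rw [Finset.sum_comm]
  refine Finset.sum_congr rfl fun i _ => ?_
  rw [Finset.sum_comm]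
  have : ∀ k, ∑ j, U i j * U k j * B (f i) (f k) = (if i = k then 1 else 0) * B (f i) (f k) := by
    intro k
    rw [← Finset.sum_mul]
    congr 1
    have := congrFun (congrFun hU i) k
    rw [Matrix.mul_apply, Matrix.one_apply] at this
    simpa using this
  rw [Finset.sum_congr rfl fun k _ => this k]
  simp

/-- Simultaneous diagonalisation: a rotation of the family diagonalises a symmetric form. -/
lemma exists_rotation_diagonal (B : X →ₗ[ℝ] X →ₗ[ℝ] ℝ) (hsymm : ∀ x y, B x y = B y x)
    {ι : Type*} [Fintype ι] [DecidableEq ι] (f : ι → X) :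
    ∃ (U : Matrix ι ι ℝ) (μ : ι → ℝ), U * U.transpose = 1 ∧ U.transpose * U = 1 ∧
      ∀ j k, B (∑ i, U i j • f i) (∑ i, U i k • f i) = if j = k then μ j else 0 := by
  let A : Matrix ι ι ℝ := Matrix.of fun i j => B (f i) (f j)
  have hA : A.IsHermitian := by
    ext i j
    simp [A, Matrix.conjTranspose_apply, hsymm (f j) (f i)]
  let U : Matrix ι ι ℝ := (hA.eigenvectorUnitary : Matrix ι ι ℝ)
  have h1 : U * U.transpose = 1 := by
    have := (Matrix.mem_unitaryGroup_iff).1 hA.eigenvectorUnitary.2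
    simpa [U, Matrix.star_eq_conjTranspose, Matrix.conjTranspose_eq_transpose_of_trivial] using this
  have h2 : U.transpose * U = 1 := by
    have := (Matrix.mem_unitaryGroup_iff').1 hA.eigenvectorUnitary.2
    simpa [U, Matrix.star_eq_conjTranspose, Matrix.conjTranspose_eq_transpose_of_trivial] using this
  refine ⟨U, hA.eigenvalues, h1, h2, ?_⟩
  have hs : U.transpose * A * U = Matrix.diagonal hA.eigenvalues := by
    have h3 : ∀ j, A.mulVec (fun i => U i j) = hA.eigenvalues j • (fun i => U i j) := by
      intro j
      have := hA.mulVec_eigenvectorBasis j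
      ext i
      have := congrFun this i
      simpa [U, Matrix.IsHermitian.eigenvectorUnitary_apply] using this
    have h4 : A * U = U * Matrix.diagonal hA.eigenvalues := by
      ext i j
      have := congrFun (h3 j) i
      simp only [Matrix.mul_diagonal]
      rw [Matrix.mul_apply]
      simp only [Matrix.mulVec, dotProduct, Pi.smul_apply, smul_eq_mul] at this
      rw [this, mul_comm]
    rw [Matrix.mul_assoc, h4, ← Matrix.mul_assoc, h2, Matrix.one_mul]
  intro j k
  rw [bilin_sum_sum]
  have := congrFun (congrFun hs j) k
  rw [Matrix.diagonal_apply] at this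
  rw [← this, Matrix.mul_apply]
  simp only [Matrix.mul_apply, Matrix.transpose_apply, Finset.sum_mul]
  rw [Finset.sum_comm]
  refine Finset.sum_congr rfl fun i _ => Finset.sum_congr rfl fun l _ => ?_
  simp only [A, Matrix.of_apply]; ring

/-- A lower bound for the trace over orthonormal families extends to families with Gram
matrix at most one. -/
lemma trace_ge_of_orthonormal (ip B : X →ₗ[ℝ] X →ₗ[ℝ] ℝ) (hsymm : ∀ x y, ip x y = ip y x)
    (hpos : ∀ x, 0 ≤ ip x x) (hdef : ∀ x, ip x x = 0 → x = 0) (L : ℝ)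
    (hL : ∀ (n : ℕ) (e : Fin n → X), (∀ i j, ip (e i) (e j) = if i = j then 1 else 0) →
      L ≤ ∑ i, B (e i) (e i))
    {ι : Type*} [Fintype ι] (f : ι → X) (hf : SubOrthonormal ip f) :
    L ≤ ∑ i, B (f i) (f i) := by
  classical
  obtain ⟨U, μ, h1, h2, h3⟩ := exists_rotation_diagonal ip hsymm f
  rw [← trace_rotate B f U h1]
  set e : ι → X := fun j => ∑ i, U i j • f i with he
  have hμ0 : ∀ j, 0 ≤ μ j := fun j => by
    have := h3 j j
    rw [if_pos rfl] at this
    rw [← this]; exact hpos _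
  have hμ1 : ∀ j, μ j ≤ 1 := fun j => by
    have h4 := h3 j j
    rw [if_pos rfl] at h4
    rw [← h4]
    refine (hf _).trans (le_of_eq ?_)
    have := congrFun (congrFun h2 j) j
    rw [Matrix.mul_apply, Matrix.one_apply_eq] at this
    simpa [sq] using this
  let J : Finset ι := Finset.univ.filter fun j => 0 < μ j ∧ B (e j) (e j) < 0
  have key : L ≤ ∑ j ∈ J, (1 / μ j) * B (e j) (e j) := by
    let φ := J.equivFin.symm
    have := hL J.card (fun k => (1 / √(μ (φ k))) • e (φ k)) ?_
    · refine this.trans (le_of_eq ?_)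
      rw [← Finset.sum_coe_sort J (fun j => (1 / μ j) * B (e j) (e j))]
      rw [← Equiv.sum_comp φ]
      refine Finset.sum_congr rfl fun k _ => ?_
      simp only [map_smul, LinearMap.smul_apply, smul_eq_mul]
      rw [← mul_assoc]; congr 1
      rw [div_mul_div_comm, Real.mul_self_sqrt (hμ0 _), one_mul]
    · intro i j
      simp only [map_smul, LinearMap.smul_apply, smul_eq_mul]
      rw [h3]
      by_cases hij : i = j
      · subst hij
        have hp : 0 < μ (φ i) := (Finset.mem_filter.1 (φ i).2).2.1
        rw [if_pos rfl, if_pos rfl, ← mul_assoc, div_mul_div_comm, Real.mul_self_sqrt (hμ0 _)]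
        field_simp
      · have : ((φ j : ι)) ≠ (φ i : ι) := fun h => hij (φ.injective (Subtype.ext h)).symm
        rw [if_neg hij, if_neg (Ne.symm this)]; simp
  refine key.trans ?_
  have hle : ∑ j ∈ J, (1 / μ j) * B (e j) (e j) ≤ ∑ j ∈ J, B (e j) (e j) := by
    refine Finset.sum_le_sum fun j hj => ?_
    obtain ⟨hp, hn⟩ := (Finset.mem_filter.1 hj).2
    have : 1 ≤ 1 / μ j := by rw [le_div_iff₀ hp]; simpa using hμ1 j
    nlinarith
  refine hle.trans ?_
  rw [← Finset.sum_filter_add_sum_filter_not Finset.univ (fun j => 0 < μ j ∧ B (e j) (e j) < 0)]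
  have : 0 ≤ ∑ j ∈ Finset.univ.filter (fun j => ¬ (0 < μ j ∧ B (e j) (e j) < 0)),
      B (e j) (e j) := by
    refine Finset.sum_nonneg fun j hj => ?_
    have := (Finset.mem_filter.1 hj).2
    by_cases hp : 0 < μ j
    · by_contra hn
      exact this ⟨hp, not_le.1 hn⟩
    · have h0 : μ j = 0 := le_antisymm (not_lt.1 hp) (hμ0 j)
      have : e j = 0 := hdef _ (by rw [h3 j j, if_pos rfl, h0])
      rw [this]; simp
  linarith

/-- Min-max bound: if for every `j` the form `B` is at least `-a j` on a subspace of
codimension at most `j`, then traces over orthonormal families are at least `-∑ a j`. -/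
lemma trace_ge_of_levels (ip B : X →ₗ[ℝ] X →ₗ[ℝ] ℝ) (hBsymm : ∀ x y, B x y = B y x)
    (a : ℕ → ℝ) (K : ℕ) (ha : ∀ j, 0 ≤ a j) (haK : a K = 0)
    (hlev : ∀ j, j ≤ K → ∃ T : X →ₗ[ℝ] (Fin j → ℝ), ∀ x, T x = 0 → -(a j) * ip x x ≤ B x x)
    (n : ℕ) (e : Fin n → X) (he : ∀ i j, ip (e i) (e j) = if i = j then 1 else 0) :
    -∑ j ∈ Finset.range K, a j ≤ ∑ i, B (e i) (e i) := by
  classical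
  obtain ⟨U, μ, h1, h2, h3⟩ := exists_rotation_diagonal B hBsymm e
  rw [← trace_rotate B e U h1]
  set v : Fin n → X := fun j => ∑ i, U i j • e i with hv
  have hvo : ∀ j k, ip (v j) (v k) = if j = k then 1 else 0 := by
    intro j k
    rw [hv, bilin_sum_sum]
    simp only [he, mul_ite, mul_one, mul_zero, Finset.sum_ite_eq, Finset.mem_univ, if_true]
    have := congrFun (congrFun h2 j) k
    rw [Matrix.mul_apply, Matrix.one_apply] at this
    simpa using this
  -- sort the eigenvalues
  let σ := Tuple.sort μ
  have hmono : Monotone (μ ∘ σ) := Tuple.monotone_sort μ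
  have hdiag : ∀ j, B (v j) (v j) = μ j := fun j => by rw [h3, if_pos rfl]
  simp only [hv] at hdiag
  rw [Finset.sum_congr rfl fun j _ => hdiag j, ← Equiv.sum_comp σ]
  have hmain : ∀ (i : Fin n) (j : ℕ), j ≤ K → j ≤ i → -(a j) ≤ μ (σ i) := by
    intro i j hjK hji
    obtain ⟨T, hT⟩ := hlev j hjK
    -- vectors σ 0, …, σ j
    have hjn : ∀ k : Fin (j + 1), (k : ℕ) < n := fun k => by have := k.2; have := i.2; omega
    let w : Fin (j + 1) → X := fun k => v (σ ⟨k, hjn k⟩)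
    let S : (Fin (j + 1) → ℝ) →ₗ[ℝ] (Fin j → ℝ) :=
      T ∘ₗ (Fintype.linearCombination ℝ w)
    have hnt : LinearMap.ker S ≠ ⊥ := by
      apply LinearMap.ker_ne_bot_of_finrank_lt
      simp
    obtain ⟨c, hc, hc0⟩ := Submodule.exists_mem_ne_zero_of_ne_bot hnt
    have hTc : T (∑ k, c k • w k) = 0 := by
      have := LinearMap.mem_ker.1 hc
      simpa [S, Fintype.linearCombination_apply] using this
    have hb := hT _ hTc
    have hinj : ∀ k l : Fin (j + 1), σ ⟨k, hjn k⟩ = σ ⟨l, hjn l⟩ ↔ k = l := by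
      intro k l
      constructor
      · intro h
        have := σ.injective h
        exact Fin.ext (by simpa using this)
      · rintro rfl; rfl
    have e1 : ip (∑ k, c k • w k) (∑ k, c k • w k) = ∑ k, c k ^ 2 := by
      rw [bilin_sum_sum]
      refine Finset.sum_congr rfl fun k _ => ?_
      simp only [w, hvo, hinj]
      simp [sq]
    have e2 : B (∑ k, c k • w k) (∑ k, c k • w k) = ∑ k, c k ^ 2 * μ (σ ⟨k, hjn k⟩) := by
      rw [bilin_sum_sum]
      refine Finset.sum_congr rfl fun k _ => ?_
      simp only [w, hv, h3, hinj]
      simp [sq]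
    have hpos : 0 < ∑ k, c k ^ 2 := by
      obtain ⟨k, hk⟩ := Function.ne_iff.1 hc0
      exact Finset.sum_pos' (fun k _ => sq_nonneg _) ⟨k, Finset.mem_univ _, by
        have : c k ≠ 0 := hk
        positivity⟩
    rw [e1, e2] at hb
    have : ∑ k, c k ^ 2 * μ (σ ⟨k, hjn k⟩) ≤ ∑ k, c k ^ 2 * μ (σ i) := by
      refine Finset.sum_le_sum fun k _ => ?_
      refine mul_le_mul_of_nonneg_left (hmono ?_) (sq_nonneg _)
      rw [Fin.le_def]
      have := k.2
      simp only
      omega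
    rw [← Finset.sum_mul] at this
    have h6 : -(a j) * ∑ k, c k ^ 2 ≤ μ (σ i) * ∑ k, c k ^ 2 := by linarith
    exact le_of_mul_le_mul_right h6 hpos
  have hb : ∀ i : Fin n, -(if (i : ℕ) < K then a i else 0) ≤ μ (σ i) := by
    intro i
    split_ifs with h
    · exact hmain i i h.le le_rfl
    · rw [← haK]; exact hmain i K le_rfl (not_lt.1 h)
  have h7 : ∑ i : Fin n, (if (i : ℕ) < K then a i else 0) ≤ ∑ j ∈ Finset.range K, a j := by
    rw [Fin.sum_univ_eq_sum_range (fun i => if i < K then a i else 0) n, ← Finset.sum_filter]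
    refine Finset.sum_le_sum_of_subset_of_nonneg ?_ fun j _ _ => ha j
    intro j hj
    simpa using (Finset.mem_filter.1 hj).2
  have h8 := Finset.sum_le_sum fun (i : Fin n) (_ : i ∈ Finset.univ) => hb i
  rw [Finset.sum_neg_distrib] at h8
  linarith

end Abstract

/-- A finite family in `L²(μ)` whose Gram matrix is bounded by the identity. -/
def SubON {α : Type*} [MeasurableSpace α] (μ : Measure α) {ι : Type*} [Fintype ι]
    (f : ι → α → ℝ) : Prop :=
  ∀ c : ι → ℝ, ∫ x, (∑ i, c i * f i x) ^ 2 ∂μ ≤ ∑ i, c i ^ 2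

section SubON

variable {α : Type*} [MeasurableSpace α] {μ : Measure α} {ι : Type*} [Fintype ι]

lemma SubON.bessel {f : ι → α → ℝ} (hf : SubON μ f) (hm : ∀ i, MemLp (f i) 2 μ)
    {g : α → ℝ} (hg : MemLp g 2 μ) : ∑ i, (∫ x, f i x * g x ∂μ) ^ 2 ≤ ∫ x, g x ^ 2 ∂μ := by
  set c : ι → ℝ := fun i => ∫ x, f i x * g x ∂μ with hc
  have hv : MemLp (fun x => ∑ i, c i * f i x) 2 μ :=
    memLp_finsetSum _ fun i _ => (hm i).const_mul (c i)
  have h1 := hf c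
  have h2 : ∫ x, (∑ i, c i * f i x) * g x ∂μ = ∑ i, c i ^ 2 := by
    simp only [Finset.sum_mul]
    rw [integral_finsetSum]
    · refine Finset.sum_congr rfl fun i _ => ?_
      simp only [mul_assoc]
      rw [integral_const_mul, sq]
    · intro i _
      simp only [mul_assoc]
      exact ((hm i).integrable_mul hg).const_mul _
  have h3 : 0 ≤ ∫ x, ((∑ i, c i * f i x) - g x) ^ 2 ∂μ := integral_nonneg fun x => sq_nonneg _
  have h4 : ∫ x, ((∑ i, c i * f i x) - g x) ^ 2 ∂μ =
      ∫ x, (∑ i, c i * f i x) ^ 2 ∂μ - 2 * ∫ x, (∑ i, c i * f i x) * g x ∂μ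
        + ∫ x, g x ^ 2 ∂μ := by
    have i1 := hv.integrable_sq
    have i2 : Integrable (fun x => (∑ i, c i * f i x) * g x) μ := hv.integrable_mul hg
    have i3 := hg.integrable_sq
    have e : ∀ x, ((∑ i, c i * f i x) - g x) ^ 2 = ((∑ i, c i * f i x) ^ 2
        - 2 * ((∑ i, c i * f i x) * g x)) + g x ^ 2 := fun x => by ring
    simp only [e]
    rw [integral_add (by exact i1.sub (i2.const_mul 2)) i3, integral_sub i1 (i2.const_mul 2),
      integral_const_mul]
  rw [h4, h2] at h3
  change ∑ i, c i ^ 2 ≤ _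
  linarith

lemma SubON.of_bessel {f : ι → α → ℝ} (hm : ∀ i, MemLp (f i) 2 μ)
    (h : ∀ c : ι → ℝ, ∑ i, (∫ x, f i x * (∑ j, c j * f j x) ∂μ) ^ 2 ≤
      ∫ x, (∑ j, c j * f j x) ^ 2 ∂μ) : SubON μ f := by
  intro c
  have h0 := h c
  set v : α → ℝ := fun x => ∑ j, c j * f j x with hv
  have hvm : MemLp v 2 μ := memLp_finsetSum _ fun i _ => (hm i).const_mul (c i)
  have h1 : ∫ x, v x ^ 2 ∂μ = ∑ i, c i * ∫ x, f i x * v x ∂μ := by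
    have : ∀ x, v x ^ 2 = ∑ i, c i * (f i x * v x) := by
      intro x
      have e : v x ^ 2 = (∑ j, c j * f j x) * v x := by rw [sq]
      rw [e, Finset.sum_mul]
      exact Finset.sum_congr rfl fun i _ => by ring
    simp only [this]
    rw [integral_finsetSum]
    · simp only [integral_const_mul]
    · intro i _
      exact ((hm i).integrable_mul hvm).const_mul _
  have h2 : (∫ x, v x ^ 2 ∂μ) ^ 2 ≤ (∑ i, c i ^ 2) * ∑ i, (∫ x, f i x * v x ∂μ) ^ 2 := by
    rw [h1]; exact Finset.sum_mul_sq_le_sq_mul_sq _ _ _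
  have h4 : 0 ≤ ∫ x, v x ^ 2 ∂μ := integral_nonneg fun x => sq_nonneg _
  have h5 : 0 ≤ ∑ i, c i ^ 2 := Finset.sum_nonneg fun i _ => sq_nonneg _
  by_contra hlt
  push Not at hlt
  have : (∑ i, c i ^ 2) * ∑ i, (∫ x, f i x * v x ∂μ) ^ 2 ≤ (∑ i, c i ^ 2) * ∫ x, v x ^ 2 ∂μ := by
    gcongr
  nlinarith

/-- A pointwise partition `∑ ζ_a² ≤ 1` preserves sub-orthonormality. -/
lemma SubON.mul_partition {f : ι → α → ℝ} (hf : SubON μ f) (hm : ∀ i, MemLp (f i) 2 μ)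
    {A : Type*} [Fintype A] (ζ : A → α → ℝ) (hζ : ∀ x, ∑ a, ζ a x ^ 2 ≤ 1) :
    SubON μ (fun (p : A × ι) x => ζ p.1 x * f p.2 x) := by
  intro c
  have key : ∀ x, (∑ p : A × ι, c p * (ζ p.1 x * f p.2 x)) ^ 2 ≤
      ∑ a, (∑ i, c (a, i) * f i x) ^ 2 := by
    intro x
    rw [Fintype.sum_prod_type]
    have : ∀ a, ∑ i, c (a, i) * (ζ a x * f i x) = ζ a x * ∑ i, c (a, i) * f i x := by
      intro a; rw [Finset.mul_sum]; exact Finset.sum_congr rfl fun i _ => by ring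
    simp only [this]
    refine (Finset.sum_mul_sq_le_sq_mul_sq _ _ _).trans ?_
    refine mul_le_of_le_one_left (Finset.sum_nonneg fun a _ => sq_nonneg _) (hζ x)
  have hInt : ∀ a, Integrable (fun x => (∑ i, c (a, i) * f i x) ^ 2) μ := fun a =>
    (memLp_finsetSum _ fun i _ => (hm i).const_mul (c (a, i))).integrable_sq
  calc _ ≤ ∫ x, ∑ a, (∑ i, c (a, i) * f i x) ^ 2 ∂μ := by
        refine integral_mono_of_nonneg (Eventually.of_forall fun x => sq_nonneg _)
          (integrable_finsetSum _ fun a _ => hInt a) (Eventually.of_forall key)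
    _ = ∑ a, ∫ x, (∑ i, c (a, i) * f i x) ^ 2 ∂μ := integral_finsetSum _ fun a _ => hInt a
    _ ≤ ∑ a, ∑ i, c (a, i) ^ 2 := Finset.sum_le_sum fun a _ => hf fun i => c (a, i)
    _ = _ := by rw [Fintype.sum_prod_type]

lemma SubON.mul_of_sq_le {f : ι → α → ℝ} (hf : SubON μ f) (hm : ∀ i, MemLp (f i) 2 μ)
    (ζ : α → ℝ) (hζ : ∀ x, ζ x ^ 2 ≤ 1) : SubON μ (fun i x => ζ x * f i x) := by
  intro c
  have := SubON.mul_partition hf hm (A := Unit) (fun _ => ζ) (by simpa using hζ)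
    (fun p => c p.2)
  simpa [Fintype.sum_prod_type] using this

/-- Joining two families living on complementary pieces of a partition `ζ² + χ² ≤ 1`, the second
given through a Bessel inequality. -/
lemma SubON.sum_elim {f : ι → α → ℝ} (hm : ∀ i, MemLp (f i) 2 μ)
    {κ : Type*} [Fintype κ] {g : κ → α → ℝ} (hgm : ∀ i, MemLp (g i) 2 μ)
    (ζ χ : α → ℝ) (hζm : Measurable ζ) (hχm : Measurable χ) (hζ : ∀ x, ζ x ^ 2 + χ x ^ 2 ≤ 1)
    (hf : ∀ u : α → ℝ, MemLp u 2 μ → ∑ i, (∫ x, f i x * u x ∂μ) ^ 2 ≤ ∫ x, (ζ x * u x) ^ 2 ∂μ)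
    (hg : ∀ u : α → ℝ, MemLp u 2 μ → ∑ i, (∫ x, g i x * u x ∂μ) ^ 2 ≤ ∫ x, (χ x * u x) ^ 2 ∂μ) :
    SubON μ (Sum.elim f g) := by
  have hm' : ∀ i, MemLp (Sum.elim f g i) 2 μ := by rintro (i | i); exacts [hm i, hgm i]
  refine SubON.of_bessel hm' fun c => ?_
  set v : α → ℝ := fun x => ∑ j, c j * Sum.elim f g j x with hv
  have hvm : MemLp v 2 μ := memLp_finsetSum _ fun i _ => (hm' i).const_mul (c i)
  rw [Fintype.sum_sum_type]
  simp only [Sum.elim_inl, Sum.elim_inr]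
  have hb : ∀ ζ : α → ℝ, Measurable ζ → (∀ x, ζ x ^ 2 ≤ 1) →
      Integrable (fun x => (ζ x * v x) ^ 2) μ := by
    intro ζ hζm hζ
    refine hvm.integrable_sq.mono' ((hζm.aestronglyMeasurable.mul hvm.1).pow 2)
      (Eventually.of_forall fun x => ?_)
    rw [Real.norm_of_nonneg (sq_nonneg _), mul_pow]
    exact mul_le_of_le_one_left (sq_nonneg _) (hζ x)
  have i1 := hb ζ hζm fun x => by nlinarith [hζ x, sq_nonneg (χ x)]
  have i2 := hb χ hχm fun x => by nlinarith [hζ x, sq_nonneg (ζ x)]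
  refine (add_le_add (hf v hvm) (hg v hvm)).trans ?_
  rw [← integral_add i1 i2]
  refine integral_mono (i1.add i2) hvm.integrable_sq fun x => ?_
  simp only [mul_pow]
  nlinarith [hζ x, sq_nonneg (v x)]

end SubON

/-- The Euclidean plane. -/
abbrev Plane : Type := EuclideanSpace ℝ (Fin 2)

/-- Smooth compactly supported functions on the plane. -/
def IsSmoothCpt (f : Plane → ℝ) : Prop :=
  ContDiff ℝ (⊤ : ℕ∞) f ∧ HasCompactSupport f

/-- Smooth functions compactly supported in the punctured plane. -/
def IsTest (f : Plane → ℝ) : Prop :=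
  IsSmoothCpt f ∧ tsupport f ⊆ {x : Plane | x ≠ 0}

/-- Measurable potentials that are locally square integrable on the punctured plane. -/
structure IsPot (V : Plane → ℝ) : Prop where
  meas : Measurable V
  loc : ∀ K : Set Plane, IsCompact K → (0 : Plane) ∉ K → IntegrableOn (fun x => V x ^ 2) K volume

/-- The Schrödinger quadratic form. -/
noncomputable def qForm (h : ℝ) (V f : Plane → ℝ) : ℝ :=
  ∫ x : Plane, (h ^ 2 * ‖fderiv ℝ f x‖ ^ 2 - V x * f x ^ 2)

/-- Partial derivatives. -/
noncomputable def pd (k : Fin 2) (f : Plane → ℝ) (x : Plane) : ℝ :=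
  fderiv ℝ f x (EuclideanSpace.single k 1)

lemma norm_sq_dual_plane (L : Plane →L[ℝ] ℝ) :
    ‖L‖ ^ 2 = L (EuclideanSpace.single 0 1) ^ 2 + L (EuclideanSpace.single 1 1) ^ 2 := by
  set v := (InnerProductSpace.toDual ℝ Plane).symm L with hv
  have h1 : ‖L‖ = ‖v‖ := by rw [hv, LinearIsometryEquiv.norm_map]
  have h2 : ∀ k, L (EuclideanSpace.single k 1) = v k := by
    intro k
    have : L (EuclideanSpace.single k 1) = inner ℝ v (EuclideanSpace.single k 1) := by
      rw [hv, InnerProductSpace.toDual_symm_apply]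
    rw [this, EuclideanSpace.inner_single_right]; simp
  rw [h1, h2, h2, EuclideanSpace.norm_sq_eq, Fin.sum_univ_two]
  simp

lemma norm_fderiv_sq (f : Plane → ℝ) (x : Plane) :
    ‖fderiv ℝ f x‖ ^ 2 = ∑ k, pd k f x ^ 2 := by
  rw [norm_sq_dual_plane, Fin.sum_univ_two]; rfl

namespace IsSmoothCpt

variable {f g : Plane → ℝ}

lemma continuous (hf : IsSmoothCpt f) : Continuous f := hf.1.continuous

lemma differentiable (hf : IsSmoothCpt f) : Differentiable ℝ f :=
  hf.1.differentiable (by simp)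

lemma add (hf : IsSmoothCpt f) (hg : IsSmoothCpt g) : IsSmoothCpt (fun x => f x + g x) :=
  ⟨hf.1.add hg.1, hf.2.add hg.2⟩

lemma mul_left (hf : IsSmoothCpt f) {η : Plane → ℝ} (hη : ContDiff ℝ (⊤ : ℕ∞) η) :
    IsSmoothCpt (fun x => η x * f x) :=
  ⟨hη.mul hf.1, hf.2.mul_left⟩

lemma memLp (hf : IsSmoothCpt f) : MemLp f 2 (volume : Measure Plane) :=
  hf.continuous.memLp_of_hasCompactSupport hf.2

lemma pd (hf : IsSmoothCpt f) (k : Fin 2) : IsSmoothCpt (pd k f) := by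
  refine ⟨?_, ?_⟩
  · have : ContDiff ℝ (⊤ : ℕ∞) (fderiv ℝ f) := hf.1.fderiv_right (by simp)
    exact this.clm_apply contDiff_const
  · exact hf.2.fderiv_apply ℝ _

lemma integrable_grad (hf : IsSmoothCpt f) :
    Integrable (fun x => ‖fderiv ℝ f x‖ ^ 2) (volume : Measure Plane) := by
  simp only [norm_fderiv_sq]
  exact integrable_finsetSum _ fun k _ => (hf.pd k).memLp.integrable_sq

end IsSmoothCpt

lemma pd_mul {f g : Plane → ℝ} {x : Plane} (hf : DifferentiableAt ℝ f x)
    (hg : DifferentiableAt ℝ g x) (k : Fin 2) :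
    pd k (fun y => f y * g y) x = f x * pd k g x + g x * pd k f x := by
  unfold pd
  rw [fderiv_fun_mul hf hg]
  simp

lemma pd_add {f g : Plane → ℝ} {x : Plane} (hf : DifferentiableAt ℝ f x)
    (hg : DifferentiableAt ℝ g x) (k : Fin 2) :
    pd k (fun y => f y + g y) x = pd k f x + pd k g x := by
  unfold pd
  rw [fderiv_fun_add hf hg]
  simp

lemma pd_const_mul {f : Plane → ℝ} {x : Plane} (hf : DifferentiableAt ℝ f x) (c : ℝ)
    (k : Fin 2) : pd k (fun y => c * f y) x = c * pd k f x := by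
  unfold pd
  rw [fderiv_const_mul hf c]
  simp

namespace IsTest

variable {f g : Plane → ℝ}

lemma add (hf : IsTest f) (hg : IsTest g) : IsTest (fun x => f x + g x) := by
  refine ⟨hf.1.add hg.1, (tsupport_add f g).trans (Set.union_subset hf.2 hg.2)⟩

lemma mul_left (hf : IsTest f) {η : Plane → ℝ} (hη : ContDiff ℝ (⊤ : ℕ∞) η) :
    IsTest (fun x => η x * f x) :=
  ⟨hf.1.mul_left hη, (tsupport_mul_subset_right (f := η)).trans hf.2⟩

lemma const_mul (hf : IsTest f) (c : ℝ) : IsTest (fun x => c * f x) :=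
  hf.mul_left contDiff_const

lemma zero : IsTest (fun _ => (0 : ℝ)) := by
  refine ⟨⟨contDiff_const, HasCompactSupport.zero⟩, ?_⟩
  have : tsupport (fun _ : Plane => (0 : ℝ)) = ∅ := by simp
  rw [this]; exact Set.empty_subset _

lemma finsetSum {ι : Type*} (s : Finset ι) {f : ι → Plane → ℝ} (hf : ∀ i, IsTest (f i)) :
    IsTest (fun x => ∑ i ∈ s, f i x) := by
  classical
  induction s using Finset.induction_on with
  | empty => simpa using zero
  | insert a s ha ih => simpa [Finset.sum_insert ha] using (hf a).add ih

end IsTest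

namespace IsPot

variable {V U f g : Plane → ℝ}

lemma add (hV : IsPot V) (hU : IsPot U) : IsPot (fun x => V x + U x) := by
  refine ⟨hV.meas.add hU.meas, fun K hK h0 => ?_⟩
  have h1 := (hV.loc K hK h0).add (hU.loc K hK h0)
  refine (h1.const_mul 2).mono' ((hV.meas.add hU.meas).pow_const 2).aestronglyMeasurable
    (Eventually.of_forall fun x => ?_)
  rw [Real.norm_of_nonneg (sq_nonneg _)]
  simp only [Pi.add_apply]
  nlinarith [sq_nonneg (V x - U x)]

lemma const_mul (hV : IsPot V) (c : ℝ) : IsPot (fun x => c * V x) := by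
  refine ⟨hV.meas.const_mul c, fun K hK h0 => ?_⟩
  simp only [mul_pow]
  exact (hV.loc K hK h0).const_mul _

lemma of_continuousOn (hm : Measurable V) (hc : ContinuousOn V {x | x ≠ 0}) : IsPot V := by
  refine ⟨hm, fun K hK h0 => ?_⟩
  have : ContinuousOn (fun x => V x ^ 2) K :=
    (hc.mono fun x hx => by rintro rfl; exact h0 hx).pow 2
  exact this.integrableOn_compact hK

lemma of_continuous (hc : Continuous V) : IsPot V :=
  of_continuousOn hc.measurable hc.continuousOn

lemma integrable_mul (hV : IsPot V) (hf : IsTest f) {g : Plane → ℝ} (hg : Continuous g) :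
    Integrable (fun x => V x * (f x * g x)) (volume : Measure Plane) := by
  have hK : IsCompact (tsupport f) := hf.1.2
  have h0 : (0 : Plane) ∉ tsupport f := fun h => hf.2 h rfl
  have h1 : IntegrableOn (fun x => V x * (f x * g x)) (tsupport f) volume := by
    have hV2 : MemLp V 2 (volume.restrict (tsupport f)) :=
      (memLp_two_iff_integrable_sq hV.meas.aestronglyMeasurable).2 (hV.loc _ hK h0)
    have hfg : MemLp (fun x => f x * g x) 2 (volume.restrict (tsupport f)) := by
      refine MemLp.restrict _ ?_
      exact (hf.1.continuous.mul hg).memLp_of_hasCompactSupport hf.1.2.mul_right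
    exact hV2.integrable_mul hfg
  refine (integrableOn_iff_integrable_of_support_subset ?_).1 h1
  intro x hx
  by_contra hx'
  exact hx (by simp [image_eq_zero_of_notMem_tsupport hx'])

lemma integrable_mul_sq (hV : IsPot V) (hf : IsTest f) :
    Integrable (fun x => V x * f x ^ 2) (volume : Measure Plane) := by
  simpa [sq] using hV.integrable_mul hf hf.1.continuous

end IsPot

section QForm

variable {h : ℝ} {V U f g : Plane → ℝ}

lemma qForm_eq (hV : IsPot V) (hf : IsTest f) :
    qForm h V f = h ^ 2 * (∫ x, ‖fderiv ℝ f x‖ ^ 2) - ∫ x, V x * f x ^ 2 := by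
  unfold qForm
  rw [integral_sub (hf.1.integrable_grad.const_mul _) (hV.integrable_mul_sq hf),
    integral_const_mul]

lemma qForm_add (hV : IsPot V) (hU : IsPot U) (hf : IsTest f) :
    qForm h (fun x => V x + U x) f = qForm h V f - ∫ x, U x * f x ^ 2 := by
  rw [qForm_eq (hV.add hU) hf, qForm_eq hV hf]
  simp only [add_mul]
  rw [integral_add (hV.integrable_mul_sq hf) (hU.integrable_mul_sq hf)]
  ring

lemma qForm_anti (hV : IsPot V) (hU : IsPot U) (hf : IsTest f)
    (hle : ∀ x, f x ≠ 0 → V x ≤ U x) : qForm h U f ≤ qForm h V f := by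
  rw [qForm_eq hU hf, qForm_eq hV hf]
  have : ∫ x, V x * f x ^ 2 ≤ ∫ x, U x * f x ^ 2 := by
    refine integral_mono (hV.integrable_mul_sq hf) (hU.integrable_mul_sq hf) fun x => ?_
    by_cases h0 : f x = 0
    · simp [h0]
    · exact mul_le_mul_of_nonneg_right (hle x h0) (sq_nonneg _)
  linarith

/-- The IMS localisation formula, with the localisation error absorbed in the potential. -/
lemma qForm_ims (hV : IsPot V) (hf : IsTest f) {A : Type*} [Fintype A] (η : A → Plane → ℝ)
    (hη : ∀ a, ContDiff ℝ (⊤ : ℕ∞) (η a)) (h1 : ∀ x, ∑ a, η a x ^ 2 = 1) :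
    qForm h V f = ∑ a, qForm h (fun x => V x + h ^ 2 * ∑ b, ‖fderiv ℝ (η b) x‖ ^ 2)
      (fun x => η a x * f x) := by
  have hd : ∀ a, Differentiable ℝ (η a) := fun a => (hη a).differentiable (by simp)
  have hGc : Continuous fun x => ∑ b, ‖fderiv ℝ (η b) x‖ ^ 2 :=
    continuous_finsetSum _ fun b _ => (((hη b).continuous_fderiv (by simp)).norm.pow 2)
  have hG : IsPot (fun x => h ^ 2 * ∑ b, ‖fderiv ℝ (η b) x‖ ^ 2) :=
    IsPot.of_continuous (continuous_const.mul hGc)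
  have hVG := hV.add hG
  have hηf : ∀ a, IsTest (fun x => η a x * f x) := fun a => hf.mul_left (hη a)
  unfold qForm
  rw [← integral_finsetSum]
  · refine integral_congr_ae (Eventually.of_forall fun x => ?_)
    have hz : ∀ k, ∑ a, η a x * pd k (η a) x = 0 := by
      intro k
      have e1 : pd k (fun y => ∑ a, η a y ^ 2) x = 0 := by
        unfold pd; simp only [h1]; simp
      have e2 : pd k (fun y => ∑ a, η a y ^ 2) x = ∑ a, 2 * (η a x * pd k (η a) x) := by
        unfold pd
        rw [fderiv_fun_sum (A := fun a y => η a y ^ 2) fun a _ => (hd a x).fun_pow 2]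
        simp only [sum_apply]
        refine Finset.sum_congr rfl fun a _ => ?_
        rw [fderiv_fun_pow _ (hd a).differentiableAt]
        simp; ring
      rw [e2, ← Finset.mul_sum] at e1
      linarith
    have hk : ∀ k, ∑ a, pd k (fun y => η a y * f y) x ^ 2 =
        pd k f x ^ 2 + (∑ a, pd k (η a) x ^ 2) * f x ^ 2 := by
      intro k
      have e : ∀ a, pd k (fun y => η a y * f y) x ^ 2 = η a x ^ 2 * pd k f x ^ 2 +
          2 * f x * pd k f x * (η a x * pd k (η a) x) + pd k (η a) x ^ 2 * f x ^ 2 := by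
        intro a
        rw [pd_mul (hd a).differentiableAt hf.1.differentiable.differentiableAt]; ring
      simp only [e, Finset.sum_add_distrib, ← Finset.sum_mul, ← Finset.mul_sum, hz, h1]
      ring
    have hk' : ∑ a, ‖fderiv ℝ (fun y => η a y * f y) x‖ ^ 2 =
        ‖fderiv ℝ f x‖ ^ 2 + (∑ b, ‖fderiv ℝ (η b) x‖ ^ 2) * f x ^ 2 := by
      simp only [norm_fderiv_sq]
      rw [Finset.sum_comm]
      simp only [hk, Finset.sum_add_distrib, ← Finset.sum_mul]
      congr 2
      rw [Finset.sum_comm]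
    simp only [Finset.sum_sub_distrib, ← Finset.mul_sum, hk', mul_pow, ← Finset.sum_mul, h1]
    ring
  · intro a _
    exact ((hηf a).1.integrable_grad.const_mul _).sub (hVG.integrable_mul_sq (hηf a))

end QForm

/-- Continuously differentiable compactly supported functions of the logarithmic radius. -/
def IsRad (u : ℝ → ℝ) : Prop := ContDiff ℝ 1 u ∧ HasCompactSupport u

/-- The radial Coulomb form with angular momentum `ℓ` in the variable `t = log r`. -/
noncomputable def radForm (g : ℝ) (ℓ : ℕ) (u : ℝ → ℝ) : ℝ :=
  ∫ t, (deriv u t ^ 2 + (ℓ : ℝ) ^ 2 * u t ^ 2 - g * exp t * u t ^ 2)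

namespace IsRad

variable {u v : ℝ → ℝ}

lemma continuous (hu : IsRad u) : Continuous u := hu.1.continuous

lemma continuous_deriv (hu : IsRad u) : Continuous (deriv u) := hu.1.continuous_deriv le_rfl

lemma hasDerivAt (hu : IsRad u) (t : ℝ) : HasDerivAt u (deriv u t) t :=
  (hu.1.differentiable one_ne_zero t).hasDerivAt

lemma integrable_mul (hu : IsRad u) {p : ℝ → ℝ} (hp : Continuous p) :
    Integrable (fun t => p t * u t) :=
  (hp.mul hu.continuous).integrable_of_hasCompactSupport hu.2.mul_left

lemma integrable_mul_mul (hu : IsRad u) {p q : ℝ → ℝ} (hp : Continuous p) (hq : Continuous q) :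
    Integrable (fun t => p t * (u t * q t)) :=
  (hp.mul (hu.continuous.mul hq)).integrable_of_hasCompactSupport (hu.2.mul_right.mul_left)

lemma integrable_mul_sq (hu : IsRad u) {p : ℝ → ℝ} (hp : Continuous p) :
    Integrable (fun t => p t * u t ^ 2) := by
  simpa [sq] using hu.integrable_mul_mul hp hu.continuous

lemma integrable_deriv_sq (hu : IsRad u) : Integrable (fun t => deriv u t ^ 2) := by
  have : Integrable (fun t => deriv u t * deriv u t) :=
    (hu.continuous_deriv.mul hu.continuous_deriv).integrable_of_hasCompactSupport
      (hu.2.deriv.mul_left (f := deriv u))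
  simpa [sq] using this

lemma integral_deriv_mul_sq (hu : IsRad u) {p p' : ℝ → ℝ} (hp : ∀ t, HasDerivAt p (p' t) t)
    (hpc : Continuous p) (hpc' : Continuous p') :
    ∫ t, (p' t * u t ^ 2 + p t * (2 * u t * deriv u t)) = 0 := by
  refine integral_eq_zero_of_hasDerivAt_of_integrable (f := fun t => p t * u t ^ 2) ?_ ?_ ?_
  · intro t
    refine ((hp t).fun_mul ((hu.hasDerivAt t).fun_pow 2)).congr_deriv ?_
    norm_num
  · have h1 := hu.integrable_mul_sq hpc'
    have h2 := hu.integrable_mul_mul (p := fun t => 2 * p t) (by fun_prop) hu.continuous_deriv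
    refine (h1.add h2).congr (Eventually.of_forall fun t => ?_)
    simp only [Pi.add_apply]; ring
  · exact hu.integrable_mul_sq hpc

lemma integrable_radForm (hu : IsRad u) (g : ℝ) (ℓ : ℕ) :
    Integrable (fun t => deriv u t ^ 2 + (ℓ : ℝ) ^ 2 * u t ^ 2 - g * exp t * u t ^ 2) :=
  (hu.integrable_deriv_sq.add (hu.integrable_mul_sq continuous_const)).sub
    (hu.integrable_mul_sq (by fun_prop))

/-- First factorisation of the radial Coulomb form. -/
lemma integral_lower_sq (hu : IsRad u) (ℓ : ℕ) (β : ℝ) :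
    ∫ t, (deriv u t - (ℓ - β * exp t) * u t) ^ 2 =
      radForm ((2 * ℓ + 1) * β) ℓ u + β ^ 2 * ∫ t, exp (2 * t) * u t ^ 2 := by
  have hp : ∀ t, HasDerivAt (fun t => (ℓ : ℝ) - β * exp t) (-(β * exp t)) t := fun t => by
    simpa using ((Real.hasDerivAt_exp t).const_mul β).const_sub (ℓ : ℝ)
  have h0 := hu.integral_deriv_mul_sq hp (by fun_prop) (by fun_prop)
  have i1 : Integrable (fun t => deriv u t ^ 2 + (ℓ : ℝ) ^ 2 * u t ^ 2
      - (2 * ℓ + 1) * β * exp t * u t ^ 2) := hu.integrable_radForm _ _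
  have i2 : Integrable (fun t => exp (2 * t) * u t ^ 2) := hu.integrable_mul_sq (by fun_prop)
  have i3 : Integrable (fun t => -(β * exp t) * u t ^ 2
      + ((ℓ : ℝ) - β * exp t) * (2 * u t * deriv u t)) := by
    have h1 := hu.integrable_mul_sq (p := fun t => -(β * exp t)) (by fun_prop)
    have h2 := hu.integrable_mul_mul (p := fun t => 2 * ((ℓ : ℝ) - β * exp t)) (by fun_prop)
      hu.continuous_deriv
    refine (h1.add h2).congr (Eventually.of_forall fun t => ?_)
    simp only [Pi.add_apply]; ring
  have e : ∀ t, (deriv u t - (ℓ - β * exp t) * u t) ^ 2 = (deriv u t ^ 2 + (ℓ : ℝ) ^ 2 * u t ^ 2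
      - (2 * ℓ + 1) * β * exp t * u t ^ 2 + β ^ 2 * (exp (2 * t) * u t ^ 2))
      - (-(β * exp t) * u t ^ 2 + ((ℓ : ℝ) - β * exp t) * (2 * u t * deriv u t)) := by
    intro t
    rw [two_mul t, Real.exp_add]; ring
  simp only [e]
  rw [integral_sub (by exact i1.add (i2.const_mul _)) i3, h0, integral_add i1 (i2.const_mul _),
    integral_const_mul]
  simp [radForm]

/-- Second factorisation, raising the angular momentum. -/
lemma integral_raise_sq (hu : IsRad u) (ℓ : ℕ) (β : ℝ) :
    ∫ t, (deriv u t + (ℓ + 1 - β * exp t) * u t) ^ 2 =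
      radForm ((2 * ℓ + 1) * β) (ℓ + 1) u + β ^ 2 * ∫ t, exp (2 * t) * u t ^ 2 := by
  have hp : ∀ t, HasDerivAt (fun t => (ℓ : ℝ) + 1 - β * exp t) (-(β * exp t)) t := fun t => by
    simpa using ((Real.hasDerivAt_exp t).const_mul β).const_sub ((ℓ : ℝ) + 1)
  have h0 := hu.integral_deriv_mul_sq hp (by fun_prop) (by fun_prop)
  have i1 : Integrable (fun t => deriv u t ^ 2 + ((ℓ : ℝ) + 1) ^ 2 * u t ^ 2
      - (2 * ℓ + 1) * β * exp t * u t ^ 2) := by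
    simpa using hu.integrable_radForm ((2 * ℓ + 1) * β) (ℓ + 1)
  have i2 : Integrable (fun t => exp (2 * t) * u t ^ 2) := hu.integrable_mul_sq (by fun_prop)
  have i3 : Integrable (fun t => -(β * exp t) * u t ^ 2
      + ((ℓ : ℝ) + 1 - β * exp t) * (2 * u t * deriv u t)) := by
    have h1 := hu.integrable_mul_sq (p := fun t => -(β * exp t)) (by fun_prop)
    have h2 := hu.integrable_mul_mul (p := fun t => 2 * ((ℓ : ℝ) + 1 - β * exp t)) (by fun_prop)
      hu.continuous_deriv
    refine (h1.add h2).congr (Eventually.of_forall fun t => ?_)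
    simp only [Pi.add_apply]; ring
  have e : ∀ t, (deriv u t + (ℓ + 1 - β * exp t) * u t) ^ 2 = (deriv u t ^ 2 + ((ℓ : ℝ) + 1) ^ 2 * u t ^ 2
      - (2 * ℓ + 1) * β * exp t * u t ^ 2 + β ^ 2 * (exp (2 * t) * u t ^ 2))
      + (-(β * exp t) * u t ^ 2 + ((ℓ : ℝ) + 1 - β * exp t) * (2 * u t * deriv u t)) := by
    intro t
    rw [two_mul t, Real.exp_add]; ring
  simp only [e]
  rw [integral_add (by exact i1.add (i2.const_mul _)) i3, h0, integral_add i1 (i2.const_mul _),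
    integral_const_mul]
  simp [radForm]

lemma integral_adjoint (hu : IsRad u) (hv : IsRad v) (ℓ : ℕ) (β : ℝ) :
    ∫ t, exp t * u t * (-(deriv v t + (ℓ + 1 - β * exp t) * v t)) =
      ∫ t, exp t * v t * (deriv u t - (ℓ - β * exp t) * u t) := by
  rw [← sub_eq_zero]
  have i1 : ∀ {w₁ w₂ : ℝ → ℝ}, IsRad w₁ → IsRad w₂ → ∀ p : ℝ → ℝ, Continuous p →
      Integrable (fun t => exp t * w₁ t * (deriv w₂ t + p t * w₂ t)) := by
    intro w₁ w₂ h1 h2 p hp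
    have := h1.integrable_mul_mul (p := exp) (q := fun t => deriv w₂ t + p t * w₂ t)
      (by fun_prop) (h2.continuous_deriv.add (hp.mul h2.continuous))
    simpa [mul_assoc] using this
  rw [← integral_sub]
  · rw [← neg_eq_zero, ← integral_neg]
    refine (integral_congr_ae (Eventually.of_forall fun t => ?_)).trans
      (integral_eq_zero_of_hasDerivAt_of_integrable (f := fun t => exp t * (u t * v t))
        (f' := fun t => exp t * u t * (deriv v t + 1 * v t) + exp t * v t *
          (deriv u t + 0 * u t)) ?_ ?_ ?_)
    · ring
    · intro t
      refine ((Real.hasDerivAt_exp t).fun_mul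
        ((hu.hasDerivAt t).fun_mul (hv.hasDerivAt t))).congr_deriv ?_
      ring
    · exact (i1 hu hv _ continuous_const).add (i1 hv hu _ continuous_const)
    · exact hu.integrable_mul_mul (by fun_prop) hv.continuous
  · have := (i1 hu hv (fun t => ℓ + 1 - β * exp t) (by fun_prop)).neg
    refine this.congr (Eventually.of_forall fun t => ?_)
    rw [Pi.neg_apply]; ring
  · have := i1 hv hu (fun t => -(ℓ - β * exp t)) (by fun_prop)
    refine this.congr (Eventually.of_forall fun t => ?_)
    ring

end IsRad

/-- The space of radial functions. -/
def radSub : Submodule ℝ (ℝ → ℝ) where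
  carrier := {u | IsRad u}
  add_mem' := fun ha hb => ⟨ha.1.add hb.1, ha.2.add hb.2⟩
  zero_mem' := ⟨contDiff_const, HasCompactSupport.zero⟩
  smul_mem' := fun _ _ hu => ⟨contDiff_const.smul hu.1, hu.2.smul_left⟩

/-- The primitive inverting the lowering operator. -/
noncomputable def radLower (ℓ : ℕ) (β : ℝ) (u : ℝ → ℝ) (t : ℝ) : ℝ :=
  -exp (β * exp t - (ℓ + 1) * t) * ∫ s in Set.Iic t, exp ((ℓ + 2) * s - β * exp s) * u s

lemma hasDerivAt_integral_Iic {F : ℝ → ℝ} (hF : Continuous F) (hi : Integrable F) (t : ℝ) :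
    HasDerivAt (fun t => ∫ s in Set.Iic t, F s) (F t) t := by
  have : (fun t => ∫ s in Set.Iic t, F s) =
      fun t => (∫ s in Set.Iic 0, F s) + ∫ s in (0 : ℝ)..t, F s := by
    ext t
    rw [← intervalIntegral.integral_Iic_sub_Iic hi.integrableOn hi.integrableOn]; ring
  rw [this]
  exact (intervalIntegral.integral_hasDerivAt_right (hF.intervalIntegrable _ _)
    (hF.stronglyMeasurableAtFilter _ _) hF.continuousAt).const_add _

namespace IsRad

variable {u : ℝ → ℝ}

lemma hasDerivAt_radLower (hu : IsRad u) (ℓ : ℕ) (β t : ℝ) :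
    HasDerivAt (radLower ℓ β u) (-(exp t * u t) - (ℓ + 1 - β * exp t) * radLower ℓ β u t) t := by
  have hF : Continuous fun s => exp ((ℓ + 2) * s - β * exp s) := by fun_prop
  have h1 := hasDerivAt_integral_Iic (F := fun s => exp ((ℓ + 2) * s - β * exp s) * u s)
    (hF.mul hu.continuous) (hu.integrable_mul hF) t
  have h2 : HasDerivAt (fun t => -exp (β * exp t - (ℓ + 1) * t))
      (-(exp (β * exp t - (ℓ + 1) * t) * (β * exp t - (ℓ + 1)))) t := by
    have h3 : HasDerivAt (fun t => β * exp t - ((ℓ : ℝ) + 1) * t) (β * exp t - (ℓ + 1)) t := by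
      simpa using ((Real.hasDerivAt_exp t).const_mul β).fun_sub
        ((hasDerivAt_id t).const_mul ((ℓ : ℝ) + 1))
    exact h3.exp.neg
  refine (h2.fun_mul h1).congr_deriv ?_
  unfold radLower
  have : exp t * u t = exp (β * exp t - (ℓ + 1) * t) *
      (exp ((ℓ + 2) * t - β * exp t) * u t) := by
    rw [← mul_assoc, ← Real.exp_add]; congr 2; ring
  rw [this]; ring

lemma radLower (hu : IsRad u) (ℓ : ℕ) (β : ℝ)
    (h0 : ∫ s, exp ((ℓ + 2) * s - β * exp s) * u s = 0) : IsRad (radLower ℓ β u) := by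
  have hd := hu.hasDerivAt_radLower ℓ β
  have hdiff : Differentiable ℝ (_root_.radLower ℓ β u) := fun t => (hd t).differentiableAt
  refine ⟨?_, ?_⟩
  · rw [contDiff_one_iff_deriv]
    refine ⟨hdiff, ?_⟩
    have : deriv (_root_.radLower ℓ β u) =
        fun t => -(exp t * u t) - (ℓ + 1 - β * exp t) * _root_.radLower ℓ β u t := by
      ext t; exact (hd t).deriv
    rw [this]
    have := hu.continuous
    have := hdiff.continuous
    fun_prop
  · obtain ⟨R, hR⟩ := hu.2.isCompact.isBounded.subset_closedBall 0
    refine HasCompactSupport.intro (isCompact_closedBall (0 : ℝ) R) fun t ht => ?_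
    have hz : ∀ s, R < |s| → u s = 0 := fun s hs => by
      by_contra hne
      have := hR (subset_tsupport u hne)
      simp at this; linarith
    have htR : R < |t| := by simpa using ht
    unfold _root_.radLower
    suffices ∫ s in Set.Iic t, exp ((ℓ + 2) * s - β * exp s) * u s = 0 by rw [this, mul_zero]
    rcases le_or_gt 0 t with h | h
    · rw [abs_of_nonneg h] at htR
      rw [setIntegral_eq_integral_of_forall_compl_eq_zero, h0]
      intro s hs
      have hs : t < s := by simpa using hs
      rw [hz s (lt_of_lt_of_le (htR.trans hs) (le_abs_self s)), mul_zero]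
    · rw [abs_of_neg h] at htR
      refine setIntegral_eq_zero_of_forall_eq_zero fun s hs => ?_
      have hs : s ≤ t := hs
      rw [hz s, mul_zero]
      rw [abs_of_neg (by linarith)]; linarith

/-- The commutation step: the bound `-E` for angular momentum `ℓ + 1` yields the same bound for
angular momentum `ℓ`, orthogonally to the ground state. -/
lemma radForm_ge_of_raise (hu : IsRad u) (ℓ : ℕ) (β E : ℝ) (hE : E < β ^ 2)
    (h0 : ∫ s, exp ((ℓ + 2) * s - β * exp s) * u s = 0)
    (hw : -E * ∫ t, exp (2 * t) * (_root_.radLower ℓ β u t) ^ 2 ≤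
      radForm ((2 * ℓ + 1) * β) (ℓ + 1) (_root_.radLower ℓ β u)) :
    -E * ∫ t, exp (2 * t) * u t ^ 2 ≤ radForm ((2 * ℓ + 1) * β) ℓ u := by
  set w := _root_.radLower ℓ β u with hwdef
  have hwr : IsRad w := hu.radLower ℓ β h0
  have hd : ∀ t, deriv w t + (ℓ + 1 - β * exp t) * w t = -(exp t * u t) := fun t => by
    rw [(hu.hasDerivAt_radLower ℓ β t).deriv, hwdef]; ring
  have h1 := hwr.integral_raise_sq ℓ β
  have h2 := hu.integral_adjoint hwr ℓ β
  have h3 := hu.integral_lower_sq ℓ β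
  simp only [hd] at h1 h2
  have e1 : ∀ t, (-(exp t * u t)) ^ 2 = exp (2 * t) * u t ^ 2 := fun t => by
    rw [two_mul t, Real.exp_add]; ring
  have e2 : ∀ t, exp t * u t * - -(exp t * u t) = exp (2 * t) * u t ^ 2 := fun t => by
    rw [two_mul t, Real.exp_add]; ring
  simp only [e1] at h1
  simp only [e2] at h2
  set N := ∫ t, exp (2 * t) * u t ^ 2
  set M := ∫ t, exp (2 * t) * w t ^ 2
  set P := ∫ t, (deriv u t - (ℓ - β * exp t) * u t) ^ 2
  have hN : 0 ≤ N := integral_nonneg fun t => by positivity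
  have hM : 0 ≤ M := integral_nonneg fun t => by positivity
  have hP : 0 ≤ P := integral_nonneg fun t => by positivity
  have hcs : N ^ 2 ≤ M * P := by
    rw [h2]
    set a := fun t => exp t * w t
    set b := fun t => deriv u t - (ℓ - β * exp t) * u t
    have ha : IsRad a := ⟨(Real.contDiff_exp.of_le le_top).mul hwr.1, hwr.2.mul_left⟩
    have hbc : Continuous b := by
      have := hu.continuous; have := hu.continuous_deriv; fun_prop
    have hbs : HasCompactSupport b := hu.2.deriv.sub hu.2.mul_left
    have hA : MemLp a 2 := ha.continuous.memLp_of_hasCompactSupport ha.2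
    have hB : MemLp b 2 := hbc.memLp_of_hasCompactSupport hbs
    have hq : ∀ x : ℝ, 0 ≤ M * (x * x) + (2 * ∫ t, a t * b t) * x + P := by
      intro x
      have := integral_nonneg (μ := volume) (f := fun t => (x * a t + b t) ^ 2)
        fun t => sq_nonneg _
      have e : ∀ t, (x * a t + b t) ^ 2 = (x * x) * (exp (2 * t) * w t ^ 2)
          + (2 * x) * (a t * b t) + b t ^ 2 := fun t => by
        simp only [a]; rw [two_mul t, Real.exp_add]; ring
      simp only [e] at this
      have i1 : Integrable fun t => exp (2 * t) * w t ^ 2 := hwr.integrable_mul_sq (by fun_prop)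
      have i2 : Integrable fun t => a t * b t := hA.integrable_mul hB
      have i3 : Integrable fun t => b t ^ 2 := hB.integrable_sq
      rw [integral_add (by exact (i1.const_mul _).add (i2.const_mul _)) i3,
        integral_add (i1.const_mul _) (i2.const_mul _), integral_const_mul,
        integral_const_mul] at this
      linarith
    have := discrim_le_zero hq
    unfold discrim at this
    nlinarith
  rcases hN.eq_or_lt with h | hpos
  · have : 0 ≤ β ^ 2 * N := by rw [← h]; simp
    rw [← h] at h3 ⊢
    simp only [mul_zero] at h3 ⊢
    linarith
  · have h5 : (β ^ 2 - E) * M ≤ N := by linarith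
    have h6 : (β ^ 2 - E) * N ^ 2 ≤ N * P := by
      calc (β ^ 2 - E) * N ^ 2 ≤ (β ^ 2 - E) * (M * P) := by
            apply mul_le_mul_of_nonneg_left hcs; linarith
        _ = ((β ^ 2 - E) * M) * P := by ring
        _ ≤ N * P := by gcongr
    have h7 : (β ^ 2 - E) * N ≤ P := by
      have : N * ((β ^ 2 - E) * N) ≤ N * P := by linarith
      exact le_of_mul_le_mul_left this hpos
    linarith

end IsRad

lemma radLower_add {u v : ℝ → ℝ} (hu : IsRad u) (hv : IsRad v) (ℓ : ℕ) (β : ℝ) :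
    radLower ℓ β (u + v) = radLower ℓ β u + radLower ℓ β v := by
  have hF : Continuous fun s => exp ((ℓ + 2) * s - β * exp s) := by fun_prop
  ext t
  simp only [radLower, Pi.add_apply, mul_add]
  rw [integral_add (hu.integrable_mul hF).integrableOn (hv.integrable_mul hF).integrableOn]
  ring

lemma radLower_smul (c : ℝ) (u : ℝ → ℝ) (ℓ : ℕ) (β : ℝ) :
    radLower ℓ β (c • u) = c • radLower ℓ β u := by
  ext t
  simp only [radLower, Pi.smul_apply, smul_eq_mul]
  have : ∀ s, exp ((ℓ + 2) * s - β * exp s) * (c * u s) =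
    c * (exp ((ℓ + 2) * s - β * exp s) * u s) := fun s => by ring
  simp only [this, integral_const_mul]
  ring

/-- The pairing with the ground state of angular momentum `ℓ`. -/
noncomputable def groundPairing (ℓ : ℕ) (β : ℝ) : radSub →ₗ[ℝ] ℝ where
  toFun u := ∫ s, exp ((ℓ + 2) * s - β * exp s) * (u : ℝ → ℝ) s
  map_add' u v := by
    have hF : Continuous fun s => exp ((ℓ + 2) * s - β * exp s) := by fun_prop
    simp only [Submodule.coe_add, Pi.add_apply, mul_add]
    exact integral_add (IsRad.integrable_mul u.2 hF) (IsRad.integrable_mul v.2 hF)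
  map_smul' c u := by
    simp only [Submodule.coe_smul, Pi.smul_apply, smul_eq_mul, RingHom.id_apply]
    rw [← integral_const_mul]
    congr 1; ext s; ring

/-- The inverse of the lowering operator on the orthogonal complement of the ground state. -/
noncomputable def radLowerMap (ℓ : ℕ) (β : ℝ) : LinearMap.ker (groundPairing ℓ β) →ₗ[ℝ] radSub where
  toFun u := ⟨radLower ℓ β (u : radSub), IsRad.radLower u.1.2 ℓ β (LinearMap.mem_ker.1 u.2)⟩
  map_add' u v := Subtype.ext (radLower_add u.1.2 v.1.2 ℓ β)
  map_smul' c _ := Subtype.ext (radLower_smul c _ ℓ β)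

/-- The radial Coulomb form is bounded below by its `j`-th level on a subspace of
codimension `j`. -/
lemma radForm_levels (g : ℝ) (hg : 0 < g) (j : ℕ) : ∀ ℓ : ℕ,
    ∃ T : radSub →ₗ[ℝ] (Fin j → ℝ), ∀ u : radSub, T u = 0 →
      -(g ^ 2 / (2 * ((ℓ : ℝ) + j) + 1) ^ 2) * ∫ t, exp (2 * t) * (u : ℝ → ℝ) t ^ 2 ≤
        radForm g ℓ u := by
  induction j with
  | zero =>
    intro ℓ
    refine ⟨0, fun u _ => ?_⟩
    have h1 := IsRad.integral_lower_sq u.2 ℓ (g / (2 * ℓ + 1))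
    have h2 : 0 ≤ ∫ t, (deriv (u : ℝ → ℝ) t - (ℓ - g / (2 * ℓ + 1) * exp t) * (u : ℝ → ℝ) t) ^ 2 :=
      integral_nonneg fun t => sq_nonneg _
    have h3 : (2 * (ℓ : ℝ) + 1) * (g / (2 * ℓ + 1)) = g := by field_simp
    rw [h3] at h1
    rw [h1, div_pow] at h2
    simp only [Nat.cast_zero, add_zero]
    linarith
  | succ j ih =>
    intro ℓ
    obtain ⟨T', hT'⟩ := ih (ℓ + 1)
    set β := g / (2 * (ℓ : ℝ) + 1) with hβ
    obtain ⟨S, hS⟩ := LinearMap.exists_extend (T' ∘ₗ radLowerMap ℓ β)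
    refine ⟨LinearMap.pi (Fin.cons (groundPairing ℓ β)
      fun i => LinearMap.proj i ∘ₗ S), fun u hu => ?_⟩
    have h0 : groundPairing ℓ β u = 0 := by simpa using congrFun hu 0
    have hSu : S u = 0 := by
      ext i
      simpa using congrFun hu i.succ
    have hT : T' (radLowerMap ℓ β ⟨u, h0⟩) = 0 := by
      rw [← hSu]
      have := LinearMap.congr_fun hS ⟨u, h0⟩
      simpa using this.symm
    have h1 := hT' _ hT
    have h3 : (2 * (ℓ : ℝ) + 1) * β = g := by rw [hβ]; field_simp
    have h4 := IsRad.radForm_ge_of_raise u.2 ℓ β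
      (g ^ 2 / (2 * ((ℓ : ℝ) + (j + 1 : ℕ)) + 1) ^ 2) ?_ h0 ?_
    · rw [h3] at h4; exact h4
    · rw [hβ, div_pow]
      apply div_lt_div_of_pos_left (by positivity) (by positivity)
      have : (0 : ℝ) ≤ ℓ := by positivity
      have : (0 : ℝ) ≤ j := by positivity
      push_cast
      nlinarith
    · rw [h3]
      have e : (ℓ : ℝ) + (j + 1 : ℕ) = ((ℓ + 1 : ℕ) : ℝ) + j := by push_cast; ring
      rw [e]
      exact h1

/-- Logarithmic polar coordinates. -/
noncomputable def logPolar (t θ : ℝ) : Plane := !₂[exp t * cos θ, exp t * sin θ]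

lemma norm_logPolar (t θ : ℝ) : ‖logPolar t θ‖ = exp t := by
  rw [logPolar, EuclideanSpace.norm_eq, Fin.sum_univ_two]
  simp only [Matrix.cons_val_zero, Matrix.cons_val_one, Real.norm_eq_abs, sq_abs]
  rw [show (exp t * cos θ) ^ 2 + (exp t * sin θ) ^ 2 = exp t ^ 2 by
    rw [mul_pow, mul_pow, ← mul_add, add_comm, Real.sin_sq_add_cos_sq, mul_one]]
  exact Real.sqrt_sq (exp_pos t).le

lemma contDiff_logPolar : ContDiff ℝ (⊤ : ℕ∞) (fun p : ℝ × ℝ => logPolar p.1 p.2) := by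
  rw [contDiff_euclidean]
  intro i
  fin_cases i
  · simp only [logPolar, Fin.zero_eta, Matrix.cons_val_zero]
    fun_prop
  · simp only [logPolar, Fin.mk_one, Matrix.cons_val_one, Matrix.cons_val_zero]
    fun_prop

lemma continuous_logPolar : Continuous (fun p : ℝ × ℝ => logPolar p.1 p.2) :=
  contDiff_logPolar.continuous

lemma exists_logPolar_eq_zero {G : Plane → ℝ} (hs : HasCompactSupport G)
    (h0 : (0 : Plane) ∉ tsupport G) :
    ∃ R : ℝ, 0 < R ∧ ∀ t, R < |t| → ∀ θ, G (logPolar t θ) = 0 := by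
  obtain ⟨M, hM⟩ := hs.isCompact.isBounded.subset_closedBall 0
  obtain ⟨ε, hε, hball⟩ := Metric.mem_nhds_iff.1
    ((isClosed_tsupport G).isOpen_compl.mem_nhds h0)
  refine ⟨max (max (log (max M 1)) (-log ε)) 1, by positivity, fun t ht θ => ?_⟩
  by_contra hne
  have hmem : logPolar t θ ∈ tsupport G := subset_tsupport _ hne
  have h1 : exp t ≤ M := by
    have := hM hmem
    rwa [mem_closedBall_zero_iff, norm_logPolar] at this
  have h2 : ε ≤ exp t := by
    by_contra hlt
    refine hball ?_ hmem
    rw [mem_ball_zero_iff, norm_logPolar]; exact not_le.1 hlt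
  have h3 : t ≤ log (max M 1) := by
    rw [Real.le_log_iff_exp_le (by positivity)]; exact h1.trans (le_max_left _ _)
  have h4 : log ε ≤ t := by
    rw [Real.log_le_iff_le_exp hε]; exact h2
  have h5 : |t| ≤ max (max (log (max M 1)) (-log ε)) 1 := by
    rw [abs_le']
    exact ⟨h3.trans ((le_max_left _ _).trans (le_max_left _ _)),
      (neg_le_neg h4).trans ((le_max_right _ _).trans (le_max_left _ _))⟩
  linarith

lemma integral_logPolar {G : Plane → ℝ} (hc : Continuous G) (hs : HasCompactSupport G) :
    ∫ x, G x = ∫ t, ∫ θ in (-π)..π, exp (2 * t) * G (logPolar t θ) := by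
  set P : ℝ × ℝ → Plane := fun p => !₂[p.1, p.2] with hP
  have hPc : Continuous P := by
    have : ContDiff ℝ 1 P := by
      rw [contDiff_euclidean]
      intro i
      fin_cases i
      · simp only [P, Fin.zero_eta, Matrix.cons_val_zero]; fun_prop
      · simp only [P, Fin.mk_one, Matrix.cons_val_one, Matrix.cons_val_zero]; fun_prop
    exact this.continuous
  have e1 : ∫ x, G x = ∫ p : ℝ × ℝ, G (P p) := by
    rw [← (PiLp.volume_preserving_toLp (Fin 2)).integral_comp
      (MeasurableEquiv.toLp 2 (Fin 2 → ℝ)).measurableEmbedding]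
    rw [← ((volume_preserving_finTwoArrow ℝ).symm _).integral_comp
      (MeasurableEquiv.finTwoArrow (α := ℝ)).symm.measurableEmbedding]
    rfl
  rw [e1, ← integral_comp_polarCoord_symm]
  set H : ℝ × ℝ → ℝ := fun p => p.1 * G (P (p.1 * cos p.2, p.1 * sin p.2)) with hH
  have hHc : Continuous H := by
    have : Continuous fun p : ℝ × ℝ => P (p.1 * cos p.2, p.1 * sin p.2) :=
      hPc.comp (by fun_prop)
    exact continuous_fst.mul (hc.comp this)
  have htar : polarCoord.target = Set.Ioi (0 : ℝ) ×ˢ Set.Ioo (-π) π := rfl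
  rw [htar]
  change ∫ p in Set.Ioi (0 : ℝ) ×ˢ Set.Ioo (-π) π, H p = _
  obtain ⟨M, hM⟩ := hs.isCompact.isBounded.subset_closedBall 0
  have hPn : ∀ t θ : ℝ, 0 ≤ t → ‖P (t * cos θ, t * sin θ)‖ = t := by
    intro t θ ht
    rw [hP, EuclideanSpace.norm_eq, Fin.sum_univ_two]
    simp only [Matrix.cons_val_zero, Matrix.cons_val_one, Real.norm_eq_abs, sq_abs]
    rw [show (t * cos θ) ^ 2 + (t * sin θ) ^ 2 = t ^ 2 by
      rw [mul_pow, mul_pow, ← mul_add, add_comm, Real.sin_sq_add_cos_sq, mul_one]]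
    exact Real.sqrt_sq ht
  have hInt : IntegrableOn H (Set.Ioi (0 : ℝ) ×ˢ Set.Ioo (-π) π) (volume.prod volume) := by
    have h1 : IntegrableOn H (Set.Icc (0 : ℝ) M ×ˢ Set.Icc (-π) π) (volume.prod volume) :=
      hHc.continuousOn.integrableOn_compact (isCompact_Icc.prod isCompact_Icc)
    refine h1.of_forall_sdiff_eq_zero (measurableSet_Ioi.prod measurableSet_Ioo) ?_
    rintro ⟨r, θ⟩ ⟨⟨hr, hθ⟩, hn⟩
    simp only [Set.mem_Ioi, Set.mem_Ioo] at hr hθ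
    have hMr : M < r := by
      by_contra hle
      exact hn ⟨⟨hr.le, not_lt.1 hle⟩, ⟨hθ.1.le, hθ.2.le⟩⟩
    have : G (P (r * cos θ, r * sin θ)) = 0 := by
      by_contra hne
      have := hM (subset_tsupport _ hne)
      rw [mem_closedBall_zero_iff, hPn _ _ hr.le] at this
      linarith
    simp [hH, this]
  rw [Measure.volume_eq_prod, setIntegral_prod _ hInt]
  have himg : Real.exp '' Set.univ = Set.Ioi 0 := by rw [Set.image_univ, Real.range_exp]
  rw [← himg, integral_image_eq_integral_abs_deriv_smul MeasurableSet.univ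
    (fun t _ => (Real.hasDerivAt_exp t).hasDerivWithinAt) Real.exp_injective.injOn,
    Measure.restrict_univ]
  congr 1
  ext t
  rw [intervalIntegral.integral_of_le (by linarith [pi_pos]), abs_of_pos (exp_pos t), smul_eq_mul,
    integral_Ioc_eq_integral_Ioo, ← integral_const_mul]
  congr 1
  ext θ
  rw [two_mul, Real.exp_add, mul_assoc]
  rfl

/-- The trigonometric system. -/
noncomputable def trig (s : Bool) (m : ℤ) (θ : ℝ) : ℝ := if s then sin (m * θ) else cos (m * θ)

lemma continuous_trig (s : Bool) (m : ℤ) : Continuous (trig s m) := by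
  have h1 : Continuous fun θ : ℝ => sin (m * θ) := by fun_prop
  have h2 : Continuous fun θ : ℝ => cos (m * θ) := by fun_prop
  unfold trig
  cases s
  · simpa using h2
  · simpa using h1

lemma hasDerivAt_trig (s : Bool) (m : ℤ) (θ : ℝ) :
    HasDerivAt (trig s m) ((if s then (m : ℝ) else -m) * trig (!s) m θ) θ := by
  have h0 : HasDerivAt (fun θ : ℝ => (m : ℝ) * θ) m θ := by
    simpa using (hasDerivAt_id θ).const_mul (m : ℝ)
  cases s
  · have : trig false m = fun θ => cos (m * θ) := by ext; simp [trig]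
    rw [this]
    refine h0.cos.congr_deriv ?_
    simp [trig]; ring
  · have : trig true m = fun θ => sin (m * θ) := by ext; simp [trig]
    rw [this]
    refine h0.sin.congr_deriv ?_
    simp [trig]; ring

lemma trig_sq_add (m : ℤ) (θ : ℝ) : ∑ s, trig s m θ ^ 2 = 1 := by
  simp [trig]

/-- Real Fourier coefficients on `[-π, π]`. -/
noncomputable def trigCoeff (s : Bool) (m : ℤ) (F : ℝ → ℝ) : ℝ :=
  (√(2 * π))⁻¹ * ∫ θ in (-π)..π, F θ * trig s m θ

lemma HasSum.congr_fun' {ι : Type*} {f g : ι → ℝ} {a : ℝ} (h : HasSum f a)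
    (hfg : ∀ i, f i = g i) : HasSum g a :=
  (funext hfg : f = g) ▸ h

/-- Parseval's identity for real Fourier coefficients. -/
lemma hasSum_trigCoeff_sq {F : ℝ → ℝ} (hF : Continuous F) :
    HasSum (fun m : ℤ => ∑ s, trigCoeff s m F ^ 2) (∫ θ in (-π)..π, F θ ^ 2) := by
  have hab : -π < π := by linarith [pi_pos]
  have hL2 : MemLp (fun θ => (F θ : ℂ)) 2 (volume.restrict (Set.Ioc (-π) π)) := by
    have : Continuous fun θ => (F θ : ℂ) := by fun_prop
    have h2 : MemLp (fun θ => (F θ : ℂ)) 2 (volume.restrict (Set.Icc (-π) π)) := by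
      obtain ⟨C, hC⟩ := isCompact_Icc.exists_bound_of_continuousOn
        (s := Set.Icc (-π) π) this.continuousOn
      exact MemLp.of_bound this.aestronglyMeasurable C
        ((ae_restrict_iff' measurableSet_Icc).2 (Eventually.of_forall hC))
    exact h2.mono_measure (Measure.restrict_mono Set.Ioc_subset_Icc_self le_rfl)
  have h := (hasSum_sq_fourierCoeffOn hab hL2).mul_left (2 * π)
  have e1 : 2 * π * ((π - -π)⁻¹ • ∫ x in (-π)..π, ‖(F x : ℂ)‖ ^ 2) = ∫ θ in (-π)..π, F θ ^ 2 := by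
    simp only [Complex.norm_real, Real.norm_eq_abs, sq_abs, smul_eq_mul]
    have : π ≠ 0 := pi_ne_zero
    field_simp
    ring
  rw [e1] at h
  refine h.congr_fun' fun m => ?_
  have hA : Continuous fun θ => F θ * cos (m * θ) := by fun_prop
  have hB : Continuous fun θ => F θ * sin (m * θ) := by fun_prop
  have e2 : ∀ θ : ℝ, fourier (-m) (θ : AddCircle (π - -π)) • (F θ : ℂ) =
      ((F θ * cos (m * θ) : ℝ) : ℂ) - ((F θ * sin (m * θ) : ℝ) : ℂ) * Complex.I := by
    intro θ
    rw [fourier_coe_apply]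
    have : 2 * (π : ℂ) * Complex.I * ((-m : ℤ) : ℂ) * (θ : ℂ) / ((π - -π : ℝ) : ℂ) =
        ((-(m * θ) : ℝ) : ℂ) * Complex.I := by
      have hpi : (π : ℂ) ≠ 0 := by exact_mod_cast pi_ne_zero
      push_cast
      field_simp
      ring
    rw [this, Complex.exp_mul_I, ← Complex.ofReal_cos, ← Complex.ofReal_sin, Real.cos_neg,
      Real.sin_neg]
    push_cast
    simp only [smul_eq_mul]
    ring
  rw [fourierCoeffOn_eq_integral]
  simp only [e2]
  rw [intervalIntegral.integral_sub
    (f := fun θ => ((F θ * cos (m * θ) : ℝ) : ℂ))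
    (g := fun θ => ((F θ * sin (m * θ) : ℝ) : ℂ) * Complex.I)
    ((Complex.continuous_ofReal.comp hA).intervalIntegrable _ _)
    (((Complex.continuous_ofReal.comp hB).mul continuous_const).intervalIntegrable _ _),
    intervalIntegral.integral_mul_const, intervalIntegral.integral_ofReal,
    intervalIntegral.integral_ofReal, norm_smul, mul_pow]
  set A := ∫ θ in (-π)..π, F θ * cos (m * θ)
  set B := ∫ θ in (-π)..π, F θ * sin (m * θ)
  have e3 : ‖(A : ℂ) - (B : ℂ) * Complex.I‖ ^ 2 = A ^ 2 + B ^ 2 := by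
    rw [← Complex.normSq_eq_norm_sq, Complex.normSq_apply]
    simp; ring
  rw [e3]
  simp only [trigCoeff, trig, Fintype.sum_bool, mul_pow, inv_pow,
    Real.sq_sqrt (by positivity : (0 : ℝ) ≤ 2 * π)]
  have hn : ‖1 / (π - -π)‖ ^ 2 = (1 / (2 * π)) ^ 2 := by
    rw [Real.norm_eq_abs, sq_abs]; ring
  rw [hn]
  have : π ≠ 0 := pi_ne_zero
  simp only [if_true, Bool.false_eq_true, if_false]
  change _ = (2 * π)⁻¹ * B ^ 2 + (2 * π)⁻¹ * A ^ 2
  field_simp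
  ring

/-- Fourier coefficients of a derivative of a periodic function. -/
lemma trigCoeff_deriv {F F' : ℝ → ℝ} (hF : ∀ θ, HasDerivAt F (F' θ) θ) (hc : Continuous F')
    (hper : F (-π) = F π) (s : Bool) (m : ℤ) :
    trigCoeff s m F' = -(if s then (m : ℝ) else -m) * trigCoeff (!s) m F := by
  have hFc : Continuous F := continuous_iff_continuousAt.2 fun θ => (hF θ).continuousAt
  have h := intervalIntegral.integral_mul_deriv_eq_deriv_mul (a := -π) (b := π)
    (u := trig s m) (v := F)
    (fun θ _ => hasDerivAt_trig s m θ) (fun θ _ => hF θ)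
    ((continuous_const.mul (continuous_trig _ m)).intervalIntegrable _ _)
    (hc.intervalIntegrable _ _)
  have hp : trig s m (-π) * F (-π) = trig s m π * F π := by
    rw [hper]
    cases s
    · simp [trig]
    · simp [trig]
  rw [hp, sub_self, zero_sub] at h
  unfold trigCoeff
  have e1 : ∀ θ, F' θ * trig s m θ = trig s m θ * F' θ := fun θ => mul_comm _ _
  simp only [e1, h]
  have e2 : ∀ θ, (if s then (m : ℝ) else -m) * trig (!s) m θ * F θ =
      (if s then (m : ℝ) else -m) * (F θ * trig (!s) m θ) := fun θ => by ring
  simp only [e2, intervalIntegral.integral_const_mul]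
  ring

lemma hasSum_trigCoeff_deriv_sq {F F' : ℝ → ℝ} (hF : ∀ θ, HasDerivAt F (F' θ) θ)
    (hc : Continuous F') (hper : F (-π) = F π) :
    HasSum (fun m : ℤ => (m : ℝ) ^ 2 * ∑ s, trigCoeff s m F ^ 2)
      (∫ θ in (-π)..π, F' θ ^ 2) := by
  have h := hasSum_trigCoeff_sq hc
  refine h.congr_fun' fun m => ?_
  simp only [trigCoeff_deriv hF hc hper, Fintype.sum_bool, Bool.not_true, Bool.not_false,
    if_true, Bool.false_eq_true, if_false]
  ring

lemma continuous_trigCoeff_param {Φ : ℝ → ℝ → ℝ} (hc : Continuous (Function.uncurry Φ))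
    (s : Bool) (m : ℤ) : Continuous (fun t => trigCoeff s m (Φ t)) := by
  unfold trigCoeff
  refine continuous_const.mul ?_
  refine intervalIntegral.continuous_parametric_intervalIntegral_of_continuous' ?_ _ _
  exact hc.mul ((continuous_trig s m).comp continuous_snd)

lemma abs_trig_le (s : Bool) (m : ℤ) (θ : ℝ) : |trig s m θ| ≤ 1 := by
  cases s
  · simpa [trig] using abs_cos_le_one _
  · simpa [trig] using abs_sin_le_one _

lemma hasDerivAt_trigCoeff_param {Φ Φt : ℝ → ℝ → ℝ}
    (hd : ∀ t θ, HasDerivAt (fun t => Φ t θ) (Φt t θ) t) (hc : Continuous (Function.uncurry Φ))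
    (hct : Continuous (Function.uncurry Φt)) {C : ℝ} (hC : ∀ t θ, |Φt t θ| ≤ C)
    (s : Bool) (m : ℤ) (t : ℝ) :
    HasDerivAt (fun t => trigCoeff s m (Φ t)) (trigCoeff s m (Φt t)) t := by
  have hθ : ∀ t, Continuous (fun θ => Φ t θ * trig s m θ) := fun t =>
    (hc.comp (Continuous.prodMk_right t)).mul (continuous_trig s m)
  have hθt : ∀ t, Continuous (fun θ => Φt t θ * trig s m θ) := fun t =>
    (hct.comp (Continuous.prodMk_right t)).mul (continuous_trig s m)
  have h := (intervalIntegral.hasDerivAt_integral_of_dominated_loc_of_deriv_le (μ := volume)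
    (F := fun t θ => Φ t θ * trig s m θ) (F' := fun t θ => Φt t θ * trig s m θ) (x₀ := t)
    (a := -π) (b := π) (s := Set.univ) (bound := fun _ => C) univ_mem
    (Eventually.of_forall fun t => (hθ t).aestronglyMeasurable)
    ((hθ t).intervalIntegrable _ _) (hθt t).aestronglyMeasurable
    (Eventually.of_forall fun θ _ t _ => by
      rw [norm_mul, Real.norm_eq_abs, Real.norm_eq_abs]
      calc |Φt t θ| * |trig s m θ| ≤ |Φt t θ| * 1 := by gcongr; exact abs_trig_le s m θ
        _ ≤ C := by simpa using hC t θ)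
    intervalIntegrable_const
    (Eventually.of_forall fun θ _ t _ => (hd t θ).mul_const _)).2
  exact h.const_mul _

lemma hasSum_integral_mul {A : ℤ → ℝ → ℝ} {S p : ℝ → ℝ} (hA : ∀ m, Continuous (A m))
    (h0 : ∀ m t, 0 ≤ A m t) (hS : ∀ t, HasSum (fun m => A m t) (S t)) (hSc : Continuous S)
    (hSs : HasCompactSupport S) (hp : Continuous p) :
    HasSum (fun m => ∫ t, p t * A m t) (∫ t, p t * S t) := by
  refine hasSum_integral_of_dominated_convergence (fun m t => |p t| * A m t)
    (fun m => (hp.mul (hA m)).aestronglyMeasurable)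
    (fun m => Eventually.of_forall fun t => ?_) (Eventually.of_forall fun t => ?_) ?_
    (Eventually.of_forall fun t => (hS t).mul_left _)
  · rw [norm_mul, Real.norm_eq_abs, Real.norm_of_nonneg (h0 m t)]
  · exact ((hS t).mul_left _).summable
  · have : (fun t => ∑' m, |p t| * A m t) = fun t => |p t| * S t := by
      ext t; exact ((hS t).mul_left _).tsum_eq
    rw [this]
    exact (hp.abs.mul hSc).integrable_of_hasCompactSupport hSs.mul_left

lemma logPolar_eq (t θ : ℝ) : logPolar t θ =
    (exp t * cos θ) • EuclideanSpace.single (0 : Fin 2) (1 : ℝ) +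
    (exp t * sin θ) • EuclideanSpace.single (1 : Fin 2) (1 : ℝ) := by
  ext i; fin_cases i <;> simp [logPolar]

/-- The angular tangent vector in logarithmic polar coordinates. -/
noncomputable def perpPolar (t θ : ℝ) : Plane :=
  (-(exp t * sin θ)) • EuclideanSpace.single (0 : Fin 2) (1 : ℝ) +
    (exp t * cos θ) • EuclideanSpace.single (1 : Fin 2) (1 : ℝ)

lemma continuous_perpPolar : Continuous (fun p : ℝ × ℝ => perpPolar p.1 p.2) := by
  unfold perpPolar; fun_prop

lemma hasDerivAt_logPolar_left (t θ : ℝ) :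
    HasDerivAt (fun t => logPolar t θ) (logPolar t θ) t := by
  have h : (fun t => logPolar t θ) = fun t => (exp t * cos θ) • EuclideanSpace.single (0 : Fin 2)
    (1 : ℝ) + (exp t * sin θ) • EuclideanSpace.single (1 : Fin 2) (1 : ℝ) :=
    funext fun t => logPolar_eq t θ
  rw [h, logPolar_eq]
  exact (((Real.hasDerivAt_exp t).mul_const _).smul_const _).add
    (((Real.hasDerivAt_exp t).mul_const _).smul_const _)

lemma hasDerivAt_logPolar_right (t θ : ℝ) :
    HasDerivAt (fun θ => logPolar t θ) (perpPolar t θ) θ := by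
  have h : (fun θ => logPolar t θ) = fun θ => (exp t * cos θ) • EuclideanSpace.single (0 : Fin 2)
    (1 : ℝ) + (exp t * sin θ) • EuclideanSpace.single (1 : Fin 2) (1 : ℝ) :=
    funext fun θ => logPolar_eq t θ
  rw [h]
  refine ((((Real.hasDerivAt_cos θ).const_mul (exp t)).smul_const _).add
    (((Real.hasDerivAt_sin θ).const_mul (exp t)).smul_const _)).congr_deriv ?_
  simp [perpPolar]

lemma norm_fderiv_logPolar (f : Plane → ℝ) (t θ : ℝ) :
    exp (2 * t) * ‖fderiv ℝ f (logPolar t θ)‖ ^ 2 =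
      (fderiv ℝ f (logPolar t θ) (logPolar t θ)) ^ 2 +
      (fderiv ℝ f (logPolar t θ) (perpPolar t θ)) ^ 2 := by
  rw [norm_sq_dual_plane]
  generalize hL : fderiv ℝ f (logPolar t θ) = L
  rw [logPolar_eq, perpPolar]
  simp only [map_add, map_smul, smul_eq_mul]
  have h1 : exp (2 * t) = exp t ^ 2 := by rw [← Real.exp_nat_mul]; norm_num
  have h2 := Real.sin_sq_add_cos_sq θ
  rw [h1]
  linear_combination (-(exp t ^ 2) * (L (EuclideanSpace.single 0 1) ^ 2 +
    L (EuclideanSpace.single 1 1) ^ 2)) * h2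

/-- Angular components of a function in logarithmic polar coordinates. -/
noncomputable def ang (s : Bool) (m : ℤ) (f : Plane → ℝ) (t : ℝ) : ℝ :=
  trigCoeff s m (fun θ => f (logPolar t θ))

namespace IsTest

variable {f : Plane → ℝ}

lemma exists_zero (hf : IsTest f) : ∃ R : ℝ, 0 < R ∧ ∀ t, R < |t| → ∀ θ,
    f (logPolar t θ) = 0 ∧ fderiv ℝ f (logPolar t θ) = 0 := by
  have h0 : (0 : Plane) ∉ tsupport f := fun h => hf.2 h rfl
  have h1 : (0 : Plane) ∉ tsupport (fun x => ‖f x‖ + ‖fderiv ℝ f x‖) := by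
    intro h
    refine h0 ?_
    refine (closure_minimal ?_ (isClosed_tsupport f)) h
    intro x hx
    by_contra hx'
    have e1 : f x = 0 := image_eq_zero_of_notMem_tsupport hx'
    have e2 : fderiv ℝ f x = 0 := by
      by_contra h2
      exact hx' (support_fderiv_subset ℝ h2)
    simp [e1, e2] at hx
  have h2 : HasCompactSupport (fun x => ‖f x‖ + ‖fderiv ℝ f x‖) :=
    hf.1.2.norm.add (hf.1.2.fderiv ℝ).norm
  obtain ⟨R, hR, h⟩ := exists_logPolar_eq_zero h2 h1
  refine ⟨R, hR, fun t ht θ => ?_⟩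
  have h3 := h t ht θ
  have n1 := norm_nonneg (f (logPolar t θ))
  have n2 := norm_nonneg (fderiv ℝ f (logPolar t θ))
  exact ⟨norm_eq_zero.1 (by linarith), norm_eq_zero.1 (by linarith)⟩

lemma continuous_fderiv (hf : IsTest f) : Continuous (fderiv ℝ f) :=
  hf.1.1.continuous_fderiv (by simp)

lemma continuous_comp_logPolar (hf : IsTest f) :
    Continuous (Function.uncurry fun t θ => f (logPolar t θ)) :=
  hf.1.continuous.comp continuous_logPolar

lemma continuous_radial (hf : IsTest f) :
    Continuous (Function.uncurry fun t θ => fderiv ℝ f (logPolar t θ) (logPolar t θ)) :=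
  (hf.continuous_fderiv.comp continuous_logPolar).clm_apply continuous_logPolar

lemma continuous_angular (hf : IsTest f) :
    Continuous (Function.uncurry fun t θ => fderiv ℝ f (logPolar t θ) (perpPolar t θ)) :=
  (hf.continuous_fderiv.comp continuous_logPolar).clm_apply continuous_perpPolar

lemma radial_bound (hf : IsTest f) :
    ∃ C, ∀ t θ, |fderiv ℝ f (logPolar t θ) (logPolar t θ)| ≤ C := by
  have hc : Continuous fun x : Plane => fderiv ℝ f x x :=
    hf.continuous_fderiv.clm_apply continuous_id
  have hs : HasCompactSupport fun x : Plane => fderiv ℝ f x x := by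
    refine (hf.1.2.fderiv ℝ).mono fun x hx => ?_
    intro h
    simp [h] at hx
  obtain ⟨C, hC⟩ := hs.exists_bound_of_continuous hc
  exact ⟨C, fun t θ => hC _⟩

lemma hasDerivAt_ang (hf : IsTest f) (s : Bool) (m : ℤ) (t : ℝ) :
    HasDerivAt (ang s m f)
      (trigCoeff s m fun θ => fderiv ℝ f (logPolar t θ) (logPolar t θ)) t := by
  obtain ⟨C, hC⟩ := hf.radial_bound
  refine hasDerivAt_trigCoeff_param (Φ := fun t θ => f (logPolar t θ))
    (Φt := fun t θ => fderiv ℝ f (logPolar t θ) (logPolar t θ)) ?_ hf.continuous_comp_logPolar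
    hf.continuous_radial hC s m t
  intro t θ
  exact (hf.1.differentiable _).hasFDerivAt.comp_hasDerivAt t (hasDerivAt_logPolar_left t θ)

lemma hasCompactSupport_of_zero {R : ℝ} {F : ℝ → ℝ} (h : ∀ t, R < |t| → F t = 0) :
    HasCompactSupport F := by
  refine HasCompactSupport.intro (isCompact_closedBall (0 : ℝ) R) fun t ht => h t ?_
  simpa [mem_closedBall_zero_iff] using ht

lemma isRad_ang (hf : IsTest f) (s : Bool) (m : ℤ) : IsRad (ang s m f) := by
  refine ⟨?_, ?_⟩
  · rw [contDiff_one_iff_deriv]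
    refine ⟨fun t => (hf.hasDerivAt_ang s m t).differentiableAt, ?_⟩
    have : deriv (ang s m f) = fun t =>
        trigCoeff s m fun θ => fderiv ℝ f (logPolar t θ) (logPolar t θ) :=
      funext fun t => (hf.hasDerivAt_ang s m t).deriv
    rw [this]
    exact continuous_trigCoeff_param hf.continuous_radial s m
  · obtain ⟨R, -, hR⟩ := hf.exists_zero
    refine hasCompactSupport_of_zero (R := R) fun t ht => ?_
    simp [ang, trigCoeff, (hR t ht _).1]

lemma continuous_integral_sq {Φ : ℝ → ℝ → ℝ} (hc : Continuous (Function.uncurry Φ)) :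
    Continuous fun t => ∫ θ in (-π)..π, Φ t θ ^ 2 :=
  intervalIntegral.continuous_parametric_intervalIntegral_of_continuous' (hc.pow 2) _ _

lemma continuous_mul_sq_log (hf : IsTest f) {w : ℝ → ℝ} (hw : Continuous w) :
    Continuous fun x : Plane => w (log ‖x‖) * f x ^ 2 := by
  rw [continuous_iff_continuousAt]
  intro x
  by_cases hx : x = 0
  · subst hx
    have h0 : (0 : Plane) ∉ tsupport f := fun h => hf.2 h rfl
    have : (fun x : Plane => w (log ‖x‖) * f x ^ 2) =ᶠ[nhds 0] fun _ => 0 := by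
      filter_upwards [(isClosed_tsupport f).isOpen_compl.mem_nhds h0] with y hy
      simp [image_eq_zero_of_notMem_tsupport hy]
    exact this.continuousAt
  · refine ContinuousAt.mul ?_ (hf.1.continuous.continuousAt.pow 2)
    exact hw.continuousAt.comp (continuous_norm.continuousAt.log (norm_ne_zero_iff.2 hx))

/-- Angular decomposition of the Schrödinger form with a radial potential. -/
theorem hasSum_ang (hf : IsTest f) (h : ℝ) {w : ℝ → ℝ} (hw : Continuous w) :
    HasSum (fun m : ℤ => ∑ s, ∫ t, (h ^ 2 * (deriv (ang s m f) t ^ 2 +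
      (m : ℝ) ^ 2 * ang s m f t ^ 2) - exp (2 * t) * w t * ang s m f t ^ 2))
      (qForm h (fun x => w (log ‖x‖)) f) := by
  obtain ⟨R, -, hR⟩ := hf.exists_zero
  set F := fun t θ => f (logPolar t θ) with hF
  set Ft := fun t θ => fderiv ℝ f (logPolar t θ) (logPolar t θ) with hFt
  set Fθ := fun t θ => fderiv ℝ f (logPolar t θ) (perpPolar t θ) with hFθ
  have cF : Continuous (Function.uncurry F) := hf.continuous_comp_logPolar
  have cFt : Continuous (Function.uncurry Ft) := hf.continuous_radial
  have cFθ : Continuous (Function.uncurry Fθ) := hf.continuous_angular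
  have c1 : ∀ {Φ : ℝ → ℝ → ℝ}, Continuous (Function.uncurry Φ) → ∀ t, Continuous (Φ t) :=
    fun hc t => hc.comp (Continuous.prodMk_right t)
  have key : ∀ {Φ : ℝ → ℝ → ℝ}, Continuous (Function.uncurry Φ) →
      (∀ t, R < |t| → ∀ θ, Φ t θ = 0) → ∀ {A : ℤ → ℝ → ℝ}, (∀ m, Continuous (A m)) →
      (∀ m t, 0 ≤ A m t) → (∀ t, HasSum (fun m => A m t) (∫ θ in (-π)..π, Φ t θ ^ 2)) →
      ∀ {p : ℝ → ℝ}, Continuous p →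
      HasSum (fun m => ∫ t, p t * A m t) (∫ t, p t * ∫ θ in (-π)..π, Φ t θ ^ 2) := by
    intro Φ hc hz A hA h0 hS p hp
    refine hasSum_integral_mul hA h0 hS (continuous_integral_sq hc) ?_ hp
    refine hasCompactSupport_of_zero (R := R) fun t ht => ?_
    simp [hz t ht]
  have hang : ∀ s m, Continuous (ang s m f) := fun s m => (hf.isRad_ang s m).continuous
  have hdang : ∀ s m t, deriv (ang s m f) t = trigCoeff s m (Ft t) := fun s m t =>
    (hf.hasDerivAt_ang s m t).deriv
  have s1 := key cFt (fun t ht θ => by simp [hFt, (hR t ht θ).2])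
    (A := fun m t => ∑ s, deriv (ang s m f) t ^ 2)
    (fun m => continuous_finsetSum _ fun s _ => (hf.isRad_ang s m).continuous_deriv.pow 2)
    (fun m t => Finset.sum_nonneg fun _ _ => sq_nonneg _)
    (fun t => by simp only [hdang]; exact hasSum_trigCoeff_sq (c1 cFt t))
    (p := fun _ => h ^ 2) continuous_const
  have s2 := key cFθ (fun t ht θ => by simp [hFθ, (hR t ht θ).2])
    (A := fun m t => (m : ℝ) ^ 2 * ∑ s, ang s m f t ^ 2)
    (fun m => continuous_const.mul (continuous_finsetSum _ fun s _ => (hang s m).pow 2))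
    (fun m t => by positivity)
    (fun t => by
      refine hasSum_trigCoeff_deriv_sq (F := F t) (F' := Fθ t) (fun θ => ?_) (c1 cFθ t) ?_
      · exact (hf.1.differentiable _).hasFDerivAt.comp_hasDerivAt θ
          (hasDerivAt_logPolar_right t θ)
      · simp [hF, logPolar])
    (p := fun _ => h ^ 2) continuous_const
  have s3 := key cF (fun t ht θ => (hR t ht θ).1)
    (A := fun m t => ∑ s, ang s m f t ^ 2)
    (fun m => continuous_finsetSum _ fun s _ => (hang s m).pow 2)
    (fun m t => Finset.sum_nonneg fun _ _ => sq_nonneg _)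
    (fun t => hasSum_trigCoeff_sq (c1 cF t))
    (p := fun t => exp (2 * t) * w t) (by fun_prop)
  have hsum := (s1.add s2).sub s3
  have hQ : qForm h (fun x => w (log ‖x‖)) f =
      (∫ t, h ^ 2 * ∫ θ in (-π)..π, Ft t θ ^ 2) + (∫ t, h ^ 2 * ∫ θ in (-π)..π, Fθ t θ ^ 2)
      - ∫ t, (exp (2 * t) * w t) * ∫ θ in (-π)..π, F t θ ^ 2 := by
    have hcs : ∀ {Φ : ℝ → ℝ → ℝ}, Continuous (Function.uncurry Φ) →
        (∀ t, R < |t| → ∀ θ, Φ t θ = 0) → ∀ {p : ℝ → ℝ}, Continuous p →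
        Integrable fun t => p t * ∫ θ in (-π)..π, Φ t θ ^ 2 := by
      intro Φ hc hz p hp
      refine (hp.mul (continuous_integral_sq hc)).integrable_of_hasCompactSupport ?_
      refine hasCompactSupport_of_zero (R := R) fun t ht => ?_
      simp [hz t ht]
    have i1 := hcs cFt (fun t ht θ => by simp [hFt, (hR t ht θ).2])
      (p := fun _ => h ^ 2) continuous_const
    have i2 := hcs cFθ (fun t ht θ => by simp [hFθ, (hR t ht θ).2])
      (p := fun _ => h ^ 2) continuous_const
    have i3 := hcs cF (fun t ht θ => (hR t ht θ).1)
      (p := fun t => exp (2 * t) * w t) (by fun_prop)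
    rw [← integral_add i1 i2, ← integral_sub (by exact i1.add i2) i3, qForm, integral_logPolar]
    · congr 1
      ext t
      rw [← intervalIntegral.integral_const_mul, ← intervalIntegral.integral_const_mul,
        ← intervalIntegral.integral_const_mul, ← intervalIntegral.integral_add,
        ← intervalIntegral.integral_sub]
      · congr 1
        ext θ
        have := norm_fderiv_logPolar f t θ
        simp only [hF, hFt, hFθ, norm_logPolar, log_exp]
        linear_combination h ^ 2 * this
      · exact ((((c1 cFt t).pow 2).const_mul _).add (((c1 cFθ t).pow 2).const_mul _)).intervalIntegrable _ _
      · exact (((c1 cF t).pow 2).const_mul _).intervalIntegrable _ _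
      · exact (((c1 cFt t).pow 2).const_mul _).intervalIntegrable _ _
      · exact (((c1 cFθ t).pow 2).const_mul _).intervalIntegrable _ _
    · exact ((hf.continuous_fderiv.norm.pow 2).const_mul _).sub (hf.continuous_mul_sq_log hw)
    · refine hf.1.2.mono' fun x hx => ?_
      by_contra hx'
      have e1 : f x = 0 := image_eq_zero_of_notMem_tsupport hx'
      have e2 : fderiv ℝ f x = 0 := by
        by_contra h2
        exact hx' (support_fderiv_subset ℝ h2)
      simp [e1, e2] at hx
  rw [hQ]
  refine hsum.congr_fun' fun m => ?_
  have j1 : ∀ s, Integrable fun t => deriv (ang s m f) t ^ 2 :=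
    fun s => (hf.isRad_ang s m).integrable_deriv_sq
  have j2 : ∀ s {p : ℝ → ℝ}, Continuous p → Integrable fun t => p t * ang s m f t ^ 2 :=
    fun s p hp => (hf.isRad_ang s m).integrable_mul_sq hp
  have e : ∀ s, ∫ t, (h ^ 2 * (deriv (ang s m f) t ^ 2 +
      (m : ℝ) ^ 2 * ang s m f t ^ 2) - exp (2 * t) * w t * ang s m f t ^ 2) =
      h ^ 2 * (∫ t, deriv (ang s m f) t ^ 2) + h ^ 2 * (∫ t, (m : ℝ) ^ 2 * ang s m f t ^ 2)
      - ∫ t, exp (2 * t) * w t * ang s m f t ^ 2 := by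
    intro s
    rw [← mul_add, ← integral_add (j1 s) (j2 s continuous_const), ← integral_const_mul,
      ← integral_sub]
    · exact ((j1 s).add (j2 s continuous_const)).const_mul _
    · exact j2 s (by fun_prop)
  simp only [e, Fintype.sum_bool]
  have g1 : ∫ t, h ^ 2 * (deriv (ang true m f) t ^ 2 + deriv (ang false m f) t ^ 2) =
      h ^ 2 * ((∫ t, deriv (ang true m f) t ^ 2) + ∫ t, deriv (ang false m f) t ^ 2) := by
    rw [integral_const_mul, integral_add (j1 _) (j1 _)]
  have g2 : ∫ t, h ^ 2 * ((m : ℝ) ^ 2 * (ang true m f t ^ 2 + ang false m f t ^ 2)) =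
      h ^ 2 * ((∫ t, (m : ℝ) ^ 2 * ang true m f t ^ 2) +
        ∫ t, (m : ℝ) ^ 2 * ang false m f t ^ 2) := by
    rw [integral_const_mul, ← integral_add (j2 _ continuous_const) (j2 _ continuous_const)]
    simp only [mul_add]
  have g3 : ∫ t, exp (2 * t) * w t * (ang true m f t ^ 2 + ang false m f t ^ 2) =
      (∫ t, exp (2 * t) * w t * ang true m f t ^ 2) +
        ∫ t, exp (2 * t) * w t * ang false m f t ^ 2 := by
    rw [← integral_add (j2 _ (by fun_prop)) (j2 _ (by fun_prop))]
    simp only [mul_add]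
  rw [g1, g2, g3]
  ring

end IsTest

lemma trigCoeff_sq_le {F : ℝ → ℝ} (hF : Continuous F) (s : Bool) (m : ℤ) :
    trigCoeff s m F ^ 2 ≤ ∫ θ in (-π)..π, F θ ^ 2 := by
  have h := hasSum_trigCoeff_sq hF
  have h1 := le_hasSum h m (fun _ _ => Finset.sum_nonneg fun _ _ => sq_nonneg _)
  refine le_trans ?_ h1
  exact Finset.single_le_sum (f := fun s => trigCoeff s m F ^ 2) (fun _ _ => sq_nonneg _)
    (Finset.mem_univ s)

lemma trigCoeff_sum_mul {ι : Type*} (I : Finset ι) (c : ι → ℝ) {F : ι → ℝ → ℝ}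
    (hF : ∀ i, Continuous (F i)) (s : Bool) (m : ℤ) :
    trigCoeff s m (fun θ => ∑ i ∈ I, c i * F i θ) = ∑ i ∈ I, c i * trigCoeff s m (F i) := by
  unfold trigCoeff
  have e : ∀ θ, (∑ i ∈ I, c i * F i θ) * trig s m θ = ∑ i ∈ I, c i * (F i θ * trig s m θ) := by
    intro θ
    rw [Finset.sum_mul]
    exact Finset.sum_congr rfl fun i _ => by ring
  simp only [e]
  rw [intervalIntegral.integral_finsetSum, Finset.mul_sum]
  · refine Finset.sum_congr rfl fun i _ => ?_
    rw [intervalIntegral.integral_const_mul]; ring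
  · intro i _
    exact (((hF i).mul (continuous_trig s m)).const_mul (c i)).intervalIntegrable _ _

lemma trigCoeff_pair_sq_le {G : Bool → ℝ → ℝ} (hG : ∀ s, Continuous (G s)) (m : ℤ) :
    (∑ s, trigCoeff s m (G s)) ^ 2 ≤ ∫ θ in (-π)..π, ∑ s, G s θ ^ 2 := by
  have hc : Continuous fun θ => ∑ s, G s θ * trig s m θ :=
    continuous_finsetSum _ fun s _ => (hG s).mul (continuous_trig s m)
  have e : ∑ s, trigCoeff s m (G s) = trigCoeff false 0 (fun θ => ∑ s, G s θ * trig s m θ) := by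
    unfold trigCoeff
    rw [← Finset.mul_sum, ← intervalIntegral.integral_finsetSum]
    · simp [trig]
    · intro s _
      exact ((hG s).mul (continuous_trig s m)).intervalIntegrable _ _
  rw [e]
  refine (trigCoeff_sq_le hc _ _).trans ?_
  refine intervalIntegral.integral_mono_on (by linarith [pi_pos]) ((hc.pow 2).intervalIntegrable _ _)
    ?_ fun θ _ => ?_
  · exact (continuous_finsetSum _ fun s _ => (hG s).pow 2).intervalIntegrable _ _
  · have := Finset.sum_mul_sq_le_sq_mul_sq Finset.univ (fun s => G s θ) (fun s => trig s m θ)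
    rwa [trig_sq_add, mul_one] at this

lemma SubON.ang {ι : Type*} [Fintype ι] {f : ι → Plane → ℝ} (hf : SubON volume f)
    (ht : ∀ i, IsTest (f i)) (m : ℤ) :
    SubON volume (fun (p : ι × Bool) t => exp t * _root_.ang p.2 m (f p.1) t) := by
  intro c
  set G : Bool → Plane → ℝ := fun s x => ∑ i, c (i, s) * f i x with hG
  have hGt : ∀ s, IsTest (G s) := fun s => IsTest.finsetSum _ fun i => (ht i).const_mul _
  have hc1 : ∀ s t, Continuous fun θ => G s (logPolar t θ) := fun s t =>
    (hGt s).continuous_comp_logPolar.comp (Continuous.prodMk_right t)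
  have e1 : ∀ t, ∑ p : ι × Bool, c p * (exp t * _root_.ang p.2 m (f p.1) t) =
      exp t * ∑ s, trigCoeff s m fun θ => G s (logPolar t θ) := by
    intro t
    rw [Fintype.sum_prod_type_right, Finset.mul_sum]
    refine Finset.sum_congr rfl fun s _ => ?_
    rw [hG, trigCoeff_sum_mul _ (fun i => c (i, s)) (F := fun i θ => f i (logPolar t θ)),
      Finset.mul_sum]
    · exact Finset.sum_congr rfl fun i _ => by unfold _root_.ang; ring
    · exact fun i => (ht i).continuous_comp_logPolar.comp (Continuous.prodMk_right t)
  have hex : ∀ t, exp (2 * t) = exp t ^ 2 := fun t => by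
    rw [← Real.exp_nat_mul]; norm_num
  have hGc : Continuous fun x => ∑ s, G s x ^ 2 :=
    continuous_finsetSum _ fun s _ => (hGt s).1.continuous.pow 2
  have hz : ∀ s, ∃ R : ℝ, ∀ t, R < |t| → ∀ θ, G s (logPolar t θ) = 0 := fun s => by
    obtain ⟨R, -, hR⟩ := (hGt s).exists_zero
    exact ⟨R, fun t h θ => (hR t h θ).1⟩
  choose R hR using hz
  have hR' : ∀ t, max (R true) (R false) < |t| → ∀ s θ, G s (logPolar t θ) = 0 := by
    intro t h s θ
    cases s
    · exact hR _ t ((le_max_right _ _).trans_lt h) θ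
    · exact hR _ t ((le_max_left _ _).trans_lt h) θ
  have e2 : ∑ s, ∫ x, G s x ^ 2 =
      ∫ t, ∫ θ in (-π)..π, exp (2 * t) * ∑ s, G s (logPolar t θ) ^ 2 := by
    rw [← integral_finsetSum _ fun s _ => (hGt s).1.memLp.integrable_sq]
    refine integral_logPolar hGc ?_
    have : ∀ s, HasCompactSupport fun x => G s x ^ 2 := fun s => by
      have := (hGt s).1.2.mul_right (f' := G s)
      simp only [sq]
      exact this
    simp only [Fintype.sum_bool]
    exact (this true).add (this false)
  have hcont2 : Continuous fun t => ∫ θ in (-π)..π, exp (2 * t) * ∑ s, G s (logPolar t θ) ^ 2 := by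
    refine intervalIntegral.continuous_parametric_intervalIntegral_of_continuous'
      (f := fun t θ => exp (2 * t) * ∑ s, G s (logPolar t θ) ^ 2) ?_ _ _
    exact (Real.continuous_exp.comp (by fun_prop)).mul (hGc.comp continuous_logPolar)
  calc ∫ t, (∑ p : ι × Bool, c p * (exp t * _root_.ang p.2 m (f p.1) t)) ^ 2
      ≤ ∫ t, ∫ θ in (-π)..π, exp (2 * t) * ∑ s, G s (logPolar t θ) ^ 2 := by
        refine integral_mono_of_nonneg (Eventually.of_forall fun t => sq_nonneg _) ?_
          (Eventually.of_forall fun t => ?_)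
        · refine hcont2.integrable_of_hasCompactSupport ?_
          refine IsTest.hasCompactSupport_of_zero (R := max (R true) (R false)) fun t ht => ?_
          simp [hR' t ht]
        · simp only
          rw [e1, mul_pow, hex, intervalIntegral.integral_const_mul]
          gcongr
          exact trigCoeff_pair_sq_le (G := fun s θ => G s (logPolar t θ)) (fun s => hc1 s t) m
    _ = ∑ s, ∫ x, G s x ^ 2 := e2.symm
    _ ≤ ∑ s, ∑ i, c (i, s) ^ 2 := Finset.sum_le_sum fun s _ => hf fun i => c (i, s)
    _ = ∑ p, c p ^ 2 := by rw [Fintype.sum_prod_type_right]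

lemma IsRad.integrable_bilin {u v p q : ℝ → ℝ} (hu : IsRad u) (hv : IsRad v) (hp : Continuous p)
    (hq : Continuous q) :
    Integrable fun t => p t * (deriv u t * deriv v t) + q t * (u t * v t) :=
  ((hp.mul (hu.continuous_deriv.mul hv.continuous_deriv)).integrable_of_hasCompactSupport
    (hu.2.deriv.mul_right.mul_left)).add (hu.integrable_mul_mul hq hv.continuous)

/-- Weighted bilinear forms on compactly supported radial functions. -/
noncomputable def radBilin (p q : C(ℝ, ℝ)) : radSub →ₗ[ℝ] radSub →ₗ[ℝ] ℝ :=
  LinearMap.mk₂ ℝ (fun u v => ∫ t, (p t * (deriv (u : ℝ → ℝ) t * deriv (v : ℝ → ℝ) t) +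
    q t * ((u : ℝ → ℝ) t * (v : ℝ → ℝ) t)))
  (by
    intro u v w
    rw [← integral_add (IsRad.integrable_bilin u.2 w.2 p.continuous q.continuous)
      (IsRad.integrable_bilin v.2 w.2 p.continuous q.continuous)]
    congr 1; ext t
    have : deriv ((u + v : radSub) : ℝ → ℝ) t = deriv (u : ℝ → ℝ) t + deriv (v : ℝ → ℝ) t :=
      ((IsRad.hasDerivAt u.2 t).add (IsRad.hasDerivAt v.2 t)).deriv
    rw [this, Submodule.coe_add, Pi.add_apply]; ring)
  (by
    intro c u w
    rw [smul_eq_mul, ← integral_const_mul]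
    congr 1; ext t
    have : deriv ((c • u : radSub) : ℝ → ℝ) t = c * deriv (u : ℝ → ℝ) t :=
      ((IsRad.hasDerivAt u.2 t).const_mul c).deriv
    rw [this, Submodule.coe_smul, Pi.smul_apply, smul_eq_mul]; ring)
  (by
    intro w u v
    rw [← integral_add (IsRad.integrable_bilin w.2 u.2 p.continuous q.continuous)
      (IsRad.integrable_bilin w.2 v.2 p.continuous q.continuous)]
    congr 1; ext t
    have : deriv ((u + v : radSub) : ℝ → ℝ) t = deriv (u : ℝ → ℝ) t + deriv (v : ℝ → ℝ) t :=
      ((IsRad.hasDerivAt u.2 t).add (IsRad.hasDerivAt v.2 t)).deriv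
    rw [this, Submodule.coe_add, Pi.add_apply]; ring)
  (by
    intro c w u
    rw [smul_eq_mul, ← integral_const_mul]
    congr 1; ext t
    have : deriv ((c • u : radSub) : ℝ → ℝ) t = c * deriv (u : ℝ → ℝ) t :=
      ((IsRad.hasDerivAt u.2 t).const_mul c).deriv
    rw [this, Submodule.coe_smul, Pi.smul_apply, smul_eq_mul]; ring)

lemma radBilin_apply (p q : C(ℝ, ℝ)) (u v : radSub) : radBilin p q u v =
    ∫ t, (p t * (deriv (u : ℝ → ℝ) t * deriv (v : ℝ → ℝ) t) +
      q t * ((u : ℝ → ℝ) t * (v : ℝ → ℝ) t)) := rfl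

/-- Trace bound for radial forms from lower bounds on subspaces of finite codimension. -/
lemma radial_trace_ge (p w : ℝ → ℝ) (hp : Continuous p) (hw : Continuous w) (a : ℕ → ℝ) (K : ℕ)
    (ha : ∀ j, 0 ≤ a j) (haK : a K = 0)
    (hlev : ∀ j, j ≤ K → ∃ T : radSub →ₗ[ℝ] (Fin j → ℝ), ∀ u : radSub, T u = 0 →
      -(a j) * (∫ t, exp (2 * t) * (u : ℝ → ℝ) t ^ 2) ≤
        ∫ t, (p t * deriv (u : ℝ → ℝ) t ^ 2 + w t * (u : ℝ → ℝ) t ^ 2))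
    {ι : Type*} [Fintype ι] (u : ι → ℝ → ℝ) (hu : ∀ i, IsRad (u i))
    (hS : SubON volume (fun i t => exp t * u i t)) :
    -∑ j ∈ Finset.range K, a j ≤ ∑ i, ∫ t, (p t * deriv (u i) t ^ 2 + w t * u i t ^ 2) := by
  have hex : ∀ t, exp (2 * t) = exp t ^ 2 := fun t => by
    rw [← Real.exp_nat_mul]; norm_num
  set ip := radBilin 0 ⟨fun t => exp (2 * t), by fun_prop⟩ with hip
  set B := radBilin ⟨p, hp⟩ ⟨w, hw⟩ with hB
  have hip' : ∀ u v : radSub, ip u v = ∫ t, exp (2 * t) * ((u : ℝ → ℝ) t * (v : ℝ → ℝ) t) := by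
    intro u v; rw [hip, radBilin_apply]; simp
  have hB' : ∀ u : radSub, B u u =
      ∫ t, (p t * deriv (u : ℝ → ℝ) t ^ 2 + w t * (u : ℝ → ℝ) t ^ 2) := by
    intro u; rw [hB, radBilin_apply]; simp [sq]
  have hBs : ∀ u v, B u v = B v u := by
    intro u v; rw [hB, radBilin_apply, radBilin_apply]
    congr 1; ext t; ring
  have h := trace_ge_of_orthonormal ip B
    (fun u v => by rw [hip', hip']; congr 1; ext t; ring)
    (fun u => by
      rw [hip']
      exact integral_nonneg fun t => mul_nonneg (exp_pos _).le (mul_self_nonneg _))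
    (fun u h0 => by
      rw [hip', integral_eq_zero_iff_of_nonneg
        (fun t => mul_nonneg (exp_pos _).le (mul_self_nonneg _))
        (IsRad.integrable_mul_mul u.2 (by fun_prop) (IsRad.continuous u.2))] at h0
      have hc : Continuous fun t => exp (2 * t) * ((u : ℝ → ℝ) t * (u : ℝ → ℝ) t) := by
        have := IsRad.continuous u.2
        fun_prop
      have h1 := (hc.ae_eq_iff_eq volume continuous_const).1 h0
      refine Subtype.ext (funext fun t => ?_)
      have h2 : exp (2 * t) * ((u : ℝ → ℝ) t * (u : ℝ → ℝ) t) = 0 := congrFun h1 t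
      simpa [exp_ne_zero] using h2)
    (-∑ j ∈ Finset.range K, a j)
    (fun n e he => trace_ge_of_levels ip B hBs a K ha haK (fun j hj => by
      obtain ⟨T, hT⟩ := hlev j hj
      refine ⟨T, fun u hu => ?_⟩
      rw [hB', hip']
      simpa [sq] using hT u hu) n e he)
    (fun i => (⟨u i, hu i⟩ : radSub))
    (by
      intro c
      rw [hip']
      refine le_trans (le_of_eq ?_) (hS c)
      congr 1; ext t
      have : ((∑ i, c i • (⟨u i, hu i⟩ : radSub) : radSub) : ℝ → ℝ) t = ∑ i, c i * u i t := by
        rw [AddSubmonoidClass.coe_finsetSum, Finset.sum_apply]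
        rfl
      rw [this, hex, ← sq, ← mul_pow, Finset.mul_sum]
      congr 1
      exact Finset.sum_congr rfl fun i _ => by ring)
  simpa only [hB'] using h

/-- The shifted Coulomb potential with a weaker singular perturbation. -/
noncomputable def hydPot (κ c q : ℝ) (x : Plane) : ℝ := κ * (‖x‖⁻¹ - 1) + c * ‖x‖ ^ (-q)

/-- Upper bounds for the moduli of the energy levels of `hydPot`. -/
noncomputable def hydLevel (κ c q h : ℝ) (n : ℕ) : ℝ :=
  max (κ ^ 2 / ((2 * n + 1) * h) ^ 2 - κ + c * (2 * κ + c + 1) * ((2 * n + 1) * h) ^ (-(2 * q)) + c)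
    0

lemma exp_neg_mul_le {q s : ℝ} (hq0 : 0 < q) (hq1 : q < 1) (hs : 0 < s) (t : ℝ) :
    exp (-(q * t)) ≤ s ^ (1 - q) * exp (-t) + s ^ (-q) := by
  have e1 : exp (-(q * t)) = exp t ^ (-q) := by
    rw [← Real.exp_mul]; congr 1; ring
  rcases le_total (exp t) s with h | h
  · have h1 : exp t ^ (1 - q) ≤ s ^ (1 - q) := Real.rpow_le_rpow (exp_pos t).le h (by linarith)
    have e2 : exp (-(q * t)) = exp t ^ (1 - q) * exp (-t) := by
      rw [← Real.exp_mul, ← Real.exp_add]; congr 1; ring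
    rw [e2]
    have := mul_le_mul_of_nonneg_right h1 (exp_pos (-t)).le
    linarith [Real.rpow_pos_of_pos hs (-q)]
  · rw [e1]
    have h1 : exp t ^ (-q) ≤ s ^ (-q) := Real.rpow_le_rpow_of_nonpos hs h (by linarith)
    have := mul_nonneg (Real.rpow_pos_of_pos hs (1 - q)).le (exp_pos (-t)).le
    linarith

lemma level_bound {κ c q ν : ℝ} (hκ : 0 < κ) (hc : 0 ≤ c) (hq0 : 0 < q) (hq1 : q < 1)
    (hν : 0 < ν) : (κ + c * min (ν ^ 2) 1 ^ (1 - q)) ^ 2 / ν ^ 2 + c * min (ν ^ 2) 1 ^ (-q) - κ ≤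
      κ ^ 2 / ν ^ 2 - κ + c * (2 * κ + c + 1) * ν ^ (-(2 * q)) + c := by
  set s := min (ν ^ 2) 1 with hs
  have hν2 : 0 < ν ^ 2 := by positivity
  have hs0 : 0 < s := lt_min hν2 one_pos
  set b := s ^ (1 - q) with hb
  have hb0 : 0 < b := Real.rpow_pos_of_pos hs0 _
  have hb1 : b ≤ 1 := Real.rpow_le_one hs0.le (min_le_right _ _) (by linarith)
  have e0 : ν ^ (-(2 * q)) = (ν ^ 2) ^ (-q) := by
    rw [← Real.rpow_natCast ν 2, ← Real.rpow_mul hν.le]; congr 1; push_cast; ring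
  have h1 : b / ν ^ 2 ≤ ν ^ (-(2 * q)) := by
    rw [e0, div_le_iff₀ hν2]
    have : (ν ^ 2) ^ (-q) * ν ^ 2 = (ν ^ 2) ^ (1 - q) := by
      rw [show (1 - q : ℝ) = -q + 1 by ring, Real.rpow_add_one hν2.ne']
    rw [this]
    exact Real.rpow_le_rpow hs0.le (min_le_left _ _) (by linarith)
  have h2 : s ^ (-q) ≤ ν ^ (-(2 * q)) + 1 := by
    rw [e0]
    rcases min_choice (ν ^ 2) 1 with h | h
    · rw [hs, h]; linarith
    · rw [hs, h, Real.one_rpow]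
      linarith [Real.rpow_pos_of_pos hν2 (-q)]
  have h3 : (κ + c * b) ^ 2 / ν ^ 2 ≤ κ ^ 2 / ν ^ 2 + c * (2 * κ + c) * (b / ν ^ 2) := by
    rw [div_add' _ _ _ hν2.ne', div_le_div_iff_of_pos_right hν2]
    have : c * (2 * κ + c) * (b / ν ^ 2) * ν ^ 2 = c * (2 * κ + c) * b := by
      field_simp
    rw [this]
    nlinarith [mul_nonneg (mul_nonneg (sq_nonneg c) hb0.le) (sub_nonneg.2 hb1)]
  have h4 : c * (2 * κ + c) * (b / ν ^ 2) ≤ c * (2 * κ + c) * ν ^ (-(2 * q)) := by gcongr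
  have h5 : c * s ^ (-q) ≤ c * (ν ^ (-(2 * q)) + 1) := by gcongr
  nlinarith

lemma hyd_channel_levels {κ c q h : ℝ} (hκ : 0 < κ) (hc : 0 ≤ c) (hq0 : 0 < q) (hq1 : q < 1)
    (hh : 0 < h) (ℓ j : ℕ) :
    ∃ T : radSub →ₗ[ℝ] (Fin j → ℝ), ∀ u : radSub, T u = 0 →
      -(hydLevel κ c q h (ℓ + j)) * (∫ t, exp (2 * t) * (u : ℝ → ℝ) t ^ 2) ≤
        ∫ t, (h ^ 2 * deriv (u : ℝ → ℝ) t ^ 2 + (h ^ 2 * (ℓ : ℝ) ^ 2 -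
          exp (2 * t) * (κ * (exp (-t) - 1) + c * exp (-(q * t)))) * (u : ℝ → ℝ) t ^ 2) := by
  set ν : ℝ := (2 * ((ℓ + j : ℕ) : ℝ) + 1) * h with hν
  have hn : (0 : ℝ) < 2 * ((ℓ + j : ℕ) : ℝ) + 1 := by positivity
  have hν0 : 0 < ν := by positivity
  set s := min (ν ^ 2) 1 with hs
  have hs0 : 0 < s := lt_min (by positivity) one_pos
  set A := κ + c * s ^ (1 - q) with hA
  have hA0 : 0 < A := by positivity
  obtain ⟨T, hT⟩ := radForm_levels (A / h ^ 2) (by positivity) j ℓ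
  refine ⟨T, fun u hu => ?_⟩
  have h1 := hT u hu
  set N := ∫ t, exp (2 * t) * (u : ℝ → ℝ) t ^ 2 with hN
  have hN0 : 0 ≤ N := integral_nonneg fun t => by positivity
  have hcmp : h ^ 2 * radForm (A / h ^ 2) ℓ u + (κ - c * s ^ (-q)) * N ≤
      ∫ t, (h ^ 2 * deriv (u : ℝ → ℝ) t ^ 2 + (h ^ 2 * (ℓ : ℝ) ^ 2 -
          exp (2 * t) * (κ * (exp (-t) - 1) + c * exp (-(q * t)))) * (u : ℝ → ℝ) t ^ 2) := by
    rw [radForm, hN, ← integral_const_mul, ← integral_const_mul, ← integral_add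
      ((IsRad.integrable_radForm u.2 _ _).const_mul _)
      ((IsRad.integrable_mul_sq u.2 (by fun_prop)).const_mul _)]
    refine integral_mono (((IsRad.integrable_radForm u.2 _ _).const_mul _).add
      ((IsRad.integrable_mul_sq u.2 (by fun_prop)).const_mul _))
      (((IsRad.integrable_deriv_sq u.2).const_mul _).add
        (IsRad.integrable_mul_sq u.2 (by fun_prop))) fun t => ?_
    have h2 := exp_neg_mul_le hq0 hq1 hs0 t
    have h3 : exp (2 * t) * exp (-t) = exp t := by rw [← Real.exp_add]; congr 1; ring
    have h4 : exp (2 * t) * (κ * (exp (-t) - 1) + c * exp (-(q * t))) ≤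
        A * exp t - (κ - c * s ^ (-q)) * exp (2 * t) := by
      have h5 : c * (exp (2 * t) * exp (-(q * t))) ≤
          c * (exp (2 * t) * (s ^ (1 - q) * exp (-t) + s ^ (-q))) := by gcongr
      have h6 : exp (2 * t) * (s ^ (1 - q) * exp (-t) + s ^ (-q)) =
          s ^ (1 - q) * exp t + s ^ (-q) * exp (2 * t) := by rw [← h3]; ring
      rw [h6] at h5
      rw [hA]
      linear_combination h5 + κ * h3
    have h5 : h ^ 2 * (A / h ^ 2) = A := by field_simp
    have h6 := mul_le_mul_of_nonneg_right h4 (sq_nonneg ((u : ℝ → ℝ) t))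
    simp only
    linear_combination h6 - exp t * (u : ℝ → ℝ) t ^ 2 * h5
  refine le_trans ?_ hcmp
  have h2 := level_bound hκ hc hq0 hq1 hν0
  have h3 : A ^ 2 / ν ^ 2 + c * s ^ (-q) - κ ≤ hydLevel κ c q h (ℓ + j) :=
    h2.trans (le_max_left _ _)
  have h4 : h ^ 2 * ((A / h ^ 2) ^ 2 / (2 * ((ℓ : ℝ) + j) + 1) ^ 2) = A ^ 2 / ν ^ 2 := by
    rw [hν]
    push_cast at hn ⊢
    field_simp
  have h5 := mul_le_mul_of_nonneg_right h3 hN0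
  have h6 := mul_le_mul_of_nonneg_left h1 (sq_nonneg h)
  have h7 : h ^ 2 * (-((A / h ^ 2) ^ 2 / (2 * ((ℓ : ℝ) + j) + 1) ^ 2) * N) =
    -(A ^ 2 / ν ^ 2) * N := by rw [← h4]; ring
  rw [h7] at h6
  linarith

lemma sum_Ioo_sum_Ico (K : ℕ) (a : ℕ → ℝ) :
    ∑ m ∈ Finset.Ioo (-(K : ℤ)) K, ∑ n ∈ Finset.Ico m.natAbs K, a n =
      ∑ n ∈ Finset.range K, (2 * (n : ℝ) + 1) * a n := by
  rw [Finset.sum_comm' (t' := Finset.range K) (s' := fun n => Finset.Icc (-(n : ℤ)) n)]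
  · refine Finset.sum_congr rfl fun n _ => ?_
    rw [Finset.sum_const, Int.card_Icc, nsmul_eq_mul]
    congr 1
    have : ((n : ℤ) + 1 - -(n : ℤ)).toNat = 2 * n + 1 := by omega
    rw [this]; push_cast; ring
  · intro m n
    simp only [Finset.mem_Ioo, Finset.mem_Ico, Finset.mem_Icc, Finset.mem_range]
    omega

/-- Lower bound for the trace of the perturbed hydrogen form. -/
theorem hyd_lower {κ c q h : ℝ} (hκ : 0 < κ) (hc : 0 ≤ c) (hq0 : 0 < q) (hq1 : q < 1)
    (hh : 0 < h) {K : ℕ} (hK : ∀ n, K ≤ n → hydLevel κ c q h n = 0)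
    {ι : Type*} [Fintype ι] (f : ι → Plane → ℝ) (hf : ∀ i, IsTest (f i))
    (hS : SubON volume f) :
    -∑ n ∈ Finset.range K, (2 * (n : ℝ) + 1) * hydLevel κ c q h n ≤
      ∑ i, qForm h (hydPot κ c q) (f i) := by
  set w : ℝ → ℝ := fun t => κ * (exp (-t) - 1) + c * exp (-(q * t)) with hw
  have hwc : Continuous w := by fun_prop
  have hq : ∀ i, qForm h (hydPot κ c q) (f i) = qForm h (fun x => w (log ‖x‖)) (f i) := by
    intro i
    unfold qForm
    congr 1; ext x
    by_cases hx : x = 0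
    · have : f i x = 0 := by
        rw [hx]; exact image_eq_zero_of_notMem_tsupport fun h => (hf i).2 h rfl
      simp [this]
    · have hn : 0 < ‖x‖ := norm_pos_iff.2 hx
      have : hydPot κ c q x = w (log ‖x‖) := by
        rw [hydPot, hw]
        simp only
        rw [Real.exp_neg, Real.exp_log hn, Real.rpow_def_of_pos hn]
        congr 3; ring
      rw [this]
  simp only [hq]
  have hsum := hasSum_sum (s := Finset.univ) fun i _ => (hf i).hasSum_ang h hwc
  have hchan : ∀ m : ℤ, -∑ n ∈ Finset.Ico m.natAbs K, hydLevel κ c q h n ≤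
      ∑ i, ∑ s, ∫ t, (h ^ 2 * (deriv (ang s m (f i)) t ^ 2 +
      (m : ℝ) ^ 2 * ang s m (f i) t ^ 2) - exp (2 * t) * w t * ang s m (f i) t ^ 2) := by
    intro m
    have hm : (m : ℝ) ^ 2 = (m.natAbs : ℝ) ^ 2 := by
      rw [Nat.cast_natAbs]; simp
    have := radial_trace_ge (fun _ => h ^ 2)
      (fun t => h ^ 2 * (m.natAbs : ℝ) ^ 2 - exp (2 * t) * w t) continuous_const (by fun_prop)
      (fun j => hydLevel κ c q h (m.natAbs + j)) (K - m.natAbs) (fun j => le_max_right _ _)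
      (hK _ (by omega)) (fun j _ => hyd_channel_levels hκ hc hq0 hq1 hh m.natAbs j)
      (fun p : ι × Bool => ang p.2 m (f p.1)) (fun p => (hf p.1).isRad_ang _ _) (hS.ang hf m)
    rw [Fintype.sum_prod_type] at this
    rw [Finset.sum_Ico_eq_sum_range]
    refine this.trans (le_of_eq ?_)
    refine Finset.sum_congr rfl fun i _ => Finset.sum_congr rfl fun s _ => ?_
    congr 1; ext t
    rw [hm]; ring
  have hfin : HasSum (fun m : ℤ => -∑ n ∈ Finset.Ico m.natAbs K, hydLevel κ c q h n)
      (∑ m ∈ Finset.Ioo (-(K : ℤ)) K, -∑ n ∈ Finset.Ico m.natAbs K, hydLevel κ c q h n) := by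
    refine hasSum_sum_of_ne_finset_zero fun m hm => ?_
    rw [Finset.Ico_eq_empty, Finset.sum_empty, neg_zero]
    simp only [Finset.mem_Ioo] at hm
    omega
  have := hasSum_le hchan hfin hsum
  rwa [Finset.sum_neg_distrib, sum_Ioo_sum_Ico] at this

lemma _root_.Filter.Tendsto.congr_lim {α : Type*} {f : α → ℝ} {l : Filter α} {a b : ℝ}
    (h : Tendsto f l (nhds a)) (e : a = b) : Tendsto f l (nhds b) := e ▸ h

lemma sum_inv_odd (K : ℕ) : ∑ n ∈ Finset.range K, (1 : ℝ) / (2 * n + 1) =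
    (harmonic (2 * K) : ℝ) - (harmonic K : ℝ) / 2 := by
  induction K with
  | zero => simp
  | succ K ih =>
    rw [Finset.sum_range_succ, ih, show 2 * (K + 1) = 2 * K + 1 + 1 by ring, harmonic_succ,
      harmonic_succ, harmonic_succ]
    push_cast
    field_simp
    ring

lemma tendsto_sum_inv_odd : Tendsto
    (fun K : ℕ => ∑ n ∈ Finset.range K, (1 : ℝ) / (2 * n + 1) - log K / 2) atTop
    (nhds (log 2 + eulerMascheroniConstant / 2)) := by
  have h1 := tendsto_harmonic_sub_log
  have h2 : Tendsto (fun K : ℕ => 2 * K) atTop atTop :=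
    tendsto_id.const_mul_atTop' (by norm_num)
  have h3 := (h1.comp h2).sub (h1.div_const 2)
  have h4 := h3.add_const (log 2)
  refine (h4.congr' ?_).congr_lim ?_
  · filter_upwards [eventually_ge_atTop 1] with K hK
    have hK' : (K : ℝ) ≠ 0 := by positivity
    simp only [Function.comp]
    rw [sum_inv_odd]
    push_cast
    rw [Real.log_mul two_ne_zero hK']
    ring
  · ring

/-- The Coulomb correction `κ²/4 (log (2κ⁻¹h²) + c^H)`. -/
noncomputable def coulombTerm (κ h : ℝ) : ℝ :=
  κ ^ 2 / 4 * (log (2 * κ⁻¹ * h ^ 2) + (-3 * log 2 - 2 * eulerMascheroniConstant + 1))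

/-- The number of bound states of the shifted hydrogen operator, without multiplicity. -/
noncomputable def hydCount (κ h : ℝ) : ℕ := ⌈(√κ / h - 1) / 2⌉₊

lemma lt_hydCount_iff {κ h : ℝ} (hh : 0 < h) (n : ℕ) :
    n < hydCount κ h ↔ (2 * n + 1) * h < √κ := by
  rw [hydCount, Nat.lt_ceil, lt_div_iff₀ two_pos, lt_sub_iff_add_lt, lt_div_iff₀ hh]
  ring_nf

lemma tendsto_sqrt_div {κ : ℝ} (hκ : 0 < κ) :
    Tendsto (fun h : ℝ => √κ / h) (nhdsWithin 0 (Set.Ioi 0)) atTop :=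
  tendsto_inv_nhdsGT_zero.const_mul_atTop (Real.sqrt_pos.2 hκ)

lemma tendsto_hydCount {κ : ℝ} (hκ : 0 < κ) :
    Tendsto (hydCount κ) (nhdsWithin 0 (Set.Ioi 0)) atTop := by
  refine tendsto_nat_ceil_atTop.comp ?_
  refine Tendsto.atTop_div_const two_pos ?_
  exact tendsto_atTop_add_const_right _ (-1) (tendsto_sqrt_div hκ)

lemma tendsto_hydCount_div {κ : ℝ} (hκ : 0 < κ) :
    Tendsto (fun h => (hydCount κ h : ℝ) / (√κ / h)) (nhdsWithin 0 (Set.Ioi 0))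
      (nhds (1 / 2)) := by
  have h1 : Tendsto (fun x : ℝ => ((⌈(x - 1) / 2⌉₊ : ℕ) : ℝ) / x) atTop (nhds (1 / 2)) := by
    have l1 : Tendsto (fun x : ℝ => 1 / 2 - x⁻¹ / 2) atTop (nhds (1 / 2)) := by
      simpa using (tendsto_const_nhds (x := (1 / 2 : ℝ))).sub
        ((tendsto_inv_atTop_zero (𝕜 := ℝ)).div_const 2)
    have l2 : Tendsto (fun x : ℝ => 1 / 2 + x⁻¹ / 2) atTop (nhds (1 / 2)) := by
      simpa using (tendsto_const_nhds (x := (1 / 2 : ℝ))).add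
        ((tendsto_inv_atTop_zero (𝕜 := ℝ)).div_const 2)
    refine tendsto_of_tendsto_of_tendsto_of_le_of_le' l1 l2 ?_ ?_
    · filter_upwards [eventually_gt_atTop 1] with x hx
      rw [le_div_iff₀ (by linarith)]
      have := Nat.le_ceil ((x - 1) / 2)
      refine le_trans (le_of_eq ?_) this
      field_simp
    · filter_upwards [eventually_gt_atTop 1] with x hx
      rw [div_le_iff₀ (by linarith)]
      have := (Nat.ceil_lt_add_one (show (0 : ℝ) ≤ (x - 1) / 2 by linarith)).le
      refine this.trans (le_of_eq ?_)
      field_simp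
      ring
  exact h1.comp (tendsto_sqrt_div hκ)

/-- Asymptotics of the hydrogen trace. -/
theorem tendsto_hyd_sum {κ : ℝ} (hκ : 0 < κ) : Tendsto (fun h => h ^ 2 *
    ∑ n ∈ Finset.range (hydCount κ h), (2 * (n : ℝ) + 1) *
      (κ ^ 2 / ((2 * n + 1) * h) ^ 2 - κ) + coulombTerm κ h)
    (nhdsWithin 0 (Set.Ioi 0)) (nhds 0) := by
  have h1 := tendsto_sum_inv_odd.comp (tendsto_hydCount hκ)
  have h2 := tendsto_hydCount_div hκ
  have h3 := h2.log (by norm_num)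
  have h4 := ((h1.add (h3.div_const 2)).sub (h2.pow 2)).const_mul (κ ^ 2)
  have h5 := h4.sub_const (κ ^ 2 * (log 2 / 2 + eulerMascheroniConstant / 2 - 1 / 4))
  refine (h5.congr' ?_).congr_lim ?_
  · filter_upwards [self_mem_nhdsWithin, (tendsto_hydCount hκ).eventually_ge_atTop 1] with h hh hK
    have hh : 0 < h := hh
    have hK' : (0 : ℝ) < hydCount κ h := by exact_mod_cast hK
    have hs : 0 < √κ := Real.sqrt_pos.2 hκ
    have hs2 : √κ ^ 2 = κ := Real.sq_sqrt hκ.le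
    simp only [Function.comp]
    rw [Real.log_div hK'.ne' (by positivity), Real.log_div hs.ne' hh.ne', Real.log_sqrt hκ.le,
      coulombTerm, Real.log_mul (by positivity) (by positivity),
      Real.log_mul two_ne_zero (by positivity), Real.log_inv, Real.log_pow]
    have e1 : h ^ 2 * ∑ n ∈ Finset.range (hydCount κ h), (2 * (n : ℝ) + 1) *
        (κ ^ 2 / ((2 * n + 1) * h) ^ 2 - κ) =
        κ ^ 2 * ∑ n ∈ Finset.range (hydCount κ h), (1 : ℝ) / (2 * n + 1) -
          κ * h ^ 2 * ∑ n ∈ Finset.range (hydCount κ h), (2 * (n : ℝ) + 1) := by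
      rw [Finset.mul_sum, Finset.mul_sum, Finset.mul_sum, ← Finset.sum_sub_distrib]
      refine Finset.sum_congr rfl fun n _ => ?_
      have : (2 * (n : ℝ) + 1) ≠ 0 := by positivity
      field_simp
    have e2 : ∑ n ∈ Finset.range (hydCount κ h), (2 * (n : ℝ) + 1) = (hydCount κ h : ℝ) ^ 2 := by
      induction hydCount κ h with
      | zero => simp
      | succ k ih => rw [Finset.sum_range_succ, ih]; push_cast; ring
    have e3 : ((hydCount κ h : ℝ) / (√κ / h)) ^ 2 * κ ^ 2 = κ * h ^ 2 * (hydCount κ h : ℝ) ^ 2 := by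
      rw [div_pow, div_pow, hs2]; field_simp
    rw [e1, e2]
    push_cast
    linear_combination -e3
  · rw [Real.log_div one_ne_zero two_ne_zero, Real.log_one]
    ring

lemma hydLevel_zero_of_lt {κ q h : ℝ} (hκ : 0 < κ) (hh : 0 < h) {n : ℕ} (hn : n < hydCount κ h) :
    hydLevel κ 0 q h n = κ ^ 2 / ((2 * n + 1) * h) ^ 2 - κ := by
  rw [lt_hydCount_iff hh] at hn
  have hν : 0 < (2 * (n : ℝ) + 1) * h := by positivity
  rw [hydLevel, zero_mul, zero_mul, add_zero, add_zero, max_eq_left]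
  rw [sub_nonneg, le_div_iff₀ (by positivity)]
  have : ((2 * (n : ℝ) + 1) * h) ^ 2 ≤ κ := by
    rw [← Real.sq_sqrt hκ.le]; gcongr
  nlinarith

lemma hydLevel_zero_of_ge {κ q h : ℝ} (hκ : 0 < κ) (hh : 0 < h) {n : ℕ} (hn : hydCount κ h ≤ n) :
    hydLevel κ 0 q h n = 0 := by
  have hν : 0 < (2 * (n : ℝ) + 1) * h := by positivity
  rw [← not_lt, lt_hydCount_iff hh, not_lt] at hn
  rw [hydLevel, zero_mul, zero_mul, add_zero, add_zero, max_eq_right]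
  rw [sub_nonpos, div_le_iff₀ (by positivity)]
  have : κ ≤ ((2 * (n : ℝ) + 1) * h) ^ 2 := by
    rw [← Real.sq_sqrt hκ.le]; gcongr
  nlinarith

/-- Sharp lower bound for the trace of the shifted hydrogen form. -/
theorem hyd_trace_ge {κ : ℝ} (hκ : 0 < κ) {ε : ℝ} (hε : 0 < ε) :
    ∀ᶠ h in nhdsWithin 0 (Set.Ioi 0), ∀ (ι : Type) [Fintype ι] (f : ι → Plane → ℝ),
      (∀ i, IsTest (f i)) → SubON volume f →
      coulombTerm κ h - ε ≤ h ^ 2 * ∑ i, qForm h (hydPot κ 0 (1 / 2)) (f i) := by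
  filter_upwards [self_mem_nhdsWithin, (tendsto_hyd_sum hκ).eventually (gt_mem_nhds hε)]
    with h hh hlt ι _ f hf hS
  have hh : 0 < h := hh
  have h1 := hyd_lower (q := 1 / 2) hκ le_rfl (by norm_num) (by norm_num) hh
    (fun n hn => hydLevel_zero_of_ge hκ hh hn) f hf hS
  have e : ∑ n ∈ Finset.range (hydCount κ h), (2 * (n : ℝ) + 1) * hydLevel κ 0 (1 / 2) h n =
      ∑ n ∈ Finset.range (hydCount κ h), (2 * (n : ℝ) + 1) *
        (κ ^ 2 / ((2 * n + 1) * h) ^ 2 - κ) :=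
    Finset.sum_congr rfl fun n hn => by
      rw [hydLevel_zero_of_lt hκ hh (Finset.mem_range.1 hn)]
  rw [e] at h1
  have h2 := mul_le_mul_of_nonneg_left h1 (sq_nonneg h)
  linarith

lemma rpow_sub_rpow_ge {r : ℝ} (hr0 : 0 < r) (hr1 : r ≤ 1) (n : ℕ) :
    ((n : ℝ) + 1) ^ (r - 1) ≤ (((n : ℝ) + 1) ^ r - (n : ℝ) ^ r) / r := by
  have hn : (0 : ℝ) < n + 1 := by positivity
  have h1 := rpow_one_add_le_one_add_mul_self (s := -1 / ((n : ℝ) + 1)) (p := r) (by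
    rw [neg_div, neg_le_neg_iff, div_le_one hn]; linarith [n.cast_nonneg (α := ℝ)]) hr0.le hr1
  have e1 : 1 + -1 / ((n : ℝ) + 1) = n / (n + 1) := by field_simp; ring
  rw [e1, Real.div_rpow n.cast_nonneg hn.le, div_le_iff₀ (Real.rpow_pos_of_pos hn r)] at h1
  rw [le_div_iff₀ hr0, Real.rpow_sub_one hn.ne']
  have : (1 + r * (-1 / ((n : ℝ) + 1))) * ((n : ℝ) + 1) ^ r =
    ((n : ℝ) + 1) ^ r - ((n : ℝ) + 1) ^ r / (n + 1) * r := by field_simp; ring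
  linarith

lemma sum_rpow_le {r : ℝ} (hr0 : 0 < r) (hr1 : r ≤ 1) (K : ℕ) :
    ∑ n ∈ Finset.range K, ((n : ℝ) + 1) ^ (r - 1) ≤ (K : ℝ) ^ r / r := by
  induction K with
  | zero => simp [Real.zero_rpow hr0.ne']
  | succ K ih =>
    rw [Finset.sum_range_succ]
    have := rpow_sub_rpow_ge hr0 hr1 K
    push_cast
    rw [sub_div] at this
    linarith

lemma sum_weight_rpow_le {q h : ℝ} (hq0 : 1 / 2 ≤ q) (hq1 : q < 1) (hh : 0 < h) (K : ℕ) :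
    h ^ 2 * ∑ n ∈ Finset.range K, (2 * (n : ℝ) + 1) * ((2 * n + 1) * h) ^ (-(2 * q)) ≤
      (K * h) ^ (2 - 2 * q) / (2 - 2 * q) := by
  have hr : 0 < 2 - 2 * q := by linarith
  have h1 : ∀ n : ℕ, h ^ 2 * ((2 * (n : ℝ) + 1) * ((2 * n + 1) * h) ^ (-(2 * q))) ≤
      h ^ (2 - 2 * q) * ((n : ℝ) + 1) ^ (2 - 2 * q - 1) := by
    intro n
    have hn : (0 : ℝ) < 2 * n + 1 := by positivity
    rw [Real.mul_rpow hn.le hh.le]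
    have e1 : h ^ (2 - 2 * q) = h ^ 2 * h ^ (-(2 * q)) := by
      rw [← Real.rpow_natCast h 2, ← Real.rpow_add hh]; congr 1
    have e2 : (2 * (n : ℝ) + 1) ^ (2 - 2 * q - 1) = (2 * n + 1) * (2 * n + 1) ^ (-(2 * q)) := by
      rw [show 2 - 2 * q - 1 = -(2 * q) + 1 by ring, Real.rpow_add_one hn.ne']; ring
    have h2 : (2 * (n : ℝ) + 1) ^ (2 - 2 * q - 1) ≤ ((n : ℝ) + 1) ^ (2 - 2 * q - 1) :=
      Real.rpow_le_rpow_of_nonpos (by positivity) (by linarith [n.cast_nonneg (α := ℝ)])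
        (by linarith)
    rw [e2] at h2
    have h3 := mul_le_mul_of_nonneg_left h2 (Real.rpow_pos_of_pos hh (2 - 2 * q)).le
    refine le_trans (le_of_eq ?_) h3
    rw [e1]; ring
  rw [Finset.mul_sum]
  refine (Finset.sum_le_sum fun n _ => h1 n).trans ?_
  rw [← Finset.mul_sum, Real.mul_rpow K.cast_nonneg hh.le, mul_comm, mul_div_right_comm]
  exact mul_le_mul_of_nonneg_right (sum_rpow_le hr (by linarith) K) (Real.rpow_pos_of_pos hh _).le

/-- Rough lower bound for the trace of the perturbed hydrogen form. -/
theorem hyd_perturbed_trace_ge {κ q : ℝ} (hκ : 0 < κ) (hq0 : 1 / 2 ≤ q) (hq1 : q < 1) :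
    ∃ M : ℝ, ∀ᶠ h in nhdsWithin 0 (Set.Ioi 0), ∀ (ι : Type) [Fintype ι] (f : ι → Plane → ℝ),
      (∀ i, IsTest (f i)) → SubON volume f →
      coulombTerm κ h - M ≤ h ^ 2 * ∑ i, qForm h (hydPot κ (κ / 2) q) (f i) := by
  set c := κ / 2 with hc
  have hc0 : 0 < c := by positivity
  set D := c * (2 * κ + c + 1) with hD
  have hD0 : 0 < D := by positivity
  set X := max 1 ((κ ^ 2 + D) / (κ - c)) with hX
  have hX1 : 1 ≤ X := le_max_left _ _
  have hkc : 0 < κ - c := by rw [hc]; linarith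
  refine ⟨1 + (D * ((X + 1) ^ (2 - 2 * q) / (2 - 2 * q)) + c * (X + 1) ^ 2), ?_⟩
  have hsmall : ∀ᶠ h : ℝ in nhdsWithin 0 (Set.Ioi 0), h < 1 :=
    nhdsWithin_le_nhds (gt_mem_nhds one_pos)
  filter_upwards [self_mem_nhdsWithin, hsmall,
    (tendsto_hyd_sum hκ).eventually (gt_mem_nhds one_pos)] with h hh hh1 hlt ι _ f hf hS
  have hh : 0 < h := hh
  set K := max ⌈X / h⌉₊ (hydCount κ h) with hK
  have hKz : ∀ n, ⌈X / h⌉₊ ≤ n → hydLevel κ c q h n = 0 := by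
    intro n hn
    have h1 : X ≤ (2 * n + 1) * h := by
      have := Nat.ceil_le.1 hn
      rw [div_le_iff₀ hh] at this
      nlinarith [n.cast_nonneg (α := ℝ)]
    set ν := (2 * (n : ℝ) + 1) * h with hν
    have hν1 : 1 ≤ ν := hX1.trans h1
    have h2 : κ ^ 2 / ν ^ 2 ≤ κ ^ 2 / ν :=
      div_le_div_of_nonneg_left (by positivity) (by positivity) (by nlinarith)
    have h3 : ν ^ (-(2 * q)) ≤ 1 / ν := by
      rw [one_div, ← Real.rpow_neg_one]
      exact Real.rpow_le_rpow_of_exponent_le hν1 (by linarith)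
    have h4 : (κ ^ 2 + D) / ν ≤ κ - c := by
      rw [div_le_iff₀ (by positivity), ← div_le_iff₀' hkc]
      exact (le_max_right _ _).trans h1
    rw [hydLevel, ← hν, ← hD, max_eq_right]
    have h5 := mul_le_mul_of_nonneg_left h3 hD0.le
    have h6 : (κ ^ 2 + D) / ν = κ ^ 2 / ν + D * (1 / ν) := by ring
    linarith
  have h1 := hyd_lower hκ hc0.le (by linarith) hq1 hh hKz f hf hS
  have h2 := mul_le_mul_of_nonneg_left h1 (sq_nonneg h)
  refine le_trans ?_ h2
  set K' := ⌈X / h⌉₊ with hK'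
  have hKh : K' * h ≤ X + 1 := by
    have := (Nat.ceil_lt_add_one (show 0 ≤ X / h by positivity)).le
    calc (K' : ℝ) * h ≤ (X / h + 1) * h := by gcongr
      _ = X + h := by field_simp
      _ ≤ X + 1 := by linarith
  have hle : ∀ n : ℕ, hydLevel κ c q h n ≤
      hydLevel κ 0 q h n + (D * ((2 * n + 1) * h) ^ (-(2 * q)) + c) := by
    intro n
    have hν : 0 < (2 * (n : ℝ) + 1) * h := by positivity
    have hp := Real.rpow_pos_of_pos hν (-(2 * q))
    unfold hydLevel
    rw [← hD]
    refine max_le ?_ ?_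
    · have := le_max_left (κ ^ 2 / ((2 * (n : ℝ) + 1) * h) ^ 2 - κ +
        0 * (2 * κ + 0 + 1) * ((2 * n + 1) * h) ^ (-(2 * q)) + 0) 0
      linarith
    · have := le_max_right (κ ^ 2 / ((2 * (n : ℝ) + 1) * h) ^ 2 - κ +
        0 * (2 * κ + 0 + 1) * ((2 * n + 1) * h) ^ (-(2 * q)) + 0) 0
      have := mul_pos hD0 hp
      linarith
  have hs1 : ∑ n ∈ Finset.range K', (2 * (n : ℝ) + 1) * hydLevel κ c q h n ≤
      ∑ n ∈ Finset.range K', (2 * (n : ℝ) + 1) * hydLevel κ 0 q h n +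
      (D * ∑ n ∈ Finset.range K', (2 * (n : ℝ) + 1) * ((2 * n + 1) * h) ^ (-(2 * q)) +
        c * ∑ n ∈ Finset.range K', (2 * (n : ℝ) + 1)) := by
    rw [Finset.mul_sum, Finset.mul_sum, ← Finset.sum_add_distrib, ← Finset.sum_add_distrib]
    refine Finset.sum_le_sum fun n _ => ?_
    have := mul_le_mul_of_nonneg_left (hle n) (show 0 ≤ 2 * (n : ℝ) + 1 by positivity)
    linarith
  have hs2 : ∑ n ∈ Finset.range K', (2 * (n : ℝ) + 1) * hydLevel κ 0 q h n ≤
      ∑ n ∈ Finset.range (hydCount κ h), (2 * (n : ℝ) + 1) *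
        (κ ^ 2 / ((2 * n + 1) * h) ^ 2 - κ) := by
    have hnn : ∀ n : ℕ, 0 ≤ (2 * (n : ℝ) + 1) * hydLevel κ 0 q h n := fun n =>
      mul_nonneg (by positivity) (le_max_right _ _)
    calc ∑ n ∈ Finset.range K', (2 * (n : ℝ) + 1) * hydLevel κ 0 q h n
        ≤ ∑ n ∈ Finset.range K, (2 * (n : ℝ) + 1) * hydLevel κ 0 q h n :=
          Finset.sum_le_sum_of_subset_of_nonneg
            (Finset.range_subset_range.2 (le_max_left _ _)) fun n _ _ => hnn n
      _ = ∑ n ∈ Finset.range (hydCount κ h), (2 * (n : ℝ) + 1) * hydLevel κ 0 q h n := by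
          symm
          refine Finset.sum_subset (Finset.range_subset_range.2 (le_max_right _ _)) fun n _ hn => ?_
          rw [hydLevel_zero_of_ge hκ hh (by simpa using hn), mul_zero]
      _ = _ := Finset.sum_congr rfl fun n hn => by
          rw [hydLevel_zero_of_lt hκ hh (Finset.mem_range.1 hn)]
  have hs3 : ∑ n ∈ Finset.range K', (2 * (n : ℝ) + 1) = (K' : ℝ) ^ 2 := by
    induction K' with
    | zero => simp
    | succ k ih => rw [Finset.sum_range_succ, ih]; push_cast; ring
  have hs4 := sum_weight_rpow_le hq0 hq1 hh K'
  have hs5 : (K' * h) ^ (2 - 2 * q) / (2 - 2 * q) ≤ (X + 1) ^ (2 - 2 * q) / (2 - 2 * q) := by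
    have : 0 < 2 - 2 * q := by linarith
    gcongr
  have hs6 : h ^ 2 * (K' : ℝ) ^ 2 ≤ (X + 1) ^ 2 := by
    have : h ^ 2 * (K' : ℝ) ^ 2 = (K' * h) ^ 2 := by ring
    rw [this]; gcongr
  rw [hs3] at hs1
  have hs7 := mul_le_mul_of_nonneg_left (hs1.trans (add_le_add_left hs2 _)) (sq_nonneg h)
  have hs8 := mul_le_mul_of_nonneg_left (hs4.trans hs5) hD0.le
  have hs9 := mul_le_mul_of_nonneg_left hs6 hc0.le
  linarith

/-- The building blocks `r ^ k * exp (-β r)`, `r = exp t`, of Coulomb eigenfunctions. -/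
noncomputable def expFun (β : ℝ) (k : ℕ) (t : ℝ) : ℝ := exp (k * t - β * exp t)

lemma contDiff_expFun (β : ℝ) (k : ℕ) : ContDiff ℝ (⊤ : ℕ∞) (expFun β k) := by
  unfold expFun; fun_prop

lemma hasDerivAt_expFun (β : ℝ) (k : ℕ) (t : ℝ) :
    HasDerivAt (expFun β k) (k * expFun β k t - β * expFun β (k + 1) t) t := by
  have h1 : HasDerivAt (fun t : ℝ => k * t - β * exp t) (k - β * exp t) t := by
    exact (((hasDerivAt_id' t).const_mul (k : ℝ)).fun_sub
      ((Real.hasDerivAt_exp t).const_mul β)).congr_deriv (by simp)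
  refine h1.exp.congr_deriv ?_
  have : expFun β (k + 1) t = exp t * expFun β k t := by
    unfold expFun; rw [← Real.exp_add]; congr 1; push_cast; ring
  rw [this]; unfold expFun; ring

lemma expFun_succ (β : ℝ) (k : ℕ) (t : ℝ) : expFun β (k + 1) t = exp t * expFun β k t := by
  unfold expFun; rw [← Real.exp_add]; congr 1; push_cast; ring

lemma expFun_bound {β : ℝ} (hβ : 0 < β) (k : ℕ) :
    ∃ C, 0 < C ∧ ∀ t, expFun β k t ≤ C * exp (k * t) ∧ expFun β k t ≤ C * exp (-(2 * t)) := by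
  refine ⟨max 1 ((k + 2).factorial / β ^ (k + 2)), by positivity, fun t => ⟨?_, ?_⟩⟩
  · have h1 : expFun β k t ≤ exp (k * t) := by
      unfold expFun; gcongr; nlinarith [exp_pos t]
    nlinarith [le_max_left (1 : ℝ) ((k + 2).factorial / β ^ (k + 2)), exp_pos (k * t)]
  · have h1 := Real.pow_div_factorial_le_exp (β * exp t) (by positivity) (k + 2)
    have h2 : exp ((k + 2 : ℕ) * t) ≤ (k + 2).factorial / β ^ (k + 2) * exp (β * exp t) := by
      rw [div_le_iff₀ (by positivity), mul_pow, ← Real.exp_nat_mul] at h1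
      rw [div_mul_eq_mul_div, le_div_iff₀ (by positivity)]
      linarith
    have h3 : expFun β k t = exp ((k + 2 : ℕ) * t) * (exp (-(β * exp t)) * exp (-(2 * t))) := by
      unfold expFun; rw [← Real.exp_add, ← Real.exp_add]; congr 1; push_cast; ring
    rw [h3]
    have h4 := mul_le_mul_of_nonneg_right h2
      (mul_pos (exp_pos (-(β * exp t))) (exp_pos (-(2 * t)))).le
    refine h4.trans ?_
    have h5 : exp (β * exp t) * exp (-(β * exp t)) = 1 := by rw [← Real.exp_add]; simp
    calc _ = (k + 2).factorial / β ^ (k + 2) * (exp (β * exp t) * exp (-(β * exp t))) *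
          exp (-(2 * t)) := by ring
      _ ≤ _ := by
        rw [h5, mul_one]
        gcongr
        exact le_max_right _ _

/-- Smooth functions on the line decaying like radial bound states in the variable `log r`. -/
structure IsBoundState (u : ℝ → ℝ) : Prop where
  smooth : ContDiff ℝ (⊤ : ℕ∞) u
  bound : ∃ C, 0 < C ∧ ∀ t, |u t| ≤ C ∧ |u t| ≤ C * exp (-(2 * t)) ∧ |deriv u t| ≤ C * exp (-|t|)

lemma isBoundState_expFun {β : ℝ} (hβ : 0 < β) (k : ℕ) : IsBoundState (expFun β k) := by
  refine ⟨contDiff_expFun β k, ?_⟩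
  obtain ⟨C, hC, h⟩ := expFun_bound hβ k
  obtain ⟨D, hD, h'⟩ := expFun_bound hβ (k + 1)
  have hpos : ∀ k t, 0 < expFun β k t := fun k t => exp_pos _
  refine ⟨k * C + β * D + C, by positivity, fun t => ?_⟩
  have hx : ∀ k : ℕ, t ≤ 0 → exp (k * t) ≤ 1 := fun k ht => by
    rw [Real.exp_le_one_iff]; exact mul_nonpos_of_nonneg_of_nonpos k.cast_nonneg ht
  have hx1 : 0 ≤ t → exp (-(2 * t)) ≤ 1 := fun ht => by
    rw [Real.exp_le_one_iff]; linarith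
  have hA : 0 ≤ k * C + β * D := by positivity
  rw [abs_of_pos (hpos k t), (hasDerivAt_expFun β k t).deriv]
  refine ⟨?_, ?_, ?_⟩
  · rcases le_total t 0 with ht | ht
    · have := (h t).1
      have := mul_le_mul_of_nonneg_left (hx k ht) hC.le
      linarith
    · have := (h t).2
      have := mul_le_mul_of_nonneg_left (hx1 ht) hC.le
      linarith
  · have := (h t).2
    nlinarith [exp_pos (-(2 * t))]
  · have h1 : |k * expFun β k t - β * expFun β (k + 1) t| ≤
        k * expFun β k t + β * expFun β (k + 1) t := by
      have a1 := mul_nonneg (k.cast_nonneg (α := ℝ)) (hpos k t).le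
      have a2 := mul_nonneg hβ.le (hpos (k + 1) t).le
      rw [abs_le]; constructor <;> linarith
    refine h1.trans ?_
    have h3 : k * expFun β k t ≤ k * (C * exp (-|t|)) := by
      rcases Nat.eq_zero_or_pos k with rfl | hk
      · simp
      have hk' : (1 : ℝ) ≤ k := by exact_mod_cast hk
      gcongr
      rcases le_total t 0 with ht | ht
      · rw [abs_of_nonpos ht]
        refine (h t).1.trans ?_
        gcongr
        nlinarith
      · rw [abs_of_nonneg ht]
        refine (h t).2.trans ?_
        gcongr
        linarith
    have h4 : expFun β (k + 1) t ≤ D * exp (-|t|) := by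
      rcases le_total t 0 with ht | ht
      · rw [abs_of_nonpos ht]
        refine (h' t).1.trans ?_
        gcongr
        push_cast
        nlinarith [k.cast_nonneg (α := ℝ)]
      · rw [abs_of_nonneg ht]
        refine (h' t).2.trans ?_
        gcongr
        linarith
    have h5 := mul_le_mul_of_nonneg_left h4 hβ.le
    have h6 := mul_pos hC (exp_pos (-|t|))
    linarith

namespace IsBoundState

variable {u v : ℝ → ℝ}

lemma add (hu : IsBoundState u) (hv : IsBoundState v) : IsBoundState (fun t => u t + v t) := by
  refine ⟨hu.smooth.add hv.smooth, ?_⟩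
  obtain ⟨C, hC, h⟩ := hu.bound
  obtain ⟨D, hD, h'⟩ := hv.bound
  refine ⟨C + D, by positivity, fun t => ?_⟩
  have e : deriv (fun t => u t + v t) t = deriv u t + deriv v t :=
    deriv_fun_add (hu.smooth.differentiable (by simp) t) (hv.smooth.differentiable (by simp) t)
  rw [e]
  obtain ⟨a, b, c⟩ := h t
  obtain ⟨a', b', c'⟩ := h' t
  have n1 := abs_add_le (u t) (v t)
  have n2 := abs_add_le (deriv u t) (deriv v t)
  exact ⟨by linarith, by linarith, by linarith⟩

lemma const_mul (hu : IsBoundState u) (c : ℝ) : IsBoundState (fun t => c * u t) := by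
  refine ⟨contDiff_const.mul hu.smooth, ?_⟩
  obtain ⟨C, hC, h⟩ := hu.bound
  refine ⟨(|c| + 1) * C, by positivity, fun t => ?_⟩
  have e : deriv (fun t => c * u t) t = c * deriv u t :=
    deriv_const_mul c (hu.smooth.differentiable (by simp) t)
  rw [e, abs_mul, abs_mul]
  obtain ⟨a, b, d⟩ := h t
  have a1 := abs_nonneg c
  refine ⟨?_, ?_, ?_⟩
  · nlinarith
  · nlinarith [abs_nonneg (u t)]
  · nlinarith [abs_nonneg (deriv u t)]

lemma finsetSum {ι : Type*} (s : Finset ι) {u : ι → ℝ → ℝ} (hu : ∀ i, IsBoundState (u i)) :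
    IsBoundState (fun t => ∑ i ∈ s, u i t) := by
  classical
  induction s using Finset.induction_on with
  | empty =>
    refine ⟨by simpa using contDiff_const, 1, one_pos, fun t => ?_⟩
    simp [exp_nonneg]
  | insert a s ha ih => simpa [Finset.sum_insert ha] using (hu a).add ih

lemma continuous (hu : IsBoundState u) : Continuous u := hu.smooth.continuous

lemma hasDerivAt (hu : IsBoundState u) (t : ℝ) : HasDerivAt u (deriv u t) t :=
  (hu.smooth.differentiable (by simp) t).hasDerivAt

lemma contDiff_deriv (hu : IsBoundState u) : ContDiff ℝ (⊤ : ℕ∞) (deriv u) :=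
  (contDiff_infty_iff_deriv.1 hu.smooth).2

lemma integrable_exp_neg_abs : Integrable fun t : ℝ => exp (-|t|) := by
  have h1 : IntegrableOn (fun t : ℝ => exp (-|t|)) (Set.Iic 0) :=
    (integrableOn_exp_Iic 0).congr_fun
      (fun t ht => by simp [abs_of_nonpos (Set.mem_Iic.1 ht)]) measurableSet_Iic
  have h2 : IntegrableOn (fun t : ℝ => exp (-|t|)) (Set.Ioi 0) :=
    (exp_neg_integrableOn_Ioi 0 one_pos).congr_fun
      (fun t ht => by simp [abs_of_pos (Set.mem_Ioi.1 ht)]) measurableSet_Ioi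
  rw [← integrableOn_univ, ← Set.Iic_union_Ioi (a := (0 : ℝ))]
  exact h1.union h2

lemma integrable_deriv_mul (hu : IsBoundState u) (hv : IsBoundState v) :
    Integrable fun t => deriv u t * v t := by
  obtain ⟨C, hC, h⟩ := hu.bound
  obtain ⟨D, hD, h'⟩ := hv.bound
  refine (integrable_exp_neg_abs.const_mul (C * D)).mono'
    (hu.contDiff_deriv.continuous.mul hv.continuous).aestronglyMeasurable
    (Eventually.of_forall fun t => ?_)
  rw [norm_mul, Real.norm_eq_abs, Real.norm_eq_abs]
  calc |deriv u t| * |v t| ≤ (C * exp (-|t|)) * D := by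
        gcongr
        · exact (h t).2.2
        · exact (h' t).1
    _ = _ := by ring

lemma integrable_exp_mul_mul (hu : IsBoundState u) (hv : IsBoundState v) :
    Integrable fun t => exp (2 * t) * (u t * v t) := by
  obtain ⟨C, hC, h⟩ := hu.bound
  obtain ⟨D, hD, h'⟩ := hv.bound
  have hu' := hu.continuous
  have hv' := hv.continuous
  refine (integrable_exp_neg_abs.const_mul (C * D)).mono' (by fun_prop)
    (Eventually.of_forall fun t => ?_)
  rw [norm_mul, norm_mul, Real.norm_eq_abs, Real.norm_eq_abs, Real.norm_eq_abs,
    abs_of_pos (exp_pos _)]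
  have hCD : 0 < C * D := by positivity
  rcases le_total t 0 with ht | ht
  · rw [abs_of_nonpos ht]
    calc exp (2 * t) * (|u t| * |v t|) ≤ exp (2 * t) * (C * D) := by
          gcongr
          · exact (h t).1
          · exact (h' t).1
      _ ≤ C * D * exp (- -t) := by
          rw [mul_comm]; gcongr; linarith
  · rw [abs_of_nonneg ht]
    calc exp (2 * t) * (|u t| * |v t|)
        ≤ exp (2 * t) * ((C * exp (-(2 * t))) * (D * exp (-(2 * t)))) := by
          gcongr
          · exact (h t).2.1
          · exact (h' t).2.1
      _ = C * D * exp (-(2 * t)) := by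
          have : exp (2 * t) * exp (-(2 * t)) = 1 := by rw [← Real.exp_add]; simp
          linear_combination (C * D * exp (-(2 * t))) * this
      _ ≤ C * D * exp (-t) := by gcongr; linarith

end IsBoundState

/-- Coefficients of the Laguerre-type polynomial in a two-dimensional Coulomb eigenfunction. -/
noncomputable def coulombCoeff (β : ℝ) (l n : ℕ) : ℕ → ℝ
  | 0 => 1
  | j + 1 => 2 * β * ((l : ℝ) + j - n) / ((j + 1) * (2 * l + j + 1)) * coulombCoeff β l n j

/-- Radial Coulomb eigenfunctions in the variable `log r`. -/
noncomputable def coulombFun (β : ℝ) (l n : ℕ) (t : ℝ) : ℝ :=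
  ∑ j ∈ Finset.range (n - l + 1), coulombCoeff β l n j * expFun β (l + j) t

lemma isBoundState_coulombFun {β : ℝ} (hβ : 0 < β) (l n : ℕ) :
    IsBoundState (coulombFun β l n) :=
  IsBoundState.finsetSum _ fun j => (isBoundState_expFun hβ (l + j)).const_mul _

lemma deriv_coulombFun (β : ℝ) (l n : ℕ) : deriv (coulombFun β l n) = fun t =>
    ∑ j ∈ Finset.range (n - l + 1), coulombCoeff β l n j *
      (((l + j : ℕ) : ℝ) * expFun β (l + j) t - β * expFun β (l + j + 1) t) := by
  funext t
  exact (HasDerivAt.fun_sum fun j _ => (hasDerivAt_expFun β (l + j) t).const_mul _).deriv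

lemma hasDerivAt_deriv_coulombFun (β : ℝ) {l n : ℕ} (hl : l ≤ n) (t : ℝ) :
    HasDerivAt (deriv (coulombFun β l n))
      (((l : ℝ) ^ 2 - (2 * n + 1) * β * exp t + β ^ 2 * exp (2 * t)) * coulombFun β l n t) t := by
  rw [deriv_coulombFun]
  have h := HasDerivAt.fun_sum (u := Finset.range (n - l + 1)) (x := t) fun j _ =>
    ((((hasDerivAt_expFun β (l + j) t).const_mul ((l + j : ℕ) : ℝ)).fun_sub
      ((hasDerivAt_expFun β (l + j + 1) t).const_mul β)).const_mul (coulombCoeff β l n j))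
  refine h.congr_deriv ?_
  set a : ℕ → ℝ := fun j => coulombCoeff β l n j * (j * (2 * l + j)) * expFun β (l + j) t with ha
  have e2 : exp (2 * t) = exp t * exp t := by rw [← Real.exp_add]; ring_nf
  have key : ∀ j : ℕ, a (j + 1) =
      coulombCoeff β l n j * (2 * β * ((l : ℝ) + j - n)) * (exp t * expFun β (l + j) t) := by
    intro j
    have h1 : ((j : ℝ) + 1) * (2 * l + j + 1) ≠ 0 := by positivity
    have h2 : expFun β (l + (j + 1)) t = exp t * expFun β (l + j) t := expFun_succ β (l + j) t
    simp only [ha, coulombCoeff]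
    rw [h2]
    push_cast
    field_simp
    ring
  have tel := Finset.sum_range_sub' a (n - l + 1)
  have a0 : a 0 = 0 := by simp [ha]
  have aN : a (n - l + 1) = 0 := by
    rw [key, Nat.cast_sub hl]; ring
  rw [a0, aN, sub_zero] at tel
  unfold coulombFun
  rw [Finset.mul_sum, ← sub_eq_zero, ← Finset.sum_sub_distrib, ← tel]
  refine Finset.sum_congr rfl fun j _ => ?_
  rw [key, expFun_succ β (l + j + 1), expFun_succ β (l + j)]
  simp only [ha]
  rw [e2]
  push_cast
  ring

lemma exists_coulombFun_ne_zero (β : ℝ) (l n : ℕ) : ∃ t, coulombFun β l n t ≠ 0 := by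
  set p : ℝ → ℝ := fun x => ∑ j ∈ Finset.range (n - l + 1), coulombCoeff β l n j * x ^ j with hp
  have hc : Continuous p := by fun_prop
  have h0 : p 0 ≠ 0 := by
    rw [hp]; simp only
    rw [Finset.sum_range_succ']
    simp [coulombCoeff]
  have h1 : ∀ᶠ x in nhdsWithin 0 (Set.Ioi 0), p x ≠ 0 :=
    nhdsWithin_le_nhds (hc.continuousAt.eventually_ne h0)
  obtain ⟨x, hx, hx0⟩ := (h1.and self_mem_nhdsWithin).exists
  have hx0' : 0 < x := hx0
  refine ⟨log x, ?_⟩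
  have : coulombFun β l n (log x) = expFun β l (log x) * p x := by
    unfold coulombFun
    rw [hp, Finset.mul_sum]
    refine Finset.sum_congr rfl fun j _ => ?_
    have : expFun β (l + j) (log x) = expFun β l (log x) * x ^ j := by
      clear * - hx0'
      induction j with
      | zero => simp
      | succ j ih => rw [← add_assoc, expFun_succ, ih, exp_log hx0']; ring
    rw [this]; ring
  rw [this]
  exact mul_ne_zero (exp_pos _).ne' hx

/-- Normalised radial eigenfunctions. -/
lemma exists_radial_eigenfunction {g : ℝ} (hg : 0 < g) {l n : ℕ} (hl : l ≤ n) :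
    ∃ u : ℝ → ℝ, IsBoundState u ∧
      (∀ t, HasDerivAt (deriv u)
        (((l : ℝ) ^ 2 - g * exp t + (g / (2 * n + 1)) ^ 2 * exp (2 * t)) * u t) t) ∧
      ∫ t, exp (2 * t) * (u t * u t) = 1 := by
  set β := g / (2 * n + 1) with hβd
  have hβ : 0 < β := by positivity
  have hb := isBoundState_coulombFun hβ l n
  set I := ∫ t, exp (2 * t) * (coulombFun β l n t * coulombFun β l n t) with hI
  have hIpos : 0 < I := by
    obtain ⟨t0, ht0⟩ := exists_coulombFun_ne_zero β l n
    have hc := hb.continuous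
    refine integral_pos_of_integrable_nonneg_nonzero (x := t0) (by fun_prop)
      (hb.integrable_exp_mul_mul hb) (fun t => ?_) ?_
    · exact mul_nonneg (exp_pos _).le (mul_self_nonneg _)
    · exact mul_ne_zero (exp_pos _).ne' (mul_ne_zero ht0 ht0)
  have hs : (√I)⁻¹ * (√I)⁻¹ * I = 1 := by
    have := Real.mul_self_sqrt hIpos.le
    have h2 := (Real.sqrt_pos.2 hIpos).ne'
    field_simp
    nlinarith
  refine ⟨fun t => (√I)⁻¹ * coulombFun β l n t, hb.const_mul _, fun t => ?_, ?_⟩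
  · have e : deriv (fun t => (√I)⁻¹ * coulombFun β l n t) =
        fun t => (√I)⁻¹ * deriv (coulombFun β l n) t := by
      funext t; exact deriv_const_mul _ (hb.smooth.differentiable (by simp) t)
    rw [e]
    refine ((hasDerivAt_deriv_coulombFun β hl t).const_mul _).congr_deriv ?_
    have : (2 * (n : ℝ) + 1) * β = g := by rw [hβd]; field_simp
    rw [this]; ring
  · rw [← hs, hI, ← integral_const_mul]
    congr 1; funext t; ring

lemma IsBoundState.orthogonal {u v q : ℝ → ℝ} {a b : ℝ} (hu : IsBoundState u)
    (hv : IsBoundState v)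
    (hu' : ∀ t, HasDerivAt (deriv u) ((q t + a * exp (2 * t)) * u t) t)
    (hv' : ∀ t, HasDerivAt (deriv v) ((q t + b * exp (2 * t)) * v t) t) (hab : a ≠ b) :
    ∫ t, exp (2 * t) * (u t * v t) = 0 := by
  have h := integral_eq_zero_of_hasDerivAt_of_integrable
    (f := fun t => deriv u t * v t - deriv v t * u t)
    (f' := fun t => (a - b) * (exp (2 * t) * (u t * v t)))
    (fun t => (((hu' t).fun_mul (hv.hasDerivAt t)).fun_sub
      ((hv' t).fun_mul (hu.hasDerivAt t))).congr_deriv (by ring))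
    ((hu.integrable_exp_mul_mul hv).const_mul _)
    ((hu.integrable_deriv_mul hv).sub (hv.integrable_deriv_mul hu))
  rw [integral_const_mul] at h
  exact (mul_eq_zero.1 h).resolve_left (sub_ne_zero.2 hab)

lemma IsBoundState.energy {u ζ : ℝ → ℝ} {l g b : ℝ} (hu : IsBoundState u)
    (hu' : ∀ t, HasDerivAt (deriv u) ((l ^ 2 - g * exp t + b * exp (2 * t)) * u t) t)
    (hζ : ContDiff ℝ (⊤ : ℕ∞) ζ) (hζc : HasCompactSupport ζ) :
    ∫ t, (deriv (fun s => ζ s * u s) t ^ 2 + (l ^ 2 - g * exp t) * (ζ t * u t) ^ 2) =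
      (∫ t, deriv ζ t ^ 2 * u t ^ 2) - b * ∫ t, exp (2 * t) * (ζ t * u t) ^ 2 := by
  have hd : ∀ t, HasDerivAt ζ (deriv ζ t) t :=
    fun t => (hζ.differentiable (by simp) t).hasDerivAt
  have c1 := hζ.continuous
  have c2 : Continuous (deriv ζ) := (contDiff_infty_iff_deriv.1 hζ).2.continuous
  have c3 := hu.continuous
  have c4 := hu.contDiff_deriv.continuous
  have e : ∀ t, deriv (fun s => ζ s * u s) t = deriv ζ t * u t + ζ t * deriv u t :=
    fun t => ((hd t).fun_mul (hu.hasDerivAt t)).deriv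
  have hcs : ∀ {F : ℝ → ℝ}, Continuous F → (∀ t, ζ t = 0 ∧ deriv ζ t = 0 → F t = 0) →
      Integrable F := by
    intro F hF h0
    refine hF.integrable_of_hasCompactSupport ?_
    refine HasCompactSupport.intro hζc (fun t ht => h0 t ⟨image_eq_zero_of_notMem_tsupport ht, ?_⟩)
    have : t ∉ tsupport (deriv ζ) := fun h => ht (tsupport_deriv_subset h)
    exact image_eq_zero_of_notMem_tsupport this
  set D : ℝ → ℝ := fun t => 2 * ζ t * deriv ζ t * (u t * deriv u t) + ζ t ^ 2 * (deriv u t) ^ 2 +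
    ζ t ^ 2 * ((l ^ 2 - g * exp t + b * exp (2 * t)) * u t ^ 2) with hD
  have hDi : Integrable D := hcs (by fun_prop) (fun t h => by simp [hD, h.1])
  have hD0 : ∫ t, D t = 0 := by
    refine integral_eq_zero_of_hasDerivAt_of_integrable
      (f := fun t => ζ t ^ 2 * (u t * deriv u t)) (fun t => ?_) hDi
      (hcs (by fun_prop) (fun t h => by simp [h.1]))
    refine (((hd t).fun_pow 2).fun_mul ((hu.hasDerivAt t).fun_mul (hu' t))).congr_deriv ?_
    simp [hD]; ring
  have i1 : Integrable fun t => deriv ζ t ^ 2 * u t ^ 2 :=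
    hcs (by fun_prop) (fun t h => by simp [h.2])
  have i2 : Integrable fun t => b * (exp (2 * t) * (ζ t * u t) ^ 2) :=
    hcs (by fun_prop) (fun t h => by simp [h.1])
  rw [← integral_const_mul, ← integral_sub i1 i2, ← add_zero (∫ t, _ - _), ← hD0,
    ← integral_add (by exact i1.sub i2) hDi]
  congr 1; funext t
  rw [e]
  simp only [hD]
  ring

/-- Solid harmonics in the plane: real and imaginary parts of powers of `x₀ ± i x₁`. -/
noncomputable def solidHarm (s : Bool) (m : ℤ) (x : Plane) : ℝ :=
  if s then (((x 0 : ℂ) + (((if m < 0 then -1 else 1) * x 1 : ℝ) : ℂ) * Complex.I) ^ m.natAbs).im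
  else (((x 0 : ℂ) + (((if m < 0 then -1 else 1) * x 1 : ℝ) : ℂ) * Complex.I) ^ m.natAbs).re

lemma contDiff_solidHarm (s : Bool) (m : ℤ) : ContDiff ℝ (⊤ : ℕ∞) (solidHarm s m) := by
  have hc : ∀ i : Fin 2, ContDiff ℝ (⊤ : ℕ∞) fun x : Plane => x i := fun i => by fun_prop
  have h : ContDiff ℝ (⊤ : ℕ∞) fun x : Plane =>
      ((x 0 : ℂ) + (((if m < 0 then -1 else 1) * x 1 : ℝ) : ℂ) * Complex.I) ^ m.natAbs := by
    refine ContDiff.pow ?_ _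
    refine (Complex.ofRealCLM.contDiff.comp (hc 0)).add (ContDiff.mul ?_ contDiff_const)
    exact Complex.ofRealCLM.contDiff.comp (contDiff_const.mul (hc 1))
  unfold solidHarm
  cases s
  · simp only [Bool.false_eq_true, if_false]
    exact Complex.reCLM.contDiff.comp h
  · simp only [if_true]
    exact Complex.imCLM.contDiff.comp h

lemma solidHarm_logPolar (s : Bool) (m : ℤ) (t θ : ℝ) :
    solidHarm s m (logPolar t θ) = exp (m.natAbs * t) * trig s m θ := by
  set σ : ℝ := if m < 0 then -1 else 1 with hσ
  have h1 : sin (σ * θ) = σ * sin θ := by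
    rw [hσ]; split_ifs <;> simp
  have h2 : cos (σ * θ) = cos θ := by
    rw [hσ]; split_ifs <;> simp
  have h3 : (m.natAbs : ℝ) * (σ * θ) = m * θ := by
    rw [hσ, ← mul_assoc]
    congr 1
    rw [Nat.cast_natAbs]
    split_ifs with h
    · rw [abs_of_neg h]; push_cast; ring
    · rw [abs_of_nonneg (not_lt.1 h)]; simp
  have h4 : (((logPolar t θ) 0 : ℝ) : ℂ) + ((σ * (logPolar t θ) 1 : ℝ) : ℂ) * Complex.I =
      (exp t : ℝ) * (Complex.cos ((σ * θ : ℝ) : ℂ) + Complex.sin ((σ * θ : ℝ) : ℂ) * Complex.I) := by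
    have e0 : (logPolar t θ) 0 = exp t * cos θ := by simp [logPolar]
    have e1 : (logPolar t θ) 1 = exp t * sin θ := by simp [logPolar]
    rw [e0, e1, ← Complex.ofReal_cos, ← Complex.ofReal_sin, h1, h2]
    push_cast; ring
  have h5 : ((((logPolar t θ) 0 : ℝ) : ℂ) + ((σ * (logPolar t θ) 1 : ℝ) : ℂ) * Complex.I) ^ m.natAbs
      = ((exp (m.natAbs * t) * cos (m * θ) : ℝ) : ℂ) +
        ((exp (m.natAbs * t) * sin (m * θ) : ℝ) : ℂ) * Complex.I := by
    rw [h4, mul_pow, Complex.cos_add_sin_mul_I_pow, ← Complex.ofReal_pow, ← Real.exp_nat_mul]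
    rw [← h3]
    push_cast
    ring
  unfold solidHarm trig
  cases s
  · simp only [Bool.false_eq_true, if_false]
    rw [h5]; simp [-Complex.ofReal_mul]
  · simp only [if_true]
    rw [h5]; simp [-Complex.ofReal_mul]

/-- The plane function `ψ(log r) cos mθ / √(2π)` or `ψ(log r) sin mθ / √(2π)`. -/
noncomputable def polarFun (ψ : ℝ → ℝ) (s : Bool) (m : ℤ) (x : Plane) : ℝ :=
  if x = 0 then 0 else
    (√(2 * π))⁻¹ * (ψ (log ‖x‖) * exp (-(m.natAbs * log ‖x‖))) * solidHarm s m x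

lemma polarFun_logPolar (ψ : ℝ → ℝ) (s : Bool) (m : ℤ) (t θ : ℝ) :
    polarFun ψ s m (logPolar t θ) = (√(2 * π))⁻¹ * ψ t * trig s m θ := by
  have h0 : logPolar t θ ≠ 0 := by
    rw [← norm_ne_zero_iff, norm_logPolar]; exact (exp_pos t).ne'
  rw [polarFun, if_neg h0, norm_logPolar, log_exp, solidHarm_logPolar]
  have : exp (-(m.natAbs * t)) * exp (m.natAbs * t) = 1 := by rw [← Real.exp_add]; simp
  linear_combination ((√(2 * π))⁻¹ * ψ t * trig s m θ) * this

lemma isTest_polarFun {ψ : ℝ → ℝ} (hψ : ContDiff ℝ (⊤ : ℕ∞) ψ) (hc : HasCompactSupport ψ)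
    (s : Bool) (m : ℤ) : IsTest (polarFun ψ s m) := by
  obtain ⟨R, hR⟩ := hc.isCompact.isBounded.subset_closedBall 0
  have hz : ∀ t, R < |t| → ψ t = 0 := fun t ht => by
    by_contra h
    have := hR (subset_tsupport _ h)
    rw [mem_closedBall_zero_iff, Real.norm_eq_abs] at this
    linarith
  have hsub : Function.support (polarFun ψ s m) ⊆
      {x : Plane | exp (-R) ≤ ‖x‖ ∧ ‖x‖ ≤ exp R} := by
    intro x hx
    have hx0 : x ≠ 0 := fun h => hx (by simp [polarFun, h])
    have hn : 0 < ‖x‖ := norm_pos_iff.2 hx0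
    have h1 : |log ‖x‖| ≤ R := by
      by_contra h
      exact hx (by simp [polarFun, hx0, hz _ (not_le.1 h)])
    rw [abs_le] at h1
    exact ⟨(Real.le_log_iff_exp_le hn).1 h1.1, (Real.log_le_iff_le_exp hn).1 h1.2⟩
  have hcl : IsClosed {x : Plane | exp (-R) ≤ ‖x‖ ∧ ‖x‖ ≤ exp R} :=
    (isClosed_le continuous_const continuous_norm).inter
      (isClosed_le continuous_norm continuous_const)
  refine ⟨⟨?_, ?_⟩, ?_⟩
  · rw [contDiff_iff_contDiffAt]
    intro x
    by_cases hx : x = 0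
    · subst hx
      have h0 : (0 : Plane) ∈ {x : Plane | exp (-R) ≤ ‖x‖ ∧ ‖x‖ ≤ exp R}ᶜ := fun h => by
        have := h.1
        rw [norm_zero] at this
        linarith [exp_pos (-R)]
      have : polarFun ψ s m =ᶠ[nhds 0] fun _ => 0 := by
        filter_upwards [hcl.isOpen_compl.mem_nhds h0] with y hy
        by_contra h
        exact hy (hsub h)
      exact contDiffAt_const.congr_of_eventuallyEq this
    · have : polarFun ψ s m =ᶠ[nhds x] fun x =>
          (√(2 * π))⁻¹ * (ψ (log ‖x‖) * exp (-(m.natAbs * log ‖x‖))) * solidHarm s m x := by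
        filter_upwards [isOpen_ne.mem_nhds hx] with y hy
        rw [polarFun, if_neg hy]
      refine ContDiffAt.congr_of_eventuallyEq ?_ this
      have hl : ContDiffAt ℝ (⊤ : ℕ∞) (fun x : Plane => log ‖x‖) x :=
        (contDiffAt_norm ℝ hx).log (norm_ne_zero_iff.2 hx)
      refine (contDiffAt_const.mul ((hψ.contDiffAt.comp x hl).mul ?_)).mul
        (contDiff_solidHarm s m).contDiffAt
      exact (contDiffAt_const.mul hl).neg.exp
  · exact HasCompactSupport.of_support_subset_isCompact (isCompact_closedBall (0 : Plane) (exp R))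
      (fun x hx => mem_closedBall_zero_iff.2 (hsub hx).2)
  · intro x hx h0
    have h := closure_minimal hsub hcl hx
    rw [h0] at h
    have := h.1
    rw [norm_zero] at this
    linarith [exp_pos (-R)]

/-- Sum of the forms of the cosine and sine functions with the same radial profile. -/
lemma sum_qForm_polarFun {ψ : ℝ → ℝ} (hψ : ContDiff ℝ (⊤ : ℕ∞) ψ) (hc : HasCompactSupport ψ)
    (m : ℤ) (κ q h : ℝ) :
    ∑ s, qForm h (hydPot κ 0 q) (polarFun ψ s m) =
      ∫ t, (h ^ 2 * (deriv ψ t ^ 2 + (m : ℝ) ^ 2 * ψ t ^ 2) -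
        exp (2 * t) * (κ * (exp (-t) - 1)) * ψ t ^ 2) := by
  have ht : ∀ s, IsTest (polarFun ψ s m) := fun s => isTest_polarFun hψ hc s m
  set w : ℝ → ℝ := fun t => κ * (exp (-t) - 1) with hw
  have hwc : Continuous w := by fun_prop
  have hG : ∀ s, qForm h (hydPot κ 0 q) (polarFun ψ s m) =
      ∫ x, (h ^ 2 * ‖fderiv ℝ (polarFun ψ s m) x‖ ^ 2 - w (log ‖x‖) * polarFun ψ s m x ^ 2) := by
    intro s
    unfold qForm
    congr 1; ext x
    by_cases hx : x = 0
    · simp [hx, polarFun]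
    · have hn : 0 < ‖x‖ := norm_pos_iff.2 hx
      simp [hw, hydPot, Real.exp_neg, exp_log hn]
  have hpol : ∀ s, qForm h (hydPot κ 0 q) (polarFun ψ s m) = ∫ t, ∫ θ in (-π)..π,
      (2 * π)⁻¹ * (h ^ 2 * (deriv ψ t ^ 2 * trig s m θ ^ 2 +
        (m : ℝ) ^ 2 * ψ t ^ 2 * trig (!s) m θ ^ 2) -
        exp (2 * t) * w t * ψ t ^ 2 * trig s m θ ^ 2) := by
    intro s
    rw [hG, integral_logPolar]
    · congr 1; ext t
      congr 1; ext θ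
      have hd := ((ht s).1.1.differentiable (by simp) (logPolar t θ)).hasFDerivAt
      have d1 : fderiv ℝ (polarFun ψ s m) (logPolar t θ) (logPolar t θ) =
          (√(2 * π))⁻¹ * deriv ψ t * trig s m θ := by
        have a1 := hd.comp_hasDerivAt t (hasDerivAt_logPolar_left t θ)
        have a2 : HasDerivAt (fun t => (√(2 * π))⁻¹ * ψ t * trig s m θ)
            ((√(2 * π))⁻¹ * deriv ψ t * trig s m θ) t :=
          ((hψ.differentiable (by simp) t).hasDerivAt.const_mul _).mul_const _
        have e : (polarFun ψ s m) ∘ (fun t => logPolar t θ) =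
            fun t => (√(2 * π))⁻¹ * ψ t * trig s m θ := by
          funext t; exact polarFun_logPolar ψ s m t θ
        rw [e] at a1
        exact a1.unique a2
      have d2 : fderiv ℝ (polarFun ψ s m) (logPolar t θ) (perpPolar t θ) =
          (√(2 * π))⁻¹ * ψ t * ((if s then (m : ℝ) else -m) * trig (!s) m θ) := by
        have a1 := hd.comp_hasDerivAt θ (hasDerivAt_logPolar_right t θ)
        have a2 := (hasDerivAt_trig s m θ).const_mul ((√(2 * π))⁻¹ * ψ t)
        have e : (polarFun ψ s m) ∘ (fun θ => logPolar t θ) =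
            fun θ => (√(2 * π))⁻¹ * ψ t * trig s m θ := by
          funext θ; exact polarFun_logPolar ψ s m t θ
        rw [e] at a1
        exact a1.unique a2
      have hn := norm_fderiv_logPolar (polarFun ψ s m) t θ
      rw [d1, d2] at hn
      have hm : (if s then (m : ℝ) else -m) ^ 2 = (m : ℝ) ^ 2 := by cases s <;> simp
      have hs : (√(2 * π))⁻¹ ^ 2 = (2 * π)⁻¹ := by
        rw [inv_pow, Real.sq_sqrt (by positivity)]
      rw [norm_logPolar, log_exp, polarFun_logPolar, ← hs]
      rw [mul_pow, mul_pow, mul_pow, mul_pow, mul_pow, hm] at hn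
      linear_combination h ^ 2 * hn
    · exact (((ht s).continuous_fderiv.norm.pow 2).const_mul _).sub
        ((ht s).continuous_mul_sq_log hwc)
    · refine (ht s).1.2.mono' fun x hx => ?_
      by_contra hx'
      have e1 : polarFun ψ s m x = 0 := image_eq_zero_of_notMem_tsupport hx'
      have e2 : fderiv ℝ (polarFun ψ s m) x = 0 := by
        by_contra h2
        exact hx' (support_fderiv_subset ℝ h2)
      simp [e1, e2] at hx
  set T : Bool → ℝ := fun s => ∫ θ in (-π)..π, trig s m θ ^ 2 with hT
  have hTi : ∀ s, IntervalIntegrable (fun θ => trig s m θ ^ 2) volume (-π) π :=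
    fun s => ((continuous_trig s m).pow 2).intervalIntegrable _ _
  have hTs : T true + T false = 2 * π := by
    rw [hT]
    simp only
    rw [← intervalIntegral.integral_add (hTi _) (hTi _)]
    have : ∀ θ, trig true m θ ^ 2 + trig false m θ ^ 2 = 1 := fun θ => by
      have := trig_sq_add m θ
      rwa [Fintype.sum_bool] at this
    simp only [this]
    simp
    ring
  have hr : IsRad ψ := ⟨hψ.of_le (by simp), hc⟩
  set α : ℝ → ℝ := fun t => h ^ 2 * deriv ψ t ^ 2 - exp (2 * t) * w t * ψ t ^ 2 with hα
  set γ : ℝ → ℝ := fun t => h ^ 2 * (m : ℝ) ^ 2 * ψ t ^ 2 with hγ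
  have iα : Integrable α := (hr.integrable_deriv_sq.const_mul _).sub
    (hr.integrable_mul_sq (by fun_prop))
  have iγ : Integrable γ := hr.integrable_mul_sq continuous_const
  have hin : ∀ s, qForm h (hydPot κ 0 q) (polarFun ψ s m) =
      (2 * π)⁻¹ * (T s * ∫ t, α t) + (2 * π)⁻¹ * (T (!s) * ∫ t, γ t) := by
    intro s
    rw [hpol, ← integral_const_mul, ← integral_const_mul, ← integral_const_mul,
      ← integral_const_mul, ← integral_add ((iα.const_mul _).const_mul _)
      ((iγ.const_mul _).const_mul _)]
    congr 1; ext t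
    rw [hT]
    simp only
    rw [← intervalIntegral.integral_mul_const, ← intervalIntegral.integral_mul_const,
      ← intervalIntegral.integral_const_mul, ← intervalIntegral.integral_const_mul,
      ← intervalIntegral.integral_add (((hTi _).mul_const _).const_mul _)
        (((hTi _).mul_const _).const_mul _)]
    congr 1; ext θ
    simp only [hα, hγ]
    ring
  have e : ∫ t, (h ^ 2 * (deriv ψ t ^ 2 + (m : ℝ) ^ 2 * ψ t ^ 2) -
        exp (2 * t) * (κ * (exp (-t) - 1)) * ψ t ^ 2) = (∫ t, α t) + ∫ t, γ t := by
    rw [← integral_add iα iγ]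
    congr 1; ext t
    simp only [hα, hγ, hw]
    ring
  rw [e, Fintype.sum_bool, hin, hin]
  have hpi : (2 * π)⁻¹ * (2 * π) = 1 := inv_mul_cancel₀ (by positivity)
  simp only [Bool.not_true, Bool.not_false]
  linear_combination ((2 * π)⁻¹ * ((∫ t, α t) + ∫ t, γ t)) * hTs + ((∫ t, α t) + ∫ t, γ t) * hpi

/-- The normalised trigonometric system is a Parseval frame; this is the dual bound. -/
lemma integral_sq_sum_trig_le (S : Finset ℤ) (a : ℤ → Bool → ℝ) :
    ∫ θ in (-π)..π, (∑ m ∈ S, ∑ s, a m s * ((√(2 * π))⁻¹ * trig s m θ)) ^ 2 ≤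
      ∑ m ∈ S, ∑ s, a m s ^ 2 := by
  set F : ℝ → ℝ := fun θ => ∑ m ∈ S, ∑ s, a m s * ((√(2 * π))⁻¹ * trig s m θ) with hF
  have hFc : Continuous F := continuous_finsetSum _ fun m _ => continuous_finsetSum _ fun s _ =>
    continuous_const.mul (continuous_const.mul (continuous_trig s m))
  have h1 : ∫ θ in (-π)..π, F θ ^ 2 = ∑ m ∈ S, ∑ s, a m s * trigCoeff s m F := by
    have e : ∀ θ, F θ ^ 2 = ∑ m ∈ S, ∑ s, a m s * ((√(2 * π))⁻¹ * (F θ * trig s m θ)) := by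
      intro θ
      rw [sq]
      nth_rewrite 2 [hF]
      simp only
      rw [Finset.mul_sum]
      refine Finset.sum_congr rfl fun m _ => ?_
      rw [Finset.mul_sum]
      exact Finset.sum_congr rfl fun s _ => by ring
    have hi : ∀ m s, IntervalIntegrable (fun θ => a m s * ((√(2 * π))⁻¹ * (F θ * trig s m θ)))
        volume (-π) π := fun m s => ((hFc.mul (continuous_trig s m)).const_mul _ |>.const_mul
          _).intervalIntegrable _ _
    simp only [e]
    have hi' : ∀ m ∈ S, IntervalIntegrable
        (fun θ => ∑ s, a m s * ((√(2 * π))⁻¹ * (F θ * trig s m θ))) volume (-π) π := fun m _ =>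
      (continuous_finsetSum _ fun s _ => continuous_const.mul (continuous_const.mul
        (hFc.mul (continuous_trig s m)))).intervalIntegrable _ _
    rw [intervalIntegral.integral_finsetSum hi']
    refine Finset.sum_congr rfl fun m _ => ?_
    rw [intervalIntegral.integral_finsetSum fun s _ => hi m s]
    refine Finset.sum_congr rfl fun s _ => ?_
    rw [intervalIntegral.integral_const_mul, intervalIntegral.integral_const_mul, trigCoeff]
  have h2 : ∑ m ∈ S, ∑ s, trigCoeff s m F ^ 2 ≤ ∫ θ in (-π)..π, F θ ^ 2 :=
    sum_le_hasSum S (fun _ _ => Finset.sum_nonneg fun _ _ => sq_nonneg _) (hasSum_trigCoeff_sq hFc)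
  have h3 : ∑ m ∈ S, ∑ s, a m s * trigCoeff s m F ≤
      (∑ m ∈ S, ∑ s, a m s ^ 2) / 2 + (∑ m ∈ S, ∑ s, trigCoeff s m F ^ 2) / 2 := by
    rw [← add_div, ← Finset.sum_add_distrib, Finset.sum_div]
    refine Finset.sum_le_sum fun m _ => ?_
    rw [← Finset.sum_add_distrib, Finset.sum_div]
    refine Finset.sum_le_sum fun s _ => ?_
    nlinarith [sq_nonneg (a m s - trigCoeff s m F)]
  linarith

lemma hasCompactSupport_finsetSum {ι α : Type*} [TopologicalSpace α] (s : Finset ι)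
    {F : ι → α → ℝ} (h : ∀ i, HasCompactSupport (F i)) :
    HasCompactSupport (fun x => ∑ i ∈ s, F i x) := by
  classical
  induction s using Finset.induction_on with
  | empty => simp only [Finset.sum_empty]; exact HasCompactSupport.zero
  | insert a s ha ih => simp only [Finset.sum_insert ha]; exact (h a).add ih

/-- Gram bound for families of products of radial and angular functions. -/
lemma subON_polarFun {ι : Type} [Fintype ι] (S : Finset ℤ) {ψ : ι → ℤ → ℝ → ℝ}
    (hψ : ∀ i m, ContDiff ℝ (⊤ : ℕ∞) (ψ i m)) (hc : ∀ i m, HasCompactSupport (ψ i m))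
    (hon : ∀ m, SubON volume (fun i t => exp t * ψ i m t)) :
    SubON volume (fun (p : ι × S × Bool) => polarFun (ψ p.1 p.2.1) p.2.2 p.2.1) := by
  intro c
  set G : Plane → ℝ := fun x => ∑ p : ι × S × Bool, c p * polarFun (ψ p.1 p.2.1) p.2.2 p.2.1 x
    with hG
  have hGt : IsTest G := IsTest.finsetSum _ fun p =>
    (isTest_polarFun (hψ _ _) (hc _ _) _ _).const_mul _
  have hψc : ∀ i m, Continuous (ψ i m) := fun i m => (hψ i m).continuous
  set A : S → Bool → ℝ → ℝ := fun m s t => ∑ i, c (i, m, s) * (exp t * ψ i m t) with hA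
  have hAc : ∀ m s, Continuous (A m s) := fun m s => continuous_finsetSum _ fun i _ =>
    continuous_const.mul (continuous_exp.mul (hψc i m))
  have hAs : ∀ m s, HasCompactSupport (A m s) := fun m s =>
    hasCompactSupport_finsetSum _ fun i => ((hc i m).mul_left (f := exp)).mul_left
      (f := fun _ => c (i, m, s))
  have key : ∀ t, ∫ θ in (-π)..π, exp (2 * t) * G (logPolar t θ) ^ 2 ≤
      ∑ m : S, ∑ s, A m s t ^ 2 := by
    intro t
    have h := integral_sq_sum_trig_le S (fun m s => if hm : m ∈ S then A ⟨m, hm⟩ s t else 0)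
    rw [← Finset.sum_coe_sort S] at h
    refine le_trans (le_of_eq ?_) (h.trans (le_of_eq (Finset.sum_congr rfl fun m _ =>
      Finset.sum_congr rfl fun s _ => by rw [dif_pos m.2])))
    congr 1; ext θ
    rw [← Finset.sum_coe_sort S]
    simp only [hG, hA, polarFun_logPolar]
    have e2 : exp (2 * t) = exp t ^ 2 := by rw [← Real.exp_nat_mul]; norm_num
    rw [e2, ← mul_pow]
    congr 1
    rw [Fintype.sum_prod_type, Finset.sum_comm, Fintype.sum_prod_type, Finset.mul_sum]
    refine Finset.sum_congr rfl fun m _ => ?_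
    rw [Finset.mul_sum]
    refine Finset.sum_congr rfl fun s _ => ?_
    rw [dif_pos m.2, Finset.mul_sum, Finset.sum_mul]
    refine Finset.sum_congr rfl fun i _ => ?_
    ring
  have hi : ∀ m s, Integrable fun t => A m s t ^ 2 := fun m s => by
    have := ((hAc m s).mul (hAc m s)).integrable_of_hasCompactSupport (μ := volume)
      ((hAs m s).mul_left (f := A m s))
    exact this.congr (Eventually.of_forall fun t => by simp [sq])
  rw [integral_logPolar (G := fun x => G x ^ 2) (hGt.1.continuous.pow 2)
    (by simp only [sq]; exact hGt.1.2.mul_left (f := G))]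
  calc ∫ t, ∫ θ in (-π)..π, exp (2 * t) * G (logPolar t θ) ^ 2
      ≤ ∫ t, ∑ m : S, ∑ s, A m s t ^ 2 := by
        refine integral_mono_of_nonneg (Eventually.of_forall fun t => ?_)
          (integrable_finsetSum _ fun m _ => integrable_finsetSum _ fun s _ => hi m s)
          (Eventually.of_forall key)
        refine intervalIntegral.integral_nonneg (by linarith [pi_pos]) fun θ _ => ?_
        positivity
    _ = ∑ m : S, ∑ s, ∫ t, A m s t ^ 2 := by
        rw [integral_finsetSum _ fun m _ => integrable_finsetSum _ fun s _ => hi m s]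
        refine Finset.sum_congr rfl fun m _ => ?_
        rw [integral_finsetSum _ fun s _ => hi m s]
    _ ≤ ∑ m : S, ∑ s, ∑ i, c (i, m, s) ^ 2 :=
        Finset.sum_le_sum fun m _ => Finset.sum_le_sum fun s _ => hon m fun i => c (i, m, s)
    _ = ∑ p, c p ^ 2 := by
        symm
        rw [Fintype.sum_prod_type fun p : ι × S × Bool => c p ^ 2, Finset.sum_comm]
        exact Fintype.sum_prod_type fun q : S × Bool => ∑ i, c (i, q) ^ 2

/-- A fixed smooth bump on the line. -/
noncomputable def lineBump : ContDiffBump (0 : ℝ) := ⟨1, 2, one_pos, one_lt_two⟩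

/-- Dilated smooth cutoffs on the line. -/
noncomputable def lineCut (N : ℕ) (t : ℝ) : ℝ := lineBump (t / (N + 1))

lemma contDiff_lineCut (N : ℕ) : ContDiff ℝ (⊤ : ℕ∞) (lineCut N) :=
  lineBump.contDiff.comp (contDiff_id.div_const _)

lemma hasCompactSupport_lineCut (N : ℕ) : HasCompactSupport (lineCut N) := by
  have h : HasCompactSupport (lineBump : ℝ → ℝ) := lineBump.hasCompactSupport
  have hN : ((N : ℝ) + 1)⁻¹ ≠ 0 := by positivity
  have := h.comp_homeomorph (Homeomorph.mulRight₀ _ hN)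
  refine (this : _)

lemma lineCut_nonneg (N : ℕ) (t : ℝ) : 0 ≤ lineCut N t := lineBump.nonneg

lemma lineCut_le_one (N : ℕ) (t : ℝ) : lineCut N t ≤ 1 := lineBump.le_one

lemma lineCut_sq_le (N : ℕ) (t : ℝ) : lineCut N t ^ 2 ≤ 1 :=
  pow_le_one₀ (lineCut_nonneg N t) (lineCut_le_one N t)

lemma tendsto_lineCut (t : ℝ) : Tendsto (fun N => lineCut N t) atTop (nhds 1) := by
  refine tendsto_const_nhds.congr' ?_
  obtain ⟨M, hM⟩ := exists_nat_ge |t|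
  filter_upwards [eventually_ge_atTop M] with N hN
  refine (lineBump.one_of_mem_closedBall ?_).symm
  rw [mem_closedBall_zero_iff, Real.norm_eq_abs, abs_div, abs_of_pos (by positivity : (0:ℝ) < N + 1)]
  have : (M : ℝ) ≤ N := by exact_mod_cast hN
  show _ ≤ (1 : ℝ)
  rw [div_le_one (by positivity)]
  linarith

lemma deriv_lineCut (N : ℕ) (t : ℝ) :
    deriv (lineCut N) t = deriv lineBump (t / (N + 1)) / (N + 1) := by
  have h : HasDerivAt (lineBump : ℝ → ℝ) (deriv lineBump (t / (N + 1))) (t / (N + 1)) :=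
    ((lineBump.contDiff (n := 1)).differentiable one_ne_zero _).hasDerivAt
  have := (h.comp t ((hasDerivAt_id' t).div_const ((N : ℝ) + 1))).deriv
  rw [mul_one_div] at this
  exact this

lemma IsBoundState.tendsto_cut_deriv {u : ℝ → ℝ} (hu : IsBoundState u) :
    Tendsto (fun N => ∫ t, deriv (lineCut N) t ^ 2 * u t ^ 2) atTop (nhds 0) := by
  obtain ⟨C, hC, hb⟩ := hu.bound
  have hdc : Continuous (deriv lineBump) := (lineBump.contDiff (n := 1)).continuous_deriv le_rfl
  have hds : HasCompactSupport (deriv lineBump) := lineBump.hasCompactSupport.deriv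
  set J := ∫ t, deriv lineBump t ^ 2 with hJ
  have hJi : Integrable fun t => deriv lineBump t ^ 2 := by
    have := (hdc.mul hdc).integrable_of_hasCompactSupport (μ := volume)
      (hds.mul_left (f := deriv lineBump))
    exact this.congr (Eventually.of_forall fun t => by simp [sq])
  have hlim : Tendsto (fun N : ℕ => C ^ 2 * J * (1 / ((N : ℝ) + 1))) atTop (nhds 0) := by
    simpa using tendsto_one_div_add_atTop_nhds_zero_nat.const_mul (C ^ 2 * J)
  refine squeeze_zero (fun N => integral_nonneg fun t => by positivity) (fun N => ?_) hlim
  have hN : (0 : ℝ) < N + 1 := by positivity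
  have e : ∫ t, C ^ 2 / ((N : ℝ) + 1) ^ 2 * deriv lineBump (t / (N + 1)) ^ 2 =
      C ^ 2 * J * (1 / ((N : ℝ) + 1)) := by
    rw [integral_const_mul,
      Measure.integral_comp_div (fun t => deriv lineBump t ^ 2) ((N : ℝ) + 1), abs_of_pos hN, smul_eq_mul, ← hJ]
    field_simp
  rw [← e]
  refine integral_mono_of_nonneg (Eventually.of_forall fun t => by positivity)
    ((hJi.comp_div hN.ne').const_mul _) (Eventually.of_forall fun t => ?_)
  simp only
  rw [deriv_lineCut, div_pow, div_mul_eq_mul_div, div_mul_eq_mul_div]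
  have h2 : u t ^ 2 ≤ C ^ 2 := by
    rw [← sq_abs]
    exact pow_le_pow_left₀ (abs_nonneg _) (hb t).1 2
  gcongr ?_ / _
  rw [mul_comm]
  gcongr

lemma IsBoundState.tendsto_cut_norm {u : ℝ → ℝ} (hu : IsBoundState u)
    (h1 : ∫ t, exp (2 * t) * (u t * u t) = 1) :
    Tendsto (fun N => ∫ t, exp (2 * t) * (lineCut N t * u t) ^ 2) atTop (nhds 1) := by
  rw [← h1]
  have c := hu.continuous
  refine tendsto_integral_of_dominated_convergence (fun t => exp (2 * t) * (u t * u t))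
    (fun N => ?_) (hu.integrable_exp_mul_mul hu) (fun N => Eventually.of_forall fun t => ?_)
    (Eventually.of_forall fun t => ?_)
  · have := (contDiff_lineCut N).continuous
    fun_prop
  · rw [Real.norm_of_nonneg (by positivity), mul_pow, ← sq]
    have := lineCut_sq_le N t
    gcongr
    nlinarith [sq_nonneg (u t)]
  · have := (((tendsto_lineCut t).mul_const (u t)).pow 2).const_mul (exp (2 * t))
    refine this.congr_lim ?_
    ring

lemma tendsto_sum_qForm_cut {κ h : ℝ} (hh : 0 < h) {n : ℕ} {m : ℤ} {u : ℝ → ℝ} (q : ℝ)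
    (hu : IsBoundState u)
    (hode : ∀ t, HasDerivAt (deriv u) (((m.natAbs : ℝ) ^ 2 - κ / h ^ 2 * exp t +
      (κ / h ^ 2 / (2 * n + 1)) ^ 2 * exp (2 * t)) * u t) t)
    (h1 : ∫ t, exp (2 * t) * (u t * u t) = 1) :
    Tendsto (fun N => ∑ s, qForm h (hydPot κ 0 q) (polarFun (fun t => lineCut N t * u t) s m))
      atTop (nhds (-(κ ^ 2 / ((2 * n + 1) * h) ^ 2 - κ))) := by
  have e : ∀ N, ∑ s, qForm h (hydPot κ 0 q) (polarFun (fun t => lineCut N t * u t) s m) =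
      h ^ 2 * (∫ t, deriv (lineCut N) t ^ 2 * u t ^ 2) -
      (κ ^ 2 / ((2 * n + 1) * h) ^ 2 - κ) * ∫ t, exp (2 * t) * (lineCut N t * u t) ^ 2 := by
    intro N
    have hs := (contDiff_lineCut N).mul hu.smooth
    have hcs : HasCompactSupport (fun t => lineCut N t * u t) :=
      (hasCompactSupport_lineCut N).mul_right
    have hr : IsRad (fun t => lineCut N t * u t) := ⟨hs.of_le (by simp), hcs⟩
    have he := hu.energy hode (contDiff_lineCut N) (hasCompactSupport_lineCut N)
    rw [sum_qForm_polarFun hs hcs]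
    have hm : (m : ℝ) ^ 2 = (m.natAbs : ℝ) ^ 2 := by
      rw [Nat.cast_natAbs, Int.cast_abs, sq_abs]
    have hc : κ ^ 2 / ((2 * n + 1) * h) ^ 2 = h ^ 2 * (κ / h ^ 2 / (2 * n + 1)) ^ 2 := by
      field_simp
    have e1 : ∀ t, h ^ 2 * (deriv (fun t => lineCut N t * u t) t ^ 2 +
        (m : ℝ) ^ 2 * (lineCut N t * u t) ^ 2) -
        exp (2 * t) * (κ * (exp (-t) - 1)) * (lineCut N t * u t) ^ 2 =
        h ^ 2 * (deriv (fun t => lineCut N t * u t) t ^ 2 +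
          ((m.natAbs : ℝ) ^ 2 - κ / h ^ 2 * exp t) * (lineCut N t * u t) ^ 2) +
        κ * (exp (2 * t) * (lineCut N t * u t) ^ 2) := by
      intro t
      have a1 : exp (2 * t) * exp (-t) = exp t := by rw [← Real.exp_add]; ring_nf
      have a2 : h ^ 2 * (κ / h ^ 2) = κ := by field_simp
      rw [hm]
      linear_combination (-κ * (lineCut N t * u t) ^ 2) * a1 +
        exp t * (lineCut N t * u t) ^ 2 * a2
    simp only [e1]
    rw [integral_add, integral_const_mul, integral_const_mul, he, hc]
    · ring
    · refine (hr.integrable_deriv_sq.add (hr.integrable_mul_sq ?_)).const_mul _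
      fun_prop
    · exact (hr.integrable_mul_sq (by fun_prop)).const_mul _
  simp only [e]
  refine ((hu.tendsto_cut_deriv.const_mul (h ^ 2)).sub
    ((hu.tendsto_cut_norm h1).const_mul _)).congr_lim ?_
  ring

lemma SubON.radial_eigen {K : ℕ} {l : ℕ} {g : ℝ} (hg : 0 < g) {u : ℕ → ℝ → ℝ}
    (hb : ∀ n, IsBoundState (u n))
    (hu : ∀ n, l ≤ n → (∀ t, HasDerivAt (deriv (u n))
        (((l : ℝ) ^ 2 - g * exp t + (g / (2 * n + 1)) ^ 2 * exp (2 * t)) * u n t) t) ∧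
      ∫ t, exp (2 * t) * (u n t * u n t) = 1)
    (h0 : ∀ n, n < l → u n = fun _ => 0) :
    SubON volume (fun (i : Fin K) t => exp t * u i t) := by
  intro c
  have hi : ∀ i j : Fin K, Integrable fun t => c i * c j * (exp (2 * t) * (u i t * u j t)) :=
    fun i j => ((hb i).integrable_exp_mul_mul (hb j)).const_mul _
  have e : ∀ t, (∑ i : Fin K, c i * (exp t * u i t)) ^ 2 =
      ∑ i, ∑ j, c i * c j * (exp (2 * t) * (u i t * u j t)) := by
    intro t
    have e2 : exp (2 * t) = exp t * exp t := by rw [← Real.exp_add]; ring_nf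
    rw [sq, Finset.sum_mul_sum, e2]
    exact Finset.sum_congr rfl fun i _ => Finset.sum_congr rfl fun j _ => by ring
  simp only [e]
  rw [integral_finsetSum _ fun i _ => integrable_finsetSum _ fun j _ => hi i j]
  refine Finset.sum_le_sum fun i _ => ?_
  rw [integral_finsetSum _ fun j _ => hi i j]
  have hne : ∀ j : Fin K, j ≠ i → ∫ t, c i * c j * (exp (2 * t) * (u i t * u j t)) = 0 := by
    intro j hj
    rw [integral_const_mul]
    refine mul_eq_zero_of_right _ ?_
    by_cases hli : (i : ℕ) < l
    · simp [h0 _ hli]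
    by_cases hlj : (j : ℕ) < l
    · simp [h0 _ hlj]
    refine (hb i).orthogonal (hb j) (q := fun t => (l : ℝ) ^ 2 - g * exp t)
      (hu i (not_lt.1 hli)).1 (hu j (not_lt.1 hlj)).1 ?_
    intro hEq
    refine hj (Fin.ext ?_)
    have h1 := (sq_eq_sq₀ (by positivity) (by positivity)).1 hEq
    rw [div_eq_div_iff (by positivity) (by positivity)] at h1
    have h2 := mul_left_cancel₀ hg.ne' h1
    have h3 : (j : ℝ) = (i : ℕ) := by linarith
    exact_mod_cast h3
  rw [Finset.sum_eq_single i (fun j _ hj => hne j hj) (by simp), integral_const_mul]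
  by_cases hli : (i : ℕ) < l
  · simp [h0 _ hli, sq_nonneg]
  · rw [(hu i (not_lt.1 hli)).2]
    exact le_of_eq (by ring)

/-- Trial families for the shifted Coulomb potential. -/
theorem exists_hyd_trial {κ : ℝ} (hκ : 0 < κ) {ε : ℝ} (hε : 0 < ε) (q : ℝ) :
    ∀ᶠ h in nhdsWithin (0 : ℝ) (Set.Ioi 0), ∃ (ι : Type) (_ : Fintype ι) (f : ι → Plane → ℝ),
      (∀ i, IsTest (f i)) ∧ SubON volume f ∧
      h ^ 2 * ∑ i, qForm h (hydPot κ 0 q) (f i) ≤ coulombTerm κ h + ε := by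
  have hlim := (tendsto_hyd_sum hκ).eventually (lt_mem_nhds (show -(ε / 2) < 0 by linarith))
  filter_upwards [hlim, self_mem_nhdsWithin] with h hlim hh
  have hh : 0 < h := hh
  set K := hydCount κ h with hK
  have hg : 0 < κ / h ^ 2 := by positivity
  have hex : ∀ l n : ℕ, ∃ u : ℝ → ℝ, IsBoundState u ∧ (l ≤ n → (∀ t, HasDerivAt (deriv u)
        (((l : ℝ) ^ 2 - κ / h ^ 2 * exp t +
          (κ / h ^ 2 / (2 * n + 1)) ^ 2 * exp (2 * t)) * u t) t) ∧
      ∫ t, exp (2 * t) * (u t * u t) = 1) ∧ (n < l → u = fun _ => 0) := by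
    intro l n
    rcases le_or_gt l n with hl | hl
    · obtain ⟨u, h1, h2, h3⟩ := exists_radial_eigenfunction hg hl
      exact ⟨u, h1, fun _ => ⟨h2, h3⟩, fun h => absurd hl (not_le.2 h)⟩
    · refine ⟨fun _ => 0, ?_, fun h => absurd hl (not_lt.2 h), fun _ => rfl⟩
      simpa using (isBoundState_expFun one_pos 0).const_mul 0
  choose u hb hu h0 using hex
  set S : Finset ℤ := Finset.Icc (-(K : ℤ)) K with hS
  set ψ : ℕ → Fin K → ℤ → ℝ → ℝ := fun N n m t => lineCut N t * u m.natAbs n t with hψ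
  have hψs : ∀ N n m, ContDiff ℝ (⊤ : ℕ∞) (ψ N n m) := fun N n m =>
    (contDiff_lineCut N).mul (hb _ _).smooth
  have hψc : ∀ N n m, HasCompactSupport (ψ N n m) := fun N n m =>
    (hasCompactSupport_lineCut N).mul_right
  have hsub : ∀ N, SubON volume (fun (p : Fin K × S × Bool) =>
      polarFun (ψ N p.1 p.2.1) p.2.2 p.2.1) := by
    intro N
    refine subON_polarFun S (hψs N) (hψc N) fun m => ?_
    have h1 := (SubON.radial_eigen (K := K) hg (hb m.natAbs) (hu m.natAbs)
      (h0 m.natAbs)).mul_of_sq_le (fun i => ?_) (lineCut N) (lineCut_sq_le N)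
    · have : (fun (i : Fin K) t => exp t * ψ N i m t) =
          fun (i : Fin K) t => lineCut N t * (exp t * u m.natAbs i t) := by
        funext i t; simp only [hψ]; ring
      rw [this]; exact h1
    · have hc := (hb m.natAbs i).continuous
      rw [memLp_two_iff_integrable_sq (by fun_prop)]
      refine ((hb m.natAbs i).integrable_exp_mul_mul (hb m.natAbs i)).congr
        (Eventually.of_forall fun t => ?_)
      have e2 : exp (2 * t) = exp t * exp t := by rw [← Real.exp_add]; ring_nf
      simp only [e2]; ring
  set E : ℕ → ℝ := fun n => -(κ ^ 2 / ((2 * n + 1) * h) ^ 2 - κ) with hE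
  have hterm : ∀ (n : Fin K) (m : S), Tendsto (fun N => ∑ s, qForm h (hydPot κ 0 q)
      (polarFun (ψ N n m) s m)) atTop (nhds (if (m : ℤ).natAbs ≤ n then E n else 0)) := by
    intro n m
    split_ifs with hl
    · obtain ⟨h2, h3⟩ := hu _ _ hl
      exact tendsto_sum_qForm_cut hh q (hb _ _) h2 h3
    · have hz := h0 _ _ (not_le.1 hl)
      have : ∀ N s, polarFun (ψ N n m) s m = fun _ => 0 := by
        intro N s; funext x; simp [polarFun, hψ, hz]
      simp only [this]
      simp [qForm]
  have htot := (tendsto_finsetSum Finset.univ fun (n : Fin K) _ =>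
    tendsto_finsetSum Finset.univ fun (m : S) _ => hterm n m).const_mul (h ^ 2)
  have hval : ∑ n : Fin K, ∑ m : S, (if (m : ℤ).natAbs ≤ n then E n else 0) =
      -∑ n ∈ Finset.range K, (2 * n + 1) * (κ ^ 2 / ((2 * n + 1) * h) ^ 2 - κ) := by
    rw [← Finset.sum_neg_distrib, ← Fin.sum_univ_eq_sum_range
      (fun n : ℕ => -((2 * n + 1) * (κ ^ 2 / ((2 * n + 1) * h) ^ 2 - κ)))]
    refine Finset.sum_congr rfl fun n _ => ?_
    rw [Finset.sum_coe_sort S (fun m : ℤ => if m.natAbs ≤ (n : ℕ) then E n else 0),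
      ← Finset.sum_filter, Finset.sum_const]
    have hf : S.filter (fun m => m.natAbs ≤ (n : ℕ)) = Finset.Icc (-(n : ℤ)) n := by
      ext m
      have := n.2
      simp only [hS, Finset.mem_filter, Finset.mem_Icc]
      omega
    rw [hf, Int.card_Icc, nsmul_eq_mul, hE]
    have : ((((n : ℕ) : ℤ) + 1 - -((n : ℕ) : ℤ)).toNat : ℝ) = 2 * (n : ℕ) + 1 := by
      have : (((n : ℕ) : ℤ) + 1 - -((n : ℕ) : ℤ)).toNat = 2 * (n : ℕ) + 1 := by omega
      rw [this]; push_cast; ring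
    rw [this]; ring
  rw [hval] at htot
  obtain ⟨N, hN⟩ := (htot.eventually (gt_mem_nhds (show _ < coulombTerm κ h + ε by linarith))).exists
  refine ⟨Fin K × S × Bool, inferInstance, _, fun p => isTest_polarFun (hψs N _ _) (hψc N _ _) _ _,
    hsub N, ?_⟩
  refine le_trans (le_of_eq ?_) hN.le
  rw [Fintype.sum_prod_type]
  congr 1
  refine Finset.sum_congr rfl fun n _ => ?_
  rw [Fintype.sum_prod_type]

section

open scoped FourierTransform SchwartzMap LineDeriv

/-- A smooth compactly supported real function as a complex Schwartz function. -/
noncomputable def IsSmoothCpt.schwartz {f : Plane → ℝ} (hf : IsSmoothCpt f) : 𝓢(Plane, ℂ) :=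
  HasCompactSupport.toSchwartzMap (f := fun x => (f x : ℂ))
    (hf.2.comp_left (g := fun y : ℝ => (y : ℂ)) Complex.ofReal_zero)
    (Complex.ofRealCLM.contDiff.comp hf.1)

lemma IsSmoothCpt.schwartz_apply {f : Plane → ℝ} (hf : IsSmoothCpt f) (x : Plane) :
    hf.schwartz x = (f x : ℂ) := rfl

lemma SchwartzMap.integrable_norm_sq (f : 𝓢(Plane, ℂ)) :
    Integrable (fun x => ‖f x‖ ^ 2) volume :=
  (f.memLp 2 volume).integrable_norm_pow (by norm_num)

lemma IsSmoothCpt.integral_norm_sq_fourier {f : Plane → ℝ} (hf : IsSmoothCpt f) :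
    ∫ ξ, ‖𝓕 hf.schwartz ξ‖ ^ 2 = ∫ x, f x ^ 2 := by
  rw [SchwartzMap.integral_norm_sq_fourier]
  simp [hf.schwartz_apply]

lemma IsSmoothCpt.norm_sq_fourier_pd {f : Plane → ℝ} (hf : IsSmoothCpt f) (k : Fin 2)
    (ξ : Plane) :
    ‖𝓕 (hf.pd k).schwartz ξ‖ ^ 2 = 4 * π ^ 2 * ξ k ^ 2 * ‖𝓕 hf.schwartz ξ‖ ^ 2 := by
  have h1 : (hf.pd k).schwartz = ∂_{(EuclideanSpace.single k (1 : ℝ) : Plane)} hf.schwartz := by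
    ext x
    rw [SchwartzMap.lineDerivOp_apply_eq_fderiv, IsSmoothCpt.schwartz_apply]
    have h2 : HasFDerivAt (fun y => (f y : ℂ)) (Complex.ofRealCLM.comp (fderiv ℝ f x)) x :=
      Complex.ofRealCLM.hasFDerivAt.comp x (hf.differentiable x).hasFDerivAt
    have h3 : fderiv ℝ (hf.schwartz : Plane → ℂ) x = Complex.ofRealCLM.comp (fderiv ℝ f x) :=
      h2.fderiv
    rw [h3]; rfl
  have hg : (fun y : Plane => inner ℝ y (EuclideanSpace.single k (1 : ℝ))).HasTemperateGrowth :=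
    ((innerSL ℝ).flip (EuclideanSpace.single k (1 : ℝ) : Plane)).hasTemperateGrowth
  rw [h1, SchwartzMap.fourier_lineDerivOp_eq, _root_.smul_apply,
    SchwartzMap.smulLeftCLM_apply_apply hg, norm_smul, norm_smul]
  simp only [norm_mul, Complex.norm_ofNat, Complex.norm_real, Complex.norm_I, mul_pow,
    EuclideanSpace.inner_single_right]
  simp [sq_abs]
  ring

lemma IsSmoothCpt.integrable_fourier_grad {f : Plane → ℝ} (hf : IsSmoothCpt f) :
    Integrable (fun ξ => 4 * π ^ 2 * ‖ξ‖ ^ 2 * ‖𝓕 hf.schwartz ξ‖ ^ 2) volume ∧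
    ∫ ξ, 4 * π ^ 2 * ‖ξ‖ ^ 2 * ‖𝓕 hf.schwartz ξ‖ ^ 2 = ∫ x, ‖fderiv ℝ f x‖ ^ 2 := by
  have e : ∀ ξ : Plane, 4 * π ^ 2 * ‖ξ‖ ^ 2 * ‖𝓕 hf.schwartz ξ‖ ^ 2 =
      ∑ k, ‖𝓕 (hf.pd k).schwartz ξ‖ ^ 2 := by
    intro ξ
    simp only [hf.norm_sq_fourier_pd, Fin.sum_univ_two]
    rw [EuclideanSpace.norm_sq_eq, Fin.sum_univ_two]
    simp only [Real.norm_eq_abs, sq_abs]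
    ring
  simp only [e, norm_fderiv_sq]
  refine ⟨integrable_finsetSum _ fun k _ => SchwartzMap.integrable_norm_sq _, ?_⟩
  rw [integral_finsetSum _ fun k _ => SchwartzMap.integrable_norm_sq _,
    integral_finsetSum _ fun k _ => (hf.pd k).memLp.integrable_sq]
  exact Finset.sum_congr rfl fun k _ => (hf.pd k).integral_norm_sq_fourier

lemma SubON.bessel_complex {α : Type*} [MeasurableSpace α] {μ : Measure α} {ι : Type*} [Fintype ι]
    {f : ι → α → ℝ} (hf : SubON μ f) (hm : ∀ i, MemLp (f i) 2 μ) {g : α → ℂ} (hg : MemLp g 2 μ) :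
    ∑ i, ‖∫ x, (f i x : ℂ) * g x ∂μ‖ ^ 2 ≤ ∫ x, ‖g x‖ ^ 2 ∂μ := by
  have hr : MemLp (fun x => (g x).re) 2 μ := hg.re
  have hi : MemLp (fun x => (g x).im) 2 μ := hg.im
  have e : ∀ i, ‖∫ x, (f i x : ℂ) * g x ∂μ‖ ^ 2 =
      (∫ x, f i x * (g x).re ∂μ) ^ 2 + (∫ x, f i x * (g x).im ∂μ) ^ 2 := by
    intro i
    have hInt : Integrable (fun x => (f i x : ℂ) * g x) μ :=
      MemLp.integrable_mul (p := 2) (q := 2) ((hm i).ofReal) hg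
    have h1 := integral_re hInt
    have h2 := integral_im hInt
    simp only [RCLike.re_to_complex, RCLike.im_to_complex, Complex.re_ofReal_mul,
      Complex.im_ofReal_mul] at h1 h2
    rw [h1, h2, Complex.sq_norm, Complex.normSq_apply]
    ring
  have e2 : ∫ x, ‖g x‖ ^ 2 ∂μ = ∫ x, (g x).re ^ 2 ∂μ + ∫ x, (g x).im ^ 2 ∂μ := by
    rw [← integral_add hr.integrable_sq hi.integrable_sq]
    refine integral_congr_ae (Eventually.of_forall fun x => ?_)
    simp only [Complex.sq_norm, Complex.normSq_apply]; ring
  simp only [e]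
  rw [Finset.sum_add_distrib, e2]
  exact add_le_add (hf.bessel hm hr) (hf.bessel hm hi)

end

section

open scoped FourierTransform SchwartzMap LineDeriv

lemma integral_phase_space {v h : ℝ} (hv : 0 ≤ v) (hh : 0 < h) :
    ∫ ξ : Plane, max (v - 4 * π ^ 2 * h ^ 2 * ‖ξ‖ ^ 2) 0 = v ^ 2 / (8 * π * h ^ 2) := by
  have h1 := integral_fun_norm_addHaar (volume : Measure Plane)
    (fun r => max (v - 4 * π ^ 2 * h ^ 2 * r ^ 2) 0)
  rw [h1]
  have hball : (volume : Measure Plane).real (Metric.ball 0 1) = π := by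
    rw [Measure.real, EuclideanSpace.volume_ball_fin_two]
    simp [pi_pos.le]
  have hd : Module.finrank ℝ Plane = 2 := by simp
  rw [hd, hball]
  set a := 4 * π ^ 2 * h ^ 2 with ha
  have ha0 : 0 < a := by positivity
  set R := √(v / a) with hR
  have hR0 : 0 ≤ R := sqrt_nonneg _
  have hR2 : a * R ^ 2 = v := by
    rw [hR, sq_sqrt (by positivity)]; field_simp
  have e : ∫ y in Set.Ioi (0 : ℝ), y ^ (2 - 1) • max (v - a * y ^ 2) 0 =
      ∫ y in Set.Ioc 0 R, (v * y - a * y ^ 3) := by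
    rw [← integral_indicator measurableSet_Ioi, ← integral_indicator measurableSet_Ioc]
    refine integral_congr_ae (Eventually.of_forall fun y => ?_)
    simp only [Set.indicator, Set.mem_Ioi, Set.mem_Ioc, smul_eq_mul]
    by_cases hy : 0 < y
    · rw [if_pos hy]
      by_cases hyR : y ≤ R
      · rw [if_pos ⟨hy, hyR⟩, max_eq_left]
        · ring
        · have : a * y ^ 2 ≤ a * R ^ 2 := by gcongr
          linarith
      · rw [if_neg fun h => hyR h.2, max_eq_right]
        · ring
        · have : a * R ^ 2 ≤ a * y ^ 2 := by gcongr; linarith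
          linarith
    · rw [if_neg hy, if_neg fun h => hy h.1]
  rw [e, ← intervalIntegral.integral_of_le hR0]
  rw [intervalIntegral.integral_sub (by apply Continuous.intervalIntegrable; fun_prop)
    (by apply Continuous.intervalIntegrable; fun_prop), intervalIntegral.integral_const_mul,
    intervalIntegral.integral_const_mul, integral_id, integral_pow]
  simp only [nsmul_eq_mul, smul_eq_mul]
  have : R ^ 2 = v / a := by rw [hR, sq_sqrt (by positivity)]
  have h4 : R ^ (3 + 1) = (v / a) ^ 2 := by rw [← this]; ring
  rw [h4, this, ha]
  field_simp
  norm_num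
  ring

lemma integrable_phase_space {v h : ℝ} (hh : 0 < h) :
    Integrable (fun ξ : Plane => max (v - 4 * π ^ 2 * h ^ 2 * ‖ξ‖ ^ 2) 0) volume := by
  refine Continuous.integrable_of_hasCompactSupport (by fun_prop) ?_
  refine HasCompactSupport.intro (isCompact_closedBall (0 : Plane) (√(v / (4 * π ^ 2 * h ^ 2))))
    fun x hx => max_eq_right ?_
  rw [mem_closedBall_zero_iff, not_le] at hx
  have := Real.lt_sq_of_sqrt_lt hx
  rw [div_lt_iff₀ (by positivity)] at this
  nlinarith

lemma berezin_li_yau {ι : Type*} [Fintype ι] {ψ : ι → Plane → ℝ} (hψ : ∀ i, IsSmoothCpt (ψ i))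
    (hs : SubON volume ψ) {η : Plane → ℝ} (hη : IsSmoothCpt η) {v h : ℝ} (hv : 0 ≤ v)
    (hh : 0 < h) :
    -(v ^ 2 / (8 * π * h ^ 2) * ∫ x, η x ^ 2) ≤
      ∑ i, qForm h (fun _ => v) (fun x => η x * ψ i x) := by
  have hf : ∀ i, IsSmoothCpt (fun x => η x * ψ i x) := fun i => (hψ i).mul_left hη.1
  have hq : ∀ i, qForm h (fun _ => v) (fun x => η x * ψ i x) =
      ∫ ξ, (4 * π ^ 2 * h ^ 2 * ‖ξ‖ ^ 2 - v) * ‖𝓕 (hf i).schwartz ξ‖ ^ 2 := by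
    intro i
    obtain ⟨h1, h2⟩ := (hf i).integrable_fourier_grad
    unfold qForm
    rw [integral_sub ((hf i).integrable_grad.const_mul _) ((hf i).memLp.integrable_sq.const_mul _),
      integral_const_mul, integral_const_mul, ← h2, ← (hf i).integral_norm_sq_fourier,
      ← integral_const_mul, ← integral_const_mul, ← integral_sub (h1.const_mul _)
        ((SchwartzMap.integrable_norm_sq _).const_mul _)]
    exact integral_congr_ae (Eventually.of_forall fun ξ => by simp only; ring)
  have hi : ∀ i, Integrable (fun ξ => (4 * π ^ 2 * h ^ 2 * ‖ξ‖ ^ 2 - v) *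
      ‖𝓕 (hf i).schwartz ξ‖ ^ 2) volume := by
    intro i
    refine (((hf i).integrable_fourier_grad.1.const_mul (h ^ 2)).sub
      ((SchwartzMap.integrable_norm_sq (𝓕 (hf i).schwartz)).const_mul v)).congr
      (Eventually.of_forall fun ξ => ?_)
    simp only [Pi.sub_apply]; ring
  have hb : ∀ ξ, ∑ i, ‖𝓕 (hf i).schwartz ξ‖ ^ 2 ≤ ∫ x, η x ^ 2 := by
    intro ξ
    have hg : MemLp (fun x : Plane => Complex.exp (↑(-2 * π * inner ℝ x ξ) * Complex.I) *
        (η x : ℂ)) 2 volume := by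
      refine Continuous.memLp_of_hasCompactSupport (by have := hη.continuous; fun_prop) ?_
      exact HasCompactSupport.mul_left (hη.2.comp_left (g := fun y : ℝ => (y : ℂ))
        Complex.ofReal_zero)
    have hn : ∀ x : Plane, ‖Complex.exp (↑(-2 * π * inner ℝ x ξ) * Complex.I) * (η x : ℂ)‖ ^ 2 =
        η x ^ 2 := by
      intro x
      rw [norm_mul, Complex.norm_exp_ofReal_mul_I]; simp
    have := hs.bessel_complex (fun i => (hψ i).memLp) hg
    simp only [hn] at this
    refine le_trans (le_of_eq (Finset.sum_congr rfl fun i _ => ?_)) this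
    rw [SchwartzMap.fourier_coe, Real.fourier_eq']
    congr 2
    refine integral_congr_ae (Eventually.of_forall fun x => ?_)
    simp only [IsSmoothCpt.schwartz_apply, smul_eq_mul]
    push_cast; ring
  simp only [hq]
  rw [← integral_finsetSum _ fun i _ => hi i, ← integral_phase_space hv hh, ← integral_mul_const,
    ← integral_neg]
  refine integral_mono ((integrable_phase_space hh).mul_const _).neg
    (integrable_finsetSum _ fun i _ => hi i) fun ξ => ?_
  simp only [← Finset.mul_sum]
  have h1 := hb ξ
  have h2 : 0 ≤ ∑ i, ‖𝓕 (hf i).schwartz ξ‖ ^ 2 := Finset.sum_nonneg fun i _ => sq_nonneg _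
  have h3 := le_max_left (v - 4 * π ^ 2 * h ^ 2 * ‖ξ‖ ^ 2) 0
  have h4 := le_max_right (v - 4 * π ^ 2 * h ^ 2 * ‖ξ‖ ^ 2) 0
  nlinarith [mul_le_mul_of_nonneg_right h3 h2, mul_le_mul_of_nonneg_left h1 h4]

end

section

open scoped FourierTransform SchwartzMap LineDeriv

/-- A smooth frequency cutoff at scale `s`. -/
noncomputable def freqCut (s : ℝ) (ξ : Plane) : ℝ :=
  (⟨1, 2, one_pos, one_lt_two⟩ : ContDiffBump (0 : Plane)) (s⁻¹ • ξ)

lemma freqCut_nonneg (s : ℝ) (ξ : Plane) : 0 ≤ freqCut s ξ := ContDiffBump.nonneg _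

lemma freqCut_le_one (s : ℝ) (ξ : Plane) : freqCut s ξ ≤ 1 := ContDiffBump.le_one _

lemma freqCut_eq_one {s : ℝ} (hs : 0 < s) {ξ : Plane} (h : ‖ξ‖ ≤ s) : freqCut s ξ = 1 := by
  refine ContDiffBump.one_of_mem_closedBall _ ?_
  rw [mem_closedBall_zero_iff, norm_smul, norm_inv, Real.norm_of_nonneg hs.le]
  change s⁻¹ * ‖ξ‖ ≤ 1
  rw [inv_mul_le_iff₀ hs]; linarith

lemma isSmoothCpt_freqCut {s : ℝ} (hs : 0 < s) : IsSmoothCpt (freqCut s) := by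
  refine ⟨(ContDiffBump.contDiff _).comp (contDiff_id.const_smul s⁻¹), ?_⟩
  exact (ContDiffBump.hasCompactSupport _).comp_homeomorph (Homeomorph.smulOfNeZero s⁻¹ (by positivity))

lemma integral_freqCut_sq {s : ℝ} (hs : 0 < s) :
    ∫ ξ, freqCut s ξ ^ 2 = s ^ 2 * ∫ ξ, freqCut 1 ξ ^ 2 := by
  have := Measure.integral_comp_inv_smul_of_nonneg (volume : Measure Plane)
    (fun ξ => freqCut 1 ξ ^ 2) hs.le
  rw [show Module.finrank ℝ Plane = 2 by simp, smul_eq_mul] at this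
  rw [← this]
  simp [freqCut]

/-- The low frequency part of a Schwartz function. -/
noncomputable def lowFreq (s : ℝ) (f : 𝓢(Plane, ℂ)) : 𝓢(Plane, ℂ) :=
  𝓕⁻ (SchwartzMap.smulLeftCLM ℂ (freqCut s) (𝓕 f))

lemma integral_norm_sq_sub_lowFreq {s : ℝ} (hs : 0 < s) (f : 𝓢(Plane, ℂ)) :
    ∫ x, ‖f x - lowFreq s f x‖ ^ 2 = ∫ ξ, (1 - freqCut s ξ) ^ 2 * ‖𝓕 f ξ‖ ^ 2 := by
  have h1 := SchwartzMap.integral_norm_sq_fourier (f - lowFreq s f)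
  have hg : (freqCut s).HasTemperateGrowth :=
    (isSmoothCpt_freqCut hs).2.hasTemperateGrowth (isSmoothCpt_freqCut hs).1
  have h2 : ∀ ξ, 𝓕 (f - lowFreq s f) ξ = ((1 - freqCut s ξ : ℝ) : ℂ) * 𝓕 f ξ := by
    intro ξ
    rw [show 𝓕 (f - lowFreq s f) = 𝓕 f - 𝓕 (lowFreq s f) from
      (FourierTransform.fourierCLM ℂ 𝓢(Plane, ℂ)).map_sub f (lowFreq s f), lowFreq,
      FourierTransform.fourier_fourierInv_eq, _root_.sub_apply,
      SchwartzMap.smulLeftCLM_apply_apply hg]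
    simp [sub_mul]
  simp only [h2, norm_mul, mul_pow, Complex.norm_real, Real.norm_eq_abs, sq_abs] at h1
  rw [h1]
  rfl

lemma sum_norm_sq_lowFreq_le {ι : Type*} [Fintype ι] {f : ι → Plane → ℝ}
    (hf : ∀ i, IsSmoothCpt (f i)) (hs : SubON volume f) {s : ℝ} (hs0 : 0 < s) (x : Plane) :
    ∑ i, ‖lowFreq s (hf i).schwartz x‖ ^ 2 ≤ s ^ 2 * ∫ ξ, freqCut 1 ξ ^ 2 := by
  have hm := isSmoothCpt_freqCut hs0
  have hg : (freqCut s).HasTemperateGrowth := hm.2.hasTemperateGrowth hm.1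
  have hE : ContDiff ℝ (⊤ : ℕ∞) (fun ξ : Plane =>
      Complex.exp (↑(2 * π * inner ℝ ξ x) * Complex.I)) :=
    (((Complex.ofRealCLM.contDiff.comp (contDiff_const.mul
      (contDiff_id.inner ℝ contDiff_const))).mul contDiff_const)).cexp
  have hGs : HasCompactSupport (fun ξ : Plane =>
      Complex.exp (↑(2 * π * inner ℝ ξ x) * Complex.I) * (freqCut s ξ : ℂ)) :=
    HasCompactSupport.mul_left (hm.2.comp_left (g := fun y : ℝ => (y : ℂ)) Complex.ofReal_zero)
  set G : 𝓢(Plane, ℂ) := hGs.toSchwartzMap (hE.mul (Complex.ofRealCLM.contDiff.comp hm.1)) with hG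
  have hlow : ∀ i, lowFreq s (hf i).schwartz x = ∫ y, (f i y : ℂ) * 𝓕 G y := by
    intro i
    have h1 := SchwartzMap.integral_fourier_mul_eq (hf i).schwartz G
    rw [show (∫ y, (f i y : ℂ) * 𝓕 G y) = ∫ y, (hf i).schwartz y * 𝓕 G y from rfl, ← h1,
      lowFreq, SchwartzMap.fourierInv_coe, Real.fourierInv_eq']
    refine integral_congr_ae (Eventually.of_forall fun ξ => ?_)
    simp only
    rw [SchwartzMap.smulLeftCLM_apply_apply hg]
    have : G ξ = Complex.exp (↑(2 * π * inner ℝ ξ x) * Complex.I) * (freqCut s ξ : ℂ) := rfl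
    rw [this]
    simp only [smul_eq_mul, Complex.real_smul]
    ring
  simp only [hlow]
  refine (hs.bessel_complex (fun i => (hf i).memLp) ((𝓕 G).memLp 2 volume)).trans (le_of_eq ?_)
  rw [SchwartzMap.integral_norm_sq_fourier, ← integral_freqCut_sq hs0]
  refine integral_congr_ae (Eventually.of_forall fun ξ => ?_)
  have : G ξ = Complex.exp (↑(2 * π * inner ℝ ξ x) * Complex.I) * (freqCut s ξ : ℂ) := rfl
  simp only [this, norm_mul, Complex.norm_exp_ofReal_mul_I]
  simp

lemma tsum_zpow_lt_le {t : ℝ} (ht : 0 ≤ t) :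
    ∑' k : ℤ, ENNReal.ofReal (if (4 : ℝ) ^ k < t then 4 ^ k else 0) ≤ ENNReal.ofReal (4 / 3 * t) := by
  rcases ht.eq_or_lt with rfl | ht
  · have : ∀ k : ℤ, ¬ ((4 : ℝ) ^ k < 0) := fun k => not_lt.2 (by positivity)
    simp [this]
  obtain ⟨n, h1, h2⟩ := exists_mem_Ico_zpow ht (show (1 : ℝ) < 4 by norm_num)
  have hinj : Function.Injective (fun j : ℕ => n - (j : ℤ)) := fun a b h => by
    simpa using h
  have hsupp : Function.support (fun k : ℤ => ENNReal.ofReal (if (4 : ℝ) ^ k < t then 4 ^ k else 0))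
      ⊆ Set.range (fun j : ℕ => n - (j : ℤ)) := by
    intro k hk
    have hk1 : (4 : ℝ) ^ k < t := by
      by_contra hc
      simp [hc] at hk
    have hk2 : k < n + 1 := (zpow_lt_zpow_iff_right₀ (show (1 : ℝ) < 4 by norm_num)).1
      (hk1.trans h2)
    exact ⟨(n - k).toNat, by simp only; omega⟩
  rw [← hinj.tsum_eq hsupp]
  have hgeo : HasSum (fun j : ℕ => (4 : ℝ) ^ n * (1 / 4) ^ j) (4 ^ n * (1 - 1 / 4)⁻¹) :=
    (hasSum_geometric_of_lt_one (by norm_num) (by norm_num)).mul_left _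
  calc _ ≤ ∑' j : ℕ, ENNReal.ofReal ((4 : ℝ) ^ n * (1 / 4) ^ j) := by
        refine ENNReal.tsum_le_tsum fun j => ENNReal.ofReal_le_ofReal ?_
        have : (4 : ℝ) ^ (n - (j : ℤ)) = (4 : ℝ) ^ n * (1 / 4) ^ j := by
          rw [zpow_sub₀ (by norm_num), zpow_natCast, div_eq_mul_inv, one_div, inv_pow]
        rw [this]
        split_ifs
        · exact le_rfl
        · positivity
    _ = ENNReal.ofReal (4 ^ n * (1 - 1 / 4)⁻¹) := by
        rw [← ENNReal.ofReal_tsum_of_nonneg (fun j => by positivity) hgeo.summable, hgeo.tsum_eq]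
    _ ≤ _ := ENNReal.ofReal_le_ofReal (by norm_num; linarith)

/-- The kinetic Lieb–Thirring inequality in the plane. -/
theorem exists_kinetic_bound : ∃ K : ℝ, 0 < K ∧ ∀ (ι : Type) [Fintype ι] (f : ι → Plane → ℝ),
    (∀ i, IsSmoothCpt (f i)) → SubON volume f →
    ∫ x, (∑ i, f i x ^ 2) ^ 2 ≤ K * ∑ i, ∫ x, ‖fderiv ℝ (f i) x‖ ^ 2 := by
  set C : ℝ := (∫ ξ, freqCut 1 ξ ^ 2) + 1 with hC
  have hC0 : 0 ≤ ∫ ξ, freqCut 1 ξ ^ 2 := integral_nonneg fun ξ => sq_nonneg _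
  have hCp : 0 < C := by linarith
  refine ⟨64 * C * (4 / 3) / (4 * π ^ 2), by positivity, fun ι _ f hf hs => ?_⟩
  have hs2 : ∀ k : ℤ, (0 : ℝ) < 2 ^ k := fun k => by positivity
  set H : ℤ → ι → Plane → ℝ := fun k i x =>
    ‖(hf i).schwartz x - lowFreq (2 ^ k) (hf i).schwartz x‖ ^ 2 with hH
  have hHc : ∀ k i, Continuous (H k i) := fun k i =>
    (((hf i).schwartz.continuous.sub (lowFreq (2 ^ k) (hf i).schwartz).continuous).norm.pow 2)
  have hHi : ∀ k i, Integrable (H k i) volume := fun k i =>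
    SchwartzMap.integrable_norm_sq ((hf i).schwartz - lowFreq (2 ^ k) (hf i).schwartz)
  have h4 : ∀ k : ℤ, ((2 : ℝ) ^ k) ^ 2 = 4 ^ k := by
    intro k
    rw [← zpow_natCast, ← zpow_mul, mul_comm, zpow_mul]; norm_num
  have hpt : ∀ x, ENNReal.ofReal ((∑ i, f i x ^ 2) ^ 2) ≤
      ∑' k : ℤ, ENNReal.ofReal (64 * C * 4 ^ k * ∑ i, H k i x) := by
    intro x
    set ρ := ∑ i, f i x ^ 2 with hρ
    have hρ0 : 0 ≤ ρ := Finset.sum_nonneg fun i _ => sq_nonneg _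
    rcases hρ0.eq_or_lt with h0 | hρp
    · rw [← h0]; simp
    obtain ⟨k, h1, h2⟩ := exists_mem_Ico_zpow (show 0 < ρ / (4 * C) by positivity)
      (show (1 : ℝ) < 4 by norm_num)
    refine le_trans (ENNReal.ofReal_le_ofReal ?_) (ENNReal.le_tsum k)
    rw [le_div_iff₀ (by positivity)] at h1
    rw [div_lt_iff₀ (by positivity), zpow_add_one₀ (by norm_num)] at h2
    have hlow := sum_norm_sq_lowFreq_le hf hs (hs2 k) x
    rw [h4] at hlow
    have h4k : (0 : ℝ) < 4 ^ k := by positivity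
    have hlow2 : ∑ i, ‖lowFreq (2 ^ k) (hf i).schwartz x‖ ^ 2 ≤ ρ / 4 := by
      refine hlow.trans ?_
      have : (4 : ℝ) ^ k * ∫ ξ, freqCut 1 ξ ^ 2 ≤ 4 ^ k * C :=
        mul_le_mul_of_nonneg_left (by linarith) h4k.le
      linarith
    have htri : ρ ≤ 2 * ∑ i, ‖lowFreq (2 ^ k) (hf i).schwartz x‖ ^ 2 + 2 * ∑ i, H k i x := by
      rw [hρ, Finset.mul_sum, Finset.mul_sum, ← Finset.sum_add_distrib]
      refine Finset.sum_le_sum fun i _ => ?_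
      have e1 : f i x ^ 2 = ‖(hf i).schwartz x‖ ^ 2 := by simp [IsSmoothCpt.schwartz_apply]
      have e2 : ‖(hf i).schwartz x‖ ≤ ‖lowFreq (2 ^ k) (hf i).schwartz x‖ +
          ‖(hf i).schwartz x - lowFreq (2 ^ k) (hf i).schwartz x‖ := by
        have := norm_add_le (lowFreq (2 ^ k) (hf i).schwartz x)
          ((hf i).schwartz x - lowFreq (2 ^ k) (hf i).schwartz x)
        simpa using this
      simp only [hH]
      rw [e1]
      have := norm_nonneg ((hf i).schwartz x)
      nlinarith [sq_nonneg (‖lowFreq (2 ^ k) (hf i).schwartz x‖ -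
        ‖(hf i).schwartz x - lowFreq (2 ^ k) (hf i).schwartz x‖)]
    have hHρ : ρ / 4 ≤ ∑ i, H k i x := by linarith
    have : ρ * ρ ≤ (4 ^ k * 4 * (4 * C)) * (4 * ∑ i, H k i x) :=
      mul_le_mul h2.le (by linarith) hρ0 (by positivity)
    linarith
  have hmeas : ∀ k : ℤ, AEMeasurable (fun x => ENNReal.ofReal (64 * C * 4 ^ k * ∑ i, H k i x))
      volume := fun k => (Continuous.measurable (by
        have := hHc k; fun_prop)).ennreal_ofReal.aemeasurable
  have hkin : ∀ i, ∑' k : ℤ, ENNReal.ofReal (4 ^ k * ∫ x, H k i x) ≤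
      ENNReal.ofReal (4 / 3 / (4 * π ^ 2) * ∫ x, ‖fderiv ℝ (f i) x‖ ^ 2) := by
    intro i
    obtain ⟨h1, h2⟩ := (hf i).integrable_fourier_grad
    set F := 𝓕 (hf i).schwartz with hF
    have hFi := SchwartzMap.integrable_norm_sq F
    have hk : ∀ k : ℤ, ENNReal.ofReal (4 ^ k * ∫ x, H k i x) ≤
        ∫⁻ ξ, ENNReal.ofReal (if (4 : ℝ) ^ k < ‖ξ‖ ^ 2 then 4 ^ k else 0) *
          ENNReal.ofReal (‖F ξ‖ ^ 2) := by
      intro k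
      have e : ∫ x, H k i x = ∫ ξ, (1 - freqCut (2 ^ k) ξ) ^ 2 * ‖F ξ‖ ^ 2 :=
        integral_norm_sq_sub_lowFreq (hs2 k) _
      have hb : ∀ ξ, (1 - freqCut (2 ^ k) ξ) ^ 2 ≤ 1 := fun ξ => by
        have := freqCut_nonneg (2 ^ k) ξ
        have := freqCut_le_one (2 ^ k) ξ
        nlinarith
      have hc : Continuous (freqCut (2 ^ k)) := (isSmoothCpt_freqCut (hs2 k)).continuous
      have hInt : Integrable (fun ξ => (4 : ℝ) ^ k * ((1 - freqCut (2 ^ k) ξ) ^ 2 * ‖F ξ‖ ^ 2))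
          volume := by
        refine Integrable.const_mul (hFi.mono' ?_ (Eventually.of_forall fun ξ => ?_)) _
        · have := F.continuous
          exact (Continuous.aestronglyMeasurable (by fun_prop))
        · rw [Real.norm_of_nonneg (by positivity)]
          exact mul_le_of_le_one_left (by positivity) (hb ξ)
      rw [e, ← integral_const_mul, ofReal_integral_eq_lintegral_ofReal hInt
        (Eventually.of_forall fun ξ => by simp only [Pi.zero_apply]; positivity)]
      refine lintegral_mono fun ξ => ?_
      rw [← ENNReal.ofReal_mul (by split_ifs <;> positivity)]
      refine ENNReal.ofReal_le_ofReal ?_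
      split_ifs with hlt
      · exact mul_le_mul_of_nonneg_left (mul_le_of_le_one_left (by positivity) (hb ξ))
          (by positivity)
      · rw [not_lt, ← h4] at hlt
        rw [freqCut_eq_one (hs2 k) ((sq_le_sq₀ (norm_nonneg _) (hs2 k).le).1 hlt)]
        simp
    calc _ ≤ ∑' k : ℤ, ∫⁻ ξ, ENNReal.ofReal (if (4 : ℝ) ^ k < ‖ξ‖ ^ 2 then 4 ^ k else 0) *
          ENNReal.ofReal (‖F ξ‖ ^ 2) := ENNReal.tsum_le_tsum hk
      _ = ∫⁻ ξ, ∑' k : ℤ, ENNReal.ofReal (if (4 : ℝ) ^ k < ‖ξ‖ ^ 2 then 4 ^ k else 0) *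
          ENNReal.ofReal (‖F ξ‖ ^ 2) := by
        rw [lintegral_tsum]
        intro k
        have m1 : Measurable fun ξ : Plane =>
            ENNReal.ofReal (if (4 : ℝ) ^ k < ‖ξ‖ ^ 2 then 4 ^ k else 0) :=
          (Measurable.ite (measurableSet_lt measurable_const (measurable_norm.pow_const 2))
            measurable_const measurable_const).ennreal_ofReal
        exact (m1.mul (F.continuous.norm.pow 2).measurable.ennreal_ofReal).aemeasurable
      _ ≤ ∫⁻ ξ, ENNReal.ofReal (4 / 3 / (4 * π ^ 2) * (4 * π ^ 2 * ‖ξ‖ ^ 2 * ‖F ξ‖ ^ 2)) := by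
        refine lintegral_mono fun ξ => ?_
        simp only
        rw [ENNReal.tsum_mul_right]
        refine (mul_le_mul_left (tsum_zpow_lt_le (sq_nonneg ‖ξ‖)) _).trans ?_
        rw [← ENNReal.ofReal_mul (by positivity)]
        refine ENNReal.ofReal_le_ofReal (le_of_eq ?_)
        field_simp
      _ = _ := by
        rw [← ofReal_integral_eq_lintegral_ofReal (h1.const_mul _)
          (Eventually.of_forall fun ξ => by simp only [Pi.zero_apply]; positivity),
          integral_const_mul, h2]
  have hg0 : ∀ i, 0 ≤ ∫ x, ‖fderiv ℝ (f i) x‖ ^ 2 := fun i => integral_nonneg fun x => sq_nonneg _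
  have hρi : Integrable (fun x => (∑ i, f i x ^ 2) ^ 2) (volume : Measure Plane) := by
    refine Continuous.integrable_of_hasCompactSupport (by
      have := fun i => (hf i).continuous; fun_prop) ?_
    have : HasCompactSupport fun x => ∑ i, f i x ^ 2 :=
      hasCompactSupport_finsetSum _ fun i => by
        simp only [sq]; exact (hf i).2.mul_left
    simp only [sq] at this ⊢
    exact this.mul_left
  have hfin : ENNReal.ofReal (∫ x, (∑ i, f i x ^ 2) ^ 2) ≤
      ENNReal.ofReal (64 * C * (4 / 3) / (4 * π ^ 2) * ∑ i, ∫ x, ‖fderiv ℝ (f i) x‖ ^ 2) := by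
    calc _ = ∫⁻ x, ENNReal.ofReal ((∑ i, f i x ^ 2) ^ 2) :=
          ofReal_integral_eq_lintegral_ofReal hρi (Eventually.of_forall fun x => sq_nonneg _)
      _ ≤ ∫⁻ x, ∑' k : ℤ, ENNReal.ofReal (64 * C * 4 ^ k * ∑ i, H k i x) := lintegral_mono hpt
      _ = ∑' k : ℤ, ∫⁻ x, ENNReal.ofReal (64 * C * 4 ^ k * ∑ i, H k i x) := lintegral_tsum hmeas
      _ = ∑' k : ℤ, ∑ i, ENNReal.ofReal (64 * C) * ENNReal.ofReal (4 ^ k * ∫ x, H k i x) := by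
          refine tsum_congr fun k => ?_
          have hH0 : ∀ i, 0 ≤ ∫ x, H k i x := fun i => integral_nonneg fun x => sq_nonneg _
          rw [← ofReal_integral_eq_lintegral_ofReal
            ((integrable_finsetSum _ fun i _ => hHi k i).const_mul _)
            (Eventually.of_forall fun x => by simp only [Pi.zero_apply, hH]; positivity),
            integral_const_mul, integral_finsetSum _ fun i _ => hHi k i, ← Finset.mul_sum,
            ← ENNReal.ofReal_sum_of_nonneg fun i _ => by have := hH0 i; positivity,
            ← ENNReal.ofReal_mul (by positivity), ← Finset.mul_sum, mul_assoc]
      _ = ∑ i, ENNReal.ofReal (64 * C) * ∑' k : ℤ, ENNReal.ofReal (4 ^ k * ∫ x, H k i x) := by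
          rw [Summable.tsum_finsetSum fun i _ => ENNReal.summable]
          exact Finset.sum_congr rfl fun i _ => ENNReal.tsum_mul_left
      _ ≤ ∑ i, ENNReal.ofReal (64 * C) *
          ENNReal.ofReal (4 / 3 / (4 * π ^ 2) * ∫ x, ‖fderiv ℝ (f i) x‖ ^ 2) :=
          Finset.sum_le_sum fun i _ => mul_le_mul_right (hkin i) _
      _ = _ := by
          rw [← Finset.mul_sum, ← ENNReal.ofReal_sum_of_nonneg fun i _ => by
            have := hg0 i; positivity, ← ENNReal.ofReal_mul (by positivity), ← Finset.mul_sum]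
          congr 1; ring
  exact (ENNReal.ofReal_le_ofReal_iff (by
    have := Finset.sum_nonneg fun i (_ : i ∈ Finset.univ) => hg0 i
    positivity)).1 hfin

/-- The Lieb–Thirring inequality in the plane. -/
theorem exists_lieb_thirring : ∃ K : ℝ, 0 < K ∧ ∀ (ι : Type) [Fintype ι] (f : ι → Plane → ℝ),
    (∀ i, IsSmoothCpt (f i)) → SubON volume f → ∀ (a : ℝ), 0 < a → ∀ w : Plane → ℝ,
    MemLp w 2 volume →
    -(K / a * ∫ x, w x ^ 2) ≤
      a * ∑ i, (∫ x, ‖fderiv ℝ (f i) x‖ ^ 2) - ∫ x, w x * ∑ i, f i x ^ 2 := by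
  obtain ⟨K, hK, h⟩ := exists_kinetic_bound
  refine ⟨K, hK, fun ι _ f hf hs a ha w hw => ?_⟩
  have h1 := h ι f hf hs
  have hρ : MemLp (fun x => ∑ i, f i x ^ 2) 2 (volume : Measure Plane) := by
    refine Continuous.memLp_of_hasCompactSupport (by
      have := fun i => (hf i).continuous; fun_prop) ?_
    exact hasCompactSupport_finsetSum _ fun i => by
        simp only [sq]; exact (hf i).2.mul_left
  have h2 : ∫ x, w x * ∑ i, f i x ^ 2 ≤
      a / K * (∫ x, (∑ i, f i x ^ 2) ^ 2) + K / a * ∫ x, w x ^ 2 := by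
    rw [← integral_const_mul, ← integral_const_mul,
      ← integral_add (hρ.integrable_sq.const_mul _) (hw.integrable_sq.const_mul _)]
    refine integral_mono (hw.integrable_mul hρ)
      ((hρ.integrable_sq.const_mul _).add (hw.integrable_sq.const_mul _)) fun x => ?_
    simp only
    set r := ∑ i, f i x ^ 2
    have e : a / K * r ^ 2 + K / a * w x ^ 2 - w x * r =
        (a * K)⁻¹ * ((a * r - K * w x / 2) ^ 2 + 3 / 4 * (K * w x) ^ 2) := by
      field_simp; ring
    have : 0 ≤ (a * K)⁻¹ * ((a * r - K * w x / 2) ^ 2 + 3 / 4 * (K * w x) ^ 2) := by positivity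
    linarith
  have h3 : a / K * ∫ x, (∑ i, f i x ^ 2) ^ 2 ≤
      a * ∑ i, (∫ x, ‖fderiv ℝ (f i) x‖ ^ 2) := by
    refine (mul_le_mul_of_nonneg_left h1 (by positivity)).trans (le_of_eq ?_)
    field_simp
  linarith

end

/-- A finite quadratic partition of unity whose bounded cells are small; the cell `none` lies
outside a prescribed ball. -/
lemma exists_fine_partition {R d : ℝ} (hR : 0 < R) (hd : 0 < d) (hd1 : d ≤ 1) :
    ∃ (A : Type) (_ : Fintype A) (ζ : Option A → Plane → ℝ),
      (∀ a, ContDiff ℝ (⊤ : ℕ∞) (ζ a)) ∧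
      (∀ a x, ζ (some a) x ≠ 0 → ‖x‖ ≤ R + 2) ∧
      (∀ a x y, ζ (some a) x ≠ 0 → ζ (some a) y ≠ 0 → dist x y < d) ∧
      (∀ x, ‖x‖ ≤ R → ζ none x = 0) ∧ (∀ x, ∑ a, ζ a x ^ 2 = 1) ∧
      (∀ a, HasCompactSupport (fderiv ℝ (ζ a))) := by
  obtain ⟨t, ht, htf, hcov⟩ := (isCompact_closedBall (0 : Plane) (R + 1)).finite_cover_balls
    (show 0 < d / 4 by positivity)
  have := htf.fintype
  set b : Option t → Plane → ℝ := fun a => a.elim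
    (fun x => 1 - (⟨R, R + 1, hR, by linarith⟩ : ContDiffBump (0 : Plane)) x)
    (fun c => (⟨d / 4, d / 2, by positivity, by linarith⟩ : ContDiffBump (c : Plane))) with hb
  have hbs : ∀ a, ContDiff ℝ (⊤ : ℕ∞) (b a) := by
    rintro (_ | c)
    · exact contDiff_const.sub (ContDiffBump.contDiff _)
    · exact ContDiffBump.contDiff _
  have hsome : ∀ (c : t) x, b (some c) x ≠ 0 → dist x c < d / 2 := by
    intro c x hx
    by_contra h
    exact hx (ContDiffBump.zero_of_le_dist _ (not_lt.1 h))
  have hnone : ∀ x, R + 1 ≤ ‖x‖ → b none x = 1 := by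
    intro x hx
    have : (⟨R, R + 1, hR, by linarith⟩ : ContDiffBump (0 : Plane)) x = 0 :=
      ContDiffBump.zero_of_le_dist _ (by simpa using hx)
    simp [hb, this]
  have hnone0 : ∀ x, ‖x‖ ≤ R → b none x = 0 := by
    intro x hx
    have : (⟨R, R + 1, hR, by linarith⟩ : ContDiffBump (0 : Plane)) x = 1 :=
      ContDiffBump.one_of_mem_closedBall _ (by simpa using hx)
    simp [hb, this]
  set s : Plane → ℝ := fun x => ∑ a, b a x ^ 2 with hs
  have hspos : ∀ x, 0 < s x := by
    intro x
    rcases le_or_gt ‖x‖ (R + 1) with hx | hx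
    · have hx' : x ∈ Metric.closedBall (0 : Plane) (R + 1) := by simpa using hx
      obtain ⟨c, hc, hxc⟩ := Set.mem_iUnion₂.1 (hcov hx')
      have h1 : b (some ⟨c, hc⟩) x = 1 :=
        ContDiffBump.one_of_mem_closedBall _ (Metric.ball_subset_closedBall hxc)
      refine Finset.sum_pos' (fun a _ => sq_nonneg _) ⟨some ⟨c, hc⟩, Finset.mem_univ _, ?_⟩
      rw [h1]; norm_num
    · refine Finset.sum_pos' (fun a _ => sq_nonneg _) ⟨none, Finset.mem_univ _, ?_⟩
      rw [hnone x hx.le]; norm_num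
  have hss : ContDiff ℝ (⊤ : ℕ∞) s := ContDiff.sum fun a _ => (hbs a).pow 2
  have hnorm : ∀ (c : t) x, b (some c) x ≠ 0 → ‖x‖ ≤ R + 2 := by
    intro c x hx
    have h1 := hsome c x hx
    have h2 : ‖(c : Plane)‖ ≤ R + 1 := by simpa using ht c.2
    have h3 : ‖x‖ ≤ ‖(c : Plane)‖ + dist x c := by
      rw [dist_eq_norm]
      calc ‖x‖ = ‖(c : Plane) + (x - c)‖ := by simp
        _ ≤ _ := norm_add_le _ _
    linarith
  refine ⟨t, inferInstance, fun a x => b a x / √(s x), fun a => ?_, fun c x hx => ?_,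
    fun c x y hx hy => ?_, fun x hx => ?_, fun x => ?_, fun a => ?_⟩
  · exact (hbs a).div (hss.sqrt fun x => (hspos x).ne') fun x => (sqrt_pos.2 (hspos x)).ne'
  · exact hnorm c x fun h => hx (by simp [h])
  · have h1 := hsome c x fun h => hx (by simp [h])
    have h2 := hsome c y fun h => hy (by simp [h])
    have := dist_triangle_right x y (c : Plane)
    linarith
  · simp [hnone0 x hx]
  · simp only [div_pow, sq_sqrt (hspos x).le]
    rw [← Finset.sum_div]
    exact div_self (hspos x).ne'
  · refine HasCompactSupport.intro (isCompact_closedBall (0 : Plane) (R + 2)) fun x hx => ?_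
    rw [mem_closedBall_zero_iff, not_le] at hx
    have hev : ∀ᶠ y in nhds x, R + 2 < ‖y‖ := continuous_norm.continuousAt.eventually (lt_mem_nhds hx)
    have hz : ∀ y, R + 2 < ‖y‖ → ∀ c : t, b (some c) y = 0 := fun y hy c => by
      by_contra h
      exact absurd (hnorm c y h) (not_le.2 hy)
    have hs1 : ∀ y, R + 2 < ‖y‖ → s y = 1 := by
      intro y hy
      simp only [hs, Fintype.sum_option, hz y hy, hnone y (by linarith)]
      simp
    have hconst : (fun y => b a y / √(s y)) =ᶠ[nhds x] fun _ => a.elim 1 fun _ => 0 := by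
      filter_upwards [hev] with y hy
      rcases a with _ | c
      · simp [hs1 y hy, hnone y (by linarith)]
      · simp [hz y hy]
    rw [hconst.fderiv_eq]
    simp

/-- Approximation of a square integrable function by constants on the cells of a partition. -/
lemma exists_step_partition {P : Plane → ℝ} (hP : MemLp P 2 volume) (hPm : Measurable P)
    (hP0 : ∀ x, 0 ≤ P x)
    (R₀ : ℝ) {ε : ℝ} (hε : 0 < ε) :
    ∃ (A : Type) (_ : Fintype A) (ζ : Option A → Plane → ℝ) (v : Option A → ℝ) (w : Plane → ℝ),
      (∀ a, ContDiff ℝ (⊤ : ℕ∞) (ζ a)) ∧ (∀ a, HasCompactSupport (ζ (some a))) ∧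
      (∀ x, ‖x‖ ≤ R₀ → ζ none x = 0) ∧ (∀ x, ∑ a, ζ a x ^ 2 = 1) ∧
      (∀ a, HasCompactSupport (fderiv ℝ (ζ a))) ∧ (∀ a, 0 ≤ v a) ∧ v none = 0 ∧
      MemLp w 2 volume ∧ Measurable w ∧ ∫ x, w x ^ 2 ≤ ε ∧ ∀ a x, ζ a x ≠ 0 → |P x - v a| ≤ w x := by
  obtain ⟨g, hgs, hgi, hgc, hgm⟩ := MemLp.exists_hasCompactSupport_integral_rpow_sub_le
    (p := 2) (by norm_num) (show MemLp P (ENNReal.ofReal 2) volume by simpa using hP)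
    (ε := ε / 4) (by positivity)
  have hgm' : MemLp g 2 volume := by simpa using hgm
  have hdi : Integrable (fun x => (P x - g x) ^ 2) volume := (hP.sub hgm').integrable_sq
  have hgi' : ∫ x, (P x - g x) ^ 2 ≤ ε / 4 := by
    refine le_trans (le_of_eq ?_) hgi
    refine integral_congr_ae (ae_of_all _ fun x => ?_)
    simp only [norm_eq_abs]
    rw [show (2 : ℝ) = ((2 : ℕ) : ℝ) by norm_num, rpow_natCast, sq_abs]
  obtain ⟨R, hR, hRR, hRg⟩ : ∃ R, 0 < R ∧ R₀ ≤ R ∧ ∀ x, R < ‖x‖ → g x = 0 := by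
    obtain ⟨R, hR⟩ := hgs.isCompact.isBounded.subset_closedBall 0
    refine ⟨max (max R R₀) 1, by positivity, (le_max_right _ _).trans (le_max_left _ _),
      fun x hx => ?_⟩
    by_contra h
    have := hR (subset_tsupport g h)
    rw [mem_closedBall_zero_iff] at this
    exact absurd hx (not_lt.2 (this.trans ((le_max_left _ _).trans (le_max_left _ _))))
  set m : ℝ := (volume (Metric.closedBall (0 : Plane) (R + 2))).toReal with hm
  have hm0 : 0 ≤ m := ENNReal.toReal_nonneg
  obtain ⟨τ, hτ, hτm⟩ : ∃ τ : ℝ, 0 < τ ∧ τ ^ 2 * m ≤ ε / 4 := by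
    refine ⟨√(ε / 4 / (m + 1)), by positivity, ?_⟩
    rw [sq_sqrt (by positivity), div_mul_eq_mul_div, div_le_iff₀ (by positivity)]
    nlinarith
  obtain ⟨d, hd, hdg⟩ := Metric.uniformContinuous_iff.1
    (hgc.uniformContinuous_of_tendsto_cocompact hgs.is_zero_at_infty) τ hτ
  obtain ⟨A, hA, ζ, hζ, hball, hcell, hnone, hsum, hgrad⟩ :=
    exists_fine_partition hR (lt_min hd one_pos) (min_le_right d 1)
  classical
  set B : Set Plane := Metric.closedBall (0 : Plane) (R + 2) with hB
  have hBm : MeasurableSet B := Metric.isClosed_closedBall.measurableSet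
  have hpt : ∀ a : A, ∃ c : ℝ, 0 ≤ c ∧ ∀ x, ζ (some a) x ≠ 0 → |max (g x) 0 - c| ≤ τ := by
    intro a
    by_cases h : ∃ y, ζ (some a) y ≠ 0
    · obtain ⟨y, hy⟩ := h
      refine ⟨max (g y) 0, le_max_right _ _, fun x hx => ?_⟩
      have h1 := hdg ((hcell a x y hx hy).trans_le (min_le_left _ _))
      rw [Real.dist_eq] at h1
      exact (abs_max_sub_max_le_abs _ _ _).trans h1.le
    · push Not at h
      exact ⟨0, le_rfl, fun x hx => absurd (h x) hx⟩
  choose c hc0 hc using hpt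
  have hindm : MemLp (B.indicator fun _ => τ) 2 (volume : Measure Plane) :=
    memLp_indicator_const 2 hBm τ (Or.inr (isCompact_closedBall _ _).measure_lt_top.ne)
  have hPg : MemLp (fun x => |P x - g x|) 2 volume := (hP.sub hgm').abs
  have hkey : ∀ x, |P x - max (g x) 0| ≤ |P x - g x| := fun x => by
    conv_lhs => rw [← max_eq_left (hP0 x)]
    exact abs_max_sub_max_le_abs _ _ _
  refine ⟨A, hA, ζ, fun a => a.elim 0 c, fun x => |P x - g x| + B.indicator (fun _ => τ) x, hζ,
    fun a => ?_, fun x hx => hnone x (hx.trans hRR), hsum, hgrad, ?_, rfl, hPg.add hindm,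
    (hPm.sub hgc.measurable).abs.add (measurable_const.indicator hBm), ?_, ?_⟩
  · refine HasCompactSupport.intro (isCompact_closedBall (0 : Plane) (R + 2)) fun x hx => ?_
    by_contra h
    exact hx (mem_closedBall_zero_iff.2 (hball a x h))
  · rintro (_ | a)
    · exact le_rfl
    · exact hc0 a
  · have hi2 : Integrable (fun x => (B.indicator (fun _ => τ) x) ^ 2) (volume : Measure Plane) :=
      hindm.integrable_sq
    have hi2v : ∫ x, (B.indicator (fun _ => τ) x) ^ 2 = τ ^ 2 * m := by
      have : (fun x : Plane => (B.indicator (fun _ => τ) x) ^ 2) = B.indicator fun _ => τ ^ 2 := by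
        funext x
        by_cases hx : x ∈ B <;> simp [hx]
      rw [this, integral_indicator_const _ hBm]
      simp [hm, hB, Measure.real, mul_comm]
    calc ∫ x, (|P x - g x| + B.indicator (fun _ => τ) x) ^ 2
        ≤ ∫ x, (2 * (P x - g x) ^ 2 + 2 * (B.indicator (fun _ => τ) x) ^ 2) := by
          refine integral_mono (hPg.add hindm).integrable_sq
            ((hdi.const_mul 2).add (hi2.const_mul 2)) fun x => ?_
          simp only
          rw [← sq_abs (P x - g x)]
          nlinarith [sq_nonneg (|P x - g x| - B.indicator (fun _ => τ) x)]
      _ = 2 * (∫ x, (P x - g x) ^ 2) + 2 * (τ ^ 2 * m) := by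
          rw [integral_add (hdi.const_mul 2) (hi2.const_mul 2), integral_const_mul,
            integral_const_mul, hi2v]
      _ ≤ ε := by linarith
  · rintro (_ | a) x hx
    · have hx' : R < ‖x‖ := by
        by_contra h
        exact hx (hnone x (not_lt.1 h))
      have := hRg x hx'
      have h0 : 0 ≤ B.indicator (fun _ => τ) x := Set.indicator_nonneg (fun _ _ => hτ.le) x
      simp only [Option.elim, this, sub_zero]
      linarith
    · have hxB : x ∈ B := mem_closedBall_zero_iff.2 (hball a x hx)
      simp only [Option.elim, Set.indicator_of_mem hxB]
      calc |P x - c a| = |(P x - max (g x) 0) + (max (g x) 0 - c a)| := by ring_nf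
        _ ≤ |P x - max (g x) 0| + |max (g x) 0 - c a| := abs_add_le _ _
        _ ≤ _ := add_le_add (hkey x) (hc a x hx)

lemma IsPot.of_memLp {w : Plane → ℝ} (hm : Measurable w) (hw : MemLp w 2 volume) : IsPot w :=
  ⟨hm, fun _ _ _ => hw.integrable_sq.integrableOn⟩

lemma IsPot.const (c : ℝ) : IsPot fun _ => c := IsPot.of_continuous continuous_const

/-- Lower bound for a localised eigenvalue sum in terms of a step approximation. -/
lemma outer_lower_of_partition {K : ℝ} (hK0 : 0 < K)
    (hK : ∀ (ι : Type) [Fintype ι] (f : ι → Plane → ℝ), (∀ i, IsSmoothCpt (f i)) →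
      SubON volume f → ∀ a : ℝ, 0 < a → ∀ w : Plane → ℝ, MemLp w 2 volume →
        -(K / a * ∫ x, w x ^ 2) ≤
          a * ∑ i, (∫ x, ‖fderiv ℝ (f i) x‖ ^ 2) - ∫ x, w x * ∑ i, f i x ^ 2)
    {U χ G P w : Plane → ℝ} (hU : IsPot U) (hχ : ContDiff ℝ (⊤ : ℕ∞) χ) (hχ1 : ∀ x, χ x ^ 2 ≤ 1)
    (hG : Continuous G) (hG2 : MemLp G 2 volume)
    (hP : MemLp P 2 volume) (hUP : ∀ x, χ x ≠ 0 → U x ≤ P x)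
    {A : Type} [Fintype A] {ζ : Option A → Plane → ℝ} {v : Option A → ℝ}
    (hζ : ∀ a, ContDiff ℝ (⊤ : ℕ∞) (ζ a)) (hζc : ∀ a, HasCompactSupport (ζ (some a)))
    (hζ1 : ∀ x, ∑ a, ζ a x ^ 2 = 1) (hζd : ∀ a, HasCompactSupport (fderiv ℝ (ζ a)))
    (hv : ∀ a, 0 ≤ v a) (hv0 : v none = 0) (hw : MemLp w 2 volume) (hwm : Measurable w)
    (hPv : ∀ a x, ζ a x ≠ 0 → |P x - v a| ≤ w x) {s : ℝ} (hs : 0 < s) (hs1 : s < 1) :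
    ∃ J : ℝ, ∀ h : ℝ, 0 < h → ∀ (ι : Type) [Fintype ι] (f : ι → Plane → ℝ),
      (∀ i, IsTest (f i)) → SubON volume f →
      -(1 / (8 * π * (1 - s)) * ((1 + s) * (∫ x, (χ x * P x) ^ 2) + (1 + 1 / s) * ∫ x, w x ^ 2))
        - K / s * (2 * (∫ x, w x ^ 2) + h ^ 4 * J) ≤
      h ^ 2 * ∑ i, qForm h (fun x => U x + h ^ 2 * G x) (fun x => χ x * f i x) := by
  set Γ : Plane → ℝ := fun x => ∑ b, ‖fderiv ℝ (ζ b) x‖ ^ 2 with hΓ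
  have hΓc : Continuous Γ :=
    continuous_finsetSum _ fun b _ => (((hζ b).continuous_fderiv (by simp)).norm.pow 2)
  have hΓs : HasCompactSupport Γ :=
    hasCompactSupport_finsetSum _ fun b => ((hζd b).norm.comp_left (g := fun t => t ^ 2) (by simp))
  have hΓ2 : MemLp Γ 2 volume := hΓc.memLp_of_hasCompactSupport hΓs
  have hGΓ : MemLp (fun x => G x + Γ x) 2 volume := hG2.add hΓ2
  have hG' : ∀ h : ℝ, IsPot fun x => h ^ 2 * G x := fun h =>
    (IsPot.of_continuous hG).const_mul _
  have hΓ' : ∀ h : ℝ, IsPot fun x => h ^ 2 * Γ x := fun h =>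
    (IsPot.of_continuous hΓc).const_mul _
  refine ⟨2 * ∫ x, (G x + Γ x) ^ 2, fun h hh ι _ f hf hfs => ?_⟩
  have hY : MemLp (fun x => w x + h ^ 2 * (G x + Γ x)) 2 volume := hw.add (hGΓ.const_mul _)
  have hYp : IsPot (fun x => w x + h ^ 2 * (G x + Γ x)) :=
    IsPot.of_memLp (hwm.add ((hG.add hΓc).measurable.const_mul _)) hY
  set Y : Plane → ℝ := fun x => w x + h ^ 2 * (G x + Γ x) with hYd
  have hYint : ∫ x, Y x ^ 2 ≤ 2 * (∫ x, w x ^ 2) + h ^ 4 * (2 * ∫ x, (G x + Γ x) ^ 2) := by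
    have i1 := hw.integrable_sq.const_mul 2
    have i2 := hGΓ.integrable_sq.const_mul (2 * h ^ 4)
    calc ∫ x, Y x ^ 2 ≤ ∫ x, (2 * w x ^ 2 + 2 * h ^ 4 * (G x + Γ x) ^ 2) := by
          refine integral_mono hY.integrable_sq (i1.add i2) fun x => ?_
          simp only [hYd]
          nlinarith [sq_nonneg (w x - h ^ 2 * (G x + Γ x))]
      _ = _ := by
          rw [integral_add i1 i2, integral_const_mul, integral_const_mul]; ring
  have hχf : ∀ i, IsTest (fun x => χ x * f i x) := fun i => (hf i).mul_left hχ
  have hg : ∀ a i, IsTest (fun x => ζ a x * (χ x * f i x)) := fun a i => (hχf i).mul_left (hζ a)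
  have hsub : SubON volume (fun (p : Option A × ι) x => ζ p.1 x * (χ x * f p.2 x)) :=
    (hfs.mul_of_sq_le (fun i => (hf i).1.memLp) χ hχ1).mul_partition
      (fun i => (hχf i).1.memLp) ζ fun x => (hζ1 x).le
  set h' : ℝ := √(1 - s) * h with hh'd
  have hh' : 0 < h' := mul_pos (sqrt_pos.2 (by linarith)) hh
  have hh'2 : h' ^ 2 = (1 - s) * h ^ 2 := by
    rw [hh'd, mul_pow, sq_sqrt (by linarith)]
  have hcell : ∀ a i, qForm h' (fun _ => v a) (fun x => ζ a x * (χ x * f i x)) +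
      (s * h ^ 2 * (∫ x, ‖fderiv ℝ (fun x => ζ a x * (χ x * f i x)) x‖ ^ 2) -
        ∫ x, Y x * (ζ a x * (χ x * f i x)) ^ 2) ≤
      qForm h (fun x => U x + h ^ 2 * G x + h ^ 2 * Γ x) (fun x => ζ a x * (χ x * f i x)) := by
    intro a i
    have h1 := qForm_anti (h := h) ((hU.add (hG' h)).add (hΓ' h)) ((IsPot.const (v a)).add hYp)
      (hg a i) fun x hx => by
        have hζx : ζ a x ≠ 0 := left_ne_zero_of_mul hx
        have hχx : χ x ≠ 0 := left_ne_zero_of_mul (right_ne_zero_of_mul hx)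
        have := hUP x hχx
        have := (abs_le.1 (hPv a x hζx)).2
        simp only [hYd]
        linarith
    refine le_trans (le_of_eq ?_) h1
    rw [qForm_add (IsPot.const (v a)) hYp (hg a i), qForm_eq (IsPot.const _) (hg a i),
      qForm_eq (IsPot.const _) (hg a i), hh'2]
    ring
  have hims : ∑ i, qForm h (fun x => U x + h ^ 2 * G x) (fun x => χ x * f i x) =
      ∑ a, ∑ i, qForm h (fun x => U x + h ^ 2 * G x + h ^ 2 * Γ x)
        (fun x => ζ a x * (χ x * f i x)) := by
    rw [Finset.sum_comm]
    exact Finset.sum_congr rfl fun i _ => qForm_ims (hU.add (hG' h)) (hχf i) ζ hζ hζ1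
  have hbly : ∀ a, -(v a ^ 2 / (8 * π * h' ^ 2) * ∫ x, (ζ a x * χ x) ^ 2) ≤
      ∑ i, qForm h' (fun _ => v a) (fun x => ζ a x * (χ x * f i x)) := by
    rintro (_ | a)
    · rw [hv0]
      simp only [ne_eq, OfNat.ofNat_ne_zero, not_false_eq_true, zero_pow, zero_div, zero_mul,
        neg_zero]
      refine Finset.sum_nonneg fun i _ => ?_
      unfold qForm
      refine integral_nonneg fun x => ?_
      simp only [zero_mul, sub_zero]
      positivity
    · have hη : IsSmoothCpt (fun x => ζ (some a) x * χ x) :=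
        ⟨(hζ _).mul hχ, (hζc a).mul_right⟩
      have := berezin_li_yau (fun i => (hf i).1) hfs hη (hv (some a)) hh'
      simpa only [mul_assoc] using this
  have hlt := hK (Option A × ι) _ (fun p => (hg p.1 p.2).1) hsub (s * h ^ 2) (by positivity) Y hY
  have hltY : ∫ x, Y x * ∑ p : Option A × ι, (ζ p.1 x * (χ x * f p.2 x)) ^ 2 =
      ∑ p : Option A × ι, ∫ x, Y x * (ζ p.1 x * (χ x * f p.2 x)) ^ 2 := by
    simp only [Finset.mul_sum]
    exact integral_finsetSum _ fun p _ => hYp.integrable_mul_sq (hg p.1 p.2)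
  have hstep : ∑ a, v a ^ 2 * (∫ x, (ζ a x * χ x) ^ 2) ≤
      (1 + s) * (∫ x, (χ x * P x) ^ 2) + (1 + 1 / s) * ∫ x, w x ^ 2 := by
    have hχP : Integrable (fun x => (χ x * P x) ^ 2) (volume : Measure Plane) := by
      refine hP.integrable_sq.mono' ?_ (ae_of_all _ fun x => ?_)
      · exact ((hχ.continuous.aestronglyMeasurable.mul hP.1).pow 2)
      · rw [norm_of_nonneg (sq_nonneg _), mul_pow]
        exact mul_le_of_le_one_left (sq_nonneg _) (hχ1 x)
    have hia : ∀ a, Integrable (fun x => v a ^ 2 * (ζ a x * χ x) ^ 2) (volume : Measure Plane) := by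
      rintro (_ | a)
      · simp [hv0]
      · have hη : IsSmoothCpt (fun x => ζ (some a) x * χ x) :=
          ⟨(hζ _).mul hχ, (hζc a).mul_right⟩
        exact hη.memLp.integrable_sq.const_mul _
    calc ∑ a, v a ^ 2 * (∫ x, (ζ a x * χ x) ^ 2)
        = ∫ x, ∑ a, v a ^ 2 * (ζ a x * χ x) ^ 2 := by
          rw [integral_finsetSum _ fun a _ => hia a]
          exact Finset.sum_congr rfl fun a _ => (integral_const_mul _ _).symm
      _ ≤ ∫ x, ((1 + s) * (χ x * P x) ^ 2 + (1 + 1 / s) * w x ^ 2) := by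
          refine integral_mono (integrable_finsetSum _ fun a _ => hia a)
            ((hχP.const_mul _).add (hw.integrable_sq.const_mul _)) fun x => ?_
          have hpt : ∀ a, v a ^ 2 * (ζ a x * χ x) ^ 2 ≤
              ζ a x ^ 2 * ((1 + s) * (χ x * P x) ^ 2 + (1 + 1 / s) * w x ^ 2) := by
            intro a
            by_cases h0 : ζ a x = 0
            · simp [h0]
            · have h1 := hPv a x h0
              have h2 : (P x - v a) ^ 2 ≤ w x ^ 2 := sq_le_sq' (by linarith [(abs_le.1 h1).1])
                (abs_le.1 h1).2
              have h3 : v a ^ 2 ≤ (1 + s) * P x ^ 2 + (1 + 1 / s) * (P x - v a) ^ 2 := by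
                have : 0 ≤ (s * P x + (P x - v a)) ^ 2 / s := by positivity
                have e : (1 + s) * P x ^ 2 + (1 + 1 / s) * (P x - v a) ^ 2 - v a ^ 2 =
                    (s * P x + (P x - v a)) ^ 2 / s := by field_simp; ring
                linarith
              have h4 : (1 + 1 / s) * (P x - v a) ^ 2 ≤ (1 + 1 / s) * w x ^ 2 := by gcongr
              have h5 : v a ^ 2 * χ x ^ 2 ≤ ((1 + s) * P x ^ 2 + (1 + 1 / s) * w x ^ 2) * χ x ^ 2 :=
                mul_le_mul_of_nonneg_right (by linarith) (sq_nonneg _)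
              have h6 : (1 + 1 / s) * w x ^ 2 * χ x ^ 2 ≤ (1 + 1 / s) * w x ^ 2 :=
                mul_le_of_le_one_right (by positivity) (hχ1 x)
              have h7 : v a ^ 2 * χ x ^ 2 ≤ (1 + s) * (χ x * P x) ^ 2 + (1 + 1 / s) * w x ^ 2 := by
                nlinarith
              calc v a ^ 2 * (ζ a x * χ x) ^ 2 = ζ a x ^ 2 * (v a ^ 2 * χ x ^ 2) := by ring
                _ ≤ _ := mul_le_mul_of_nonneg_left h7 (sq_nonneg _)
          refine (Finset.sum_le_sum fun a _ => hpt a).trans (le_of_eq ?_)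
          rw [← Finset.sum_mul, hζ1, one_mul]
      _ = _ := by
          rw [integral_add (hχP.const_mul _) (hw.integrable_sq.const_mul _), integral_const_mul,
            integral_const_mul]
  rw [hltY, Fintype.sum_prod_type fun p : Option A × ι =>
      (∫ x, ‖fderiv ℝ (fun x => ζ p.1 x * (χ x * f p.2 x)) x‖ ^ 2),
    Fintype.sum_prod_type fun p : Option A × ι =>
      (∫ x, Y x * (ζ p.1 x * (χ x * f p.2 x)) ^ 2)] at hlt
  have h1 := Finset.sum_le_sum fun a (_ : a ∈ Finset.univ) =>
    Finset.sum_le_sum fun i (_ : i ∈ Finset.univ) => hcell a i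
  simp only [Finset.sum_add_distrib, Finset.sum_sub_distrib, ← Finset.mul_sum] at h1
  have h2 := Finset.sum_le_sum fun a (_ : a ∈ Finset.univ) => hbly a
  have h3 : ∑ a, -(v a ^ 2 / (8 * π * h' ^ 2) * ∫ x, (ζ a x * χ x) ^ 2) =
      -(1 / (8 * π * h' ^ 2) * ∑ a, v a ^ 2 * ∫ x, (ζ a x * χ x) ^ 2) := by
    rw [Finset.mul_sum, Finset.sum_neg_distrib]
    exact congrArg _ (Finset.sum_congr rfl fun a _ => by ring)
  rw [hims]
  have h4 : -(1 / (8 * π * h' ^ 2) * ∑ a, v a ^ 2 * ∫ x, (ζ a x * χ x) ^ 2) -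
      K / (s * h ^ 2) * (∫ x, Y x ^ 2) ≤ ∑ a, ∑ i, qForm h
        (fun x => U x + h ^ 2 * G x + h ^ 2 * Γ x) (fun x => ζ a x * (χ x * f i x)) := by
    linarith
  have h5 : (1 / (8 * π * h' ^ 2) * ∑ a, v a ^ 2 * ∫ x, (ζ a x * χ x) ^ 2) ≤
      1 / (8 * π * h' ^ 2) * ((1 + s) * (∫ x, (χ x * P x) ^ 2) + (1 + 1 / s) * ∫ x, w x ^ 2) :=
    mul_le_mul_of_nonneg_left hstep (by positivity)
  have h6 : K / (s * h ^ 2) * (∫ x, Y x ^ 2) ≤ K / (s * h ^ 2) *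
      (2 * (∫ x, w x ^ 2) + h ^ 4 * (2 * ∫ x, (G x + Γ x) ^ 2)) :=
    mul_le_mul_of_nonneg_left hYint (by positivity)
  have h7 := mul_le_mul_of_nonneg_left ((sub_le_sub (neg_le_neg h5) h6).trans h4) (sq_nonneg h)
  refine le_trans (le_of_eq ?_) h7
  rw [hh'2]
  have : 1 - s ≠ 0 := by linarith
  field_simp

/-- Semiclassical lower bound away from the singularity. -/
lemma outer_lower {U χ G P : Plane → ℝ} (hU : IsPot U) (hχ : ContDiff ℝ (⊤ : ℕ∞) χ)
    (hχ1 : ∀ x, χ x ^ 2 ≤ 1) (hG : Continuous G) (hG2 : MemLp G 2 volume)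
    (hP : MemLp P 2 volume) (hPm : Measurable P) (hP0 : ∀ x, 0 ≤ P x)
    (hUP : ∀ x, χ x ≠ 0 → U x ≤ P x) {ε : ℝ} (hε : 0 < ε) :
    ∀ᶠ h in nhdsWithin (0 : ℝ) (Set.Ioi 0), ∀ (ι : Type) [Fintype ι] (f : ι → Plane → ℝ),
      (∀ i, IsTest (f i)) → SubON volume f →
      -(1 / (8 * π)) * (∫ x, (χ x * P x) ^ 2) - ε ≤
      h ^ 2 * ∑ i, qForm h (fun x => U x + h ^ 2 * G x) (fun x => χ x * f i x) := by
  obtain ⟨K, hK0, hK⟩ := exists_lieb_thirring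
  set I : ℝ := ∫ x, (χ x * P x) ^ 2 with hI
  have hI0 : 0 ≤ I := integral_nonneg fun x => sq_nonneg _
  have hπ := pi_pos
  have e1 : ∀ᶠ s in nhdsWithin (0 : ℝ) (Set.Ioi 0),
      1 / (8 * π * (1 - s)) * ((1 + s) * I) < 1 / (8 * π) * I + ε / 2 := by
    have hc : ContinuousAt (fun s : ℝ => 1 / (8 * π * (1 - s)) * ((1 + s) * I)) 0 := by
      have : (8 * π * (1 - 0)) ≠ 0 := by positivity
      fun_prop (disch := assumption)
    refine (hc.tendsto.mono_left nhdsWithin_le_nhds).eventually (gt_mem_nhds ?_)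
    simp only [sub_zero, mul_one, add_zero, one_mul]
    linarith
  have e0 : ∀ᶠ s in nhdsWithin (0 : ℝ) (Set.Ioi 0), 0 < s ∧ s < 1 := Ioo_mem_nhdsGT one_pos
  obtain ⟨s, hs1, hs0, hsl⟩ := (e1.and e0).exists
  set M : ℝ := 1 / (8 * π * (1 - s)) * (1 + 1 / s) + K / s * 2 with hM
  have hM0 : 0 < M := by
    have : 0 < 1 - s := by linarith
    positivity
  obtain ⟨A, _, ζ, v, w, hζ, hζc, -, hζ1, hζd, hv, hv0, hw, hwm, hwε, hPv⟩ :=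
    exists_step_partition hP hPm hP0 0 (show 0 < ε / 4 / M by positivity)
  obtain ⟨J, hJ⟩ := outer_lower_of_partition hK0 hK hU hχ hχ1 hG hG2 hP hUP hζ hζc hζ1 hζd hv hv0
    hw hwm hPv hs0 hsl
  have e2 : ∀ᶠ h in nhdsWithin (0 : ℝ) (Set.Ioi 0), K / s * (h ^ 4 * J) < ε / 4 := by
    have hc : ContinuousAt (fun h : ℝ => K / s * (h ^ 4 * J)) 0 := by fun_prop
    refine (hc.tendsto.mono_left nhdsWithin_le_nhds).eventually (gt_mem_nhds ?_)
    simp only [ne_eq, OfNat.ofNat_ne_zero, not_false_eq_true, zero_pow, zero_mul, mul_zero]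
    positivity
  filter_upwards [e2, self_mem_nhdsWithin] with h hh2 hh0 ι _ f hf hfs
  have h1 := hJ h hh0 ι f hf hfs
  have h2 : M * ∫ x, w x ^ 2 ≤ ε / 4 := by
    rw [le_div_iff₀ hM0] at hwε
    linarith
  refine le_trans ?_ h1
  rw [hM] at h2
  linear_combination hs1 + h2 + hh2

section

open scoped Pointwise

/-- Lattice points in a disc, with their count and second moment. -/
lemma exists_lattice_frequencies {v : ℝ} (hv : 0 ≤ v) :
    ∃ F : ℕ → Finset (Fin 2 → ℝ),
      (∀ n, 0 < n → ∀ x ∈ F n, ∀ i, ∃ k : ℤ, (n : ℝ) * x i = k) ∧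
      Tendsto (fun n => ((F n).card : ℝ) / (n : ℝ) ^ 2) atTop (nhds (v / (4 * π))) ∧
      Tendsto (fun n => (∑ x ∈ F n, 4 * π ^ 2 * (x 0 ^ 2 + x 1 ^ 2)) / (n : ℝ) ^ 2) atTop
        (nhds (v ^ 2 / (8 * π))) := by
  classical
  have hπ := pi_pos
  set r : ℝ := √v / (2 * π) with hr
  have hr0 : 0 ≤ r := by positivity
  have hr2 : 4 * π ^ 2 * r ^ 2 = v := by
    rw [hr, div_pow, sq_sqrt hv]; field_simp; ring
  set S : Set (Fin 2 → ℝ) := WithLp.toLp 2 ⁻¹' Metric.ball (0 : Plane) r with hS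
  have hmp := PiLp.volume_preserving_toLp (Fin 2)
  have hnorm : ∀ x : Fin 2 → ℝ, ‖(WithLp.toLp 2 x : Plane)‖ ^ 2 = x 0 ^ 2 + x 1 ^ 2 := fun x => by
    rw [EuclideanSpace.norm_sq_eq]; simp
  have hmem : ∀ x, x ∈ S ↔ 4 * π ^ 2 * (x 0 ^ 2 + x 1 ^ 2) < v := by
    intro x
    rw [hS, Set.mem_preimage, mem_ball_zero_iff, ← sq_lt_sq₀ (norm_nonneg _) hr0, hnorm, ← hr2]
    exact (mul_lt_mul_iff_of_pos_left (by positivity)).symm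
  have hSm : MeasurableSet S := hmp.measurable Metric.isOpen_ball.measurableSet
  have hSb : Bornology.IsBounded S := by
    refine (Metric.isBounded_closedBall (x := (0 : Fin 2 → ℝ)) (r := r)).subset fun x hx => ?_
    rw [mem_closedBall_zero_iff, pi_norm_le_iff_of_nonneg hr0]
    intro i
    rw [hS, Set.mem_preimage, mem_ball_zero_iff] at hx
    exact (PiLp.norm_apply_le (WithLp.toLp 2 x : Plane) i).trans hx.le
  have hSc : Convex ℝ S :=
    (convex_ball (0 : Plane) r).linear_preimage (WithLp.linearEquiv 2 ℝ (Fin 2 → ℝ)).symm.toLinearMap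
  have hSf : volume (frontier S) = 0 := hSc.addHaar_frontier _
  set Λ : ℕ → Set (Fin 2 → ℝ) := fun n => S ∩ (n : ℝ)⁻¹ •
    (Submodule.span ℤ (Set.range (Pi.basisFun ℝ (Fin 2))) : Set (Fin 2 → ℝ)) with hΛ
  have hfin : ∀ n, 0 < n → (Λ n).Finite := by
    intro n hn
    rw [hΛ]
    simp only
    rw [← Submodule.coe_pointwise_smul, ZSpan.smul _ (inv_ne_zero (by positivity))]
    exact ZSpan.setFinite_inter _ hSb
  set F : ℕ → Finset (Fin 2 → ℝ) := fun n => if hn : 0 < n then (hfin n hn).toFinset else ∅ with hF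
  have hFn : ∀ n, 0 < n → (F n : Set (Fin 2 → ℝ)) = Λ n := fun n hn => by simp [hF, hn]
  have hsum : ∀ g : (Fin 2 → ℝ) → ℝ, Continuous g →
      Tendsto (fun n => (∑ x ∈ F n, g x) / (n : ℝ) ^ 2) atTop (nhds (∫ x in S, g x)) := by
    intro g hg
    have h1 := tendsto_tsum_div_pow_atTop_integral S g hg hSb hSm hSf
    refine h1.congr' ?_
    filter_upwards [eventually_gt_atTop 0] with n hn
    rw [Fintype.card_fin]
    congr 1
    change ∑' x : Λ n, g x = _
    rw [← hFn n hn, Finset.tsum_subtype']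
  have hvol : volume.real S = v / (4 * π) := by
    rw [Measure.real, hS, hmp.measure_preimage Metric.isOpen_ball.measurableSet.nullMeasurableSet,
      EuclideanSpace.volume_ball_fin_two]
    rw [ENNReal.toReal_mul, ENNReal.toReal_pow, ENNReal.toReal_ofReal hr0, ← hr2]
    simp [hπ.le]
    field_simp
  have hInt : ∫ x in S, (v - 4 * π ^ 2 * (x 0 ^ 2 + x 1 ^ 2)) = v ^ 2 / (8 * π) := by
    have h1 := integral_phase_space hv one_pos
    rw [← hmp.integral_comp (MeasurableEquiv.toLp 2 (Fin 2 → ℝ)).measurableEmbedding] at h1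
    rw [← integral_indicator hSm]
    simp only [one_pow, mul_one] at h1
    rw [← h1]
    refine integral_congr_ae (ae_of_all _ fun x => ?_)
    simp only
    rw [hnorm]
    by_cases hx : x ∈ S
    · rw [Set.indicator_of_mem hx, max_eq_left]
      linarith [(hmem x).1 hx]
    · rw [Set.indicator_of_notMem hx, max_eq_right]
      have := mt (hmem x).2 hx
      linarith
  have hone := hsum (fun _ => 1) continuous_const
  rw [setIntegral_const, hvol] at hone
  have hcard : Tendsto (fun n => ((F n).card : ℝ) / (n : ℝ) ^ 2) atTop (nhds (v / (4 * π))) := by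
    simpa using hone
  refine ⟨F, fun n hn x hx i => ?_, hcard, ?_⟩
  · have hx' : x ∈ Λ n := by rw [← hFn n hn]; exact hx
    have hx2 := hx'.2
    rw [Set.mem_inv_smul_set_iff₀ (by positivity)] at hx2
    obtain ⟨k, hk⟩ := ((Pi.basisFun ℝ (Fin 2)).mem_span_iff_repr_mem ℤ _).1 hx2 i
    exact ⟨k, by simpa using hk.symm⟩
  · have h2 := hsum (fun x => v - 4 * π ^ 2 * (x 0 ^ 2 + x 1 ^ 2)) (by fun_prop)
    rw [hInt] at h2
    have h3 := (hcard.const_mul v).sub h2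
    refine (h3.congr fun n => ?_).congr_lim ?_
    · rw [Finset.sum_sub_distrib, Finset.sum_const]
      simp only [nsmul_eq_mul]
      ring
    · field_simp; ring

end

/-- The centred half-open square of side `ℓ`. -/
def squareBox (ℓ : ℝ) : Set Plane := {y | ∀ i, y i ∈ Set.Ioc (-(ℓ / 2)) (ℓ / 2)}

/-- The phase `2π x·y / h`. -/
noncomputable def wavePhase (h : ℝ) (x : Fin 2 → ℝ) (y : Plane) : ℝ :=
  2 * π / h * (x 0 * y 0 + x 1 * y 1)

lemma continuous_wavePhase (h : ℝ) (x : Fin 2 → ℝ) : Continuous (wavePhase h x) := by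
  unfold wavePhase; fun_prop

lemma wavePhase_sub (h : ℝ) (x z : Fin 2 → ℝ) (y : Plane) :
    wavePhase h (x - z) y = wavePhase h x y - wavePhase h z y := by
  simp only [wavePhase, Pi.sub_apply]; ring

lemma measurableSet_squareBox (ℓ : ℝ) : MeasurableSet (squareBox ℓ) := by
  have : squareBox ℓ = ⋂ i, (fun y : Plane => y i) ⁻¹' Set.Ioc (-(ℓ / 2)) (ℓ / 2) := by
    ext y; simp [squareBox]
  rw [this]
  refine MeasurableSet.iInter fun i => ?_
  have hc : Continuous fun y : Plane => y i := by fun_prop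
  exact hc.measurable measurableSet_Ioc

lemma integral_squareBox_prod (ℓ : ℝ) (g : Fin 2 → ℝ → ℂ) :
    ∫ y in squareBox ℓ, ∏ i, g i (y i) = ∏ i, ∫ t in Set.Ioc (-(ℓ / 2)) (ℓ / 2), g i t := by
  have hmp := PiLp.volume_preserving_toLp (Fin 2)
  rw [← integral_indicator (measurableSet_squareBox ℓ),
    ← hmp.integral_comp (MeasurableEquiv.toLp 2 (Fin 2 → ℝ)).measurableEmbedding]
  simp only [← integral_indicator (measurableSet_Ioc (a := -(ℓ / 2)) (b := ℓ / 2))]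
  rw [← integral_fintype_prod_volume_eq_prod]
  refine integral_congr_ae (ae_of_all _ fun y => ?_)
  simp only [Fin.prod_univ_two]
  by_cases h : WithLp.toLp 2 y ∈ squareBox ℓ
  · have h' : ∀ i, y i ∈ Set.Ioc (-(ℓ / 2)) (ℓ / 2) := h
    rw [Set.indicator_of_mem h, Set.indicator_of_mem (h' 0), Set.indicator_of_mem (h' 1)]
  · rw [Set.indicator_of_notMem h]
    have h' : ¬ ∀ i, y i ∈ Set.Ioc (-(ℓ / 2)) (ℓ / 2) := h
    rw [Fin.forall_fin_two, not_and_or] at h'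
    rcases h' with h' | h'
    · rw [Set.indicator_of_notMem h', zero_mul]
    · rw [Set.indicator_of_notMem h', mul_zero]

lemma volume_squareBox {ℓ : ℝ} (hℓ : 0 ≤ ℓ) : volume.real (squareBox ℓ) = ℓ ^ 2 := by
  have h := integral_squareBox_prod ℓ fun _ _ => 1
  simp only [Finset.prod_const_one, setIntegral_const, Complex.real_smul, mul_one,
    Finset.prod_const, Finset.card_univ, Fintype.card_fin, Measure.real, Real.volume_Ioc] at h
  rw [ENNReal.toReal_ofReal (by linarith)] at h
  have h2 : ((volume.real (squareBox ℓ) : ℝ) : ℂ) = ((ℓ ^ 2 : ℝ) : ℂ) := by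
    rw [Measure.real, h]; push_cast; ring
  exact_mod_cast h2

lemma volume_squareBox_lt_top (ℓ : ℝ) : volume (squareBox ℓ) < ⊤ := by
  refine Bornology.IsBounded.measure_lt_top ?_
  refine (Metric.isBounded_closedBall (x := (0 : Plane)) (r := |ℓ| + |ℓ|)).subset fun y hy => ?_
  rw [mem_closedBall_zero_iff, EuclideanSpace.norm_eq, Fin.sum_univ_two]
  refine Real.sqrt_le_iff.2 ⟨by positivity, ?_⟩
  have : ∀ i, ‖y i‖ ^ 2 ≤ |ℓ| ^ 2 := fun i => by
    rw [norm_eq_abs]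
    have h := hy i
    have h1 : |y i| ≤ |ℓ / 2| := abs_le_abs h.2 (by linarith [h.1])
    have h2 : |ℓ / 2| ≤ |ℓ| := by
      rw [abs_div, abs_two]; linarith [abs_nonneg ℓ]
    exact pow_le_pow_left₀ (abs_nonneg _) (h1.trans h2) 2
  nlinarith [this 0, this 1, abs_nonneg ℓ]

lemma integrable_squareBox {ℓ C : ℝ} {g : Plane → ℝ} (hg : Continuous g) (hC : ∀ y, |g y| ≤ C) :
    Integrable g (volume.restrict (squareBox ℓ)) := by
  have : IsFiniteMeasure (volume.restrict (squareBox ℓ)) :=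
    ⟨by rw [Measure.restrict_apply_univ]; exact volume_squareBox_lt_top ℓ⟩
  exact Integrable.of_bound hg.aestronglyMeasurable C (ae_of_all _ hC)

lemma integral_exp_wavePhase {h : ℝ} (hh : 0 < h) {n : ℕ} {z : Fin 2 → ℝ}
    (hz : ∀ i, ∃ k : ℤ, (n : ℝ) * z i = k) (hz0 : z ≠ 0) :
    ∫ y in squareBox (n * h), Complex.exp (Complex.I * wavePhase h z y) = 0 := by
  have h1 : ∀ y : Plane, Complex.exp (Complex.I * wavePhase h z y) =
      ∏ i, (fun i (t : ℝ) => Complex.exp (2 * π / h * z i * Complex.I * t)) i (y i) := by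
    intro y
    simp only [Fin.prod_univ_two, ← Complex.exp_add, wavePhase]
    congr 1
    push_cast
    ring
  simp only [h1]
  rw [integral_squareBox_prod (n * h) fun i t => Complex.exp (2 * π / h * z i * Complex.I * t)]
  obtain ⟨i, hi⟩ := Function.ne_iff.1 hz0
  refine Finset.prod_eq_zero (Finset.mem_univ i) ?_
  have hi' : z i ≠ 0 := hi
  have hn : (0 : ℝ) ≤ n * h := by positivity
  rw [← intervalIntegral.integral_of_le (by linarith),
    integral_exp_mul_complex (by
      have : (h : ℂ) ≠ 0 := by exact_mod_cast hh.ne'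
      have : (z i : ℂ) ≠ 0 := by exact_mod_cast hi'
      have : (π : ℂ) ≠ 0 := by exact_mod_cast pi_ne_zero
      simp [*])]
  obtain ⟨k, hk⟩ := hz i
  have hk' : (n : ℂ) * z i = k := by exact_mod_cast hk
  have : Complex.exp (2 * π / h * z i * Complex.I * ((n * h / 2 : ℝ) : ℂ)) =
      Complex.exp (2 * π / h * z i * Complex.I * ((-(n * h / 2) : ℝ) : ℂ)) := by
    rw [Complex.exp_eq_exp_iff_exists_int]
    refine ⟨k, ?_⟩
    have hh' : (h : ℂ) ≠ 0 := by exact_mod_cast hh.ne'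
    rw [← hk']
    push_cast
    field_simp
    ring
  rw [this, sub_self, zero_div]

lemma integral_cos_wavePhase {h : ℝ} (hh : 0 < h) {n : ℕ} {z : Fin 2 → ℝ}
    (hz : ∀ i, ∃ k : ℤ, (n : ℝ) * z i = k) (hz0 : z ≠ 0) :
    (∫ y in squareBox (n * h), cos (wavePhase h z y)) = 0 ∧
      (∫ y in squareBox (n * h), sin (wavePhase h z y)) = 0 := by
  have h0 := integral_exp_wavePhase hh hz hz0
  have hc := continuous_wavePhase h z
  have i1 : Integrable (fun y => cos (wavePhase h z y)) (volume.restrict (squareBox (n * h))) :=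
    integrable_squareBox (continuous_cos.comp hc) fun y => abs_cos_le_one _
  have i2 : Integrable (fun y => sin (wavePhase h z y)) (volume.restrict (squareBox (n * h))) :=
    integrable_squareBox (continuous_sin.comp hc) fun y => abs_sin_le_one _
  have h1 : ∀ y, Complex.exp (Complex.I * wavePhase h z y) =
      ((cos (wavePhase h z y) : ℝ) : ℂ) + ((sin (wavePhase h z y) : ℝ) : ℂ) * Complex.I := by
    intro y
    rw [mul_comm, Complex.exp_mul_I]; push_cast; rfl
  simp only [h1] at h0
  rw [integral_add i1.ofReal (i2.ofReal.mul_const _), integral_mul_const, integral_complex_ofReal,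
    integral_complex_ofReal] at h0
  constructor
  · simpa using congrArg Complex.re h0
  · simpa using congrArg Complex.im h0

/-- Plane waves of a lattice, normalised in a box of matching side, are sub-orthonormal. -/
lemma subON_planeWaves {h : ℝ} (hh : 0 < h) {n : ℕ} (hn : 0 < n) (F : Finset (Fin 2 → ℝ))
    (hF : ∀ x ∈ F, ∀ i, ∃ k : ℤ, (n : ℝ) * x i = k) :
    SubON (volume.restrict (squareBox (n * h))) (fun (p : F × Bool) y =>
      (n * h)⁻¹ * (bif p.2 then cos (wavePhase h p.1 y) else sin (wavePhase h p.1 y))) := by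
  classical
  intro c
  set ℓ : ℝ := n * h with hℓ
  have hℓ0 : 0 < ℓ := by positivity
  set a : F → ℝ := fun x => c (x, true) with ha
  set b : F → ℝ := fun x => c (x, false) with hb
  have hcont : ∀ x, Continuous (wavePhase h x) := continuous_wavePhase h
  have hcosI : ∀ z, Integrable (fun y => cos (wavePhase h z y)) (volume.restrict (squareBox ℓ)) :=
    fun z => integrable_squareBox (continuous_cos.comp (hcont z)) fun y => abs_cos_le_one _
  have hsinI : ∀ z, Integrable (fun y => sin (wavePhase h z y)) (volume.restrict (squareBox ℓ)) :=
    fun z => integrable_squareBox (continuous_sin.comp (hcont z)) fun y => abs_sin_le_one _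
  have hT : ∀ x z : F, Integrable (fun y =>
      (a x * a z + b x * b z) * cos (wavePhase h (x - z : Fin 2 → ℝ) y) +
      (b x * a z - a x * b z) * sin (wavePhase h (x - z : Fin 2 → ℝ) y))
      (volume.restrict (squareBox ℓ)) := fun x z =>
    ((hcosI _).const_mul _).add ((hsinI _).const_mul _)
  have hpt : ∀ y, (∑ p : F × Bool, c p * (ℓ⁻¹ * (bif p.2 then cos (wavePhase h p.1 y)
      else sin (wavePhase h p.1 y)))) ^ 2 ≤ (ℓ⁻¹) ^ 2 * ∑ x : F, ∑ z : F,
      ((a x * a z + b x * b z) * cos (wavePhase h (x - z : Fin 2 → ℝ) y) +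
      (b x * a z - a x * b z) * sin (wavePhase h (x - z : Fin 2 → ℝ) y)) := by
    intro y
    set C : F → ℝ := fun x => cos (wavePhase h x y)
    set D : F → ℝ := fun x => sin (wavePhase h x y)
    have e1 : ∑ p : F × Bool, c p * (ℓ⁻¹ * (bif p.2 then cos (wavePhase h p.1 y)
      else sin (wavePhase h p.1 y))) = ℓ⁻¹ * ∑ x, (a x * C x + b x * D x) := by
      rw [Fintype.sum_prod_type fun p : F × Bool => c p * (ℓ⁻¹ * (bif p.2
        then cos (wavePhase h p.1 y) else sin (wavePhase h p.1 y))), Finset.mul_sum]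
      refine Finset.sum_congr rfl fun x _ => ?_
      simp only [Fintype.sum_bool, cond_true, cond_false, ha, hb, C, D]
      ring
    have e2 : ∑ x : F, ∑ z : F,
      ((a x * a z + b x * b z) * cos (wavePhase h (x - z : Fin 2 → ℝ) y) +
      (b x * a z - a x * b z) * sin (wavePhase h (x - z : Fin 2 → ℝ) y)) =
      (∑ x, (a x * C x + b x * D x)) ^ 2 + (∑ x, (a x * D x - b x * C x)) ^ 2 := by
      rw [sq, sq, Finset.sum_mul_sum, Finset.sum_mul_sum, ← Finset.sum_add_distrib]
      refine Finset.sum_congr rfl fun x _ => ?_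
      rw [← Finset.sum_add_distrib]
      refine Finset.sum_congr rfl fun z _ => ?_
      rw [wavePhase_sub, cos_sub, sin_sub]
      simp only [C, D]
      ring
    rw [e1, e2, mul_pow]
    exact mul_le_mul_of_nonneg_left (by nlinarith [sq_nonneg (∑ x, (a x * D x - b x * C x))])
      (sq_nonneg _)
  have hzero : ∀ y, wavePhase h 0 y = 0 := fun y => by simp [wavePhase]
  have hval : ∀ x z : F, ∫ y in squareBox ℓ,
      ((a x * a z + b x * b z) * cos (wavePhase h (x - z : Fin 2 → ℝ) y) +
      (b x * a z - a x * b z) * sin (wavePhase h (x - z : Fin 2 → ℝ) y)) =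
      if x = z then ℓ ^ 2 * (a x ^ 2 + b x ^ 2) else 0 := by
    intro x z
    split_ifs with hxz
    · subst hxz
      simp only [sub_self, hzero, cos_zero, sin_zero, setIntegral_const, volume_squareBox hℓ0.le,
        smul_eq_mul]
      ring
    · have hz0 : (x - z : Fin 2 → ℝ) ≠ 0 := fun h0 => hxz (Subtype.ext (sub_eq_zero.1 h0))
      obtain ⟨h1, h2⟩ := integral_cos_wavePhase hh (n := n) (z := (x - z : Fin 2 → ℝ)) (fun i => by
        obtain ⟨k, hk⟩ := hF x x.2 i
        obtain ⟨l, hl⟩ := hF z z.2 i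
        exact ⟨k - l, by push_cast; rw [← hk, ← hl, Pi.sub_apply]; ring⟩) hz0
      rw [integral_add ((hcosI _).const_mul _) ((hsinI _).const_mul _), integral_const_mul,
        integral_const_mul]
      rw [h1, h2]
      ring
  have hI := fun x => integrable_finsetSum Finset.univ fun z (_ : z ∈ Finset.univ) => hT x z
  have hI2 := integrable_finsetSum Finset.univ fun x (_ : x ∈ Finset.univ) => hI x
  refine (integral_mono_of_nonneg (ae_of_all _ fun y => sq_nonneg _) (hI2.const_mul ((ℓ⁻¹) ^ 2))
    (ae_of_all _ hpt)).trans (le_of_eq ?_)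
  rw [integral_const_mul, integral_finsetSum _ fun x _ => hI x]
  simp only [integral_finsetSum _ fun z (_ : z ∈ Finset.univ) => hT _ z, hval]
  rw [Fintype.sum_prod_type fun p : F × Bool => c p ^ 2, Finset.mul_sum]
  refine Finset.sum_congr rfl fun x _ => ?_
  simp only [Finset.sum_ite_eq, Finset.mem_univ, if_true, Fintype.sum_bool, ha, hb]
  field_simp

/-- The cosine or sine wave of a given frequency. -/
noncomputable def wave (h : ℝ) (x : Fin 2 → ℝ) (c : Bool) (y : Plane) : ℝ :=
  bif c then cos (wavePhase h x y) else sin (wavePhase h x y)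

lemma contDiff_wave (h : ℝ) (x : Fin 2 → ℝ) (c : Bool) : ContDiff ℝ (⊤ : ℕ∞) (wave h x c) := by
  have hp : ContDiff ℝ (⊤ : ℕ∞) (wavePhase h x) := by
    unfold wavePhase
    have h0 : ∀ i, ContDiff ℝ (⊤ : ℕ∞) fun y : Plane => y i := fun i =>
      (EuclideanSpace.proj (𝕜 := ℝ) i).contDiff
    exact contDiff_const.mul ((contDiff_const.mul (h0 0)).add (contDiff_const.mul (h0 1)))
  cases c
  · exact hp.sin
  · exact hp.cos

lemma abs_wave_le (h : ℝ) (x : Fin 2 → ℝ) (c : Bool) (y : Plane) : |wave h x c y| ≤ 1 := by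
  cases c
  · exact abs_sin_le_one _
  · exact abs_cos_le_one _

lemma pd_wavePhase (h : ℝ) (x : Fin 2 → ℝ) (y : Plane) (k : Fin 2) :
    pd k (wavePhase h x) y = 2 * π / h * x k := by
  have h0 : ∀ i, HasFDerivAt (fun y : Plane => y i) (EuclideanSpace.proj (𝕜 := ℝ) i) y := fun i =>
    (EuclideanSpace.proj (𝕜 := ℝ) i).hasFDerivAt
  have h1 : HasFDerivAt (wavePhase h x) _ y :=
    (((h0 0).const_mul (x 0)).add ((h0 1).const_mul (x 1))).const_mul (2 * π / h)
  unfold pd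
  rw [h1.fderiv]
  fin_cases k <;> simp

lemma pd_wave (h : ℝ) (x : Fin 2 → ℝ) (y : Plane) (k : Fin 2) :
    pd k (wave h x true) y = -sin (wavePhase h x y) * (2 * π / h * x k) ∧
    pd k (wave h x false) y = cos (wavePhase h x y) * (2 * π / h * x k) := by
  have hd : DifferentiableAt ℝ (wavePhase h x) y := by
    unfold wavePhase
    have h0 : ∀ i, DifferentiableAt ℝ (fun y : Plane => y i) y := fun i =>
      (EuclideanSpace.proj (𝕜 := ℝ) i).differentiableAt
    exact ((h0 0).const_mul _ |>.add ((h0 1).const_mul _)).const_mul _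
  constructor
  · rw [← pd_wavePhase h x y k]
    unfold pd
    change fderiv ℝ (fun y => cos (wavePhase h x y)) y _ = _
    rw [hd.hasFDerivAt.cos.fderiv]
    simp
  · rw [← pd_wavePhase h x y k]
    unfold pd
    change fderiv ℝ (fun y => sin (wavePhase h x y)) y _ = _
    rw [hd.hasFDerivAt.sin.fderiv]
    simp

lemma qForm_wave_add {h : ℝ} (hh : h ≠ 0) {U η : Plane → ℝ} (hU : IsPot U) (hη : IsTest η)
    (A : ℝ) (x : Fin 2 → ℝ) :
    qForm h U (fun y => (A * wave h x true y) * η y) +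
      qForm h U (fun y => (A * wave h x false y) * η y) =
    A ^ 2 * (h ^ 2 * (∫ y, ‖fderiv ℝ η y‖ ^ 2) +
      4 * π ^ 2 * (x 0 ^ 2 + x 1 ^ 2) * (∫ y, η y ^ 2) - ∫ y, U y * η y ^ 2) := by
  have hw : ∀ c, ContDiff ℝ (⊤ : ℕ∞) (fun y => A * wave h x c y) := fun c =>
    contDiff_const.mul (contDiff_wave h x c)
  have ht : ∀ c, IsTest (fun y => (A * wave h x c y) * η y) := fun c => hη.mul_left (hw c)
  have hi : ∀ c, Integrable (fun y => h ^ 2 * ‖fderiv ℝ (fun y => (A * wave h x c y) * η y) y‖ ^ 2 -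
      U y * ((A * wave h x c y) * η y) ^ 2) (volume : Measure Plane) := fun c =>
    ((ht c).1.integrable_grad.const_mul _).sub (hU.integrable_mul_sq (ht c))
  have i1 := hη.1.integrable_grad.const_mul (h ^ 2)
  have i2 := hη.1.memLp.integrable_sq.const_mul (4 * π ^ 2 * (x 0 ^ 2 + x 1 ^ 2))
  have i3 := hU.integrable_mul_sq hη
  have i12 : Integrable (fun y => h ^ 2 * ‖fderiv ℝ η y‖ ^ 2 +
      4 * π ^ 2 * (x 0 ^ 2 + x 1 ^ 2) * η y ^ 2) (volume : Measure Plane) := i1.add i2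
  unfold qForm
  rw [← integral_add (hi true) (hi false), ← integral_const_mul, ← integral_const_mul,
    ← integral_add i1 i2, ← integral_sub i12 i3, ← integral_const_mul]
  refine integral_congr_ae (ae_of_all _ fun y => ?_)
  simp only [norm_fderiv_sq, Fin.sum_univ_two]
  have hp : ∀ c k, pd k (fun y => (A * wave h x c y) * η y) y =
      A * (wave h x c y * pd k η y + η y * pd k (wave h x c) y) := by
    intro c k
    have hd := ((contDiff_wave h x c).differentiable (by simp)).differentiableAt (x := y)
    rw [pd_mul (hd.const_mul A) hη.1.differentiable.differentiableAt, pd_const_mul hd]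
    ring
  simp only [hp, (pd_wave h x y _).1, (pd_wave h x y _).2]
  simp only [wave, cond_true, cond_false]
  have hcs := sin_sq_add_cos_sq (wavePhase h x y)
  set c := cos (wavePhase h x y)
  set s := sin (wavePhase h x y)
  have hk : ∀ i, h * (2 * π / h * x i) = 2 * π * x i := fun i => by field_simp
  have hk2 : 4 * π ^ 2 * (x 0 ^ 2 + x 1 ^ 2) =
      (h * (2 * π / h * x 0)) ^ 2 + (h * (2 * π / h * x 1)) ^ 2 := by rw [hk, hk]; ring
  rw [hk2]
  generalize 2 * π / h * x 0 = k0
  generalize 2 * π / h * x 1 = k1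
  linear_combination A ^ 2 * (h ^ 2 * (pd 0 η y ^ 2 + pd 1 η y ^ 2) +
    ((h * k0) ^ 2 + (h * k1) ^ 2) * η y ^ 2 - U y * η y ^ 2) * hcs

lemma planeWave_bessel {h : ℝ} (hh : 0 < h) {n : ℕ} (hn : 0 < n) (F : Finset (Fin 2 → ℝ))
    (hF : ∀ x ∈ F, ∀ i, ∃ k : ℤ, (n : ℝ) * x i = k) {η u : Plane → ℝ} (hη : Continuous η)
    (hη1 : ∀ x, η x ^ 2 ≤ 1) (hsupp : ∀ x, η x ≠ 0 → x ∈ squareBox (n * h)) (hu : MemLp u 2 volume) :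
    ∑ p : F × Bool, (∫ y, ((n * h)⁻¹ * wave h p.1 p.2 y) * η y * u y) ^ 2 ≤
      ∫ y, (η y * u y) ^ 2 := by
  have hfin : IsFiniteMeasure (volume.restrict (squareBox (n * h))) :=
    ⟨by rw [Measure.restrict_apply_univ]; exact volume_squareBox_lt_top _⟩
  have hm : ∀ p : F × Bool, MemLp (fun y => ((n : ℝ) * h)⁻¹ * wave h p.1 p.2 y) 2
      (volume.restrict (squareBox (n * h))) := fun p =>
    MemLp.const_mul (MemLp.of_bound (contDiff_wave h p.1 p.2).continuous.aestronglyMeasurable 1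
      (ae_of_all _ fun y => abs_wave_le h p.1 p.2 y)) _
  have hηu : MemLp (fun y => η y * u y) 2 volume := by
    refine hu.mono (hη.aestronglyMeasurable.mul hu.1) (ae_of_all _ fun y => ?_)
    rw [norm_mul]
    refine mul_le_of_le_one_left (norm_nonneg _) ?_
    have := hη1 y
    rw [norm_eq_abs]
    exact abs_le_one_iff_mul_self_le_one.2 (by nlinarith)
  have h1 := (subON_planeWaves hh hn F hF).bessel hm (hηu.restrict (squareBox (n * h)))
  rw [setIntegral_eq_integral_of_forall_compl_eq_zero (fun y hy => by
    by_cases h0 : η y = 0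
    · simp [h0]
    · exact absurd (hsupp y h0) hy)] at h1
  refine le_trans (le_of_eq (Finset.sum_congr rfl fun p _ => ?_)) h1
  rw [setIntegral_eq_integral_of_forall_compl_eq_zero (fun y hy => by
    by_cases h0 : η y = 0
    · simp [h0]
    · exact absurd (hsupp y h0) hy)]
  congr 1
  refine integral_congr_ae (ae_of_all _ fun y => ?_)
  simp only [wave]
  ring

lemma sum_qForm_planeWave {h : ℝ} (hh : h ≠ 0) {U η : Plane → ℝ} (hU : IsPot U) (hη : IsTest η)
    {n : ℕ} (F : Finset (Fin 2 → ℝ)) :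
    h ^ 2 * ∑ p : F × Bool, qForm h U (fun y => ((n * h)⁻¹ * wave h p.1 p.2 y) * η y) =
      (F.card : ℝ) / n ^ 2 * (h ^ 2 * (∫ y, ‖fderiv ℝ η y‖ ^ 2)) +
      (∑ x ∈ F, 4 * π ^ 2 * (x 0 ^ 2 + x 1 ^ 2)) / n ^ 2 * (∫ y, η y ^ 2) -
      (F.card : ℝ) / n ^ 2 * ∫ y, U y * η y ^ 2 := by
  rw [Fintype.sum_prod_type fun p : F × Bool =>
    qForm h U (fun y => ((n * h)⁻¹ * wave h p.1 p.2 y) * η y)]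
  simp only [Fintype.sum_bool]
  simp only [qForm_wave_add hh hU hη]
  rw [Finset.sum_coe_sort F fun x => ((n * h)⁻¹) ^ 2 * (h ^ 2 * (∫ y, ‖fderiv ℝ η y‖ ^ 2) +
      4 * π ^ 2 * (x 0 ^ 2 + x 1 ^ 2) * (∫ y, η y ^ 2) - ∫ y, U y * η y ^ 2), ← Finset.mul_sum,
    Finset.sum_sub_distrib, Finset.sum_add_distrib, ← Finset.sum_mul]
  simp only [Finset.sum_const, nsmul_eq_mul]
  rcases Nat.eq_zero_or_pos n with rfl | hn
  · simp
  · have : (n : ℝ) ≠ 0 := by positivity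
    field_simp
    rw [← Finset.sum_mul]
    ring

lemma IsPot.integrable_sq_mul {U f : Plane → ℝ} (hU : IsPot U) (hf : IsTest f) :
    Integrable (fun x => (f x * U x) ^ 2) (volume : Measure Plane) := by
  have h1 := (integrable_indicator_iff hf.1.2.measurableSet).2
    (hU.loc _ hf.1.2 fun h => hf.2 h rfl)
  obtain ⟨B, hB⟩ := hf.1.2.exists_bound_of_continuous hf.1.continuous
  refine (h1.const_mul (B ^ 2)).mono'
    ((hf.1.continuous.measurable.mul hU.meas).pow_const 2).aestronglyMeasurable
    (ae_of_all _ fun x => ?_)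
  rw [norm_of_nonneg (sq_nonneg _), mul_pow]
  by_cases hx : x ∈ tsupport f
  · rw [Set.indicator_of_mem hx]
    refine mul_le_mul_of_nonneg_right ?_ (sq_nonneg _)
    have := hB x
    rw [norm_eq_abs] at this
    exact sq_le_sq' (by linarith [abs_le.1 this]) (abs_le.1 this).2
  · rw [Set.indicator_of_notMem hx, image_eq_zero_of_notMem_tsupport hx]; simp

lemma step_energy_le {τ u v w : ℝ} (hτ : 0 < τ) (hv : 0 ≤ v) (h : |max u 0 - v| ≤ w) :
    v ^ 2 - 2 * v * u ≤ (1 + 1 / τ) * w ^ 2 + τ * u ^ 2 - max u 0 ^ 2 := by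
  have h1 := abs_le.1 h
  have hw : 0 ≤ w := (abs_nonneg _).trans h
  rcases le_total 0 u with hu | hu
  · rw [max_eq_left hu] at h1 ⊢
    have : (v - u) ^ 2 ≤ w ^ 2 := by apply sq_le_sq' <;> linarith
    have h2 : 0 ≤ 1 / τ * w ^ 2 := by positivity
    nlinarith [mul_nonneg hτ.le (sq_nonneg u)]
  · rw [max_eq_right hu] at h1 ⊢
    have h2 : v ≤ w := by linarith
    have h3 : 0 ≤ 1 / τ * (w + τ * u) ^ 2 := by positivity
    have h4 : 1 / τ * (w + τ * u) ^ 2 = 1 / τ * w ^ 2 + 2 * w * u + τ * u ^ 2 := by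
      field_simp
      ring
    nlinarith [mul_nonneg (sub_nonneg.2 h2) (neg_nonneg.2 hu)]

/-- Trial families for the semiclassical upper bound away from the singularity. -/
lemma exists_outer_trial {U χ : Plane → ℝ} (hU : IsPot U) (hχ : IsTest χ)
    (hχ1 : ∀ x, χ x ^ 2 ≤ 1) {ε : ℝ} (hε : 0 < ε) :
    ∀ᶠ h in nhdsWithin (0 : ℝ) (Set.Ioi 0), ∃ (ι : Type) (_ : Fintype ι) (t : ι → Plane → ℝ),
      (∀ i, IsTest (t i)) ∧
      (∀ u, MemLp u 2 volume → ∑ i, (∫ x, t i x * u x) ^ 2 ≤ ∫ x, (χ x * u x) ^ 2) ∧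
      h ^ 2 * ∑ i, qForm h U (t i) ≤ -(1 / (8 * π)) * (∫ x, (χ x * max (U x) 0) ^ 2) + ε := by
  have hπ := pi_gt_three
  set K := tsupport χ with hK
  have hKc : IsCompact K := hχ.1.2
  have hK0 : (0 : Plane) ∉ K := fun h => hχ.2 h rfl
  set I : ℝ := ∫ x, (χ x * U x) ^ 2 with hI
  have hI0 : 0 ≤ I := integral_nonneg fun x => sq_nonneg _
  set τ : ℝ := ε / (4 * (I + 1)) with hτ
  have hτ0 : 0 < τ := by positivity
  set ε₁ : ℝ := ε / 4 / (1 + 1 / τ) with hε₁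
  have hε₁0 : 0 < ε₁ := by positivity
  set P : Plane → ℝ := K.indicator fun x => max (U x) 0 with hP
  have hPm : Measurable P := (hU.meas.max measurable_const).indicator hKc.measurableSet
  have hP0 : ∀ x, 0 ≤ P x := fun x => Set.indicator_nonneg (fun _ _ => le_max_right _ _) x
  have hPL : MemLp P 2 volume := by
    rw [memLp_two_iff_integrable_sq hPm.aestronglyMeasurable]
    refine ((integrable_indicator_iff hKc.measurableSet).2 (hU.loc _ hKc hK0)).mono'
      (hPm.pow_const 2).aestronglyMeasurable (ae_of_all _ fun x => ?_)
    rw [norm_of_nonneg (sq_nonneg _)]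
    by_cases hx : x ∈ K
    · simp only [hP, Set.indicator_of_mem hx]
      rcases le_total (U x) 0 with h | h
      · rw [max_eq_right h, zero_pow two_ne_zero]; positivity
      · rw [max_eq_left h]
    · simp [hP, Set.indicator_of_notMem hx]
  obtain ⟨A, _, ζ, v, w, hζs, -, -, hζ1, -, hv0, -, hw2, hwm, hwε, hζw⟩ :=
    exists_step_partition hPL hPm hP0 0 hε₁0
  choose F hFint hFcard hFsum using fun a => exists_lattice_frequencies (hv0 a)
  set η : Option A → Plane → ℝ := fun a x => ζ a x * χ x with hη
  have hηt : ∀ a, IsTest (η a) := fun a => hχ.mul_left (hζs a)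
  have hηsum : ∀ x, ∑ a, η a x ^ 2 = χ x ^ 2 := fun x => by
    simp only [hη, mul_pow]; rw [← Finset.sum_mul, hζ1, one_mul]
  have hη1 : ∀ a x, η a x ^ 2 ≤ 1 := fun a x =>
    (Finset.single_le_sum (f := fun a => η a x ^ 2) (fun _ _ => sq_nonneg _)
      (Finset.mem_univ a)).trans ((hηsum x).trans_le (hχ1 x))
  obtain ⟨L₁, hL₁⟩ := hKc.isBounded.exists_norm_le
  set L : ℝ := 2 * |L₁| + 1 with hL
  have hL0 : 0 < L := by positivity
  set N : ℝ → ℕ := fun h => ⌈L / h⌉₊ with hN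
  have hNt : Tendsto N (nhdsWithin 0 (Set.Ioi 0)) atTop :=
    tendsto_nat_ceil_atTop.comp
      ((tendsto_inv_nhdsGT_zero (𝕜 := ℝ)).const_mul_atTop hL0)
  set D : Option A → ℝ := fun a => ∫ y, ‖fderiv ℝ (η a) y‖ ^ 2 with hD
  set M : Option A → ℝ := fun a => ∫ y, η a y ^ 2 with hM
  set B : Option A → ℝ := fun a => ∫ y, U y * η a y ^ 2 with hB
  have hh2 : Tendsto (fun h : ℝ => h ^ 2) (nhdsWithin 0 (Set.Ioi 0)) (nhds 0) := by
    have : Tendsto (fun h : ℝ => h ^ 2) (nhds 0) (nhds (0 ^ 2)) := (continuous_pow 2).tendsto 0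
    rw [zero_pow two_ne_zero] at this
    exact this.mono_left nhdsWithin_le_nhds
  have hlim : Tendsto (fun h : ℝ => ∑ a, (((F a (N h)).card : ℝ) / (N h : ℝ) ^ 2 * (h ^ 2 * D a) +
      (∑ x ∈ F a (N h), 4 * π ^ 2 * (x 0 ^ 2 + x 1 ^ 2)) / (N h : ℝ) ^ 2 * M a -
      ((F a (N h)).card : ℝ) / (N h : ℝ) ^ 2 * B a)) (nhdsWithin 0 (Set.Ioi 0))
      (nhds (∑ a, (v a / (4 * π) * (0 * D a) + v a ^ 2 / (8 * π) * M a - v a / (4 * π) * B a))) :=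
    tendsto_finsetSum _ fun a _ =>
      ((((hFcard a).comp hNt).mul (hh2.mul_const (D a))).add
        (((hFsum a).comp hNt).mul_const (M a))).sub (((hFcard a).comp hNt).mul_const (B a))
  have hχU := hU.integrable_sq_mul hχ
  have hχU' : Integrable (fun x => (χ x * max (U x) 0) ^ 2) (volume : Measure Plane) := by
    refine hχU.mono' ((hχ.1.continuous.measurable.mul
      (hU.meas.max measurable_const)).pow_const 2).aestronglyMeasurable (ae_of_all _ fun x => ?_)
    rw [norm_of_nonneg (sq_nonneg _), mul_pow, mul_pow]
    refine mul_le_mul_of_nonneg_left ?_ (sq_nonneg _)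
    rcases le_total (U x) 0 with h | h
    · rw [max_eq_right h, zero_pow two_ne_zero]; positivity
    · rw [max_eq_left h]
  have hE : ∑ a, (v a / (4 * π) * (0 * D a) + v a ^ 2 / (8 * π) * M a - v a / (4 * π) * B a) ≤
      -(1 / (8 * π)) * (∫ x, (χ x * max (U x) 0) ^ 2) + ε / 2 := by
    have e1 : ∑ a, (v a / (4 * π) * (0 * D a) + v a ^ 2 / (8 * π) * M a - v a / (4 * π) * B a) =
        1 / (8 * π) * ∫ y, ∑ a, (v a ^ 2 * η a y ^ 2 - 2 * v a * (U y * η a y ^ 2)) := by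
      rw [integral_finsetSum, Finset.mul_sum]
      · refine Finset.sum_congr rfl fun a _ => ?_
        rw [integral_sub ((hηt a).1.memLp.integrable_sq.const_mul _)
          ((hU.integrable_mul_sq (hηt a)).const_mul _), integral_const_mul, integral_const_mul]
        field_simp
        ring
      · exact fun a _ => ((hηt a).1.memLp.integrable_sq.const_mul _).sub
          ((hU.integrable_mul_sq (hηt a)).const_mul _)
    have i1 : Integrable (fun y => (1 + 1 / τ) * w y ^ 2 + τ * (χ y * U y) ^ 2)
        (volume : Measure Plane) := (hw2.integrable_sq.const_mul _).add (hχU.const_mul _)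
    have e2 : ∫ y, ∑ a, (v a ^ 2 * η a y ^ 2 - 2 * v a * (U y * η a y ^ 2)) ≤
        ∫ y, ((1 + 1 / τ) * w y ^ 2 + τ * (χ y * U y) ^ 2 - (χ y * max (U y) 0) ^ 2) := by
      refine integral_mono (integrable_finsetSum _ fun a _ =>
        ((hηt a).1.memLp.integrable_sq.const_mul _).sub
          ((hU.integrable_mul_sq (hηt a)).const_mul _)) (i1.sub hχU') fun y => ?_
      have e3 : ∀ a, v a ^ 2 * η a y ^ 2 - 2 * v a * (U y * η a y ^ 2) ≤
          ((1 + 1 / τ) * w y ^ 2 + τ * U y ^ 2 - max (U y) 0 ^ 2) * η a y ^ 2 := by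
        intro a
        by_cases h0 : η a y = 0
        · simp [h0]
        · have hy : y ∈ K := subset_tsupport _ (right_ne_zero_of_mul h0)
          have h1 := hζw a y (left_ne_zero_of_mul h0)
          rw [hP, Set.indicator_of_mem hy] at h1
          nlinarith [mul_le_mul_of_nonneg_right (step_energy_le hτ0 (hv0 a) h1)
            (sq_nonneg (η a y))]
      refine (Finset.sum_le_sum fun a _ => e3 a).trans ?_
      rw [← Finset.mul_sum, hηsum]
      have h2 : 0 ≤ (1 + 1 / τ) * w y ^ 2 := by positivity
      have := mul_le_of_le_one_right h2 (hχ1 y)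
      simp only [mul_pow]
      nlinarith
    rw [integral_sub i1 hχU', integral_add (hw2.integrable_sq.const_mul _) (hχU.const_mul _),
      integral_const_mul, integral_const_mul] at e2
    have e4 : (1 + 1 / τ) * ∫ y, w y ^ 2 ≤ ε / 4 := by
      have h2 : (0 : ℝ) < 1 + 1 / τ := by positivity
      calc _ ≤ (1 + 1 / τ) * ε₁ := mul_le_mul_of_nonneg_left hwε h2.le
        _ = ε / 4 := by rw [hε₁]; field_simp
    have e5 : τ * I ≤ ε / 4 := by
      rw [hτ, div_mul_eq_mul_div, div_le_div_iff₀ (by positivity) (by norm_num)]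
      nlinarith
    rw [e1]
    have e6 : 1 / (8 * π) ≤ 1 := by rw [div_le_one (by positivity)]; linarith
    have e7 : 0 < 1 / (8 * π) := by positivity
    have e8 := mul_le_mul_of_nonneg_left e2 e7.le
    have e9 : 1 / (8 * π) * (ε / 2) ≤ ε / 2 := mul_le_of_le_one_left (by positivity) e6
    have e10 : 1 / (8 * π) * ((1 + 1 / τ) * (∫ y, w y ^ 2) + τ * I) ≤ 1 / (8 * π) * (ε / 2) :=
      mul_le_mul_of_nonneg_left (by linarith) e7.le
    linarith
  filter_upwards [hlim.eventually (gt_mem_nhds (lt_of_le_of_lt hE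
    (by linarith : _ < -(1 / (8 * π)) * (∫ x, (χ x * max (U x) 0) ^ 2) + ε))),
    self_mem_nhdsWithin] with h hlt (hh : 0 < h)
  have hn : 0 < N h := Nat.ceil_pos.2 (by positivity)
  have hside : L ≤ N h * h := by
    have := Nat.le_ceil (L / h)
    rwa [div_le_iff₀ hh] at this
  have hsq : ∀ a y, η a y ≠ 0 → y ∈ squareBox (N h * h) := by
    intro a y hy i
    have h1 := hL₁ y (subset_tsupport _ (right_ne_zero_of_mul hy))
    have h2 : |y i| ≤ ‖y‖ := by simpa using PiLp.norm_apply_le y i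
    have h3 := abs_le.1 (h2.trans (h1.trans (le_abs_self L₁)))
    constructor <;> linarith
  refine ⟨Σ a, F a (N h) × Bool, inferInstance,
    fun p y => ((N h * h)⁻¹ * wave h p.2.1 p.2.2 y) * η p.1 y,
    fun p => (hηt p.1).mul_left (contDiff_const.mul (contDiff_wave _ _ _)), fun u hu => ?_, ?_⟩
  · rw [Fintype.sum_sigma]
    have hInt : ∀ a, Integrable (fun y => (η a y * u y) ^ 2) (volume : Measure Plane) := fun a => by
      refine hu.integrable_sq.mono' (((hηt a).1.continuous.aestronglyMeasurable.mul hu.1).pow 2)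
        (ae_of_all _ fun y => ?_)
      rw [norm_of_nonneg (sq_nonneg _), mul_pow]
      exact mul_le_of_le_one_left (sq_nonneg _) (hη1 a y)
    refine (Finset.sum_le_sum fun a _ => planeWave_bessel hh hn (F a (N h)) (hFint a _ hn)
      (hηt a).1.continuous (hη1 a) (hsq a) hu).trans (le_of_eq ?_)
    rw [← integral_finsetSum _ fun a _ => hInt a]
    refine integral_congr_ae (ae_of_all _ fun y => ?_)
    simp only [mul_pow]
    rw [← Finset.sum_mul, hηsum]
  · rw [Fintype.sum_sigma, Finset.mul_sum]
    refine le_trans (le_of_eq ?_) hlt.le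
    exact Finset.sum_congr rfl fun a _ => sum_qForm_planeWave hh.ne' hU (hηt a) _

/-- A smooth quadratic partition of unity separating the singularity from infinity at scale `r`. -/
structure IsSplit (r : ℝ) (η χ : Plane → ℝ) : Prop where
  inner : ContDiff ℝ (⊤ : ℕ∞) η
  outer : ContDiff ℝ (⊤ : ℕ∞) χ
  sq_add : ∀ x, η x ^ 2 + χ x ^ 2 = 1
  inner_supp : ∀ x, η x ≠ 0 → ‖x‖ ≤ r
  outer_supp : ∀ x, ‖x‖ ≤ r / 2 → χ x = 0
  inner_grad : HasCompactSupport (fderiv ℝ η)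
  outer_grad : HasCompactSupport (fderiv ℝ χ)

lemma exists_isSplit {r : ℝ} (hr : 0 < r) : ∃ η χ, IsSplit r η χ := by
  set b : ContDiffBump (0 : Plane) := ⟨r / 2, r, by positivity, by linarith⟩ with hb
  have hbs : ContDiff ℝ (⊤ : ℕ∞) b := b.contDiff
  obtain ⟨φ, hφ⟩ : ∃ φ : Plane → ℝ, φ = fun x => π / 2 * (1 - b x) := ⟨_, rfl⟩
  have hφs : ContDiff ℝ (⊤ : ℕ∞) φ := hφ ▸ contDiff_const.mul (contDiff_const.sub hbs)
  have hφd : ∀ x, DifferentiableAt ℝ φ x := fun x => hφs.differentiable (by simp) x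
  have hout : ∀ x, r ≤ ‖x‖ → b x = 0 := fun x hx =>
    b.zero_of_le_dist (by simpa [hb] using hx)
  have hφc : HasCompactSupport (fderiv ℝ φ) := by
    have : fderiv ℝ φ = fun x => (-(π / 2)) • fderiv ℝ b x := by
      funext x
      have h1 : HasFDerivAt φ _ x := hφ ▸ ((hbs.differentiable (by simp) x).hasFDerivAt.const_sub 1).const_mul (π / 2)
      rw [h1.fderiv, smul_neg, neg_smul]
    rw [this]
    exact (b.hasCompactSupport.fderiv ℝ).smul_left (f := fun _ => -(π / 2))
  refine ⟨fun x => cos (φ x), fun x => sin (φ x), hφs.cos, hφs.sin,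
    fun x => cos_sq_add_sin_sq _, fun x hx => ?_, fun x hx => ?_, ?_, ?_⟩
  · by_contra h
    push Not at h
    simp [hφ, hout x h.le] at hx
  · have : b x = 1 := b.one_of_mem_closedBall (by simpa [hb] using hx)
    simp [hφ, this]
  · have : fderiv ℝ (fun x => cos (φ x)) = fun x => (-sin (φ x)) • fderiv ℝ φ x := by
      funext x; exact (hφd x).hasFDerivAt.cos.fderiv
    rw [this]
    exact hφc.smul_left (f := fun x => -sin (φ x))
  · have : fderiv ℝ (fun x => sin (φ x)) = fun x => cos (φ x) • fderiv ℝ φ x := by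
      funext x; exact (hφd x).hasFDerivAt.sin.fderiv
    rw [this]
    exact hφc.smul_left (f := fun x => cos (φ x))

/-- The localisation error of a split. -/
noncomputable def splitErr (η χ : Plane → ℝ) (x : Plane) : ℝ :=
  ‖fderiv ℝ η x‖ ^ 2 + ‖fderiv ℝ χ x‖ ^ 2

namespace IsSplit

variable {r : ℝ} {η χ : Plane → ℝ}

lemma inner_sq_le (s : IsSplit r η χ) (x : Plane) : η x ^ 2 ≤ 1 := by
  nlinarith [s.sq_add x, sq_nonneg (χ x)]

lemma outer_sq_le (s : IsSplit r η χ) (x : Plane) : χ x ^ 2 ≤ 1 := by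
  nlinarith [s.sq_add x, sq_nonneg (η x)]

lemma continuous_splitErr (s : IsSplit r η χ) : Continuous (splitErr η χ) :=
  ((s.inner.continuous_fderiv (by simp)).norm.pow 2).add
    ((s.outer.continuous_fderiv (by simp)).norm.pow 2)

lemma hasCompactSupport_splitErr (s : IsSplit r η χ) : HasCompactSupport (splitErr η χ) := by
  have h : ∀ f : Plane → ℝ, HasCompactSupport (fderiv ℝ f) →
      HasCompactSupport fun x => ‖fderiv ℝ f x‖ ^ 2 := fun f hf =>
    hf.comp_left (g := fun L => ‖L‖ ^ 2) (by simp)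
  exact (h η s.inner_grad).add (h χ s.outer_grad)

lemma memLp_splitErr (s : IsSplit r η χ) : MemLp (splitErr η χ) 2 (volume : Measure Plane) :=
  s.continuous_splitErr.memLp_of_hasCompactSupport s.hasCompactSupport_splitErr

lemma isPot_splitErr (s : IsSplit r η χ) (h : ℝ) : IsPot fun x => h ^ 2 * splitErr η χ x :=
  IsPot.of_continuous (continuous_const.mul s.continuous_splitErr)

lemma qForm_ims (s : IsSplit r η χ) {V f : Plane → ℝ} (hV : IsPot V) (hf : IsTest f) (h : ℝ) :
    qForm h V f = qForm h (fun x => V x + h ^ 2 * splitErr η χ x) (fun x => η x * f x) +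
      qForm h (fun x => V x + h ^ 2 * splitErr η χ x) (fun x => χ x * f x) := by
  have h1 := _root_.qForm_ims (h := h) hV hf (fun b : Bool => bif b then η else χ)
    (by rintro (_ | _); exacts [s.outer, s.inner]) (by simpa using s.sq_add)
  simpa [splitErr] using h1

/-- Truncating the outer part to a test function. -/
lemma exists_test (s : IsSplit r η χ) (hr : 0 < r) {P : Plane → ℝ}
    (hP : MemLp (fun x => χ x * P x) 2 (volume : Measure Plane)) {ε : ℝ} (hε : 0 < ε) :
    ∃ χ', IsTest χ' ∧ (∀ x, χ' x ^ 2 ≤ χ x ^ 2) ∧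
      (∫ x, (χ x * P x) ^ 2) - ε ≤ ∫ x, (χ' x * P x) ^ 2 := by
  set b : ℕ → ContDiffBump (0 : Plane) := fun N => ⟨N + 1, N + 2, by positivity, by linarith⟩
  have hb1 : ∀ N x, b N x ^ 2 ≤ 1 := fun N x => pow_le_one₀ (b N).nonneg (b N).le_one
  have hlim : Tendsto (fun N => ∫ x, (b N x * χ x * P x) ^ 2) atTop
      (nhds (∫ x, (χ x * P x) ^ 2)) := by
    refine tendsto_integral_of_dominated_convergence (fun x => (χ x * P x) ^ 2) (fun N => ?_)
      hP.integrable_sq (fun N => ae_of_all _ fun x => ?_) (ae_of_all _ fun x => ?_)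
    · simp only [mul_assoc]
      exact ((b N).continuous.aestronglyMeasurable.mul hP.1).pow 2
    · rw [norm_of_nonneg (sq_nonneg _), mul_assoc, mul_pow]
      exact mul_le_of_le_one_left (sq_nonneg _) (hb1 N x)
    · refine tendsto_const_nhds.congr' ?_
      filter_upwards [eventually_ge_atTop ⌈‖x‖⌉₊] with N hN
      have h1 : ‖x‖ ≤ N := (Nat.le_ceil _).trans (by exact_mod_cast hN)
      rw [(b N).one_of_mem_closedBall (by simp [b]; linarith), one_mul]
  obtain ⟨N, hN⟩ := (hlim.eventually (lt_mem_nhds (sub_lt_self _ hε))).exists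
  refine ⟨fun x => b N x * χ x, ⟨⟨(b N).contDiff.mul s.outer, (b N).hasCompactSupport.mul_right⟩,
    ?_⟩, fun x => ?_, hN.le⟩
  · intro x hx h0
    subst h0
    have hmem : (0 : Plane) ∉ tsupport fun x => b N x * χ x := by
      rw [notMem_tsupport_iff_eventuallyEq]
      filter_upwards [Metric.ball_mem_nhds (0 : Plane) (half_pos hr)] with y hy
      rw [s.outer_supp y (by simpa using (mem_ball_zero_iff.1 hy).le)]
      simp
    exact hmem hx
  · rw [mul_pow]
    exact mul_le_of_le_one_left (sq_nonneg _) (hb1 N x)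

lemma memLp_indicator {P : Plane → ℝ} (s : IsSplit r η χ) (hPm : Measurable P)
    (hP : IntegrableOn (fun x => P x ^ 2) {x : Plane | r / 2 ≤ ‖x‖} volume) :
    MemLp ({x : Plane | r / 2 ≤ ‖x‖}.indicator P) 2 (volume : Measure Plane) ∧
      ∀ x, χ x * {x : Plane | r / 2 ≤ ‖x‖}.indicator P x = χ x * P x := by
  have hm : MeasurableSet {x : Plane | r / 2 ≤ ‖x‖} := measurableSet_le measurable_const measurable_norm
  constructor
  · rw [memLp_two_iff_integrable_sq (hPm.indicator hm).aestronglyMeasurable]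
    refine ((integrable_indicator_iff hm).2 hP).congr (ae_of_all _ fun x => ?_)
    by_cases hx : x ∈ {x : Plane | r / 2 ≤ ‖x‖}
    · simp only [Set.indicator_of_mem hx]
    · simp [Set.indicator_of_notMem hx]
  · intro x
    by_cases hx : x ∈ {x : Plane | r / 2 ≤ ‖x‖}
    · rw [Set.indicator_of_mem hx]
    · rw [s.outer_supp x (not_le.1 hx).le]; simp

lemma memLp_mul (s : IsSplit r η χ) {P : Plane → ℝ} (hPm : Measurable P)
    (hP : IntegrableOn (fun x => P x ^ 2) {x : Plane | r / 2 ≤ ‖x‖} volume) :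
    MemLp (fun x => χ x * P x) 2 (volume : Measure Plane) := by
  obtain ⟨h1, h2⟩ := s.memLp_indicator hPm hP
  simp only [← h2]
  refine h1.mono (s.outer.continuous.aestronglyMeasurable.mul h1.1) (ae_of_all _ fun x => ?_)
  rw [norm_mul]
  refine mul_le_of_le_one_left (norm_nonneg _) ?_
  rw [norm_eq_abs]
  exact abs_le_one_iff_mul_self_le_one.2 (by nlinarith [s.outer_sq_le x])

end IsSplit

lemma isPot_rpow (q : ℝ) : IsPot fun x : Plane => ‖x‖ ^ (-q) := by
  refine IsPot.of_continuousOn (measurable_norm.pow_const _) fun x hx => ?_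
  exact (continuous_norm.continuousAt.rpow_const (Or.inl (norm_ne_zero_iff.2 hx))).continuousWithinAt

lemma isPot_hydPot (κ c q : ℝ) : IsPot (hydPot κ c q) := by
  refine IsPot.add (V := fun x => κ * (‖x‖⁻¹ - 1)) (U := fun x => c * ‖x‖ ^ (-q)) ?_
    ((isPot_rpow q).const_mul c)
  have h1 : IsPot fun x : Plane => ‖x‖⁻¹ := by
    simpa [rpow_neg_one] using isPot_rpow 1
  exact (h1.add (IsPot.const (-1))).const_mul κ

lemma hydPot_zero (κ q : ℝ) (x : Plane) : hydPot κ 0 q x = κ * (‖x‖⁻¹ - 1) := by simp [hydPot]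

lemma qForm_hydPot (κ c q h : ℝ) {f : Plane → ℝ} (hf : IsTest f) :
    qForm h (hydPot κ c q) f = qForm h (hydPot κ 0 q) f - c * ∫ x, ‖x‖ ^ (-q) * f x ^ 2 := by
  rw [← integral_const_mul]
  have := qForm_add (h := h) (isPot_hydPot κ 0 q) ((isPot_rpow q).const_mul c) hf
  simp only [mul_assoc] at this
  rw [← this]
  congr 1
  funext x
  simp [hydPot]

lemma sum_qForm_hydPot (κ c q h : ℝ) {ι : Type*} [Fintype ι] {f : ι → Plane → ℝ}
    (hf : ∀ i, IsTest (f i)) : ∑ i, qForm h (hydPot κ c q) (f i) =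
      (∑ i, qForm h (hydPot κ 0 q) (f i)) - c * ∑ i, ∫ x, ‖x‖ ^ (-q) * f i x ^ 2 := by
  simp only [fun i => qForm_hydPot κ c q h (hf i), Finset.sum_sub_distrib, Finset.mul_sum]

lemma integrableOn_hydPot_sq {κ : ℝ} (hκ : 0 < κ) (q : ℝ) {r : ℝ} (hr : 0 < r) :
    IntegrableOn (fun x => max (hydPot κ 0 q x) 0 ^ 2) {x : Plane | r ≤ ‖x‖} volume := by
  have hm : MeasurableSet {x : Plane | r ≤ ‖x‖} := measurableSet_le measurable_const measurable_norm
  have hK : IsCompact ({x : Plane | r ≤ ‖x‖} ∩ Metric.closedBall 0 1) :=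
    (isCompact_closedBall _ _).inter_left (isClosed_le continuous_const continuous_norm)
  have h1 := (isPot_hydPot κ 0 q).loc _ hK fun h => by
    have : r ≤ ‖(0 : Plane)‖ := h.1
    rw [norm_zero] at this
    linarith
  rw [← integrable_indicator_iff hK.measurableSet] at h1
  refine h1.integrableOn.mono' (((isPot_hydPot κ 0 q).meas.max
    measurable_const).pow_const 2).aestronglyMeasurable
    ((ae_restrict_iff' hm).2 (ae_of_all _ fun x hx => ?_))
  rw [norm_of_nonneg (sq_nonneg _)]
  by_cases hx1 : ‖x‖ ≤ 1
  · have hxK : x ∈ {x : Plane | r ≤ ‖x‖} ∩ Metric.closedBall 0 1 := ⟨hx, by simpa using hx1⟩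
    rw [Set.indicator_of_mem hxK]
    rcases le_total (hydPot κ 0 q x) 0 with h | h
    · rw [max_eq_right h, zero_pow two_ne_zero]; positivity
    · rw [max_eq_left h]
  · have h2 : ‖x‖⁻¹ ≤ 1 := inv_le_one_of_one_le₀ (not_le.1 hx1).le
    rw [max_eq_right, zero_pow two_ne_zero]
    · exact Set.indicator_nonneg (fun _ _ => sq_nonneg _) _
    · rw [hydPot_zero]; exact mul_nonpos_of_nonneg_of_nonpos hκ.le (by linarith)

namespace IsSplit

variable {r : ℝ} {η χ : Plane → ℝ}

lemma eventually_splitErr_le (s : IsSplit r η χ) (hr1 : r ≤ 1) {c q : ℝ} (hc : 0 < c)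
    (hq : 0 ≤ q) : ∀ᶠ h in nhdsWithin (0 : ℝ) (Set.Ioi 0), ∀ x : Plane, x ≠ 0 → ‖x‖ ≤ r →
      h ^ 2 * splitErr η χ x ≤ c * ‖x‖ ^ (-q) := by
  obtain ⟨B, hB⟩ := s.hasCompactSupport_splitErr.exists_bound_of_continuous s.continuous_splitErr
  have hlim : Tendsto (fun h : ℝ => h ^ 2 * B) (nhds 0) (nhds 0) := by
    have : Continuous fun h : ℝ => h ^ 2 * B := by fun_prop
    simpa using this.tendsto 0
  filter_upwards [nhdsWithin_le_nhds (hlim.eventually (gt_mem_nhds hc))] with h hh x hx hxr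
  have h1 : splitErr η χ x ≤ B := (le_abs_self _).trans (hB x)
  have h2 : 1 ≤ ‖x‖ ^ (-q) :=
    one_le_rpow_of_pos_of_le_one_of_nonpos (norm_pos_iff.2 hx) (hxr.trans hr1) (by linarith)
  have h3 := mul_le_mul_of_nonneg_left h1 (sq_nonneg h)
  nlinarith

lemma bessel_inner (s : IsSplit r η χ) {ι : Type*} [Fintype ι] {f : ι → Plane → ℝ}
    (hf : ∀ i, IsTest (f i)) (hon : SubON volume f) {u : Plane → ℝ} (hu : MemLp u 2 volume) :
    ∑ i, (∫ x, η x * f i x * u x) ^ 2 ≤ ∫ x, (η x * u x) ^ 2 := by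
  have hηu : MemLp (fun y => η y * u y) 2 volume := by
    refine hu.mono (s.inner.continuous.aestronglyMeasurable.mul hu.1) (ae_of_all _ fun y => ?_)
    rw [norm_mul]
    refine mul_le_of_le_one_left (norm_nonneg _) ?_
    rw [norm_eq_abs]
    exact abs_le_one_iff_mul_self_le_one.2 (by nlinarith [s.inner_sq_le y])
  refine le_trans (le_of_eq (Finset.sum_congr rfl fun i _ => ?_))
    (hon.bessel (fun i => (hf i).1.memLp) hηu)
  congr 1
  exact integral_congr_ae (ae_of_all _ fun x => by ring)

/-- Joining an inner family with an outer trial family. -/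
lemma subON_join (s : IsSplit r η χ) {ι : Type*} [Fintype ι] {f : ι → Plane → ℝ}
    (hf : ∀ i, IsTest (f i)) (hon : SubON volume f) {χ' : Plane → ℝ} (hχ' : IsTest χ')
    (hle : ∀ x, χ' x ^ 2 ≤ χ x ^ 2) {ι' : Type*} [Fintype ι'] {t : ι' → Plane → ℝ}
    (ht : ∀ i, IsTest (t i))
    (hb : ∀ u, MemLp u 2 volume → ∑ i, (∫ x, t i x * u x) ^ 2 ≤ ∫ x, (χ' x * u x) ^ 2) :
    SubON volume (Sum.elim (fun i x => η x * f i x) t) :=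
  SubON.sum_elim (fun i => ((hf i).mul_left s.inner).1.memLp) (fun i => (ht i).1.memLp) η χ'
    s.inner.continuous.measurable hχ'.1.continuous.measurable
    (fun x => by linarith [s.sq_add x, hle x]) (fun _ hu => s.bessel_inner hf hon hu) hb

end IsSplit

lemma one_div_eight_pi_mul_le {a : ℝ} (ha : 0 ≤ a) : 1 / (8 * π) * a ≤ a :=
  mul_le_of_le_one_left ha (by rw [div_le_one (by positivity)]; linarith [pi_gt_three])

/-- Lower bound for the trace in terms of the hydrogen trace and a semiclassical correction. -/
lemma trace_ge_of_split {κ q r σ M ε : ℝ} (hκ : 0 < κ) (hq0 : 1 / 2 ≤ q) (hr : 0 < r)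
    (hr1 : r ≤ 1) (hσ0 : 0 < σ) (hσ1 : σ ≤ 1) (hε : 0 < ε)
    (hM : ∀ᶠ h in nhdsWithin (0 : ℝ) (Set.Ioi 0), ∀ (ι : Type) [Fintype ι] (f : ι → Plane → ℝ),
      (∀ i, IsTest (f i)) → SubON volume f →
      coulombTerm κ h - M ≤ h ^ 2 * ∑ i, qForm h (hydPot κ (κ / 2) q) (f i))
    {V : Plane → ℝ} (hV : IsPot V)
    (hfar : IntegrableOn (fun x => max (V x) 0 ^ 2) {x : Plane | r / 2 ≤ ‖x‖} volume)
    (hsing : ∀ x : Plane, x ≠ 0 → ‖x‖ ≤ r →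
      |V x - hydPot κ 0 q x| ≤ σ * κ / 4 * ‖x‖ ^ (-q))
    {η χ : Plane → ℝ} (s : IsSplit r η χ) :
    ∀ᶠ h in nhdsWithin (0 : ℝ) (Set.Ioi 0), ∀ (ι : Type) [Fintype ι] (f : ι → Plane → ℝ),
      (∀ i, IsTest (f i)) → SubON volume f →
      coulombTerm κ h - σ * M - 1 / (8 * π) * ((∫ x, (χ x * max (V x) 0) ^ 2) -
        ∫ x, (χ x * max (hydPot κ 0 q x) 0) ^ 2) - 4 * ε ≤ h ^ 2 * ∑ i, qForm h V (f i) := by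
  have hr2 : 0 < r / 2 := by positivity
  have hWfar := integrableOn_hydPot_sq hκ q hr2
  have hW := isPot_hydPot κ 0 q
  obtain ⟨χ', hχ', hχle, hχε⟩ := s.exists_test hr
    (s.memLp_mul (hW.meas.max measurable_const) hWfar) hε
  obtain ⟨hP, hPe⟩ := s.memLp_indicator (hV.meas.max measurable_const) hfar
  have hout := outer_lower hV s.outer s.outer_sq_le s.continuous_splitErr s.memLp_splitErr hP
    ((hV.meas.max measurable_const).indicator (measurableSet_le measurable_const measurable_norm))
    (fun x => Set.indicator_nonneg (fun _ _ => le_max_right _ _) x)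
    (fun x hx => (le_max_left (V x) 0).trans (le_of_eq
      (mul_left_cancel₀ hx (hPe x).symm))) hε
  simp only [hPe] at hout
  filter_upwards [hout, exists_outer_trial hW hχ' (fun x => (hχle x).trans (s.outer_sq_le x)) hε,
    hM, hyd_trace_ge hκ hε, s.eventually_splitErr_le hr1 (show 0 < σ * κ / 4 by positivity)
      (show 0 ≤ q by linarith), self_mem_nhdsWithin]
    with h h1 ⟨ι', _, t, ht, htb, hte⟩ h3 h4 h5 (hh : 0 < h) ι _ f hf hon
  have hc : 0 ≤ σ * (κ / 2) := by positivity
  have hηf : ∀ i, IsTest fun x => η x * f i x := fun i => (hf i).mul_left s.inner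
  have hon' := s.subON_join hf hon hχ' hχle ht htb
  have htest : ∀ j, IsTest (Sum.elim (fun i x => η x * f i x) t j) := by
    rintro (i | j); exacts [hηf i, ht j]
  have a1 := h1 ι f hf hon
  have a3 := h3 _ _ htest hon'
  have a4 := h4 _ _ htest hon'
  have e0 : hydPot κ 0 (1 / 2) = hydPot κ 0 q := by funext x; simp [hydPot]
  rw [e0] at a4
  have hQ := sum_qForm_hydPot κ (σ * (κ / 2)) q h htest
  rw [sum_qForm_hydPot κ (κ / 2) q h htest] at a3
  have hsplit : ∑ j, qForm h (hydPot κ (σ * (κ / 2)) q) (Sum.elim (fun i x => η x * f i x) t j) =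
      (∑ i, qForm h (hydPot κ (σ * (κ / 2)) q) fun x => η x * f i x) +
        ∑ j, qForm h (hydPot κ (σ * (κ / 2)) q) (t j) := by
    rw [Fintype.sum_sum_type]; rfl
  have hin : (∑ i, qForm h (hydPot κ (σ * (κ / 2)) q) fun x => η x * f i x) ≤
      ∑ i, qForm h (fun x => V x + h ^ 2 * splitErr η χ x) fun x => η x * f i x := by
    refine Finset.sum_le_sum fun i _ => qForm_anti (hV.add (s.isPot_splitErr h))
      (isPot_hydPot _ _ _) (hηf i) fun x hx => ?_
    have hxr := s.inner_supp x (left_ne_zero_of_mul hx)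
    have hx0 : x ≠ 0 := (hf i).2 (subset_tsupport _ (right_ne_zero_of_mul hx))
    have b1 := (abs_le.1 (hsing x hx0 hxr)).2
    have b2 := h5 x hx0 hxr
    have b3 : hydPot κ (σ * (κ / 2)) q x = hydPot κ 0 q x + σ * (κ / 2) * ‖x‖ ^ (-q) := by
      simp [hydPot]
    rw [b3]
    linarith
  have htr : ∑ j, qForm h (hydPot κ (σ * (κ / 2)) q) (t j) ≤
      ∑ j, qForm h (hydPot κ 0 q) (t j) := by
    refine Finset.sum_le_sum fun j _ => qForm_anti hW (isPot_hydPot _ _ _) (ht j) fun x _ => ?_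
    have : 0 ≤ σ * (κ / 2) * ‖x‖ ^ (-q) := by positivity
    simp only [hydPot]
    linarith
  have hims : ∑ i, qForm h V (f i) =
      (∑ i, qForm h (fun x => V x + h ^ 2 * splitErr η χ x) fun x => η x * f i x) +
      ∑ i, qForm h (fun x => V x + h ^ 2 * splitErr η χ x) fun x => χ x * f i x := by
    rw [← Finset.sum_add_distrib]
    exact Finset.sum_congr rfl fun i _ => s.qForm_ims hV (hf i) h
  have hh2 : 0 < h ^ 2 := by positivity
  have c1 := mul_le_mul_of_nonneg_left hin hh2.le
  have c2 := mul_le_mul_of_nonneg_left htr hh2.le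
  have c3 : 1 / (8 * π) * ((∫ x, (χ x * max (hydPot κ 0 q x) 0) ^ 2) - ε) ≤
      1 / (8 * π) * ∫ x, (χ' x * max (hydPot κ 0 q x) 0) ^ 2 :=
    mul_le_mul_of_nonneg_left hχε (by positivity)
  have c4 := one_div_eight_pi_mul_le hε.le
  have c5 := mul_le_mul_of_nonneg_left a3 hσ0.le
  have c6 := mul_le_mul_of_nonneg_left a4 (sub_nonneg.2 hσ1)
  have c7 : (1 - σ) * ε ≤ ε := mul_le_of_le_one_left hε.le (by linarith)
  rw [hsplit] at hQ
  rw [hims]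
  set X := ∑ i, qForm h (hydPot κ 0 q) (Sum.elim (fun i x => η x * f i x) t i)
  set Y := ∑ i, ∫ x, ‖x‖ ^ (-q) * Sum.elim (fun i x => η x * f i x) t i x ^ 2
  have hQ' := congrArg (fun z => h ^ 2 * z) hQ
  beta_reduce at hQ'
  linear_combination a1 + hte + c1 + c2 + c3 + c4 + c5 + c6 + c7 - hQ'

/-- Upper bound by trial families, in terms of the hydrogen trace and a semiclassical
correction. -/
lemma exists_family_of_split {κ q r σ M ε : ℝ} (hκ : 0 < κ) (hq0 : 1 / 2 ≤ q) (hr : 0 < r)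
    (hr1 : r ≤ 1) (hσ0 : 0 < σ) (hσ1 : σ ≤ 1) (hε : 0 < ε)
    (hM : ∀ᶠ h in nhdsWithin (0 : ℝ) (Set.Ioi 0), ∀ (ι : Type) [Fintype ι] (f : ι → Plane → ℝ),
      (∀ i, IsTest (f i)) → SubON volume f →
      coulombTerm κ h - M ≤ h ^ 2 * ∑ i, qForm h (hydPot κ (κ / 2) q) (f i))
    {V : Plane → ℝ} (hV : IsPot V)
    (hfar : IntegrableOn (fun x => max (V x) 0 ^ 2) {x : Plane | r / 2 ≤ ‖x‖} volume)
    (hsing : ∀ x : Plane, x ≠ 0 → ‖x‖ ≤ r →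
      |V x - hydPot κ 0 q x| ≤ σ * κ / 4 * ‖x‖ ^ (-q))
    {η χ : Plane → ℝ} (s : IsSplit r η χ) :
    ∀ᶠ h in nhdsWithin (0 : ℝ) (Set.Ioi 0), ∃ (ι : Type) (_ : Fintype ι) (f : ι → Plane → ℝ),
      (∀ i, IsTest (f i)) ∧ SubON volume f ∧
      h ^ 2 * ∑ i, qForm h V (f i) ≤
        coulombTerm κ h + σ * M - 1 / (8 * π) * ((∫ x, (χ x * max (V x) 0) ^ 2) -
          ∫ x, (χ x * max (hydPot κ 0 q x) 0) ^ 2) + 5 * ε := by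
  have hr2 : 0 < r / 2 := by positivity
  have hWfar := integrableOn_hydPot_sq hκ q hr2
  have hW := isPot_hydPot κ 0 q
  have hc : 0 ≤ σ * (κ / 2) := by positivity
  have hneg : ∀ x : Plane, hydPot κ (-(σ * (κ / 2))) q x =
      hydPot κ 0 q x - σ * (κ / 2) * ‖x‖ ^ (-q) := fun x => by simp [hydPot]; ring
  obtain ⟨χ', hχ', hχle, hχε⟩ := s.exists_test hr
    (s.memLp_mul (hV.meas.max measurable_const) hfar) hε
  obtain ⟨hP, hPe⟩ := s.memLp_indicator (hW.meas.max measurable_const) hWfar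
  have hout := outer_lower (isPot_hydPot κ (-(σ * (κ / 2))) q) s.outer s.outer_sq_le
    s.continuous_splitErr s.memLp_splitErr hP
    ((hW.meas.max measurable_const).indicator (measurableSet_le measurable_const measurable_norm))
    (fun x => Set.indicator_nonneg (fun _ _ => le_max_right _ _) x)
    (fun x hx => by
      rw [mul_left_cancel₀ hx (hPe x), hneg]
      have : 0 ≤ σ * (κ / 2) * ‖x‖ ^ (-q) := by positivity
      linarith [le_max_left (hydPot κ 0 q x) 0]) hε
  simp only [hPe] at hout
  filter_upwards [hout, exists_outer_trial hV hχ' (fun x => (hχle x).trans (s.outer_sq_le x)) hε,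
    hM, exists_hyd_trial hκ hε q, s.eventually_splitErr_le hr1 (show 0 < σ * κ / 4 by positivity)
      (show 0 ≤ q by linarith), self_mem_nhdsWithin]
    with h h1 ⟨ι', _, t, ht, htb, hte⟩ h3 ⟨ι, _, f, hf, hon, hfe⟩ h5 (hh : 0 < h)
  have hηf : ∀ i, IsTest fun x => η x * f i x := fun i => (hf i).mul_left s.inner
  refine ⟨ι ⊕ ι', inferInstance, Sum.elim (fun i x => η x * f i x) t,
    by rintro (i | j); exacts [hηf i, ht j], s.subON_join hf hon hχ' hχle ht htb, ?_⟩
  have a1 := h1 ι f hf hon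
  have a3 := h3 ι f hf hon
  rw [sum_qForm_hydPot κ (κ / 2) q h hf] at a3
  have hQ := sum_qForm_hydPot κ (-(σ * (κ / 2))) q h hf
  have hsplit : ∑ j, qForm h V (Sum.elim (fun i x => η x * f i x) t j) =
      (∑ i, qForm h V fun x => η x * f i x) + ∑ j, qForm h V (t j) := by
    rw [Fintype.sum_sum_type]; rfl
  have hin : (∑ i, qForm h V fun x => η x * f i x) ≤
      ∑ i, qForm h (fun x => hydPot κ (-(σ * (κ / 2))) q x + h ^ 2 * splitErr η χ x)
        fun x => η x * f i x := by
    refine Finset.sum_le_sum fun i _ => qForm_anti ((isPot_hydPot _ _ _).add (s.isPot_splitErr h))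
      hV (hηf i) fun x hx => ?_
    have hxr := s.inner_supp x (left_ne_zero_of_mul hx)
    have hx0 : x ≠ 0 := (hf i).2 (subset_tsupport _ (right_ne_zero_of_mul hx))
    have b1 := (abs_le.1 (hsing x hx0 hxr)).1
    have b2 := h5 x hx0 hxr
    rw [hneg]
    linarith
  have hims : ∑ i, qForm h (hydPot κ (-(σ * (κ / 2))) q) (f i) =
      (∑ i, qForm h (fun x => hydPot κ (-(σ * (κ / 2))) q x + h ^ 2 * splitErr η χ x)
        fun x => η x * f i x) +
      ∑ i, qForm h (fun x => hydPot κ (-(σ * (κ / 2))) q x + h ^ 2 * splitErr η χ x)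
        fun x => χ x * f i x := by
    rw [← Finset.sum_add_distrib]
    exact Finset.sum_congr rfl fun i _ => s.qForm_ims (isPot_hydPot _ _ _) (hf i) h
  have hh2 : 0 < h ^ 2 := by positivity
  have c1 := mul_le_mul_of_nonneg_left hin hh2.le
  have c3 : 1 / (8 * π) * ((∫ x, (χ x * max (V x) 0) ^ 2) - ε) ≤
      1 / (8 * π) * ∫ x, (χ' x * max (V x) 0) ^ 2 :=
    mul_le_mul_of_nonneg_left hχε (by positivity)
  have c4 := one_div_eight_pi_mul_le hε.le
  have c5 := mul_le_mul_of_nonneg_left a3 hσ0.le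
  have c6 := mul_le_mul_of_nonneg_left hfe hσ0.le
  have c7 : σ * ε ≤ ε := mul_le_of_le_one_left hε.le hσ1
  rw [hsplit]
  rw [hims] at hQ
  set X := ∑ i, qForm h (hydPot κ 0 q) (f i)
  set Y := ∑ i, ∫ x, ‖x‖ ^ (-q) * f i x ^ 2
  have hQ' := congrArg (fun z => h ^ 2 * z) hQ
  beta_reduce at hQ'
  linear_combination a1 + hte + c1 + c3 + c4 + c5 + c6 + c7 + hfe + hQ'

lemma tendsto_volume_closedBall :
    Tendsto (fun r : ℝ => volume (Metric.closedBall (0 : Plane) r)) (nhdsWithin 0 (Set.Ioi 0))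
      (nhds 0) := by
  have h1 : Tendsto (fun r : ℝ => ENNReal.ofReal (r ^ 2) * volume (Metric.ball (0 : Plane) 1))
      (nhds 0) (nhds (ENNReal.ofReal (0 ^ 2) * volume (Metric.ball (0 : Plane) 1))) :=
    ENNReal.Tendsto.mul_const (ENNReal.tendsto_ofReal ((continuous_pow 2).tendsto 0))
      (Or.inr measure_ball_lt_top.ne)
  rw [zero_pow two_ne_zero, ENNReal.ofReal_zero, zero_mul] at h1
  refine (h1.mono_left nhdsWithin_le_nhds).congr' ?_
  filter_upwards [self_mem_nhdsWithin] with r (hr : 0 < r)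
  rw [Measure.addHaar_closedBall _ _ hr.le]
  simp

lemma integrableOn_rpow_closedBall {p : ℝ} (hp : -2 < p) (R : ℝ) (hR : 0 < R) :
    IntegrableOn (fun x : Plane => ‖x‖ ^ p) (Metric.ball 0 R) volume := by
  rw [← integrable_indicator_iff measurableSet_ball]
  have h1 : (Metric.ball (0 : Plane) R).indicator (fun x => ‖x‖ ^ p) =
      fun x => (Set.Iio R).indicator (fun t : ℝ => t ^ p) ‖x‖ := by
    funext x
    by_cases hx : ‖x‖ < R
    · rw [Set.indicator_of_mem (by simpa using hx), Set.indicator_of_mem (by simpa using hx)]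
    · rw [Set.indicator_of_notMem (by simpa using hx), Set.indicator_of_notMem (by simpa using hx)]
  rw [h1, integrable_fun_norm_addHaar (volume : Measure Plane)
    (f := (Set.Iio R).indicator fun t : ℝ => t ^ p)]
  have h2 := (intervalIntegral.integrableOn_Ioo_rpow_iff (s := p + 1) hR).2 (by linarith)
  rw [← integrable_indicator_iff measurableSet_Ioo] at h2
  rw [← integrable_indicator_iff measurableSet_Ioi]
  refine h2.congr (ae_of_all _ fun t => ?_)
  by_cases ht : 0 < t
  · rw [Set.indicator_of_mem (show t ∈ Set.Ioi 0 from ht)]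
    by_cases htR : t < R
    · simp only [Set.indicator_of_mem (show t ∈ Set.Ioo 0 R from ⟨ht, htR⟩),
        Set.indicator_of_mem (show t ∈ Set.Iio R from htR)]
      rw [rpow_add_one ht.ne']
      simp [mul_comm]
    · rw [Set.indicator_of_notMem (fun h => htR h.2), Set.indicator_of_notMem (show t ∉ Set.Iio R from htR)]
      simp
  · rw [Set.indicator_of_notMem (fun h => ht h.1), Set.indicator_of_notMem (show t ∉ Set.Ioi 0 from ht)]

section Correction

variable {κ θ A ρ q : ℝ} {V : Plane → ℝ}

lemma integrableOn_posPart_sq (hV : IsPot V)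
    (hfar : IntegrableOn (fun x => max (V x) 0 ^ 2) {x : Plane | 1 ≤ ‖x‖} volume) {r : ℝ}
    (hr : 0 < r) : IntegrableOn (fun x => max (V x) 0 ^ 2) {x : Plane | r ≤ ‖x‖} volume := by
  have hK : IsCompact ({x : Plane | r ≤ ‖x‖} ∩ Metric.closedBall 0 1) :=
    (isCompact_closedBall _ _).inter_left (isClosed_le continuous_const continuous_norm)
  have h1 := hV.loc _ hK fun h => by
    have : r ≤ ‖(0 : Plane)‖ := h.1
    rw [norm_zero] at this
    linarith
  have h2 : IntegrableOn (fun x => max (V x) 0 ^ 2)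
      ({x : Plane | r ≤ ‖x‖} ∩ Metric.closedBall 0 1) volume := by
    refine h1.mono' ((hV.meas.max measurable_const).pow_const 2).aestronglyMeasurable
      (ae_of_all _ fun x => ?_)
    rw [norm_of_nonneg (sq_nonneg _)]
    rcases le_total (V x) 0 with h | h
    · rw [max_eq_right h, zero_pow two_ne_zero]; positivity
    · rw [max_eq_left h]
  refine (h2.union hfar).mono_set fun x hx => ?_
  rcases le_total ‖x‖ 1 with h | h
  · exact Or.inl ⟨hx, by simpa using h⟩
  · exact Or.inr h

lemma integrable_posPart_sq_sub (hκ : 0 < κ) (hθ0 : 0 < θ) (hθ1 : θ < 1) (hA : 0 ≤ A)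
    (hρ : 0 < ρ) (hρ1 : ρ ≤ 1) (hV : IsPot V)
    (hfar : IntegrableOn (fun x => max (V x) 0 ^ 2) {x : Plane | 1 ≤ ‖x‖} volume)
    (hsing : ∀ x : Plane, x ≠ 0 → ‖x‖ ≤ ρ → |V x - hydPot κ 0 q x| ≤ A * ‖x‖ ^ (-θ)) :
    Integrable (fun x => max (V x) 0 ^ 2 - max (hydPot κ 0 q x) 0 ^ 2)
      (volume : Measure Plane) := by
  have hm : Measurable fun x => max (V x) 0 ^ 2 - max (hydPot κ 0 q x) 0 ^ 2 :=
    ((hV.meas.max measurable_const).pow_const 2).sub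
      (((isPot_hydPot κ 0 q).meas.max measurable_const).pow_const 2)
  have h1 : IntegrableOn (fun x => max (V x) 0 ^ 2 - max (hydPot κ 0 q x) 0 ^ 2)
      {x : Plane | ρ ≤ ‖x‖} volume :=
    (integrableOn_posPart_sq hV hfar hρ).sub (integrableOn_hydPot_sq hκ q hρ)
  have h2 : IntegrableOn (fun x => max (V x) 0 ^ 2 - max (hydPot κ 0 q x) 0 ^ 2)
      (Metric.ball 0 ρ) volume := by
    refine ((integrableOn_rpow_closedBall (p := -1 - θ) (by linarith) ρ hρ).const_mul
      (A * (2 * κ + A))).mono' hm.aestronglyMeasurable ?_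
    have hne : ∀ᵐ x : Plane, x ≠ 0 := by
      rw [ae_iff]; simp
    filter_upwards [ae_restrict_of_ae hne, ae_restrict_mem measurableSet_ball] with x hx0 hx
    have hxρ : ‖x‖ < ρ := by simpa using hx
    have hn : 0 < ‖x‖ := norm_pos_iff.2 hx0
    have b1 := hsing x hx0 hxρ.le
    set v := max (V x) 0
    set w := max (hydPot κ 0 q x) 0 with hw
    have b2 : |v - w| ≤ A * ‖x‖ ^ (-θ) := (abs_max_sub_max_le_abs _ _ _).trans b1
    have b3 : w ≤ κ * ‖x‖⁻¹ := by
      refine max_le ?_ (by positivity)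
      rw [hydPot_zero]
      nlinarith
    have b4 : 0 ≤ w := le_max_right _ _
    have b5 : ‖x‖ ^ (-θ) ≤ ‖x‖⁻¹ := by
      rw [← rpow_neg_one]
      exact rpow_le_rpow_of_exponent_ge hn (hxρ.le.trans hρ1) (by linarith)
    have b6 : ‖x‖ ^ (-1 - θ) = ‖x‖ ^ (-θ) * ‖x‖⁻¹ := by
      rw [← rpow_neg_one, ← rpow_add hn]; congr 1; ring
    have b7 : |v + w| ≤ (2 * κ + A) * ‖x‖⁻¹ := by
      have : v + w = (v - w) + 2 * w := by ring
      rw [this]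
      refine (abs_add_le _ _).trans ?_
      rw [abs_of_nonneg (by linarith : 0 ≤ 2 * w)]
      nlinarith
    rw [norm_eq_abs, sq_sub_sq, abs_mul, b6]
    calc |v + w| * |v - w| ≤ ((2 * κ + A) * ‖x‖⁻¹) * (A * ‖x‖ ^ (-θ)) :=
          mul_le_mul b7 b2 (abs_nonneg _) (by positivity)
      _ = _ := by ring
  have h3 := h2.union h1
  rw [← integrableOn_univ]
  refine h3.mono_set fun x _ => ?_
  rcases lt_or_ge ‖x‖ ρ with h | h
  · exact Or.inl (by simpa using h)
  · exact Or.inr h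

lemma tendsto_split_correction {D : Plane → ℝ} (hD : Integrable D (volume : Measure Plane))
    {ε : ℝ} (hε : 0 < ε) :
    ∀ᶠ r in nhdsWithin (0 : ℝ) (Set.Ioi 0), ∀ η χ : Plane → ℝ, IsSplit r η χ →
      |(∫ x, χ x ^ 2 * D x) - ∫ x, D x| ≤ ε := by
  have hlim := hD.norm.tendsto_setIntegral_nhds_zero tendsto_volume_closedBall
  filter_upwards [hlim.eventually (gt_mem_nhds hε)] with r hr η χ s
  have hi : Integrable (fun x => χ x ^ 2 * D x) (volume : Measure Plane) := by
    refine hD.norm.mono' ((s.outer.continuous.pow 2).aestronglyMeasurable.mul hD.1)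
      (ae_of_all _ fun x => ?_)
    rw [norm_mul, norm_of_nonneg (sq_nonneg _)]
    exact mul_le_of_le_one_left (norm_nonneg _) (s.outer_sq_le x)
  rw [← integral_sub hi hD, ← norm_eq_abs]
  refine (norm_integral_le_integral_norm _).trans (le_trans ?_ hr.le)
  rw [← integral_indicator Metric.isClosed_closedBall.measurableSet]
  refine integral_mono (hi.sub hD).norm
    (hD.norm.indicator Metric.isClosed_closedBall.measurableSet) fun x => ?_
  have e : χ x ^ 2 * D x - D x = -(η x ^ 2 * D x) := by
    have := s.sq_add x
    linear_combination (D x) * this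
  simp only [e]
  rw [norm_neg, norm_mul, norm_of_nonneg (sq_nonneg _)]
  by_cases h0 : η x = 0
  · rw [h0, zero_pow two_ne_zero, zero_mul]
    exact Set.indicator_nonneg (fun _ _ => norm_nonneg _) _
  · rw [Set.indicator_of_mem (by simpa using s.inner_supp x h0)]
    exact mul_le_of_le_one_left (norm_nonneg _) (s.inner_sq_le x)

end Correction

/-- Trace asymptotics up to an arbitrary error, over sub-orthonormal families. -/
lemma trace_asymptotics {κ θ q A ρ : ℝ} {V : Plane → ℝ} (hκ : 0 < κ) (hθ0 : 0 < θ) (hθ1 : θ < 1)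
    (hq0 : 1 / 2 ≤ q) (hθq : θ < q) (hq1 : q < 1) (hA : 0 ≤ A) (hρ : 0 < ρ) (hρ1 : ρ ≤ 1)
    (hV : IsPot V)
    (hfar : IntegrableOn (fun x => max (V x) 0 ^ 2) {x : Plane | 1 ≤ ‖x‖} volume)
    (hsing : ∀ x : Plane, x ≠ 0 → ‖x‖ ≤ ρ → |V x - hydPot κ 0 q x| ≤ A * ‖x‖ ^ (-θ))
    {ε : ℝ} (hε : 0 < ε) :
    ∀ᶠ h in nhdsWithin (0 : ℝ) (Set.Ioi 0),
      (∀ (ι : Type) [Fintype ι] (f : ι → Plane → ℝ), (∀ i, IsTest (f i)) → SubON volume f →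
        coulombTerm κ h - 1 / (8 * π) * (∫ x, (max (V x) 0 ^ 2 - max (hydPot κ 0 q x) 0 ^ 2)) -
          6 * ε ≤ h ^ 2 * ∑ i, qForm h V (f i)) ∧
      ∃ (ι : Type) (_ : Fintype ι) (f : ι → Plane → ℝ),
        (∀ i, IsTest (f i)) ∧ SubON volume f ∧ h ^ 2 * ∑ i, qForm h V (f i) ≤
          coulombTerm κ h - 1 / (8 * π) * (∫ x, (max (V x) 0 ^ 2 - max (hydPot κ 0 q x) 0 ^ 2)) +
            7 * ε := by
  obtain ⟨M, hM⟩ := hyd_perturbed_trace_ge hκ hq0 hq1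
  set σ := min 1 (ε / (|M| + 1)) with hσ
  have hM0 : 0 < |M| + 1 := by positivity
  have hσ0 : 0 < σ := lt_min one_pos (by positivity)
  have hσ1 : σ ≤ 1 := min_le_left _ _
  have hσM : |σ * M| ≤ ε := by
    rw [abs_mul, abs_of_pos hσ0]
    calc σ * |M| ≤ ε / (|M| + 1) * (|M| + 1) :=
          mul_le_mul (min_le_right _ _) (by linarith) (abs_nonneg _) (by positivity)
      _ = ε := div_mul_cancel₀ _ hM0.ne'
  have hD := integrable_posPart_sq_sub (q := q) hκ hθ0 hθ1 hA hρ hρ1 hV hfar hsing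
  have hlim : Tendsto (fun r : ℝ => A * r ^ (q - θ)) (nhdsWithin 0 (Set.Ioi 0)) (nhds 0) := by
    have h1 : Tendsto (fun r : ℝ => A * r ^ (q - θ)) (nhds 0) (nhds (A * 0 ^ (q - θ))) :=
      (continuousAt_rpow_const 0 (q - θ) (Or.inr (by linarith))).const_mul A
    rw [zero_rpow (by linarith), mul_zero] at h1
    exact h1.mono_left nhdsWithin_le_nhds
  obtain ⟨r, ⟨hrρ, hrA, hrD⟩, hr⟩ := (((Eventually.filter_mono nhdsWithin_le_nhds
    (gt_mem_nhds hρ)).and ((hlim.eventually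
      (gt_mem_nhds (show 0 < σ * κ / 4 by positivity))).and
      (tendsto_split_correction hD hε))).and self_mem_nhdsWithin).exists
  have hr : 0 < r := hr
  obtain ⟨η, χ, s⟩ := exists_isSplit hr
  have hr1 : r ≤ 1 := hrρ.le.trans hρ1
  have hfar2 := integrableOn_posPart_sq hV hfar (half_pos hr)
  have hsing2 : ∀ x : Plane, x ≠ 0 → ‖x‖ ≤ r →
      |V x - hydPot κ 0 q x| ≤ σ * κ / 4 * ‖x‖ ^ (-q) := by
    intro x hx hxr
    have hn : 0 < ‖x‖ := norm_pos_iff.2 hx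
    refine (hsing x hx (hxr.trans hrρ.le)).trans ?_
    have e : ‖x‖ ^ (-θ) = ‖x‖ ^ (q - θ) * ‖x‖ ^ (-q) := by
      rw [← rpow_add hn]; congr 1; ring
    rw [e, ← mul_assoc]
    refine mul_le_mul_of_nonneg_right (le_trans ?_ hrA.le) (rpow_nonneg hn.le _)
    exact mul_le_mul_of_nonneg_left (rpow_le_rpow hn.le hxr (by linarith)) hA
  have hcor : |((∫ x, (χ x * max (V x) 0) ^ 2) - ∫ x, (χ x * max (hydPot κ 0 q x) 0) ^ 2) -
      ∫ x, (max (V x) 0 ^ 2 - max (hydPot κ 0 q x) 0 ^ 2)| ≤ ε := by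
    have e1 := (s.memLp_mul (hV.meas.max measurable_const) hfar2).integrable_sq
    have e2 := (s.memLp_mul ((isPot_hydPot κ 0 q).meas.max measurable_const)
      (integrableOn_hydPot_sq hκ q (half_pos hr))).integrable_sq
    rw [← integral_sub e1 e2]
    convert hrD η χ s using 4
    ext x; ring
  obtain ⟨c1, c2⟩ := abs_le.1 hcor
  obtain ⟨m1, m2⟩ := abs_le.1 hσM
  set I := (∫ x, (χ x * max (V x) 0) ^ 2) - ∫ x, (χ x * max (hydPot κ 0 q x) 0) ^ 2 with hI
  set J := ∫ x, (max (V x) 0 ^ 2 - max (hydPot κ 0 q x) 0 ^ 2) with hJ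
  have k0 : 0 ≤ 1 / (8 * π) := by positivity
  have k1 : 1 / (8 * π) * ε ≤ ε := one_div_eight_pi_mul_le hε.le
  have k2 : 1 / (8 * π) * (I - J) ≤ 1 / (8 * π) * ε := mul_le_mul_of_nonneg_left c2 k0
  have k3 : 1 / (8 * π) * (-ε) ≤ 1 / (8 * π) * (I - J) := mul_le_mul_of_nonneg_left c1 k0
  rw [mul_sub] at k2 k3
  filter_upwards [trace_ge_of_split hκ hq0 hr hr1 hσ0 hσ1 hε hM hV hfar2 hsing2 s,
    exists_family_of_split hκ hq0 hr hr1 hσ0 hσ1 hε hM hV hfar2 hsing2 s] with h h1 h2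
  refine ⟨fun ι _ f hf hS => ?_, ?_⟩
  · have := h1 ι f hf hS
    linarith
  · obtain ⟨ι, _, f, hf, hS, hle⟩ := h2
    exact ⟨ι, _, f, hf, hS, by linarith⟩

/-- Test functions on the punctured plane. -/
def testSub : Submodule ℝ (Plane → ℝ) where
  carrier := {f | IsTest f}
  add_mem' := IsTest.add
  zero_mem' := IsTest.zero
  smul_mem' c _ hf := hf.const_mul c

lemma IsSmoothCpt.integrable_mul {f g : Plane → ℝ} (hf : IsSmoothCpt f) (hg : IsSmoothCpt g) :
    Integrable (fun x => f x * g x) (volume : Measure Plane) :=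
  (hf.continuous.mul hg.continuous).integrable_of_hasCompactSupport hf.2.mul_right

/-- The `L²` pairing of test functions. -/
noncomputable def testInner : testSub →ₗ[ℝ] testSub →ₗ[ℝ] ℝ :=
  LinearMap.mk₂ ℝ (fun u v => ∫ x, (u : Plane → ℝ) x * (v : Plane → ℝ) x)
  (by
    intro u v w
    rw [← integral_add (u.2.1.integrable_mul w.2.1) (v.2.1.integrable_mul w.2.1)]
    congr 1; ext t
    rw [Submodule.coe_add, Pi.add_apply]; ring)
  (by
    intro c u w
    rw [smul_eq_mul, ← integral_const_mul]
    congr 1; ext t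
    rw [Submodule.coe_smul, Pi.smul_apply, smul_eq_mul]; ring)
  (by
    intro w u v
    rw [← integral_add (w.2.1.integrable_mul u.2.1) (w.2.1.integrable_mul v.2.1)]
    congr 1; ext t
    rw [Submodule.coe_add, Pi.add_apply]; ring)
  (by
    intro c w u
    rw [smul_eq_mul, ← integral_const_mul]
    congr 1; ext t
    rw [Submodule.coe_smul, Pi.smul_apply, smul_eq_mul]; ring)

lemma IsPot.integrable_bilin {V f g : Plane → ℝ} (hV : IsPot V) (hf : IsTest f) (hg : IsTest g)
    (h : ℝ) : Integrable (fun x => h ^ 2 * ∑ k, pd k f x * pd k g x - V x * (f x * g x))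
      (volume : Measure Plane) :=
  ((integrable_finsetSum _ fun k _ => (hf.1.pd k).integrable_mul (hg.1.pd k)).const_mul _).sub
    (hV.integrable_mul hf hg.1.continuous)

/-- The bilinear form of the Schrödinger operator on test functions. -/
noncomputable def testBilin {V : Plane → ℝ} (hV : IsPot V) (h : ℝ) :
    testSub →ₗ[ℝ] testSub →ₗ[ℝ] ℝ :=
  LinearMap.mk₂ ℝ (fun u v => ∫ x, (h ^ 2 * ∑ k, pd k u x * pd k v x -
    V x * ((u : Plane → ℝ) x * (v : Plane → ℝ) x)))
  (by
    intro u v w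
    rw [← integral_add (hV.integrable_bilin u.2 w.2 h) (hV.integrable_bilin v.2 w.2 h)]
    congr 1; ext x
    have hk : ∀ k, pd k ((u + v : testSub) : Plane → ℝ) x = pd k u x + pd k v x :=
      fun k => pd_add (u.2.1.differentiable x) (v.2.1.differentiable x) k
    simp only [hk]; simp only [Submodule.coe_add, Pi.add_apply, Fin.sum_univ_two]; ring)
  (by
    intro c u w
    rw [smul_eq_mul, ← integral_const_mul]
    congr 1; ext x
    have hk : ∀ k, pd k ((c • u : testSub) : Plane → ℝ) x = c * pd k u x :=
      fun k => pd_const_mul (u.2.1.differentiable x) c k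
    simp only [hk]; simp only [Submodule.coe_smul, Pi.smul_apply, smul_eq_mul, Fin.sum_univ_two]; ring)
  (by
    intro w u v
    rw [← integral_add (hV.integrable_bilin w.2 u.2 h) (hV.integrable_bilin w.2 v.2 h)]
    congr 1; ext x
    have hk : ∀ k, pd k ((u + v : testSub) : Plane → ℝ) x = pd k u x + pd k v x :=
      fun k => pd_add (u.2.1.differentiable x) (v.2.1.differentiable x) k
    simp only [hk]; simp only [Submodule.coe_add, Pi.add_apply, Fin.sum_univ_two]; ring)
  (by
    intro c w u
    rw [smul_eq_mul, ← integral_const_mul]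
    congr 1; ext x
    have hk : ∀ k, pd k ((c • u : testSub) : Plane → ℝ) x = c * pd k u x :=
      fun k => pd_const_mul (u.2.1.differentiable x) c k
    simp only [hk]; simp only [Submodule.coe_smul, Pi.smul_apply, smul_eq_mul, Fin.sum_univ_two]; ring)

lemma testBilin_self {V : Plane → ℝ} (hV : IsPot V) (h : ℝ) (u : testSub) :
    testBilin hV h u u = qForm h V u := by
  change ∫ x, (h ^ 2 * ∑ k, pd k u x * pd k u x -
    V x * ((u : Plane → ℝ) x * (u : Plane → ℝ) x)) = _
  simp only [qForm, norm_fderiv_sq, ← sq]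

/-- Lower bounds over orthonormal families extend to sub-orthonormal families. -/
lemma sum_qForm_ge_of_orthonormal {V : Plane → ℝ} (hV : IsPot V) {h L : ℝ}
    (hL : ∀ (n : ℕ) (e : Fin n → Plane → ℝ), (∀ i, IsTest (e i)) →
      (∀ i j, (∫ x, e i x * e j x) = if i = j then (1 : ℝ) else 0) → L ≤ ∑ i, qForm h V (e i))
    {ι : Type*} [Fintype ι] {f : ι → Plane → ℝ} (hf : ∀ i, IsTest (f i))
    (hS : SubON volume f) : L ≤ ∑ i, qForm h V (f i) := by
  have key := trace_ge_of_orthonormal testInner (testBilin hV h)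
    (fun u v => by
      change ∫ x, (u : Plane → ℝ) x * (v : Plane → ℝ) x = ∫ x, (v : Plane → ℝ) x * (u : Plane → ℝ) x
      simp only [mul_comm])
    (fun u => integral_nonneg fun x => mul_self_nonneg ((u : Plane → ℝ) x))
    (fun u h0 => by
      change ∫ x, (u : Plane → ℝ) x * (u : Plane → ℝ) x = 0 at h0
      rw [integral_eq_zero_iff_of_nonneg (fun x => mul_self_nonneg ((u : Plane → ℝ) x))
        (u.2.1.integrable_mul u.2.1)] at h0
      have h1 := ((u.2.1.continuous.mul u.2.1.continuous).ae_eq_iff_eq volume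
        continuous_const).1 h0
      refine Subtype.ext (funext fun t => ?_)
      exact mul_self_eq_zero.1 (congrFun h1 t))
    L
    (fun n e he => by
      simp only [testBilin_self]
      exact hL n (fun i => e i) (fun i => (e i).2) he)
    (fun i => (⟨f i, hf i⟩ : testSub))
    (by
      intro c
      refine le_trans (le_of_eq ?_) (hS c)
      change ∫ x, ((∑ i, c i • (⟨f i, hf i⟩ : testSub) : testSub) : Plane → ℝ) x *
        ((∑ i, c i • (⟨f i, hf i⟩ : testSub) : testSub) : Plane → ℝ) x = _
      congr 1; ext x
      rw [← sq]
      simp)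
  simpa only [testBilin_self] using key

lemma subON_of_orthonormal {ι : Type*} [Fintype ι] [DecidableEq ι] {f : ι → Plane → ℝ}
    (hf : ∀ i, IsTest (f i))
    (ho : ∀ i j, (∫ x, f i x * f j x) = if i = j then (1 : ℝ) else 0) : SubON volume f := by
  intro c
  have e : ∀ x, (∑ i, c i * f i x) ^ 2 = ∑ i, ∑ j, c i * c j * (f i x * f j x) := fun x => by
    rw [sq, Finset.sum_mul_sum]
    exact Finset.sum_congr rfl fun i _ => Finset.sum_congr rfl fun j _ => by ring
  simp only [e]
  have hi : ∀ i j, Integrable (fun x => c i * c j * (f i x * f j x)) (volume : Measure Plane) :=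
    fun i j => ((hf i).1.integrable_mul (hf j).1).const_mul _
  rw [integral_finsetSum _ fun i _ => integrable_finsetSum _ fun j _ => hi i j]
  refine le_of_eq (Finset.sum_congr rfl fun i _ => ?_)
  rw [integral_finsetSum _ fun j _ => hi i j]
  simp only [integral_const_mul, ho]
  simp [sq]

lemma le_negEigSum {V : Plane → ℝ} {h L : ℝ}
    (hL : ∀ (n : ℕ) (f : Fin n → Plane → ℝ), (∀ i, IsTest (f i)) → SubON volume f →
      L ≤ ∑ i, qForm h V (f i)) : L ≤ negEigSum V h := by
  refine le_csInf ⟨0, 0, fun i => 0, by simp⟩ ?_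
  rintro E ⟨n, ψ, h1, h2, h3, h4, rfl⟩
  have ht : ∀ i, IsTest (ψ i) := fun i => ⟨⟨h1 i, h2 i⟩, h3 i⟩
  exact hL n ψ ht (subON_of_orthonormal ht h4)

lemma negEigSum_le {V : Plane → ℝ} (hV : IsPot V) {h L : ℝ}
    (hL : ∀ (n : ℕ) (f : Fin n → Plane → ℝ), (∀ i, IsTest (f i)) → SubON volume f →
      L ≤ ∑ i, qForm h V (f i))
    {ι : Type*} [Fintype ι] {f : ι → Plane → ℝ} (hf : ∀ i, IsTest (f i)) (hS : SubON volume f) :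
    negEigSum V h ≤ ∑ i, qForm h V (f i) := by
  refine sum_qForm_ge_of_orthonormal hV (fun n e he ho => ?_) hf hS
  unfold negEigSum
  refine csInf_le ⟨L, ?_⟩
    ⟨n, e, fun i => (he i).1.1, fun i => (he i).1.2, fun i => (he i).2, ho, rfl⟩
  rintro E ⟨n, ψ, h1, h2, h3, h4, rfl⟩
  have ht : ∀ i, IsTest (ψ i) := fun i => ⟨⟨h1 i, h2 i⟩, h3 i⟩
  exact hL n ψ ht (subON_of_orthonormal ht h4)

/-- **Semiclassics for Coulomb singular potentials.** Let `κ, δ, C > 0`, `θ ∈ (0,1)` and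
let `V ∈ L²_loc(ℝ² ∖ {0})` be measurable with `1_{|x|≥1} V₊ ∈ L²` and
`|V(x) − κ|x|⁻¹| ≤ C|x|^{−θ}` for `0 < |x| ≤ δ`. Then, as `h → 0⁺`,
`S(h) = −(8πh²)⁻¹ ∫ ([V]₊² − κ²[|x|⁻¹ − 1]₊²) + κ²(4h²)⁻¹(ln(2κ⁻¹h²) + c^H) + o(h⁻²)`,
where `c^H = −3 ln 2 − 2γ_E + 1`. -/
theorem semiclassics_coulomb_singular_potential
    (κ δ θ C : ℝ) (hκ : 0 < κ) (hδ : 0 < δ) (hθ0 : 0 < θ) (hθ1 : θ < 1) (hC : 0 < C)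
    (V : EuclideanSpace ℝ (Fin 2) → ℝ)
    (hmeas : Measurable V)
    (hloc : ∀ K : Set (EuclideanSpace ℝ (Fin 2)), IsCompact K →
      (0 : EuclideanSpace ℝ (Fin 2)) ∉ K → IntegrableOn (fun x => V x ^ 2) K volume)
    (hfar : IntegrableOn (fun x => max (V x) 0 ^ 2)
      {x : EuclideanSpace ℝ (Fin 2) | 1 ≤ ‖x‖} volume)
    (hsing : ∀ x : EuclideanSpace ℝ (Fin 2), x ≠ 0 → ‖x‖ ≤ δ →
      |V x - κ * ‖x‖⁻¹| ≤ C * ‖x‖ ^ (-θ : ℝ)) :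
    Tendsto (fun h : ℝ =>
        h ^ 2 * (negEigSum V h -
          (-(8 * Real.pi * h ^ 2)⁻¹ *
              (∫ x : EuclideanSpace ℝ (Fin 2),
                (max (V x) 0 ^ 2 - κ ^ 2 * max (‖x‖⁻¹ - 1) 0 ^ 2)) +
            κ ^ 2 * (4 * h ^ 2)⁻¹ *
              (Real.log (2 * κ⁻¹ * h ^ 2) +
                (-3 * Real.log 2 - 2 * Real.eulerMascheroniConstant + 1)))))
      (nhdsWithin 0 (Set.Ioi 0)) (nhds 0) := by
  have hV : IsPot V := ⟨hmeas, hloc⟩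
  obtain ⟨q, hq0, hq1⟩ := exists_between (max_lt (show (1 / 2 : ℝ) < 1 by norm_num) hθ1)
  obtain ⟨hqh, hqθ⟩ := max_lt_iff.1 hq0
  have hsing' : ∀ x : Plane, x ≠ 0 → ‖x‖ ≤ min δ 1 →
      |V x - hydPot κ 0 q x| ≤ (C + κ) * ‖x‖ ^ (-θ) := by
    intro x hx hxr
    have h1 := hsing x hx (hxr.trans (min_le_left _ _))
    have h2 : 1 ≤ ‖x‖ ^ (-θ) := one_le_rpow_of_pos_of_le_one_of_nonpos (norm_pos_iff.2 hx)
      (hxr.trans (min_le_right _ _)) (by linarith)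
    have e : V x - hydPot κ 0 q x = (V x - κ * ‖x‖⁻¹) + κ := by rw [hydPot_zero]; ring
    rw [e]
    refine (abs_add_le _ _).trans ?_
    rw [abs_of_pos hκ]
    nlinarith
  have hJ : (∫ x : EuclideanSpace ℝ (Fin 2),
      (max (V x) 0 ^ 2 - κ ^ 2 * max (‖x‖⁻¹ - 1) 0 ^ 2)) =
      ∫ x : Plane, (max (V x) 0 ^ 2 - max (hydPot κ 0 q x) 0 ^ 2) := by
    congr 1; ext x
    have e : max (κ * (‖x‖⁻¹ - 1)) 0 = κ * max (‖x‖⁻¹ - 1) 0 := by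
      rw [mul_max_of_nonneg _ _ hκ.le, mul_zero]
    rw [hydPot_zero, e, mul_pow]
  rw [hJ]
  refine Metric.tendsto_nhds.2 fun ε hε => ?_
  filter_upwards [self_mem_nhdsWithin, trace_asymptotics hκ hθ0 hθ1 hqh.le hqθ hq1
    (show 0 ≤ C + κ by positivity) (lt_min hδ one_pos) (min_le_right _ _) hV hfar hsing'
    (show 0 < ε / 8 by positivity)] with h hh ⟨hlow, ι, _, f, hf, hS, hup⟩
  have hh : 0 < h := hh
  have hh2 : 0 < h ^ 2 := by positivity
  set J := ∫ x : Plane, (max (V x) 0 ^ 2 - max (hydPot κ 0 q x) 0 ^ 2)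
  have hL : ∀ (n : ℕ) (f : Fin n → Plane → ℝ), (∀ i, IsTest (f i)) → SubON volume f →
      (coulombTerm κ h - 1 / (8 * π) * J - 6 * (ε / 8)) / h ^ 2 ≤ ∑ i, qForm h V (f i) :=
    fun n f hf hS => by
      rw [div_le_iff₀' hh2]
      exact hlow (Fin n) f hf hS
  have b1 := (div_le_iff₀' hh2).1 (le_negEigSum hL)
  have b2 := mul_le_mul_of_nonneg_left (negEigSum_le hV hL hf hS) hh2.le
  have e : h ^ 2 * (negEigSum V h - (-(8 * π * h ^ 2)⁻¹ * J + κ ^ 2 * (4 * h ^ 2)⁻¹ *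
      (log (2 * κ⁻¹ * h ^ 2) + (-3 * log 2 - 2 * eulerMascheroniConstant + 1)))) =
      h ^ 2 * negEigSum V h - (coulombTerm κ h - 1 / (8 * π) * J) := by
    rw [coulombTerm]
    field_simp
    ring
  rw [e, dist_zero_right, norm_eq_abs, abs_lt]
  constructor <;> linarith
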